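/- Let K be a congruence function field over 𝔽₂ with genus g_K = 4 and class number h_K = 1, and let k = 𝔽₂(T) be its unique rational subfield with [K : k] = 5. Then the extension K/k is normal, hence Galois with cyclic Galois group of order 5. -/

import Mathlib

set_option synthInstance.maxHeartbeats 1000000
set_option maxHeartbeats 1000000

open scoped Classical

noncomputable section

namespace CFF

variable (F : Type*) [Field F]

/-- `K` is a (congruence) function field in one variable over `F`: a finitely
generated field extension of transcendence degree one. -/
def IsFunctionField (K : Type*) [Field K] [Algebra F K] : Prop :=
  ∃ x : K, Transcendental F x ∧
    FiniteDimensional (IntermediateField.adjoin F {x}) K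

/-- The exact field of constants of `K` is `F`: every element of `K` algebraic
over `F` already lies in `F`. -/
def HasExactConstants (K : Type*) [Field K] [Algebra F K] : Prop :=
  ∀ a : K, IsAlgebraic F a → a ∈ (algebraMap F K).range

variable (K : Type*) [Field K] [Algebra F K]

/-- A place of the function field `K/F`: a proper valuation subring of `K`
containing the constants. -/
def IsPlace (O : ValuationSubring K) : Prop :=
  O ≠ ⊤ ∧ ∀ c : F, algebraMap F K c ∈ O

/-- The type of places (prime divisors) of `K/F`. -/
def Place := {O : ValuationSubring K // IsPlace F K O}

variable {K}

/-- `𝔪`-adic order of an element of a valuation subring. -/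
def ordAux (O : ValuationSubring K) (x : O) : ℕ :=
  sSup {n : ℕ | x ∈ IsLocalRing.maximalIdeal O ^ n}

/-- The order (normalized valuation) of `f ∈ K` at a valuation subring `O`. -/
def ordAt (O : ValuationSubring K) (f : K) : ℤ :=
  if h : f ∈ O then (ordAux O ⟨f, h⟩ : ℤ)
  else -(ordAux O ⟨f⁻¹, (O.mem_or_inv_mem f).resolve_left h⟩ : ℤ)

/-- The constants embed into (the valuation ring of) any place. -/
def constHom (p : Place F K) : F →+* p.1 :=
  (algebraMap F K).codRestrict p.1.toSubring fun c => p.2.2 c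

/-- The map from the constants to the residue field of a place. -/
def residueHom (p : Place F K) : F →+* IsLocalRing.ResidueField p.1 :=
  (IsLocalRing.residue (p.1 : ValuationSubring K)).comp (constHom F p)

/-- The degree of a place: the dimension of its residue field over the
constants. -/
def placeDegree (p : Place F K) : ℕ :=
  letI := (residueHom F p).toAlgebra
  Module.finrank F (IsLocalRing.ResidueField p.1)

variable (K)

/-- The group of divisors of `K/F`. -/
abbrev Divisor := Place F K →₀ ℤ

/-- The degree homomorphism on divisors. -/
def degHom : Divisor F K →+ ℤ :=
  Finsupp.liftAddHom fun p => AddMonoidHom.mulRight (placeDegree F p : ℤ)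

variable {K}

/-- The Riemann-Roch space `L(D)` of a divisor `D` (the span coincides with the
set of `f` with `div f ≥ -D`, which is an `F`-subspace). -/
def RRspace (D : Divisor F K) : Submodule F K :=
  Submodule.span F {f : K | ∀ p : Place F K, 0 ≤ D p + ordAt p.1 f}

/-- `ℓ(D)`, the dimension of the Riemann-Roch space of `D`. -/
def ell (D : Divisor F K) : ℕ := Module.finrank F (RRspace F D)

variable (K)

/-- The genus of `K/F`, via Riemann's theorem: `g = max_D (deg D + 1 - ℓ(D))`. -/
def genus : ℕ :=
  sSup {g : ℕ | ∃ D : Divisor F K, (g : ℤ) = degHom F K D + 1 - ell F D}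

/-- The subgroup of divisors of degree zero. -/
def zeroDivisors : AddSubgroup (Divisor F K) := (degHom F K).ker

/-- The subgroup of principal divisors. -/
def principalDivisors : AddSubgroup (Divisor F K) :=
  AddSubgroup.closure
    {D : Divisor F K | ∃ f : K, f ≠ 0 ∧ ∀ p : Place F K, D p = ordAt p.1 f}

/-- The group of divisor classes of degree zero of `K/F`. -/
def ClassGroup0 :=
  zeroDivisors F K ⧸ (principalDivisors F K).addSubgroupOf (zeroDivisors F K)

instance : AddGroup (ClassGroup0 F K) := by
  unfold ClassGroup0; infer_instance

/-- The class number of `K/F`: the order of the group of divisor classes of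
degree zero. -/
def classNumber : ℕ := Nat.card (ClassGroup0 F K)

section Extension

variable {k L : Type*} [Field k] [Field L] [Algebra F k] [Algebra F L] [Algebra k L]

/-- A place `P` of `L` lies over the place `p` of `k`. -/
def LiesOver (P : Place F L) (p : Place F k) : Prop :=
  P.1.comap (algebraMap k L) = p.1

variable (L)

/-- `p` is inert in `L/k`: there is a unique place of `L` above `p`, and its
degree is `[L:k] · deg p` (i.e. the residue degree is `[L:k]`, so `e = 1`). -/
def IsInert (p : Place F k) : Prop :=
  ∃ P : Place F L, LiesOver F P p ∧
    placeDegree F P = Module.finrank k L * placeDegree F p ∧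
    ∀ P' : Place F L, LiesOver F P' p → P' = P

/-- `p` splits completely in `L/k`: there are `[L:k]` places above `p`, each of
the same degree as `p`. -/
def SplitsCompletely (p : Place F k) : Prop :=
  Nat.card {P : Place F L // LiesOver F P p} = Module.finrank k L ∧
    ∀ P : Place F L, LiesOver F P p → placeDegree F P = placeDegree F p

/-- `p` is totally ramified in `L/k`: there is a unique place above `p`, of the
same degree (so `f = 1` and `e = [L:k]`). -/
def IsTotallyRamified (p : Place F k) : Prop :=
  ∃ P : Place F L, LiesOver F P p ∧ placeDegree F P = placeDegree F p ∧
    ∀ P' : Place F L, LiesOver F P' p → P' = P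

/-- `p` is unramified in `L/k`: at every place above `p` the orders of elements
of `k` are preserved (`e = 1`). -/
def IsUnramifiedAt (p : Place F k) : Prop :=
  ∀ P : Place F L, LiesOver F P p →
    ∀ x : k, ordAt P.1 (algebraMap k L x) = ordAt p.1 x

end Extension

section Rational

/-- The finite place of `𝔽₂(T)` corresponding to an irreducible polynomial `P`:
the place contains all polynomials and `P` lies in its maximal ideal. -/
def IsFinitePlaceOf (p : Place (ZMod 2) (RatFunc (ZMod 2)))
    (P : Polynomial (ZMod 2)) : Prop :=
  (∀ g : Polynomial (ZMod 2), algebraMap (Polynomial (ZMod 2)) (RatFunc (ZMod 2)) g ∈ p.1) ∧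
    (algebraMap (Polynomial (ZMod 2)) (RatFunc (ZMod 2)) P)⁻¹ ∉ p.1

/-- The infinite place `𝔭_∞` of `𝔽₂(T)`: the place where `T` has a pole. -/
def IsInfinitePlace (p : Place (ZMod 2) (RatFunc (ZMod 2))) : Prop :=
  RatFunc.X ∉ p.1

end Rational

end CFF

namespace CFF

open Polynomial

/-- A function field in one variable with full constant field `F`. -/
class FunField (F K : Type*) [Field F] [Field K] [Algebra F K] : Prop where
  isFunctionField : IsFunctionField F K
  hasExactConstants : HasExactConstants F K

section Places

variable {F K : Type*} [Field F] [Field K] [Algebra F K]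

theorem finiteDimensional_of_transcendental (h : IsFunctionField F K) {x : K}
    (hx : Transcendental F x) : FiniteDimensional (IntermediateField.adjoin F {x}) K := by
  obtain ⟨x0, h0, hfin⟩ := h
  have e0 : Algebra.EssFiniteType F (IntermediateField.adjoin F {x0}) := by
    have : (IntermediateField.adjoin F {x0}).FG :=
      IntermediateField.fg_adjoin_of_finite (Set.finite_singleton x0)
    exact IntermediateField.essFiniteType_iff.mpr this
  have e1 : Algebra.EssFiniteType F K :=
    Algebra.EssFiniteType.comp F (IntermediateField.adjoin F {x0}) K
  have e2 : Algebra.EssFiniteType (IntermediateField.adjoin F {x}) K :=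
    Algebra.EssFiniteType.of_comp F _ K
  have hx0 : Algebra.IsAlgebraic (Algebra.adjoin F (Set.range fun _ : Unit => x0)) K := by
    rw [Set.range_const]
    constructor
    intro y
    have : IsAlgebraic (IntermediateField.adjoin F {x0}) y := Algebra.IsAlgebraic.isAlgebraic y
    open scoped IntermediateField.algebraAdjoinAdjoin in
    exact (IsFractionRing.isAlgebraic_iff (Algebra.adjoin F {x0})
      (IntermediateField.adjoin F {x0}) K).mpr this
  have i0 : AlgebraicIndependent F (fun _ : Unit => x0) :=
    algebraicIndependent_unique_type_iff.mpr h0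
  have i1 : AlgebraicIndependent F (fun _ : Unit => x) :=
    algebraicIndependent_unique_type_iff.mpr hx
  have t0 := ((i0.isTranscendenceBasis_iff_isAlgebraic).mpr hx0).lift_cardinalMk_eq_trdeg
  have b1 : IsTranscendenceBasis F (fun _ : Unit => x) :=
    AlgebraicIndependent.isTranscendenceBasis_of_lift_trdeg_le_of_finite i1 t0.ge
  have := b1.isAlgebraic_field
  rw [Set.range_const] at this
  exact Algebra.finite_of_essFiniteType_of_isAlgebraic

/-- Linear independence over the polynomial ring `F[x]`. -/
def XInd (F : Type*) {K : Type*} [Field F] [Field K] [Algebra F K] {ι : Type*} [Fintype ι]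
    (x : K) (u : ι → K) : Prop :=
  ∀ p : ι → F[X], ∑ i, aeval x (p i) * u i = 0 → p = 0

theorem XInd.linearIndependent {ι : Type*} [Fintype ι] {x : K} {u : ι → K} (h : XInd F x u) :
    LinearIndependent (IntermediateField.adjoin F {x}) u := by
  open scoped IntermediateField.algebraAdjoinAdjoin in
  rw [← LinearIndependent.iff_fractionRing (Algebra.adjoin F {x})]
  rw [Fintype.linearIndependent_iff]
  intro g hg
  have : ∀ i, ∃ p : F[X], aeval x p = (g i : K) := fun i => by
    exact (SetLike.ext_iff.mp (Algebra.adjoin_singleton_eq_range_aeval F x) _).mp (g i).2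
  choose p hp using this
  have := h p (by simpa [hp, Subalgebra.smul_def] using hg)
  intro i
  have h1 := hp i
  rw [this] at h1
  simp at h1
  exact Subtype.ext h1.symm

theorem LinearIndependent.xInd {ι : Type*} [Fintype ι] {x : K} (hx : Transcendental F x)
    {u : ι → K} (h : LinearIndependent (IntermediateField.adjoin F {x}) u) : XInd F x u := by
  intro p hp
  rw [Fintype.linearIndependent_iff] at h
  have hm : ∀ i, aeval x (p i) ∈ IntermediateField.adjoin F {x} := fun i =>
    IntermediateField.algebra_adjoin_le_adjoin _ _
      (by rw [Algebra.adjoin_singleton_eq_range_aeval]; exact ⟨_, rfl⟩)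
  have := h (fun i => ⟨_, hm i⟩) (by simpa [IntermediateField.smul_def] using hp)
  funext i
  have h2 : aeval x (p i) = 0 := congrArg Subtype.val (this i)
  by_contra h3
  exact hx ⟨p i, h3, h2⟩

/-- The degree of `K` over `F(x)`. -/
def xdeg (F : Type*) {K : Type*} [Field F] [Field K] [Algebra F K] (x : K) : ℕ :=
  Module.finrank (IntermediateField.adjoin F {x}) K

theorem XInd.card_le (hF : IsFunctionField F K) {ι : Type*} [Fintype ι] {x : K}
    (hx : Transcendental F x) {u : ι → K} (h : XInd F x u) : Fintype.card ι ≤ xdeg F x := by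
  have := finiteDimensional_of_transcendental hF hx
  exact h.linearIndependent.fintype_card_le_finrank

theorem exists_xInd (hF : IsFunctionField F K) {x : K} (hx : Transcendental F x) :
    ∃ u : Fin (xdeg F x) → K, XInd F x u := by
  have := finiteDimensional_of_transcendental hF hx
  exact ⟨Module.finBasis (IntermediateField.adjoin F {x}) K,
    LinearIndependent.xInd hx (Module.finBasis _ K).linearIndependent⟩

theorem transcendental_of_not_mem [FunField F K] {x : K} (hx : x ∉ (algebraMap F K).range) :
    Transcendental F x := fun h => hx (FunField.hasExactConstants x h)

theorem Place.const_mem (p : Place F K) (c : F) : algebraMap F K c ∈ p.1 := p.2.2 c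

/-- `aeval x` preserves the valuation ring. -/
theorem Place.aeval_mem (p : Place F K) {x : K} (hx : x ∈ p.1) (q : F[X]) : aeval x q ∈ p.1 := by
  rw [aeval_eq_sum_range]
  refine p.1.toSubring.sum_mem fun i _ => ?_
  rw [Algebra.smul_def]
  exact p.1.mul_mem _ _ (p.const_mem _) (p.1.toSubring.pow_mem hx _)

theorem Place.valuation_const (p : Place F K) {c : F} (hc : c ≠ 0) :
    p.1.valuation (algebraMap F K c) = 1 := by
  apply le_antisymm ((p.1.valuation_le_one_iff _).mpr (p.const_mem c))
  have h := (p.1.valuation_le_one_iff _).mpr (p.const_mem c⁻¹)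
  rw [map_inv₀, map_inv₀] at h
  have h0 : 0 < p.1.valuation (algebraMap F K c) :=
    zero_lt_iff.mpr (by simpa using hc)
  exact (inv_le_one₀ h0).mp h

/-- Elements of the valuation ring which are `F`-independent modulo `x` are independent
over `F[x]`. -/
theorem Place.xInd (p : Place F K) {ι : Type*} [Fintype ι] {x : K} (hx0 : x ≠ 0)
    (hx : p.1.valuation x < 1) {u : ι → K} (hu : ∀ i, u i ∈ p.1)
    (hind : ∀ c : ι → F, p.1.valuation (∑ i, algebraMap F K (c i) * u i) ≤ p.1.valuation x →
      c = 0) : XInd F x u := by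
  have hxm : x ∈ p.1 := (p.1.valuation_le_one_iff _).mp hx.le
  have key : ∀ q : ι → F[X], ∑ i, aeval x (q i) * u i = 0 →
      ∀ i, (q i) = X * (q i).divX := by
    intro q hq
    have h1 : (∑ i, algebraMap F K ((q i).coeff 0) * u i) =
        - (x * ∑ i, aeval x (q i).divX * u i) := by
      rw [eq_neg_iff_add_eq_zero, ← hq, Finset.mul_sum, ← Finset.sum_add_distrib]
      refine Finset.sum_congr rfl fun i _ => ?_
      conv_rhs => rw [← divX_mul_X_add (q i)]
      simp
      ring
    have h2 := hind (fun i => (q i).coeff 0) (by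
      rw [h1, Valuation.map_neg, map_mul]
      apply mul_le_of_le_one_right'
      rw [p.1.valuation_le_one_iff]
      exact p.1.toSubring.sum_mem fun i _ => p.1.mul_mem _ _ (p.aeval_mem hxm _) (hu i))
    intro i
    conv_lhs => rw [← divX_mul_X_add (q i)]
    rw [show (q i).coeff 0 = 0 from congrFun h2 i]
    simp [mul_comm]
  have main : ∀ n : ℕ, ∀ q : ι → F[X], ∑ i, aeval x (q i) * u i = 0 →
      ∀ i, X ^ n ∣ q i := by
    intro n
    induction n with
    | zero => intro q _ i; simp
    | succ n ih =>
      intro q hq i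
      have h1 := key q hq
      have h2 : ∑ i, aeval x (q i).divX * u i = 0 := by
        have : x * ∑ i, aeval x (q i).divX * u i = 0 := by
          rw [← hq, Finset.mul_sum]
          refine Finset.sum_congr rfl fun i _ => ?_
          conv_rhs => rw [h1 i]
          simp
          ring
        simpa [hx0] using this
      rw [h1 i, pow_succ']
      exact mul_dvd_mul_left _ (ih _ h2 i)
  intro q hq
  funext i
  by_contra h
  have := main (natDegree (q i) + 1) q hq i
  have := Polynomial.natDegree_le_of_dvd this h
  simp at this

theorem Place.xInd_of_valuation (p : Place F K) {ι : Type*} [Fintype ι] {x : K} (hx0 : x ≠ 0)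
    (hx : p.1.valuation x < 1) {u : ι → K} (hu : ∀ i, p.1.valuation (u i) ≤ 1)
    (hu' : ∀ i, p.1.valuation x < p.1.valuation (u i))
    (hinj : Function.Injective fun i => p.1.valuation (u i)) : XInd F x u := by
  refine p.xInd hx0 hx (fun i => (p.1.valuation_le_one_iff _).mp (hu i)) ?_
  intro c hc
  by_contra hne
  obtain ⟨i0, hi0⟩ := Function.ne_iff.mp hne
  obtain ⟨j, hj, hmax⟩ := Finset.exists_max_image (Finset.univ.filter fun i => c i ≠ 0)
    (fun i => p.1.valuation (u i)) ⟨i0, by simpa using hi0⟩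
  have hcj : c j ≠ 0 := by simpa using hj
  have e1 : ∀ i, c i ≠ 0 → p.1.valuation (algebraMap F K (c i) * u i) = p.1.valuation (u i) := by
    intro i hi
    rw [map_mul, p.valuation_const hi, one_mul]
  have hpos : 0 < p.1.valuation (u j) := lt_of_le_of_lt zero_le (hu' j)
  have := Valuation.map_sum_eq_of_lt p.1.valuation
    (f := fun i => algebraMap F K (c i) * u i) (Finset.mem_univ j) (by
      intro i hi
      have hij : i ≠ j := by simpa using hi
      rw [e1 j hcj]
      by_cases hci : c i = 0
      · simpa [hci] using hpos
      · rw [e1 i hci]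
        exact lt_of_le_of_ne (hmax i (by simpa using hci)) fun h => hij (hinj h))
  rw [this, e1 j hcj] at hc
  exact absurd hc (not_le.mpr (hu' j))

theorem Place.exists_valuation_lt_one (p : Place F K) : ∃ x : K, x ≠ 0 ∧ p.1.valuation x < 1 := by
  have : ∃ f : K, f ∉ p.1 := by
    by_contra! h
    exact p.2.1 (ValuationSubring.ext _ _ fun x => ⟨fun _ => ValuationSubring.mem_top x, fun _ => h x⟩)
  obtain ⟨f, hf⟩ := this
  have hf0 : f ≠ 0 := fun h => hf (h ▸ p.1.zero_mem)
  refine ⟨f⁻¹, inv_ne_zero hf0, ?_⟩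
  rw [← ValuationSubring.valuation_le_one_iff, not_le] at hf
  rw [map_inv₀]
  exact inv_lt_one_of_one_lt₀ hf

theorem Place.transcendental [FunField F K] (p : Place F K) {x : K} (hx0 : x ≠ 0)
    (hx : p.1.valuation x < 1) : Transcendental F x := by
  apply transcendental_of_not_mem
  rintro ⟨c, rfl⟩
  have : c ≠ 0 := by rintro rfl; simp at hx0
  rw [p.valuation_const this] at hx
  exact lt_irrefl _ hx

theorem Place.finite_values [FunField F K] (p : Place F K) {x : K} (hx0 : x ≠ 0)
    (hx : p.1.valuation x < 1) :
    {g | p.1.valuation x < g ∧ g ≤ 1}.Finite := by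
  by_contra hinf
  obtain ⟨t, ht, hc⟩ := Set.Infinite.exists_subset_card_eq hinf (xdeg F x + 1)
  choose u hu using p.1.valuation_surjective
  have := Place.xInd_of_valuation p hx0 hx (u := fun g : t => u g.1)
    (fun g => by rw [hu]; exact (ht g.2).2) (fun g => by rw [hu]; exact (ht g.2).1)
    (fun a b h => Subtype.ext (by simpa only [hu] using h))
  have := this.card_le (FunField.isFunctionField) (p.transcendental hx0 hx)
  rw [Fintype.card_coe, hc] at this
  omega

theorem Place.exists_uniformizer [FunField F K] (p : Place F K) :
    ∃ π : K, π ≠ 0 ∧ p.1.valuation π < 1 ∧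
      ∀ f : K, f ≠ 0 → ∃ n : ℤ, p.1.valuation f = p.1.valuation π ^ n := by
  obtain ⟨x, hx0, hx⟩ := p.exists_valuation_lt_one
  have hxp : 0 < p.1.valuation x := zero_lt_iff.mpr (by simpa using hx0)
  have hfin : {g | p.1.valuation x ≤ g ∧ g < 1}.Finite := by
    apply ((p.finite_values hx0 hx).union (Set.finite_singleton (p.1.valuation x))).subset
    rintro g ⟨h1, h2⟩
    rcases h1.eq_or_lt with h | h
    · right; exact h.symm
    · left; exact ⟨h, h2.le⟩
  obtain ⟨g, ⟨hg1, hg2⟩, hmax⟩ := Set.exists_max_image _ id hfin ⟨_, le_rfl, hx⟩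
  obtain ⟨π, rfl⟩ := p.1.valuation_surjective g
  have hgpos : 0 < p.1.valuation π := hxp.trans_le hg1
  have hπ0 : π ≠ 0 := by rintro rfl; simp at hgpos
  have hmax' : ∀ y, p.1.valuation y < 1 → p.1.valuation y ≤ p.1.valuation π := by
    intro y hy
    rcases le_total (p.1.valuation y) (p.1.valuation x) with h | h
    · exact h.trans hg1
    · exact hmax _ ⟨h, hy⟩
  refine ⟨π, hπ0, hg2, ?_⟩
  have key : ∀ f : K, f ≠ 0 → p.1.valuation f ≤ 1 →
      ∃ n : ℤ, p.1.valuation f = p.1.valuation π ^ n := by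
    intro f hf0 hf
    have hfp : 0 < p.1.valuation f := zero_lt_iff.mpr (by simpa using hf0)
    rcases hf.eq_or_lt with h1 | h1
    · exact ⟨0, by simpa using h1⟩
    have hex : ∃ n : ℕ, p.1.valuation π ^ n ≤ p.1.valuation f := by
      by_contra! hcon
      refine Set.infinite_of_injective_forall_mem (f := fun n : ℕ => p.1.valuation π ^ n) ?_ ?_
        (p.finite_values hf0 h1)
      · exact (pow_right_strictAnti₀ hgpos hg2).injective
      · exact fun n => ⟨hcon n, pow_le_one₀ zero_le hg2.le⟩
    have hspec := Nat.find_spec hex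
    have hmin : ∀ m < Nat.find hex, _ := fun m => Nat.find_min hex
    set n := Nat.find hex with hn
    rcases n with _ | n
    · simp at hspec; exact absurd hspec (not_le.mpr h1)
    · refine ⟨(n + 1 : ℕ), ?_⟩
      rw [zpow_natCast]
      refine le_antisymm ?_ hspec
      have h2 := hmin n (Nat.lt_succ_self n)
      rw [not_le] at h2
      have hpn : 0 < p.1.valuation π ^ n := pow_pos hgpos n
      have h3 := hmax' (f / π ^ n) (by
        rw [map_div₀, map_pow]; exact (div_lt_one₀ hpn).mpr h2)
      rw [map_div₀, map_pow, div_le_iff₀ hpn] at h3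
      rwa [pow_succ']
  intro f hf0
  rcases le_total (p.1.valuation f) 1 with h | h
  · exact key f hf0 h
  · obtain ⟨n, hn⟩ := key f⁻¹ (inv_ne_zero hf0) (by
      rw [map_inv₀]; exact inv_le_one_of_one_le₀ h)
    refine ⟨-n, ?_⟩
    rw [zpow_neg, ← hn, map_inv₀, inv_inv]

/-- The normalized valuation attached to a place. -/
def Place.ord (p : Place F K) (f : K) : ℤ := ordAt p.1 f

theorem Place.ordAux_eq (p : Place F K) {π : K} (hπ : π ≠ 0) (hπ1 : p.1.valuation π < 1)
    (hall : ∀ f : K, f ≠ 0 → ∃ n : ℤ, p.1.valuation f = p.1.valuation π ^ n)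
    {f : K} (hf : f ∈ p.1) {n : ℕ} (hn : p.1.valuation f = p.1.valuation π ^ n) :
    ordAux p.1 ⟨f, hf⟩ = n := by
  have hpos : 0 < p.1.valuation π := zero_lt_iff.mpr (by simpa using hπ)
  have hπm : π ∈ p.1 := (p.1.valuation_le_one_iff _).mp hπ1.le
  have hmax : IsLocalRing.maximalIdeal p.1 = Ideal.span {⟨π, hπm⟩} := by
    apply le_antisymm
    · intro y hy
      rw [Ideal.mem_span_singleton']
      rw [ValuationSubring.valuation_lt_one_iff] at hy
      by_cases hy0 : (y : K) = 0
      · exact ⟨0, by rw [zero_mul]; exact Subtype.ext hy0.symm⟩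
      obtain ⟨k, hk⟩ := hall y hy0
      have : p.1.valuation y ≤ p.1.valuation π := by
        rw [hk] at hy ⊢
        have hk0 : 0 < k := by
          by_contra hcon
          have : 1 ≤ p.1.valuation π ^ k := one_le_zpow_of_nonpos₀ hpos hπ1.le (not_lt.mp hcon)
          exact absurd hy (not_lt.mpr this)
        calc _ ≤ p.1.valuation π ^ (1 : ℤ) := zpow_le_zpow_right_of_le_one₀ hpos hπ1.le hk0
          _ = _ := zpow_one _
      obtain ⟨a, ha⟩ := (p.1.valuation_le_iff _ _).mp this
      exact ⟨a, Subtype.ext ha⟩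
    · rw [Ideal.span_singleton_le_iff_mem, ValuationSubring.valuation_lt_one_iff]
      exact hπ1
  have hset : {m : ℕ | (⟨f, hf⟩ : p.1) ∈ IsLocalRing.maximalIdeal p.1 ^ m} = Set.Iic n := by
    ext m
    rw [Set.mem_ofPred_eq, hmax, Ideal.span_singleton_pow, Ideal.mem_span_singleton', Set.mem_Iic]
    have h1 : p.1.valuation f ≤ p.1.valuation (π ^ m) ↔ m ≤ n := by
      rw [hn, map_pow]
      exact (pow_right_strictAnti₀ hpos hπ1).le_iff_ge
    rw [← h1, ValuationSubring.valuation_le_iff]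
    constructor
    · rintro ⟨a, ha⟩
      exact ⟨a, congrArg Subtype.val ha⟩
    · rintro ⟨a, ha⟩
      exact ⟨a, Subtype.ext ha⟩
  unfold ordAux
  rw [hset]
  exact csSup_Iic

theorem Place.ord_eq (p : Place F K) {π : K} (hπ : π ≠ 0) (hπ1 : p.1.valuation π < 1)
    (hall : ∀ f : K, f ≠ 0 → ∃ n : ℤ, p.1.valuation f = p.1.valuation π ^ n)
    {f : K} {n : ℤ} (hn : p.1.valuation f = p.1.valuation π ^ n) : p.ord f = n := by
  have hpos : 0 < p.1.valuation π := zero_lt_iff.mpr (by simpa using hπ)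
  unfold Place.ord ordAt
  split_ifs with h
  · have h1 := (p.1.valuation_le_one_iff _).mpr h
    rw [hn] at h1
    have h0 : 0 ≤ n := by
      by_contra hcon
      exact absurd h1 (not_le.mpr (one_lt_zpow_of_neg₀ hpos hπ1 (not_le.mp hcon)))
    lift n to ℕ using h0
    rw [p.ordAux_eq hπ hπ1 hall h (by simpa using hn)]
  · have h1 : ¬ p.1.valuation f ≤ 1 := fun h' => h ((p.1.valuation_le_one_iff _).mp h')
    rw [hn] at h1
    have h0 : n ≤ 0 := by
      by_contra hcon
      exact h1 ((zpow_le_zpow_right_of_le_one₀ hpos hπ1.le (not_le.mp hcon).le).trans_eq (zpow_zero _))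
    obtain ⟨k, rfl⟩ := Int.exists_eq_neg_ofNat h0
    rw [p.ordAux_eq hπ hπ1 hall _ (n := k) (by rw [map_inv₀, hn]; simp)]

theorem Place.ord_zero (p : Place F K) : p.ord 0 = 0 := by
  unfold Place.ord ordAt
  rw [dif_pos p.1.zero_mem]
  unfold ordAux
  have : {n : ℕ | (⟨0, p.1.zero_mem⟩ : p.1) ∈ IsLocalRing.maximalIdeal p.1 ^ n} = Set.univ := by
    ext n
    simp only [Set.mem_ofPred_eq, Set.mem_univ, iff_true]
    exact Ideal.zero_mem _
  rw [this]
  simp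

variable [FunField F K]

theorem Place.exists_ord (p : Place F K) :
    ∃ π : K, π ≠ 0 ∧ p.1.valuation π < 1 ∧ p.ord π = 1 ∧
      ∀ f : K, f ≠ 0 → p.1.valuation f = p.1.valuation π ^ p.ord f := by
  obtain ⟨π, h0, h1, h2⟩ := p.exists_uniformizer
  refine ⟨π, h0, h1, p.ord_eq h0 h1 h2 (zpow_one _).symm, fun f hf => ?_⟩
  obtain ⟨n, hn⟩ := h2 f hf
  rw [p.ord_eq h0 h1 h2 hn, hn]

theorem Place.exists_ord_eq_one (p : Place F K) : ∃ π : K, π ≠ 0 ∧ p.ord π = 1 :=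
  let ⟨π, h0, _, h2, _⟩ := p.exists_ord
  ⟨π, h0, h2⟩

theorem Place.ord_le_iff (p : Place F K) {f g : K} (hf : f ≠ 0) (hg : g ≠ 0) :
    p.ord g ≤ p.ord f ↔ p.1.valuation f ≤ p.1.valuation g := by
  obtain ⟨π, h0, h1, -, h2⟩ := p.exists_ord
  have hpos : 0 < p.1.valuation π := zero_lt_iff.mpr (by simpa using h0)
  rw [h2 f hf, h2 g hg]
  exact (zpow_right_strictAnti₀ hpos h1).le_iff_ge.symm

theorem Place.ord_mul (p : Place F K) {f g : K} (hf : f ≠ 0) (hg : g ≠ 0) :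
    p.ord (f * g) = p.ord f + p.ord g := by
  obtain ⟨π, h0, h1, -, h2⟩ := p.exists_ord
  have hpos : 0 < p.1.valuation π := zero_lt_iff.mpr (by simpa using h0)
  apply (zpow_right_strictAnti₀ hpos h1).injective
  simp only
  rw [← h2 _ (mul_ne_zero hf hg), zpow_add₀ hpos.ne', ← h2 f hf, ← h2 g hg, map_mul]

theorem Place.ord_const (p : Place F K) (c : F) : p.ord (algebraMap F K c) = 0 := by
  by_cases hc : c = 0
  · rw [hc, map_zero, p.ord_zero]
  obtain ⟨π, h0, h1, h3, h2⟩ := p.exists_ord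
  have hpos : 0 < p.1.valuation π := zero_lt_iff.mpr (by simpa using h0)
  apply (zpow_right_strictAnti₀ hpos h1).injective
  simp only
  rw [← h2 _ (by simpa using hc), p.valuation_const hc, zpow_zero]

theorem Place.ord_one (p : Place F K) : p.ord 1 = 0 := by
  simpa using p.ord_const 1

theorem Place.ord_inv (p : Place F K) (f : K) : p.ord f⁻¹ = - p.ord f := by
  by_cases hf : f = 0
  · simp [hf, p.ord_zero]
  have := p.ord_mul hf (inv_ne_zero hf)
  rw [mul_inv_cancel₀ hf, p.ord_one] at this
  omega

theorem Place.ord_div (p : Place F K) {f g : K} (hf : f ≠ 0) (hg : g ≠ 0) :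
    p.ord (f / g) = p.ord f - p.ord g := by
  rw [div_eq_mul_inv, p.ord_mul hf (inv_ne_zero hg), p.ord_inv]; ring

theorem Place.ord_pow (p : Place F K) (f : K) (n : ℕ) : p.ord (f ^ n) = n * p.ord f := by
  by_cases hf : f = 0
  · rcases n with _ | n <;> simp [hf, p.ord_zero, p.ord_one]
  induction n with
  | zero => simp [p.ord_one]
  | succ n ih => rw [pow_succ, p.ord_mul (pow_ne_zero _ hf) hf, ih]; push_cast; ring

theorem Place.ord_zpow (p : Place F K) (f : K) (n : ℤ) : p.ord (f ^ n) = n * p.ord f := by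
  obtain ⟨n, rfl | rfl⟩ := n.eq_nat_or_neg
  · simp [p.ord_pow]
  · simp [p.ord_pow, p.ord_inv]

theorem Place.exists_ord_eq (p : Place F K) (n : ℤ) : ∃ f : K, f ≠ 0 ∧ p.ord f = n := by
  obtain ⟨π, h0, h1⟩ := p.exists_ord_eq_one
  exact ⟨π ^ n, zpow_ne_zero _ h0, by rw [p.ord_zpow, h1, mul_one]⟩

theorem Place.mem_iff (p : Place F K) {f : K} (hf : f ≠ 0) : f ∈ p.1 ↔ 0 ≤ p.ord f := by
  rw [← p.ord_one, p.ord_le_iff hf one_ne_zero, map_one, ValuationSubring.valuation_le_one_iff]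

theorem Place.valuation_lt_one_iff (p : Place F K) {f : K} (hf : f ≠ 0) :
    p.1.valuation f < 1 ↔ 0 < p.ord f := by
  have := p.ord_le_iff one_ne_zero hf
  rw [map_one, p.ord_one] at this
  rw [← not_le, ← this, not_le]

theorem Place.mem_of_ord (p : Place F K) {f : K} (h : 0 ≤ p.ord f) : f ∈ p.1 := by
  by_cases hf : f = 0
  · exact hf ▸ p.1.zero_mem
  · exact (p.mem_iff hf).mpr h

theorem Place.le_ord_add (p : Place F K) {f g : K} (h : f + g ≠ 0) {n : ℤ}
    (hf : f ≠ 0 → n ≤ p.ord f) (hg : g ≠ 0 → n ≤ p.ord g) : n ≤ p.ord (f + g) := by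
  obtain ⟨a, ha0, ha⟩ := p.exists_ord_eq n
  rw [← ha] at hf hg ⊢
  rw [p.ord_le_iff h ha0]
  refine p.1.valuation.map_add_le ?_ ?_
  · by_cases hf0 : f = 0
    · simp [hf0]
    · exact (p.ord_le_iff hf0 ha0).mp (hf hf0)
  · by_cases hg0 : g = 0
    · simp [hg0]
    · exact (p.ord_le_iff hg0 ha0).mp (hg hg0)

instance residueAlgebra (p : Place F K) : Algebra F (IsLocalRing.ResidueField p.1) :=
  (residueHom F p).toAlgebra

/-- Evaluation at a place. -/
def Place.res (p : Place F K) (f : K) : IsLocalRing.ResidueField p.1 :=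
  if h : f ∈ p.1 then IsLocalRing.residue p.1 ⟨f, h⟩ else 0

omit [FunField F K] in
theorem Place.res_of_mem (p : Place F K) {f : K} (h : f ∈ p.1) :
    p.res f = IsLocalRing.residue p.1 ⟨f, h⟩ := dif_pos h

omit [FunField F K] in
theorem Place.res_add (p : Place F K) {f g : K} (hf : f ∈ p.1) (hg : g ∈ p.1) :
    p.res (f + g) = p.res f + p.res g := by
  rw [p.res_of_mem hf, p.res_of_mem hg, p.res_of_mem (p.1.add_mem _ _ hf hg), ← map_add]
  rfl

omit [FunField F K] in
theorem Place.res_mul (p : Place F K) {f g : K} (hf : f ∈ p.1) (hg : g ∈ p.1) :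
    p.res (f * g) = p.res f * p.res g := by
  rw [p.res_of_mem hf, p.res_of_mem hg, p.res_of_mem (p.1.mul_mem _ _ hf hg), ← map_mul]
  rfl

omit [FunField F K] in
theorem Place.res_const (p : Place F K) (c : F) :
    p.res (algebraMap F K c) = algebraMap F _ c := by
  rw [p.res_of_mem (p.const_mem c)]
  rfl

omit [FunField F K] in
theorem Place.res_smul (p : Place F K) (c : F) {f : K} (hf : f ∈ p.1) :
    p.res (c • f) = c • p.res f := by
  rw [Algebra.smul_def, p.res_mul (p.const_mem c) hf, p.res_const, Algebra.smul_def]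

omit [FunField F K] in
theorem Place.res_eq_zero_iff (p : Place F K) {f : K} (hf : f ∈ p.1) :
    p.res f = 0 ↔ p.1.valuation f < 1 := by
  rw [p.res_of_mem hf, IsLocalRing.residue_eq_zero_iff, ValuationSubring.valuation_lt_one_iff]

theorem Place.res_eq_zero_iff_ord (p : Place F K) {f : K} (hf : f ∈ p.1) (h0 : f ≠ 0) :
    p.res f = 0 ↔ 0 < p.ord f := by
  rw [p.res_eq_zero_iff hf, p.valuation_lt_one_iff h0]

omit [FunField F K] in
theorem Place.res_surjective (p : Place F K) (a : IsLocalRing.ResidueField p.1) :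
    ∃ f ∈ p.1, p.res f = a := by
  obtain ⟨⟨f, hf⟩, rfl⟩ := IsLocalRing.residue_surjective a
  exact ⟨f, hf, p.res_of_mem hf⟩

instance residue_finite (p : Place F K) :
    Module.Finite F (IsLocalRing.ResidueField p.1) := by
  obtain ⟨π, h0, h1, -, -⟩ := p.exists_ord
  have key : Module.rank F (IsLocalRing.ResidueField p.1) ≤ (xdeg F π : ℕ) := by
    refine rank_le ?_
    intro s hs
    choose u hu hur using p.res_surjective
    have : XInd F π (fun i : s => u i.1) := by
      refine p.xInd h0 h1 (fun i => hu _) ?_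
      intro c hc
      rw [Fintype.linearIndependent_iff] at hs
      funext i
      refine hs c ?_ i
      have hm : ∀ t : Finset s, ∑ i ∈ t, algebraMap F K (c i) * u i.1 ∈ p.1 ∧
          p.res (∑ i ∈ t, algebraMap F K (c i) * u i.1) = ∑ i ∈ t, c i • i.1 := by
        intro t
        induction t using Finset.induction_on with
        | empty =>
          simp only [Finset.sum_empty]
          exact ⟨p.1.zero_mem, by simpa using p.res_const 0⟩
        | insert a t ha ih =>
          rw [Finset.sum_insert ha, Finset.sum_insert ha]
          have hmm := p.1.mul_mem _ _ (p.const_mem (c a)) (hu a.1)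
          refine ⟨p.1.add_mem _ _ hmm ih.1, ?_⟩
          rw [p.res_add hmm ih.1, ih.2, p.res_mul (p.const_mem _) (hu _), p.res_const, hur,
            Algebra.smul_def]
      have h3 := hm Finset.univ
      rw [← h3.2, p.res_eq_zero_iff h3.1]
      exact hc.trans_lt h1
    have := this.card_le FunField.isFunctionField (p.transcendental h0 h1)
    simpa using this
  exact Module.rank_lt_aleph0_iff.mp (key.trans_lt (Cardinal.natCast_lt_aleph0))

omit [FunField F K] in
theorem placeDegree_eq (p : Place F K) :
    placeDegree F p = Module.finrank F (IsLocalRing.ResidueField p.1) := rfl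

theorem placeDegree_pos (p : Place F K) : 0 < placeDegree F p := by
  rw [placeDegree_eq]
  exact Module.finrank_pos

end Places

section Divisors

variable {F K : Type*} [Field F] [Field K] [Algebra F K]

theorem finrank_of_ker_eq {V W : Type*} [AddCommGroup V] [Module F V] [AddCommGroup W] [Module F W]
    [Module.Finite F W] {S T : Submodule F V} (hST : S ≤ T) [hS : Module.Finite F S]
    (φ : T →ₗ[F] W) (hφ : LinearMap.ker φ = S.submoduleOf T) :
    Module.Finite F T ∧
      Module.finrank F T = Module.finrank F S + Module.finrank F (LinearMap.range φ) := by
  have e : LinearMap.ker φ ≃ₗ[F] S :=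
    (LinearEquiv.ofEq _ _ hφ).trans (Submodule.submoduleOfEquivOfLe hST)
  have h1 : Module.Finite F (LinearMap.ker φ) := Module.Finite.equiv e.symm
  have h2 : Module.Finite F (T ⧸ LinearMap.ker φ) := Module.Finite.equiv φ.quotKerEquivRange.symm
  have h3 : Module.Finite F T := Module.Finite.of_submodule_quotient (LinearMap.ker φ)
  refine ⟨h3, ?_⟩
  rw [← φ.finrank_range_add_finrank_ker, e.finrank_eq, add_comm]

variable [FunField F K]

/-- The Riemann-Roch space, described by its elements. -/
def LL (D : Divisor F K) : Submodule F K where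
  carrier := {f | f ≠ 0 → ∀ p : Place F K, 0 ≤ D p + p.ord f}
  zero_mem' h := absurd rfl h
  add_mem' := by
    intro f g hf hg h p
    have := p.le_ord_add (n := - D p) h (fun h' => by have := hf h' p; omega)
      (fun h' => by have := hg h' p; omega)
    omega
  smul_mem' := by
    intro c f hf h p
    rw [Algebra.smul_def] at h ⊢
    rw [p.ord_mul (left_ne_zero_of_mul h) (right_ne_zero_of_mul h), p.ord_const]
    have := hf (right_ne_zero_of_mul h) p
    omega

theorem RRspace_eq (D : Divisor F K) : RRspace F D = LL D := by
  apply le_antisymm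
  · exact Submodule.span_le.mpr fun f hf _ p => hf p
  · intro f hf
    by_cases h : f = 0
    · exact h ▸ Submodule.zero_mem _
    · exact Submodule.subset_span fun p => hf h p

theorem ell_eq (D : Divisor F K) : ell F D = Module.finrank F (LL D) := by
  rw [← RRspace_eq]; rfl

theorem LL_mono {D E : Divisor F K} (h : D ≤ E) : LL D ≤ LL E := by
  intro f hf h0 p
  have h1 := hf h0 p
  have h2 := h p
  omega

theorem LL_mul {D E : Divisor F K} {f g : K} (hf : f ∈ LL D) (hg : g ∈ LL E) :
    f * g ∈ LL (D + E) := by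
  intro h p
  have hf0 := left_ne_zero_of_mul h
  have hg0 := right_ne_zero_of_mul h
  rw [p.ord_mul hf0 hg0, Finsupp.add_apply]
  have h1 := hf hf0 p
  have h2 := hg hg0 p
  omega

omit [FunField F K] in
theorem degHom_single (p : Place F K) (n : ℤ) :
    degHom F K (Finsupp.single p n) = n * placeDegree F p := by
  simp [degHom]

omit [FunField F K] in
theorem degHom_nonneg {D : Divisor F K} (h : 0 ≤ D) : 0 ≤ degHom F K D := by
  simp only [degHom, Finsupp.liftAddHom_apply]
  exact Finset.sum_nonneg fun p _ => mul_nonneg (h p) (by positivity)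

/-- The leading coefficient map `L(D + p) → κ(p)`. -/
theorem exists_leadMap (D : Divisor F K) (p : Place F K) {π : K} (hπ : π ≠ 0)
    (hπD : p.ord π = D p + 1) :
    ∃ φ : LL (D + Finsupp.single p 1) →ₗ[F] IsLocalRing.ResidueField p.1,
      (∀ f, φ f = p.res (f.1 * π)) ∧ (∀ f : LL (D + Finsupp.single p 1), f.1 * π ∈ p.1) ∧
      LinearMap.ker φ = (LL D).submoduleOf (LL (D + Finsupp.single p 1)) := by
  have hm : ∀ f : LL (D + Finsupp.single p 1), f.1 * π ∈ p.1 := by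
    rintro ⟨f, hf⟩
    by_cases h0 : f = 0
    · simp [h0]
    apply p.mem_of_ord
    rw [p.ord_mul h0 hπ]
    have := hf h0 p
    simp at this
    simp
    omega
  refine ⟨{ toFun := fun f => p.res (f.1 * π), map_add' := ?_, map_smul' := ?_ }, fun f => rfl, hm, ?_⟩
  · intro f g
    rw [← p.res_add (hm f) (hm g), ← add_mul]; rfl
  · intro c f
    rw [RingHom.id_apply, ← p.res_smul c (hm f), ← smul_mul_assoc]; rfl
  · ext f
    rw [LinearMap.mem_ker]
    change p.res (f.1 * π) = 0 ↔ f.1 ∈ LL D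
    by_cases h0 : f.1 = 0
    · simp only [h0, zero_mul, Submodule.zero_mem, iff_true]
      simpa using p.res_const 0
    rw [p.res_eq_zero_iff_ord (hm f) (mul_ne_zero h0 hπ), p.ord_mul h0 hπ, hπD]
    constructor
    · intro h _ q
      by_cases hq : q = p
      · subst hq; omega
      · have := f.2 h0 q
        simpa [Finsupp.single_apply, Ne.symm hq] using this
    · intro h
      have := h h0 p
      omega

theorem LL_add_single (D : Divisor F K) (p : Place F K) (h : Module.Finite F (LL D)) :
    Module.Finite F (LL (D + Finsupp.single p 1)) ∧
      ell F (D + Finsupp.single p 1) ≤ ell F D + placeDegree F p := by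
  obtain ⟨π, hπ, hπD⟩ := p.exists_ord_eq (D p + 1)
  obtain ⟨φ, -, -, hk⟩ := exists_leadMap D p hπ hπD
  have hle : LL D ≤ LL (D + Finsupp.single p 1) :=
    LL_mono (by simp)
  obtain ⟨h1, h2⟩ := finrank_of_ker_eq hle φ hk
  refine ⟨h1, ?_⟩
  rw [ell_eq, ell_eq, h2, placeDegree_eq]
  exact Nat.add_le_add_left (Submodule.finrank_le _) _

theorem divisor_induction {P : Divisor F K → Prop} (D : Divisor F K) (h0 : P D)
    (h1 : ∀ E p, D ≤ E → P E → P (E + Finsupp.single p 1)) {E : Divisor F K} (hE : D ≤ E) :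
    P E := by
  have key : ∀ n : ℕ, ∀ E, D ≤ E → degHom F K (E - D) ≤ n → P E := by
    intro n
    induction n with
    | zero =>
      intro E hE hn
      have h2 := degHom_nonneg (sub_nonneg.mpr hE)
      by_cases h : E = D
      · exact h ▸ h0
      exfalso
      obtain ⟨p, hp⟩ := Finsupp.ne_iff.mp h
      have h3 : 0 ≤ E - D - Finsupp.single p 1 := by
        intro q
        have := hE q
        by_cases hq : q = p
        · subst hq
          simp
          omega
        · simp [Ne.symm hq]
          exact this
      have := degHom_nonneg h3
      rw [map_sub, degHom_single] at this
      have := placeDegree_pos p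
      push_cast at hn
      omega
    | succ n ih =>
      intro E hE hn
      by_cases h : E = D
      · exact h ▸ h0
      obtain ⟨p, hp⟩ := Finsupp.ne_iff.mp h
      have h3 : D ≤ E - Finsupp.single p 1 := by
        intro q
        have := hE q
        by_cases hq : q = p
        · subst hq
          simp
          omega
        · simpa [Finsupp.single_apply, Ne.symm hq] using this
      have h4 := ih _ h3 (by
        rw [sub_right_comm, map_sub, degHom_single]
        have := placeDegree_pos p
        push_cast at hn
        omega)
      simpa using h1 _ p h3 h4
  exact key (degHom F K (E - D)).toNat E hE (by
    rw [Int.toNat_of_nonneg (degHom_nonneg (sub_nonneg.mpr hE))])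

theorem LL_le_deg {D E : Divisor F K} (hDE : D ≤ E) (hD : Module.Finite F (LL D)) :
    Module.Finite F (LL E) ∧ (ell F E : ℤ) ≤ ell F D + degHom F K (E - D) := by
  refine divisor_induction (P := fun E => Module.Finite F (LL E) ∧
    (ell F E : ℤ) ≤ ell F D + degHom F K (E - D)) D ⟨hD, by simp⟩ ?_ hDE
  rintro E p - ⟨h1, h2⟩
  obtain ⟨h3, h4⟩ := LL_add_single E p h1
  refine ⟨h3, ?_⟩
  rw [add_sub_right_comm, map_add, degHom_single]
  omega

end Divisors

section Residues

variable {F K : Type*} [Field F] [Field K] [Algebra F K]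

theorem Place.res_pow (p : Place F K) {f : K} (hf : f ∈ p.1) (n : ℕ) :
    p.res (f ^ n) = p.res f ^ n := by
  induction n with
  | zero => simpa using p.res_const 1
  | succ n ih => rw [pow_succ, p.res_mul (p.1.toSubring.pow_mem hf n) hf, ih, pow_succ]

theorem Place.res_aeval (p : Place F K) {f : K} (hf : f ∈ p.1) (P : F[X]) :
    p.res (aeval f P) = aeval (p.res f) P := by
  induction P using Polynomial.induction_on' with
  | add P Q hP hQ =>
    rw [map_add, map_add, p.res_add (p.aeval_mem hf P) (p.aeval_mem hf Q), hP, hQ]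
  | monomial n c =>
    rw [aeval_monomial, aeval_monomial, p.res_mul (p.const_mem c) (p.1.toSubring.pow_mem hf n),
      p.res_pow hf, p.res_const]

end Residues

/-- A function field of genus four and class number one. -/
class Genus4 (F K : Type*) [Field F] [Field K] [Algebra F K] : Prop extends FunField F K where
  genus_eq : genus F K = 4
  classNumber_eq : classNumber F K = 1

section Riemann

variable {F K : Type*} [Field F] [Field K] [Algebra F K] [Genus4 F K]

theorem genus_spec : (∀ D : Divisor F K, degHom F K D - 3 ≤ ell F D) ∧
    ∃ D : Divisor F K, (ell F D : ℤ) = degHom F K D - 3 := by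
  have hg : genus F K = 4 := Genus4.genus_eq
  unfold genus at hg
  set S := {g : ℕ | ∃ D : Divisor F K, (g : ℤ) = degHom F K D + 1 - ell F D} with hS
  have hne : S.Nonempty := by
    by_contra h
    rw [Set.not_nonempty_iff_eq_empty] at h
    rw [h] at hg
    simp at hg
  have hb : BddAbove S := by
    by_contra h
    rw [Nat.sSup_of_not_bddAbove h] at hg
    simp at hg
  have hmem := Nat.sSup_mem hne hb
  rw [hg] at hmem
  obtain ⟨D, hD⟩ := hmem
  refine ⟨fun E => ?_, D, by push_cast at hD; omega⟩
  by_contra hcon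
  have : (degHom F K E + 1 - ell F E).toNat ∈ S := ⟨E, by omega⟩
  have := le_csSup hb this
  rw [hg] at this
  omega

theorem riemann (D : Divisor F K) : degHom F K D - 3 ≤ ell F D := genus_spec.1 D

instance : Nonempty (Place F K) := by
  obtain ⟨D, hD⟩ := (genus_spec (F := F) (K := K)).2
  by_contra h
  rw [not_nonempty_iff] at h
  have : D = 0 := Subsingleton.elim _ _
  rw [this, map_zero] at hD
  omega

instance LL_finite (D : Divisor F K) : Module.Finite F (LL D) := by
  obtain ⟨p⟩ := (inferInstance : Nonempty (Place F K))
  let n : ℤ := |degHom F K D| + 4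
  have hE : 0 < ell F (D + Finsupp.single p n) := by
    have := riemann (D + Finsupp.single p n)
    rw [map_add, degHom_single] at this
    have h1 := placeDegree_pos p
    have h3 : n ≤ n * placeDegree F p := by
      have : 0 ≤ n := by positivity
      nlinarith
    have h4 := neg_abs_le (degHom F K D)
    omega
  rw [ell_eq] at hE
  have := Module.finite_of_finrank_pos hE
  have hle : LL D ≤ LL (D + Finsupp.single p n) := by
    apply LL_mono
    simp only [le_add_iff_nonneg_right, Finsupp.single_nonneg]
    positivity
  exact Submodule.finiteDimensional_of_le hle

theorem ell_le_add {D E : Divisor F K} (h : D ≤ E) :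
    (ell F E : ℤ) ≤ ell F D + degHom F K (E - D) := (LL_le_deg h inferInstance).2

theorem ell_le_of_mul {D E : Divisor F K} {f : K} (hf : f ≠ 0) (h : ∀ g ∈ LL D, f * g ∈ LL E) :
    ell F D ≤ ell F E := by
  rw [ell_eq, ell_eq]
  exact LinearMap.finrank_le_finrank_of_injective
    (f := ((LinearMap.mulLeft F f).restrict h)) (by
      intro a b hab
      have : f * a.1 = f * b.1 := congrArg Subtype.val hab
      exact Subtype.ext (mul_left_cancel₀ hf this))

theorem deg_lower {D : Divisor F K} {f : K} (hf : f ≠ 0) (h : f ∈ LL D) :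
    -3 - (ell F (0 : Divisor F K) : ℤ) ≤ degHom F K D := by
  have h1 := riemann (-D)
  have h2 : ell F (-D) ≤ ell F (0 : Divisor F K) := ell_le_of_mul hf fun g hg => by
    simpa using LL_mul h hg
  rw [map_neg] at h1
  omega

theorem finite_zeros_of_finite_poles {f : K} (hf : f ≠ 0)
    (h : {p : Place F K | p.ord f < 0}.Finite) : {p : Place F K | 0 < p.ord f}.Finite := by
  let E : Divisor F K := Finsupp.onFinset h.toFinset (fun p => max 0 (- p.ord f)) (by
    intro p hp
    simp at hp
    simpa using hp)
  have hE : ∀ p, E p = max 0 (- p.ord f) := fun p => rfl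
  by_contra hinf
  obtain ⟨t, ht, hc⟩ := Set.Infinite.exists_subset_card_eq hinf
    (degHom F K E + 3 + ell F (0 : Divisor F K) + 1).toNat
  let Z : Divisor F K := ∑ p ∈ t, Finsupp.single p 1
  have hZ : ∀ p, Z p = if p ∈ t then 1 else 0 := by
    intro p
    simp only [Z, Finsupp.finsetSum_apply, Finsupp.single_apply]
    simp
  have hmem : f ∈ LL (E - Z) := by
    intro _ p
    rw [Finsupp.sub_apply, hE, hZ]
    split_ifs with hp
    · have : 0 < p.ord f := ht hp
      omega
    · omega
  have h1 := deg_lower hf hmem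
  have h2 : (t.card : ℤ) ≤ degHom F K Z := by
    simp only [Z, map_sum, degHom_single]
    rw [Finset.card_eq_sum_ones]
    push_cast
    refine Finset.sum_le_sum fun p _ => ?_
    have := placeDegree_pos p
    omega
  rw [map_sub] at h1
  rw [hc] at h2
  omega

theorem exists_transcendental_finite_poles :
    ∃ y : K, Transcendental F y ∧ {p : Place F K | p.ord y < 0}.Finite := by
  obtain ⟨p⟩ := (inferInstance : Nonempty (Place F K))
  let D : Divisor F K := Finsupp.single p 5
  have h1 := riemann D
  rw [degHom_single, ell_eq] at h1
  have hp := placeDegree_pos p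
  have h2 : ¬ LL D ≤ (1 : Submodule F K) := by
    intro hle
    rw [Submodule.one_eq_span] at hle
    have := Submodule.finrank_mono hle
    rw [finrank_span_singleton one_ne_zero] at this
    omega
  obtain ⟨y, hy, hy1⟩ := SetLike.not_le_iff_exists.mp h2
  have hyr : y ∉ (algebraMap F K).range := by
    rintro ⟨c, rfl⟩
    exact hy1 (Submodule.mem_one.mpr ⟨c, rfl⟩)
  refine ⟨y, transcendental_of_not_mem hyr, (D.support.finite_toSet).subset ?_⟩
  intro q hq
  have hy0 : y ≠ 0 := by rintro rfl; exact hyr ⟨0, map_zero _⟩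
  have := hy hy0 q
  have hq : q.ord y < 0 := hq
  simp only [Finset.mem_coe, Finsupp.mem_support_iff]
  omega

theorem finite_poles (f : K) : {p : Place F K | p.ord f < 0}.Finite := by
  obtain ⟨y, hy, hfin⟩ := exists_transcendental_finite_poles (F := F) (K := K)
  have hy0 : y ≠ 0 := by rintro rfl; exact hy (isAlgebraic_zero)
  have := finiteDimensional_of_transcendental FunField.isFunctionField hy
  have halg : IsAlgebraic (Algebra.adjoin F {y}) f := by
    have : IsAlgebraic (IntermediateField.adjoin F {y}) f := Algebra.IsAlgebraic.isAlgebraic f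
    open scoped IntermediateField.algebraAdjoinAdjoin in
    exact (IsFractionRing.isAlgebraic_iff (Algebra.adjoin F {y})
      (IntermediateField.adjoin F {y}) K).mpr this
  obtain ⟨P, hP0, hP⟩ := halg
  let a : K := P.leadingCoeff
  have ha0 : a ≠ 0 := by
    simpa [a] using hP0
  have hinteg : ∀ p : Place F K, 0 ≤ p.ord y → ∀ b : Algebra.adjoin F {y}, (b : K) ∈ p.1 := by
    intro p hp b
    obtain ⟨q, hq⟩ := (SetLike.ext_iff.mp (Algebra.adjoin_singleton_eq_range_aeval F y) _).mp b.2
    rw [← hq]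
    exact p.aeval_mem (p.mem_of_ord hp) q
  have hap : {p : Place F K | p.ord a < 0}.Finite := by
    refine hfin.subset fun p hp => ?_
    by_contra hcon
    have h1 := hinteg p (not_lt.mp hcon) P.leadingCoeff
    rw [p.mem_iff ha0] at h1
    exact absurd hp (not_lt.mpr h1)
  have haz := finite_zeros_of_finite_poles ha0 hap
  refine (hfin.union haz).subset fun p hp => ?_
  by_contra hcon
  simp only [Set.mem_union, not_or] at hcon
  have h1 : 0 ≤ p.ord y := not_lt.mp hcon.1
  have h2 : p.ord a ≤ 0 := not_lt.mp hcon.2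
  have hf0 : f ≠ 0 := by
    rintro rfl
    simp [p.ord_zero] at hp
  have hp : p.ord f < 0 := hp
  have h3 : 1 < p.1.valuation f := by
    rw [← not_le, ValuationSubring.valuation_le_one_iff, p.mem_iff hf0]; omega
  have h4 : p.1.valuation a = 1 := by
    apply le_antisymm
    · rw [ValuationSubring.valuation_le_one_iff]; exact hinteg p h1 _
    · rw [← not_lt, p.valuation_lt_one_iff ha0]; omega
  rw [aeval_eq_sum_range] at hP
  have h5 := Valuation.map_sum_eq_of_lt p.1.valuation
    (s := Finset.range (P.natDegree + 1)) (f := fun i => P.coeff i • f ^ i) (j := P.natDegree)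
    (by simp) (by
      intro i hi
      have hi : i < P.natDegree := by
        simp at hi; omega
      simp only [Subalgebra.smul_def, smul_eq_mul, map_mul, map_pow]
      have h6 : p.1.valuation (P.coeff P.natDegree : K) = 1 := h4
      rw [h6, one_mul]
      calc _ ≤ p.1.valuation f ^ i := by
            apply mul_le_of_le_one_left'
            rw [ValuationSubring.valuation_le_one_iff]; exact hinteg p h1 _
        _ < _ := pow_lt_pow_right₀ h3 hi)
  rw [hP, map_zero] at h5
  have h6 : P.coeff P.natDegree • f ^ P.natDegree ≠ 0 := by
    rw [Subalgebra.smul_def, smul_eq_mul]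
    exact mul_ne_zero ha0 (pow_ne_zero _ hf0)
  exact h6 ((Valuation.zero_iff _).mp h5.symm)

theorem finite_ord_ne_zero (f : K) : (Function.support fun p : Place F K => p.ord f).Finite := by
  refine ((finite_poles f).union (finite_poles f⁻¹)).subset fun p hp => ?_
  have hp : p.ord f ≠ 0 := hp
  rcases lt_or_gt_of_ne hp with h | h
  · left; exact h
  · right
    have : p.ord f⁻¹ < 0 := by rw [p.ord_inv]; omega
    exact this

/-- The divisor of a function. -/
def divf (F : Type*) {K : Type*} [Field F] [Field K] [Algebra F K] [Genus4 F K] (f : K) :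
    Divisor F K :=
  Finsupp.ofSupportFinite (fun p => p.ord f) (finite_ord_ne_zero f)

theorem divf_mul {f g : K} (hf : f ≠ 0) (hg : g ≠ 0) : divf F (f * g) = divf F f + divf F g :=
  Finsupp.ext fun p => p.ord_mul hf hg

theorem divf_inv (f : K) : divf F f⁻¹ = - divf F f := Finsupp.ext fun p => p.ord_inv f

theorem divf_div {f g : K} (hf : f ≠ 0) (hg : g ≠ 0) : divf F (f / g) = divf F f - divf F g :=
  Finsupp.ext fun p => p.ord_div hf hg

theorem divf_one : divf F (1 : K) = 0 := Finsupp.ext fun p => p.ord_one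

theorem divf_zpow (f : K) (n : ℤ) : divf F (f ^ n) = n • divf F f :=
  Finsupp.ext fun p => by rw [Finsupp.smul_apply, smul_eq_mul]; exact p.ord_zpow f n

theorem mem_LL_iff {D : Divisor F K} {f : K} (hf : f ≠ 0) : f ∈ LL D ↔ 0 ≤ D + divf F f :=
  ⟨fun h p => h hf p, fun h _ p => h p⟩

theorem mul_mem_LL_iff {D : Divisor F K} {f g : K} (hf : f ≠ 0) :
    f * g ∈ LL D ↔ g ∈ LL (D + divf F f) := by
  by_cases hg : g = 0
  · simp [hg]
  rw [mem_LL_iff hg, mem_LL_iff (mul_ne_zero hf hg), divf_mul hf hg, add_assoc]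

theorem ell_add_divf (D : Divisor F K) {f : K} (hf : f ≠ 0) :
    ell F (D + divf F f) = ell F D := by
  apply le_antisymm
  · exact ell_le_of_mul hf fun g hg => (mul_mem_LL_iff hf).mpr hg
  · refine ell_le_of_mul (inv_ne_zero hf) fun g hg => ?_
    rwa [mul_mem_LL_iff (inv_ne_zero hf), divf_inv, add_neg_cancel_right]

theorem deg_divf (f : K) (hf : f ≠ 0) : degHom F K (divf F f) = 0 := by
  have key : ∀ n : ℤ, n * degHom F K (divf F f) - 3 ≤ ell F (0 : Divisor F K) := by
    intro n
    have h1 := riemann (divf F (f ^ n))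
    have h2 := ell_add_divf (0 : Divisor F K) (zpow_ne_zero n hf)
    rw [zero_add] at h2
    rw [h2, divf_zpow, map_zsmul, smul_eq_mul] at h1
    exact h1
  by_contra hne
  have := key ((ell F (0 : Divisor F K) + 4) * degHom F K (divf F f))
  have h2 : 1 ≤ degHom F K (divf F f) ^ 2 := by
    have := sq_pos_of_ne_zero hne
    omega
  nlinarith

theorem deg_nonneg_of_mem {D : Divisor F K} {f : K} (hf : f ≠ 0) (h : f ∈ LL D) :
    0 ≤ degHom F K D := by
  have := degHom_nonneg ((mem_LL_iff hf).mp h)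
  rwa [map_add, deg_divf f hf, add_zero] at this

theorem LL_eq_bot {D : Divisor F K} (h : degHom F K D < 0) : LL D = ⊥ := by
  rw [eq_bot_iff]
  intro f hf
  by_contra h0
  exact absurd h (not_lt.mpr (deg_nonneg_of_mem h0 hf))

theorem eq_zero_of_deg {D : Divisor F K} (h : 0 ≤ D) (hd : degHom F K D = 0) : D = 0 := by
  by_contra hne
  obtain ⟨p, hp⟩ := Finsupp.ne_iff.mp hne
  have hp : D p ≠ 0 := hp
  have h2 : (0 : Divisor F K) ≤ D - Finsupp.single p 1 := by
    intro q
    have := h q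
    simp at this
    by_cases hq : q = p
    · subst hq
      simp
      omega
    · simpa [Finsupp.single_apply, Ne.symm hq] using this
  have := degHom_nonneg h2
  rw [map_sub, degHom_single, hd] at this
  have := placeDegree_pos p
  omega

theorem mem_LL_zero_iff {f : K} : f ∈ LL (0 : Divisor F K) ↔ f ∈ (algebraMap F K).range := by
  constructor
  · intro h
    by_contra hcon
    have htr := transcendental_of_not_mem hcon
    obtain ⟨p⟩ := (inferInstance : Nonempty (Place F K))
    have hf0 : f ≠ 0 := by rintro rfl; exact hcon ⟨0, map_zero _⟩
    have hmem : ∀ q : Place F K, f ∈ q.1 := fun q => q.mem_of_ord (by simpa using h hf0 q)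
    have halg : IsAlgebraic F (p.res f) := Algebra.IsAlgebraic.isAlgebraic _
    obtain ⟨P, hP0, hP⟩ := halg
    have hg0 : aeval f P ≠ 0 := fun h0 => htr ⟨P, hP0, h0⟩
    have hres := p.res_aeval (hmem p) P
    have h1 : aeval f P ∈ LL (- Finsupp.single p 1 : Divisor F K) := by
      intro _ q
      have h2 := (q.mem_iff hg0).mp (q.aeval_mem (hmem q) P)
      by_cases hq : q = p
      · subst hq
        have := (q.res_eq_zero_iff_ord (q.aeval_mem (hmem q) P) hg0).mp (hres.trans hP)
        simp
        omega
      · simpa [Finsupp.single_apply, Ne.symm hq] using h2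
    have := deg_nonneg_of_mem hg0 h1
    rw [map_neg, degHom_single] at this
    have := placeDegree_pos p
    omega
  · rintro ⟨c, rfl⟩ _ p
    simp [p.ord_const]

theorem ell_zero : ell F (0 : Divisor F K) = 1 := by
  have : LL (0 : Divisor F K) = (1 : Submodule F K) := by
    ext f
    rw [mem_LL_zero_iff, Submodule.mem_one]
    rfl
  rw [ell_eq, this, Submodule.one_eq_span, finrank_span_singleton one_ne_zero]

theorem exists_divf_eq {D : Divisor F K} (hD : degHom F K D = 0) :
    ∃ f : K, f ≠ 0 ∧ divf F f = D := by
  have h1 : Nat.card (ClassGroup0 F K) = 1 := Genus4.classNumber_eq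
  have h2 := (Nat.card_eq_one_iff_unique.mp h1).1
  have h3 : D ∈ principalDivisors F K := by
    have h4 : (QuotientAddGroup.mk (⟨D, hD⟩ : zeroDivisors F K) :
        zeroDivisors F K ⧸ (principalDivisors F K).addSubgroupOf (zeroDivisors F K)) =
        QuotientAddGroup.mk 0 := h2.elim _ _
    rw [QuotientAddGroup.mk_zero, QuotientAddGroup.eq_zero_iff] at h4
    exact h4
  unfold principalDivisors at h3
  clear hD
  induction h3 using AddSubgroup.closure_induction with
  | mem E hE =>
    obtain ⟨f, hf, hE⟩ := hE
    exact ⟨f, hf, Finsupp.ext fun p => (hE p).symm⟩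
  | zero => exact ⟨1, one_ne_zero, divf_one⟩
  | add E E' h1 h2 ih1 ih2 =>
    obtain ⟨f, hf, rfl⟩ := ih1
    obtain ⟨g, hg, rfl⟩ := ih2
    exact ⟨f * g, mul_ne_zero hf hg, divf_mul hf hg⟩
  | neg E h1 ih =>
    obtain ⟨f, hf, rfl⟩ := ih
    exact ⟨f⁻¹, inv_ne_zero hf, divf_inv f⟩

theorem ell_eq_of_deg_eq {D E : Divisor F K} (h : degHom F K D = degHom F K E) :
    ell F D = ell F E := by
  obtain ⟨f, hf, h1⟩ := exists_divf_eq (D := D - E) (by rw [map_sub, h, sub_self])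
  rw [← ell_add_divf E hf, h1, add_sub_cancel]

theorem exists_ell_eq : ∃ N : ℤ, ∀ D : Divisor F K, N ≤ degHom F K D →
    (ell F D : ℤ) = degHom F K D - 3 := by
  obtain ⟨D0, hD0⟩ := (genus_spec (F := F) (K := K)).2
  refine ⟨degHom F K D0 + 4, fun D hD => le_antisymm ?_ (riemann D)⟩
  have h1 := riemann (D - D0)
  rw [map_sub] at h1
  have h2 : 0 < ell F (D - D0) := by omega
  rw [ell_eq, Module.finrank_pos_iff] at h2
  obtain ⟨⟨f, hf⟩, hf0⟩ := exists_ne (0 : LL (D - D0))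
  have hf0 : f ≠ 0 := fun h => hf0 (Subtype.ext h)
  have h3 := (mem_LL_iff hf0).mp hf
  have h4 : D0 ≤ D + divf F f := by
    have : D + divf F f = D0 + (D - D0 + divf F f) := by abel
    rw [this]
    exact le_add_of_nonneg_right h3
  have h5 := ell_le_add h4
  rw [ell_add_divf D hf0, map_sub, map_add, deg_divf f hf0] at h5
  omega

end Riemann

section RiemannRoch

theorem finrank_map_of_injective {F V W : Type*} [Field F] [AddCommGroup V] [Module F V]
    [AddCommGroup W] [Module F W] {f : V →ₗ[F] W} (hf : Function.Injective f)
    (S : Submodule F V) : Module.finrank F (S.map f) = Module.finrank F S :=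
  (Submodule.equivMapOfInjective f hf S).finrank_eq.symm

universe u v

variable {F : Type u} {K : Type v} [Field F] [Field K] [Algebra F K] [Genus4 F K]

/-- The restricted product of copies of `K` over all places (the adeles without completion). -/
def adeleSubmodule (F K : Type*) [Field F] [Field K] [Algebra F K] [Genus4 F K] :
    Submodule F (Place F K → K) where
  carrier := {α | {p : Place F K | p.ord (α p) < 0}.Finite}
  zero_mem' := by simp [Place.ord_zero]
  add_mem' := by
    intro α β hα hβ
    refine (hα.union hβ).subset fun p hp => ?_
    by_contra hcon
    simp only [Set.mem_union, Set.mem_ofPred_eq, not_or, not_lt] at hcon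
    have hp : p.ord (α p + β p) < 0 := hp
    have h0 : α p + β p ≠ 0 := fun h => by rw [h, p.ord_zero] at hp; omega
    have := p.le_ord_add h0 (fun _ => hcon.1) (fun _ => hcon.2)
    omega
  smul_mem' := by
    intro c α hα
    refine Set.Finite.subset hα fun p hp => ?_
    have hp : p.ord (c • α p) < 0 := hp
    have h0 : c • α p ≠ 0 := fun h => by rw [h, p.ord_zero] at hp; omega
    rw [Algebra.smul_def] at hp h0
    rw [p.ord_mul (left_ne_zero_of_mul h0) (right_ne_zero_of_mul h0), p.ord_const, zero_add] at hp
    exact hp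

/-- The type of adeles. -/
def Adele (F : Type u) (K : Type v) [Field F] [Field K] [Algebra F K] [Genus4 F K] : Type v :=
  adeleSubmodule F K

instance : AddCommGroup (Adele F K) := inferInstanceAs (AddCommGroup (adeleSubmodule F K))

instance : Module F (Adele F K) := inferInstanceAs (Module F (adeleSubmodule F K))

/-- The adeles bounded by a divisor. -/
def AD (D : Divisor F K) : Submodule F (Adele F K) where
  carrier := {α | ∀ p : Place F K, α.1 p ≠ 0 → - D p ≤ p.ord (α.1 p)}
  zero_mem' := fun p h => absurd rfl h
  add_mem' := fun hα hβ p h => p.le_ord_add h (hα p) (hβ p)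
  smul_mem' := by
    intro c α hα p h
    have h : c • α.1 p ≠ 0 := h
    change _ ≤ p.ord (c • α.1 p)
    rw [Algebra.smul_def] at h ⊢
    rw [p.ord_mul (left_ne_zero_of_mul h) (right_ne_zero_of_mul h), p.ord_const, zero_add]
    exact hα p (right_ne_zero_of_mul h)

/-- The diagonal embedding of `K`. -/
def diag (F K : Type*) [Field F] [Field K] [Algebra F K] [Genus4 F K] : K →ₗ[F] Adele F K where
  toFun f := ⟨fun _ => f, finite_poles f⟩
  map_add' _ _ := rfl
  map_smul' _ _ := rfl

theorem diag_mem_AD {D : Divisor F K} {f : K} : diag F K f ∈ AD D ↔ f ∈ LL D := by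
  constructor
  · intro h h0 p
    have : - D p ≤ p.ord f := h p h0
    omega
  · intro h p h0
    have : 0 ≤ D p + p.ord f := h h0 p
    change - D p ≤ p.ord f
    omega

/-- The sum of the bounded adeles and the principal adeles. -/
def SD (D : Divisor F K) : Submodule F (Adele F K) := AD D ⊔ LinearMap.range (diag F K)

theorem AD_mono {D E : Divisor F K} (h : D ≤ E) : AD D ≤ AD E := by
  intro α hα p h0
  have := hα p h0
  have := h p
  omega

theorem mem_SD {D : Divisor F K} {α : Adele F K} : α ∈ SD D ↔ ∃ f : K, α - diag F K f ∈ AD D := by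
  unfold SD
  rw [Submodule.mem_sup]
  constructor
  · rintro ⟨β, hβ, _, ⟨f, rfl⟩, rfl⟩
    exact ⟨f, by simpa using hβ⟩
  · rintro ⟨f, hf⟩
    exact ⟨_, hf, _, ⟨f, rfl⟩, by simp⟩

/-- The adele supported at one place. -/
def localAdele (p : Place F K) (f : K) : Adele F K :=
  ⟨fun q => if q = p then f else 0, (Set.finite_singleton p).subset fun q hq => by
    by_contra hcon
    have hcon : q ≠ p := hcon
    have hq : q.ord (if q = p then f else 0) < 0 := hq
    rw [if_neg hcon, q.ord_zero] at hq
    omega⟩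

/-- The leading coefficient map on bounded adeles. -/
theorem exists_leadMap_AD (D : Divisor F K) (p : Place F K) {π : K} (hπ : π ≠ 0)
    (hπD : p.ord π = D p + 1) :
    ∃ φ : AD (D + Finsupp.single p 1) →ₗ[F] IsLocalRing.ResidueField p.1,
      (∀ α, φ α = p.res (α.1.1 p * π)) ∧ Function.Surjective φ ∧
      ∀ α : AD (D + Finsupp.single p 1), φ α = 0 ↔ α.1 ∈ AD D := by
  have hm : ∀ α : AD (D + Finsupp.single p 1), α.1.1 p * π ∈ p.1 := by
    rintro ⟨α, hα⟩
    by_cases h0 : α.1 p = 0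
    · simp [h0]
    apply p.mem_of_ord
    rw [p.ord_mul h0 hπ]
    have := hα p h0
    simp at this
    omega
  refine ⟨{ toFun := fun f => p.res (f.1.1 p * π), map_add' := ?_, map_smul' := ?_ },
    fun f => rfl, ?_, ?_⟩
  · intro f g
    rw [← p.res_add (hm f) (hm g), ← add_mul]; rfl
  · intro c f
    rw [RingHom.id_apply, ← p.res_smul c (hm f), ← smul_mul_assoc]; rfl
  · intro a
    obtain ⟨g, hg, rfl⟩ := p.res_surjective a
    refine ⟨⟨localAdele p (g / π), ?_⟩, ?_⟩
    · intro q hq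
      by_cases hqp : q = p
      · subst hqp
        simp only [localAdele, if_true] at hq ⊢
        have hg0 : g ≠ 0 := by rintro rfl; simp at hq
        rw [q.ord_div hg0 hπ, hπD]
        have := (q.mem_iff hg0).mp hg
        simp
        omega
      · simp [localAdele, hqp] at hq
    · change p.res ((if p = p then g / π else 0) * π) = _
      rw [if_pos rfl, div_mul_cancel₀ _ hπ]
  · intro α
    change p.res (α.1.1 p * π) = 0 ↔ _
    by_cases h0 : α.1.1 p = 0
    · rw [h0, zero_mul]
      have : p.res (0 : K) = 0 := by simpa using p.res_const 0
      simp only [this, true_iff]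
      intro q hq
      by_cases hqp : q = p
      · subst hqp; exact absurd h0 hq
      · have := α.2 q hq
        simpa [Finsupp.single_apply, Ne.symm hqp] using this
    rw [p.res_eq_zero_iff_ord (hm α) (mul_ne_zero h0 hπ), p.ord_mul h0 hπ, hπD]
    constructor
    · intro h q hq
      by_cases hqp : q = p
      · subst hqp; omega
      · have := α.2 q hq
        simpa [Finsupp.single_apply, Ne.symm hqp] using this
    · intro h
      have := h p h0
      omega

theorem leadMap_compare (D : Divisor F K) (p : Place F K) :
    ∃ (κ : Type v) (_ : AddCommGroup κ) (_ : Module F κ) (_ : Module.Finite F κ)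
      (φ : AD (D + Finsupp.single p 1) →ₗ[F] κ) (R : Submodule F κ),
      Module.finrank F κ = placeDegree F p ∧ Function.Surjective φ ∧
      (∀ α : AD (D + Finsupp.single p 1), φ α = 0 ↔ α.1 ∈ AD D) ∧
      (∀ a, a ∈ R ↔ ∃ f, ∃ hf : diag F K f ∈ AD (D + Finsupp.single p 1), φ ⟨_, hf⟩ = a) ∧
      Module.finrank F R + ell F D = ell F (D + Finsupp.single p 1) := by
  obtain ⟨π, hπ, hπD⟩ := p.exists_ord_eq (D p + 1)
  obtain ⟨φ, h1, h2, h3⟩ := exists_leadMap_AD D p hπ hπD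
  obtain ⟨ψ, h4, -, h5⟩ := exists_leadMap D p hπ hπD
  have hle : LL D ≤ LL (D + Finsupp.single p 1) := LL_mono (by simp)
  have h6 := (finrank_of_ker_eq hle ψ h5).2
  refine ⟨IsLocalRing.ResidueField p.1, inferInstance, inferInstance, inferInstance, φ,
    LinearMap.range ψ, (placeDegree_eq p).symm, h2, h3, ?_, by rw [ell_eq, ell_eq, h6, add_comm]⟩
  intro a
  constructor
  · rintro ⟨f, rfl⟩
    exact ⟨f.1, diag_mem_AD.mpr f.2, by rw [h1, h4]; rfl⟩
  · rintro ⟨f, hf, rfl⟩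
    exact ⟨⟨f, diag_mem_AD.mp hf⟩, by rw [h1, h4]; rfl⟩

theorem SD_eq_top : ∃ N : ℤ, ∀ D : Divisor F K, N ≤ degHom F K D →
    (ell F D : ℤ) = degHom F K D - 3 ∧ SD D = ⊤ := by
  obtain ⟨N, hN⟩ := exists_ell_eq (F := F) (K := K)
  refine ⟨N, fun D hD => ⟨hN D hD, ?_⟩⟩
  rw [eq_top_iff]
  rintro α -
  have hfin : {p : Place F K | p.ord (α.1 p) < 0}.Finite := α.2
  obtain ⟨E, hE, hα⟩ : ∃ E : Divisor F K, D ≤ E ∧ α ∈ AD E := by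
    refine ⟨D ⊔ Finsupp.onFinset hfin.toFinset (fun p => max 0 (- p.ord (α.1 p))) ?_,
      le_sup_left, ?_⟩
    · intro p hp
      simp at hp
      simpa using hp
    · intro p _
      rw [Finsupp.sup_apply, Finsupp.onFinset_apply]
      have h1 := le_max_right 0 (- p.ord (α.1 p))
      have h2 := le_max_right (D p) (max 0 (- p.ord (α.1 p)))
      change _ ≤ D p ⊔ _ at h2
      omega
  have key : AD E ≤ SD D := by
    refine divisor_induction (P := fun E => AD E ≤ SD D) D le_sup_left ?_ hE
    intro E p hDE ih β hβ
    obtain ⟨κ, _, _, _, φ, R, h0, h1, h2, h3, h4⟩ := leadMap_compare E p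
    have hdeg : degHom F K D ≤ degHom F K E := by
      have := degHom_nonneg (sub_nonneg.mpr hDE)
      rw [map_sub] at this
      omega
    have h5 := hN E (by omega)
    have h6 := hN (E + Finsupp.single p 1) (by
      rw [map_add, degHom_single]
      omega)
    rw [map_add, degHom_single] at h6
    have hR : R = ⊤ := by
      apply Submodule.eq_top_of_finrank_eq
      omega
    have h7 : φ ⟨β, hβ⟩ ∈ R := hR ▸ Submodule.mem_top
    obtain ⟨f, hf, h8⟩ := (h3 _).mp h7
    have h9 : φ (⟨β, hβ⟩ - ⟨_, hf⟩) = 0 := by rw [map_sub, h8, sub_self]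
    rw [h2] at h9
    have h10 := ih h9
    have : β = (β - diag F K f) + diag F K f := by simp
    rw [this]
    exact Submodule.add_mem _ h10 (Submodule.mem_sup_right ⟨f, rfl⟩)
  exact key hα

/-- The codimension of `A(D) + K` in the adeles is the index of speciality. -/
def Spec (D : Divisor F K) : Prop := Module.Finite F (Adele F K ⧸ SD D) ∧
    (Module.finrank F (Adele F K ⧸ SD D) : ℤ) = 3 - degHom F K D + ell F D

theorem Spec_of_add_single {D : Divisor F K} {p : Place F K}
    (h : Spec (D + Finsupp.single p 1)) : Spec D := by
  obtain ⟨hfin, hrk⟩ := h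
  obtain ⟨κ, _, _, _, φ, R, h0, h1, h2, h3, h4⟩ := leadMap_compare D p
  have hle : AD D ≤ AD (D + Finsupp.single p 1) := AD_mono (by simp)
  have hST : SD D ≤ SD (D + Finsupp.single p 1) := sup_le_sup_right hle _
  let T := (SD (D + Finsupp.single p 1)).map (SD D).mkQ
  let ψ : AD (D + Finsupp.single p 1) →ₗ[F] Adele F K ⧸ SD D :=
    (SD D).mkQ.comp (Submodule.subtype _)
  let χ : AD (D + Finsupp.single p 1) →ₗ[F] κ ⧸ R := R.mkQ.comp φ
  have hker : LinearMap.ker ψ = LinearMap.ker χ := by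
    ext α
    simp only [ψ, χ, LinearMap.mem_ker, LinearMap.comp_apply, Submodule.mkQ_apply,
      Submodule.Quotient.mk_eq_zero, Submodule.subtype_apply, mem_SD, h3]
    constructor
    · rintro ⟨f, hf⟩
      have hf' : diag F K f ∈ AD (D + Finsupp.single p 1) := by
        have := Submodule.sub_mem _ α.2 (hle hf)
        simpa using this
      refine ⟨f, hf', ?_⟩
      have := (h2 (α - ⟨_, hf'⟩)).mpr hf
      rw [map_sub, sub_eq_zero] at this
      exact this.symm
    · rintro ⟨f, hf, h⟩
      refine ⟨f, ?_⟩
      refine (h2 (α - ⟨_, hf⟩)).mp ?_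
      rw [map_sub, h, sub_self]
  have hrange : LinearMap.range ψ = T := by
    apply le_antisymm
    · rintro _ ⟨α, rfl⟩
      exact ⟨α.1, Submodule.mem_sup_left α.2, rfl⟩
    · rintro _ ⟨α, hα, rfl⟩
      obtain ⟨f, hf⟩ := mem_SD.mp hα
      refine ⟨⟨_, hf⟩, ?_⟩
      change (SD D).mkQ (α - diag F K f) = _
      rw [map_sub, sub_eq_self]
      rw [Submodule.mkQ_apply, Submodule.Quotient.mk_eq_zero]
      exact Submodule.mem_sup_right ⟨f, rfl⟩
  have hχ : Function.Surjective χ := (Submodule.mkQ_surjective R).comp h1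
  have e : T ≃ₗ[F] κ ⧸ R :=
    (LinearEquiv.ofEq _ _ hrange.symm).trans (ψ.quotKerEquivRange.symm.trans
      ((Submodule.quotEquivOfEq _ _ hker).trans (χ.quotKerEquivOfSurjective hχ)))
  have e2 : ((Adele F K ⧸ SD D) ⧸ T) ≃ₗ[F] Adele F K ⧸ SD (D + Finsupp.single p 1) :=
    Submodule.quotientQuotientEquivQuotient _ _ hST
  have hT : Module.Finite F T := Module.Finite.equiv e.symm
  have hQ : Module.Finite F ((Adele F K ⧸ SD D) ⧸ T) := Module.Finite.equiv e2.symm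
  have hfinD : Module.Finite F (Adele F K ⧸ SD D) := Module.Finite.of_submodule_quotient T
  refine ⟨hfinD, ?_⟩
  have h5 := T.finrank_quotient_add_finrank
  rw [e.finrank_eq, e2.finrank_eq] at h5
  have h6 := R.finrank_quotient_add_finrank
  rw [map_add, degHom_single] at hrk
  omega

theorem spec_all (D : Divisor F K) : Spec D := by
  obtain ⟨N, hN⟩ := SD_eq_top (F := F) (K := K)
  obtain ⟨p⟩ := (inferInstance : Nonempty (Place F K))
  have hpd := placeDegree_pos p
  have key : ∀ n : ℕ, ∀ D : Divisor F K, N ≤ degHom F K D + n → Spec D := by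
    intro n
    induction n with
    | zero =>
      intro D hD
      obtain ⟨h1, h2⟩ := hN D (by simpa using hD)
      have : Subsingleton (Adele F K ⧸ SD D) := Submodule.Quotient.subsingleton_iff.mpr h2
      refine ⟨inferInstance, ?_⟩
      rw [Module.finrank_zero_of_subsingleton, h1]
      simp
    | succ n ih =>
      intro D hD
      refine Spec_of_add_single (p := p) (ih _ ?_)
      rw [map_add, degHom_single]
      push_cast at hD
      omega
  exact key (N - degHom F K D).toNat D (by omega)

/-- Functionals on the adeles vanishing on `A(D) + K`. -/
def Omega (D : Divisor F K) : Submodule F (Module.Dual F (Adele F K)) := (SD D).dualAnnihilator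

theorem mem_Omega {D : Divisor F K} {ω : Module.Dual F (Adele F K)} :
    ω ∈ Omega D ↔ (∀ α ∈ AD D, ω α = 0) ∧ ∀ f, ω (diag F K f) = 0 := by
  unfold Omega
  rw [Submodule.mem_dualAnnihilator]
  constructor
  · exact fun h => ⟨fun α hα => h α (Submodule.mem_sup_left hα),
      fun f => h _ (Submodule.mem_sup_right ⟨f, rfl⟩)⟩
  · rintro ⟨h1, h2⟩ α hα
    obtain ⟨f, hf⟩ := mem_SD.mp hα
    have := h1 _ hf
    rw [map_sub, h2, sub_zero] at this
    exact this

theorem finrank_Omega (D : Divisor F K) : Module.Finite F (Omega D) ∧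
    (Module.finrank F (Omega D) : ℤ) = 3 - degHom F K D + ell F D := by
  obtain ⟨h1, h2⟩ := spec_all D
  have e := (SD D).dualQuotEquivDualAnnihilator
  refine ⟨Module.Finite.equiv e, ?_⟩
  unfold Omega
  rw [← e.finrank_eq, Subspace.dual_finrank_eq, h2]

/-- Multiplication by a function on the adeles. -/
def mulA (F : Type*) {K : Type*} [Field F] [Field K] [Algebra F K] [Genus4 F K] (f : K) :
    Adele F K →ₗ[F] Adele F K where
  toFun α := ⟨fun p => f * α.1 p, ((finite_poles f).union α.2).subset fun p hp => by
    by_contra hcon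
    simp only [Set.mem_union, Set.mem_ofPred_eq, not_or, not_lt] at hcon
    have hp : p.ord (f * α.1 p) < 0 := hp
    have h0 : f * α.1 p ≠ 0 := fun h => by rw [h, p.ord_zero] at hp; omega
    rw [p.ord_mul (left_ne_zero_of_mul h0) (right_ne_zero_of_mul h0)] at hp
    omega⟩
  map_add' α β := Subtype.ext (funext fun p => mul_add _ _ _)
  map_smul' c α := Subtype.ext (funext fun p => mul_smul_comm _ _ _)

theorem mulA_mem {D E : Divisor F K} {f : K} {α : Adele F K} (hf : f ∈ LL E) (hα : α ∈ AD D) :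
    mulA F f α ∈ AD (D + E) := by
  intro p h0
  have h0 : f * α.1 p ≠ 0 := h0
  change _ ≤ p.ord (f * α.1 p)
  have h1 := hf (left_ne_zero_of_mul h0) p
  have h2 := hα p (right_ne_zero_of_mul h0)
  rw [p.ord_mul (left_ne_zero_of_mul h0) (right_ne_zero_of_mul h0), Finsupp.add_apply]
  omega

theorem mulA_mulA (f g : K) (α : Adele F K) : mulA F f (mulA F g α) = mulA F (f * g) α :=
  Subtype.ext (funext fun _ => (mul_assoc _ _ _).symm)

theorem mulA_one (α : Adele F K) : mulA F (1 : K) α = α :=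
  Subtype.ext (funext fun _ => one_mul _)

/-- The action of functions on functionals. -/
def actW (ω : Module.Dual F (Adele F K)) : K →ₗ[F] Module.Dual F (Adele F K) where
  toFun f := ω.comp (mulA F f)
  map_add' f g := by
    ext α
    change ω (mulA F (f + g) α) = ω (mulA F f α) + ω (mulA F g α)
    rw [← map_add]
    exact congrArg ω (Subtype.ext (funext fun p => add_mul _ _ _))
  map_smul' c f := by
    ext α
    change ω (mulA F (c • f) α) = c • ω (mulA F f α)
    rw [← map_smul]
    exact congrArg ω (Subtype.ext (funext fun p => smul_mul_assoc _ _ _))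

theorem actW_mem {ω : Module.Dual F (Adele F K)} {D E : Divisor F K} (hω : ω ∈ Omega (D + E))
    {f : K} (hf : f ∈ LL E) : actW ω f ∈ Omega D := by
  rw [mem_Omega] at hω ⊢
  exact ⟨fun α hα => hω.1 _ (mulA_mem hf hα), fun g => hω.2 (f * g)⟩

theorem actW_injective {ω : Module.Dual F (Adele F K)} (hω : ω ≠ 0) :
    Function.Injective (actW ω) := by
  rw [injective_iff_map_eq_zero]
  intro f hf
  by_contra h0
  apply hω
  ext α
  have : actW ω f (mulA F f⁻¹ α) = 0 := by rw [hf]; rfl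
  change ω (mulA F f (mulA F f⁻¹ α)) = 0 at this
  rwa [mulA_mulA, mul_inv_cancel₀ h0, mulA_one] at this

theorem exists_eq_actW {ω ω' : Module.Dual F (Adele F K)} {D D' : Divisor F K}
    (hω : ω ∈ Omega D) (hω' : ω' ∈ Omega D') (h0 : ω ≠ 0) (h0' : ω' ≠ 0) :
    ∃ h : K, h ≠ 0 ∧ ω' = actW ω h := by
  obtain ⟨p⟩ := (inferInstance : Nonempty (Place F K))
  have hpd := placeDegree_pos p
  let n : ℤ := -(|degHom F K D| + |degHom F K D'| + 10)
  let E : Divisor F K := Finsupp.single p n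
  have hE : degHom F K E ≤ n := by
    rw [degHom_single]
    have h1 : n ≤ 0 := by simp only [n]; have := abs_nonneg (degHom F K D); have := abs_nonneg (degHom F K D'); omega
    nlinarith
  have hE0 : degHom F K E < 0 := by
    have := abs_nonneg (degHom F K D)
    have := abs_nonneg (degHom F K D')
    omega
  obtain ⟨hfin, hrk⟩ := finrank_Omega E
  have hell : ell F E = 0 := by rw [ell_eq, LL_eq_bot hE0, finrank_bot]
  let a : Submodule F _ := (LL (D - E)).map (actW ω)
  let b : Submodule F _ := (LL (D' - E)).map (actW ω')
  have ha : a ≤ Omega E := by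
    rintro _ ⟨f, hf, rfl⟩
    exact actW_mem (E := D - E) (by simpa using hω) hf
  have hb : b ≤ Omega E := by
    rintro _ ⟨f, hf, rfl⟩
    exact actW_mem (E := D' - E) (by simpa using hω') hf
  have hra : Module.finrank F a = ell F (D - E) := by
    rw [ell_eq]
    exact finrank_map_of_injective (actW_injective h0) _
  have hrb : Module.finrank F b = ell F (D' - E) := by
    rw [ell_eq]
    exact finrank_map_of_injective (actW_injective h0') _
  have hfa : Module.Finite F a := Submodule.finiteDimensional_of_le ha
  have hfb : Module.Finite F b := Submodule.finiteDimensional_of_le hb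
  have hne : a ⊓ b ≠ ⊥ := by
    intro hbot
    have h1 := Submodule.finrank_sup_add_finrank_inf_eq a b
    rw [hbot, finrank_bot] at h1
    have h2 := Submodule.finrank_mono (sup_le ha hb)
    have h3 := riemann (D - E)
    have h4 := riemann (D' - E)
    rw [map_sub] at h3 h4
    have := neg_abs_le (degHom F K D)
    have := neg_abs_le (degHom F K D')
    omega
  obtain ⟨η, ⟨⟨f, hf, hf1⟩, ⟨g, hg, hg1⟩⟩, hη⟩ := (Submodule.ne_bot_iff _).mp hne
  have hg0 : g ≠ 0 := by
    rintro rfl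
    apply hη
    rw [← hg1, map_zero]
  have hf0 : f ≠ 0 := by
    rintro rfl
    apply hη
    rw [← hf1, map_zero]
  refine ⟨f * g⁻¹, mul_ne_zero hf0 (inv_ne_zero hg0), ?_⟩
  ext α
  have : actW ω f (mulA F g⁻¹ α) = actW ω' g (mulA F g⁻¹ α) := by rw [hf1, hg1]
  change ω (mulA F f (mulA F g⁻¹ α)) = ω' (mulA F g (mulA F g⁻¹ α)) at this
  rw [mulA_mulA, mulA_mulA, mul_inv_cancel₀ hg0, mulA_one] at this
  exact this.symm

theorem exists_canonical : ∃ W : Divisor F K, degHom F K W = 6 ∧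
    ∀ D : Divisor F K, (ell F (W - D) : ℤ) = 3 - degHom F K D + ell F D := by
  obtain ⟨N, hN⟩ := SD_eq_top (F := F) (K := K)
  obtain ⟨hf0, hr0⟩ := finrank_Omega (0 : Divisor F K)
  rw [map_zero, ell_zero] at hr0
  have : Nontrivial (Omega (0 : Divisor F K)) := by
    rw [← Module.finrank_pos_iff (R := F)]
    omega
  obtain ⟨⟨ω, hω⟩, hω0⟩ := exists_ne (0 : Omega (0 : Divisor F K))
  have hω0 : ω ≠ 0 := fun h => hω0 (Subtype.ext h)
  have hbd : ∀ n : ℤ, (∃ W : Divisor F K, ω ∈ Omega W ∧ degHom F K W = n) → n ≤ N := by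
    rintro n ⟨W, hW, rfl⟩
    by_contra hcon
    apply hω0
    have h1 := (hN W (by omega)).2
    unfold Omega at hW
    rw [h1, Submodule.dualAnnihilator_top] at hW
    exact hW
  obtain ⟨n, ⟨W, hW, rfl⟩, hmax⟩ := Int.exists_greatest_of_bdd ⟨N, hbd⟩ ⟨0, 0, hω, map_zero _⟩
  have hlargest : ∀ W' : Divisor F K, ω ∈ Omega W' → W' ≤ W := by
    intro W' hW' p
    by_contra hcon
    have hcon : W p < W' p := not_le.mp hcon
    have h1 : ω ∈ Omega (W + Finsupp.single p 1) := by
      rw [mem_Omega] at hW hW' ⊢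
      refine ⟨fun α hα => ?_, hW.2⟩
      have h2 : localAdele p (α.1 p) ∈ AD W' := by
        intro q hq
        by_cases hqp : q = p
        · subst hqp
          simp only [localAdele, if_true] at hq ⊢
          have := hα q hq
          simp at this
          omega
        · simp [localAdele, hqp] at hq
      have h3 : α - localAdele p (α.1 p) ∈ AD W := by
        intro q hq
        have hq : α.1 q - (if q = p then α.1 p else 0) ≠ 0 := hq
        change _ ≤ q.ord (α.1 q - (if q = p then α.1 p else 0))
        by_cases hqp : q = p
        · subst hqp; simp at hq
        · rw [if_neg hqp, sub_zero] at hq ⊢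
          have := hα q hq
          simpa [Finsupp.single_apply, Ne.symm hqp] using this
      have h4 := hW.1 _ h3
      rw [map_sub, hW'.1 _ h2, sub_zero] at h4
      exact h4
    have h2 := hmax _ ⟨_, h1, rfl⟩
    rw [map_add, degHom_single] at h2
    have := placeDegree_pos p
    omega
  have key : ∀ D : Divisor F K, (ell F (W - D) : ℤ) = 3 - degHom F K D + ell F D := by
    intro D
    rw [← (finrank_Omega D).2, ell_eq]
    have : (LL (W - D)).map (actW ω) = Omega D := by
      apply le_antisymm
      · rintro _ ⟨f, hf, rfl⟩
        exact actW_mem (E := W - D) (by simpa using hW) hf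
      · intro η hη
        by_cases hη0 : η = 0
        · rw [hη0]; exact Submodule.zero_mem _
        obtain ⟨h, hh0, rfl⟩ := exists_eq_actW hW hη hω0 hη0
        refine ⟨h, ?_, rfl⟩
        have h1 : ω = actW (actW ω h) h⁻¹ := by
          ext α
          change _ = ω (mulA F h (mulA F h⁻¹ α))
          rw [mulA_mulA, mul_inv_cancel₀ hh0, mulA_one]
        have h2 : ω ∈ Omega (D - divf F h) := by
          rw [h1]
          refine actW_mem (E := divf F h) (by simpa using hη) ?_
          rw [mem_LL_iff (inv_ne_zero hh0), divf_inv, add_neg_cancel]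
        have h3 := hlargest _ h2
        rw [SetLike.mem_coe, mem_LL_iff hh0]
        have : W - D + divf F h = W - (D - divf F h) := by abel
        rw [this]
        exact sub_nonneg.mpr h3
    rw [← this, finrank_map_of_injective (actW_injective hω0) _]
  refine ⟨W, ?_, key⟩
  have h1 := key 0
  have h2 := key W
  rw [sub_zero, map_zero, ell_zero] at h1
  rw [sub_self, ell_zero] at h2
  omega

end RiemannRoch

section Degree

variable {F K : Type*} [Field F] [Field K] [Algebra F K] [Genus4 F K]

/-- The polar divisor of a function. -/
def poles (F : Type*) {K : Type*} [Field F] [Field K] [Algebra F K] [Genus4 F K] (x : K) :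
    Divisor F K :=
  Finsupp.ofSupportFinite (fun p => max 0 (- p.ord x)) ((finite_poles x).subset fun p hp => by
    have hp : max 0 (- p.ord x) ≠ 0 := hp
    change p.ord x < 0
    by_contra hcon
    exact hp (max_eq_left (by omega)))

theorem poles_apply (x : K) (p : Place F K) : poles F x p = max 0 (- p.ord x) := rfl

theorem poles_nonneg (x : K) : 0 ≤ poles F x := fun p => le_max_left 0 (- p.ord x)

theorem mem_LL_poles (x : K) : x ∈ LL (poles F x) := by
  intro _ p
  rw [poles_apply]
  have := le_max_right 0 (- p.ord x)
  omega

theorem one_mem_LL {D : Divisor F K} (h : 0 ≤ D) : (1 : K) ∈ LL D := by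
  intro _ p
  rw [p.ord_one, add_zero]
  exact h p

theorem pow_mem_LL {D : Divisor F K} {x : K} (h : x ∈ LL D) (n : ℕ) : x ^ n ∈ LL ((n : ℤ) • D) := by
  induction n with
  | zero => simpa using one_mem_LL le_rfl
  | succ n ih =>
    have := LL_mul ih h
    rw [← pow_succ] at this
    convert this using 1
    push_cast
    rw [add_smul, one_smul]

theorem aeval_mem_LL {D : Divisor F K} (hD : 0 ≤ D) {x : K} (h : x ∈ LL D) {n : ℕ} {q : F[X]}
    (hq : q ∈ degreeLT F n) : aeval x q ∈ LL (((n : ℤ) - 1) • D) := by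
  rw [mem_degreeLT] at hq
  by_cases hq0 : q = 0
  · rw [hq0, map_zero]; exact Submodule.zero_mem _
  rw [aeval_eq_sum_range]
  have hn := (natDegree_lt_iff_degree_lt hq0).mpr hq
  refine Submodule.sum_mem _ fun i hi => Submodule.smul_mem _ _ ?_
  refine LL_mono ?_ (pow_mem_LL h i)
  have : (i : ℤ) ≤ n - 1 := by
    have := Finset.mem_range.mp hi
    omega
  intro p
  have h1 : (0 : ℤ) ≤ D p := hD p
  change (i : ℤ) * D p ≤ ((n : ℤ) - 1) * D p
  exact mul_le_mul_of_nonneg_right this h1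

theorem xdeg_le {x : K} (hx : Transcendental F x) : (xdeg F x : ℤ) ≤ degHom F K (poles F x) := by
  obtain ⟨u, hu⟩ := exists_xInd FunField.isFunctionField hx
  generalize xdeg F x = n at u hu ⊢
  let B := poles F x
  let C : Divisor F K := ∑ i, poles F (u i)
  have hC : ∀ i, u i ∈ LL C := fun i =>
    LL_mono (Finset.single_le_sum (fun j _ => poles_nonneg (u j)) (Finset.mem_univ i))
      (mem_LL_poles (u i))
  have hC0 : 0 ≤ C := Finset.sum_nonneg fun j _ => poles_nonneg (u j)
  have hB0 : 0 ≤ B := poles_nonneg x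
  have key : ∀ m : ℕ, ((n : ℤ) * (m + 1)) ≤ m * degHom F K B + (degHom F K C + 1) := by
    intro m
    let φ : (Fin n → degreeLT F (m + 1)) →ₗ[F] K :=
      ∑ i, ((LinearMap.mulRight F (u i)).comp ((aeval x).toLinearMap.comp
        ((degreeLT F (m + 1)).subtype.comp (LinearMap.proj i))))
    have hφ : ∀ p, φ p = ∑ i, aeval x (p i).1 * u i := fun p => by
      simp [φ]
    have hmem : ∀ p, φ p ∈ LL ((m : ℤ) • B + C) := by
      intro p
      rw [hφ]
      refine Submodule.sum_mem _ fun i _ => LL_mul ?_ (hC i)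
      simpa using aeval_mem_LL hB0 (mem_LL_poles x) (p i).2
    have hinj : Function.Injective (φ.codRestrict _ hmem) := by
      rw [injective_iff_map_eq_zero]
      intro p hp
      have hp : φ p = 0 := congrArg Subtype.val hp
      rw [hφ] at hp
      have := hu (fun i => (p i).1) hp
      funext i
      exact Subtype.ext (congrFun this i)
    have h1 := LinearMap.finrank_le_finrank_of_injective hinj
    have h2 : Module.finrank F (Fin n → degreeLT F (m + 1)) = n * (m + 1) := by
      rw [Module.finrank_pi_fintype, (degreeLTEquiv F (m + 1)).finrank_eq]
      simp
    rw [h2, ← ell_eq] at h1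
    have h3 : (0 : Divisor F K) ≤ (m : ℤ) • B + C := add_nonneg (by positivity) hC0
    have h4 := ell_le_add h3
    rw [ell_zero, sub_zero, map_add, map_zsmul, smul_eq_mul] at h4
    have h5 : ((n * (m + 1) : ℕ) : ℤ) ≤ ell F ((m : ℤ) • B + C) := by exact_mod_cast h1
    push_cast at h5 h4
    linarith
  by_contra hcon
  have h1 := key (degHom F K C + 1).toNat
  have h2 := degHom_nonneg hC0
  rw [Int.toNat_of_nonneg (by omega)] at h1
  change ¬ (n : ℤ) ≤ degHom F K B at hcon
  have h3 : degHom F K B + 1 ≤ n := by omega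
  have h4 := mul_le_mul_of_nonneg_left h3 (by omega : 0 ≤ degHom F K C + 1)
  have h5 := degHom_nonneg hB0
  linarith

theorem le_xdeg {x : K} (hx : Transcendental F x) : degHom F K (poles F x) ≤ xdeg F x := by
  set B := poles F x with hB
  have hB0 : 0 ≤ B := poles_nonneg x
  have hx0 : x ≠ 0 := by rintro rfl; exact hx isAlgebraic_zero
  rcases (degHom_nonneg hB0).eq_or_lt with h0 | hpos
  · rw [← h0]; positivity
  obtain ⟨N, hN⟩ := exists_ell_eq (F := F) (K := K)
  let m : ℤ := |N| + 1
  have hmN : N ≤ degHom F K ((m - 1) • B) := by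
    rw [map_zsmul, smul_eq_mul]
    have := le_abs_self N
    have := abs_nonneg N
    simp only [m]
    nlinarith
  have h1 := hN _ hmN
  have h2 := hN (m • B) (by
    rw [map_zsmul, smul_eq_mul] at hmN ⊢
    linarith)
  rw [map_zsmul, smul_eq_mul] at h1 h2
  have hle : LL ((m - 1) • B) ≤ LL (m • B) := by
    apply LL_mono
    rw [sub_smul, one_smul]
    exact sub_le_self _ hB0
  let S := (LL ((m - 1) • B)).submoduleOf (LL (m • B))
  let d := Module.finrank F (LL (m • B) ⧸ S)
  have hd : degHom F K B = d := by
    have h3 := S.finrank_quotient_add_finrank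
    rw [(Submodule.submoduleOfEquivOfLe hle).finrank_eq, ← ell_eq, ← ell_eq] at h3
    have h3' : (d : ℤ) + ell F ((m - 1) • B) = ell F (m • B) := by exact_mod_cast h3
    linarith
  let b := Module.finBasis F (LL (m • B) ⧸ S)
  choose u hu using fun i => S.mkQ_surjective (b i)
  have key : ∀ N : ℕ, ∀ p : Fin d → F[X], (∀ i, p i ∈ degreeLT F N) →
      ∑ i, aeval x (p i) * (u i).1 = 0 → p = 0 := by
    intro N
    induction N with
    | zero =>
      intro p hp _
      funext i
      have := mem_degreeLT.mp (hp i)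
      simpa using this
    | succ N ih =>
      intro p hp hrel
      refine ih p (fun i => ?_) hrel
      have hq : ∀ i, p i - Polynomial.C ((p i).coeff N) * X ^ N ∈ degreeLT F N := by
        intro i
        rw [mem_degreeLT, degree_lt_iff_coeff_zero]
        intro k hk
        rw [coeff_sub, coeff_C_mul, coeff_X_pow]
        rcases hk.eq_or_lt with rfl | hk
        · simp
        · have := mem_degreeLT.mp (hp i)
          rw [degree_lt_iff_coeff_zero] at this
          rw [this k hk, if_neg (by omega)]
          simp
      let w : LL (m • B) := ∑ i, (p i).coeff N • u i
      have hw : x ^ N * w.1 = - ∑ i, aeval x (p i - Polynomial.C ((p i).coeff N) * X ^ N) * (u i).1 := by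
        simp only [w, map_sub, map_mul, aeval_C, map_pow, aeval_X, sub_mul, Finset.sum_sub_distrib,
          hrel, zero_sub, neg_neg, AddSubmonoidClass.coe_finsetSum, Submodule.coe_smul,
          Finset.mul_sum, Algebra.smul_def]
        exact Finset.sum_congr rfl fun i _ => by ring
      have hwm : x ^ N * w.1 ∈ LL (((N : ℤ) - 1) • B + m • B) := by
        rw [hw]
        exact Submodule.neg_mem _ (Submodule.sum_mem _ fun i _ =>
          LL_mul (aeval_mem_LL hB0 (mem_LL_poles x) (hq i)) (u i).2)
      have hwS : w ∈ S := by
        change w.1 ∈ LL ((m - 1) • B)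
        intro hw0 p
        have h3 := hwm (mul_ne_zero (pow_ne_zero _ hx0) hw0) p
        have h4 := w.2 hw0 p
        rw [p.ord_mul (pow_ne_zero _ hx0) hw0, p.ord_pow] at h3
        change 0 ≤ (((N : ℤ) - 1) * B p + m * B p) + _ at h3
        change 0 ≤ m * B p + _ at h4
        change 0 ≤ (m - 1) * B p + _
        rcases le_total (- p.ord x) 0 with h5 | h5
        · have h6 : B p = 0 := max_eq_left h5
          rw [h6] at h4 ⊢
          linarith
        · have h6 : B p = - p.ord x := max_eq_right h5
          have h7 : p.ord x = - B p := by omega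
          rw [h7] at h3
          linarith
      have hzero : ∑ i, (p i).coeff N • b i = 0 := by
        have : S.mkQ w = 0 := by rwa [Submodule.mkQ_apply, Submodule.Quotient.mk_eq_zero]
        rw [← this]
        simp only [w, map_sum, map_smul, hu]
      have hc := Fintype.linearIndependent_iff.mp b.linearIndependent _ hzero i
      have := hq i
      rwa [hc, map_zero, zero_mul, sub_zero] at this
  have hX : XInd F x fun i => (u i).1 := by
    intro p hp
    refine key ((Finset.univ.sup fun i => (p i).natDegree) + 1) p (fun i => ?_) hp
    rw [mem_degreeLT]
    refine (degree_le_natDegree).trans_lt ?_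
    have := Finset.le_sup (f := fun i => (p i).natDegree) (Finset.mem_univ i)
    exact_mod_cast Nat.lt_succ_of_le this
  have := hX.card_le FunField.isFunctionField hx
  rw [Fintype.card_fin] at this
  rw [hd]
  exact_mod_cast this

theorem xdeg_eq {x : K} (hx : Transcendental F x) : degHom F K (poles F x) = xdeg F x :=
  le_antisymm (le_xdeg hx) (xdeg_le hx)

end Degree

section Graded

variable {K : Type} [Field K] [Algebra (ZMod 2) K]

/-- A homogeneous element without nontrivial homogeneous factorization. -/
structure Irr (V : ℤ → Submodule (ZMod 2) K) (d : ℤ) (f : K) : Prop where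
  mem : f ∈ V d
  ne : f ≠ 0
  pos : 0 < d
  irr : ∀ i, 0 < i → i < d → ∀ g ∈ V i, ∀ h ∈ V (d - i), f ≠ g * h

/-- Homogeneous divisibility. -/
def HDvd (V : ℤ → Submodule (ZMod 2) K) (d : ℤ) (f : K) (n : ℤ) (g : K) : Prop :=
  ∃ h ∈ V (n - d), g = f * h

/-- A family of evaluation maps at the prime `f` of degree `d`. -/
structure Ev (V : ℤ → Submodule (ZMod 2) K) (d : ℤ) (f : K) (κ : Type) [Field κ]
    (ev : ℤ → K → κ) : Prop where
  add : ∀ n, ∀ g ∈ V n, ∀ h ∈ V n, ev n (g + h) = ev n g + ev n h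
  mul : ∀ m n, ∀ g ∈ V m, ∀ h ∈ V n, ev (m + n) (g * h) = ev m g * ev n h
  one : ev 0 1 = 1
  zero_iff : ∀ n, ∀ g ∈ V n, ev n g = 0 ↔ HDvd V d f n g

/-- Two homogeneous elements of the same degree have no common factor. -/
def HCoprime (V : ℤ → Submodule (ZMod 2) K) (n : ℤ) (f g : K) : Prop :=
  ∀ i, 0 < i → ∀ u ∈ V i, HDvd V i u n f → ¬ HDvd V i u n g

/-- The properties of the graded ring of a function field of genus four and class number one
over the field with two elements, embedded degreewise in the function field. -/
structure Cox (V : ℤ → Submodule (ZMod 2) K) : Prop where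
  mul : ∀ {m n : ℤ} {f g : K}, f ∈ V m → g ∈ V n → f * g ∈ V (m + n)
  one_mem : (1 : K) ∈ V 0
  eq_one : ∀ f ∈ V 0, f ≠ 0 → f = 1
  neg : ∀ n < 0, V n = ⊥
  finite : ∀ n, Module.Finite (ZMod 2) (V n)
  rank : ∀ n, (Module.finrank (ZMod 2) (V n) : ℤ) = Module.finrank (ZMod 2) (V (6 - n)) + n - 3
  exists_ev : ∀ d f, Irr V d f → ∃ (κ : Type) (_ : Field κ) (ev : ℤ → K → κ),
    Nat.card κ = 2 ^ d.toNat ∧ Ev V d f κ ev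
  split : ∀ n, ∀ f₁ ∈ V n, ∀ f₂ ∈ V n, ∀ f₃ ∈ V n, ∀ f₄ ∈ V n, f₁ ≠ 0 → f₂ ≠ 0 →
    f₁ * f₂ = f₃ * f₄ → ∃ i, ∃ α ∈ V i, ∃ β ∈ V (n - i), ∃ γ ∈ V (n - i), ∃ δ ∈ V i,
      f₁ = α * β ∧ f₂ = γ * δ ∧ f₃ = α * γ ∧ f₄ = β * δ
  degree : ∀ n, ∀ f ∈ V n, ∀ g ∈ V n, f ≠ 0 → g ≠ 0 → f ≠ g → HCoprime V n f g →
    (xdeg (ZMod 2) (f / g) : ℤ) = n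
  fraction : ∀ x : K, x ≠ 0 → x ≠ 1 → ∃ f ∈ V (xdeg (ZMod 2) x), ∃ g ∈ V (xdeg (ZMod 2) x),
    f ≠ 0 ∧ g ≠ 0 ∧ x = f / g ∧ HCoprime V (xdeg (ZMod 2) x) f g

section Construction

variable [Genus4 (ZMod 2) K]

/-- The graded pieces `L(n W)`. -/
def VV (W : Divisor (ZMod 2) K) (n : ℤ) : Submodule (ZMod 2) K := LL (n • W)

variable {W : Divisor (ZMod 2) K}

/-- The effective divisor of a homogeneous element. -/
def hdiv (W : Divisor (ZMod 2) K) (n : ℤ) (f : K) : Divisor (ZMod 2) K := n • W + divf (ZMod 2) f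

theorem mem_VV {n : ℤ} {f : K} (hf : f ≠ 0) : f ∈ VV W n ↔ 0 ≤ hdiv W n f := mem_LL_iff hf

theorem hdiv_mul {m n : ℤ} {f g : K} (hf : f ≠ 0) (hg : g ≠ 0) :
    hdiv W (m + n) (f * g) = hdiv W m f + hdiv W n g := by
  unfold hdiv
  rw [divf_mul hf hg, add_smul]
  abel

theorem VV_mul {m n : ℤ} {f g : K} (hf : f ∈ VV W m) (hg : g ∈ VV W n) : f * g ∈ VV W (m + n) := by
  have := LL_mul hf hg
  rwa [← add_smul] at this

theorem deg_hdiv (hW : degHom (ZMod 2) K W = 1) {n : ℤ} {f : K} (hf : f ≠ 0) :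
    degHom (ZMod 2) K (hdiv W n f) = n := by
  unfold hdiv
  rw [map_add, deg_divf f hf, map_zsmul, hW]
  simp

theorem exists_hdiv_eq (hW : degHom (ZMod 2) K W = 1) {D : Divisor (ZMod 2) K} {n : ℤ}
    (hD : degHom (ZMod 2) K D = n) : ∃ f : K, f ≠ 0 ∧ hdiv W n f = D := by
  obtain ⟨f, hf, h⟩ := exists_divf_eq (D := D - n • W) (by rw [map_sub, map_zsmul, hW, hD]; simp)
  exact ⟨f, hf, by unfold hdiv; rw [h]; abel⟩

theorem exists_hdiv_eq_of_nonneg (hW : degHom (ZMod 2) K W = 1) {D : Divisor (ZMod 2) K} {n : ℤ}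
    (hD : degHom (ZMod 2) K D = n) (h0 : 0 ≤ D) : ∃ f ∈ VV W n, f ≠ 0 ∧ hdiv W n f = D := by
  obtain ⟨f, hf, h⟩ := exists_hdiv_eq hW hD
  exact ⟨f, (mem_VV hf).mpr (h ▸ h0), hf, h⟩

theorem zmod2_eq_one {c : ZMod 2} (h : c ≠ 0) : c = 1 := by
  revert h; revert c; decide

theorem eq_one_of_mem_LL_zero {f : K} (h : f ∈ LL (0 : Divisor (ZMod 2) K)) (hf : f ≠ 0) :
    f = 1 := by
  obtain ⟨c, rfl⟩ := mem_LL_zero_iff.mp h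
  have : c = 1 := zmod2_eq_one (by rintro rfl; simp at hf)
  rw [this, map_one]

theorem eq_of_hdiv_eq {n : ℤ} {f g : K} (hf : f ≠ 0) (hg : g ≠ 0)
    (h : hdiv W n f = hdiv W n g) : f = g := by
  have h1 : divf (ZMod 2) f = divf (ZMod 2) g := add_left_cancel h
  have h2 : f / g = 1 := by
    refine eq_one_of_mem_LL_zero ?_ (div_ne_zero hf hg)
    rw [mem_LL_iff (div_ne_zero hf hg), divf_div hf hg, h1]
    simp
  rwa [div_eq_one_iff_eq hg] at h2

theorem hDvd_iff {d n : ℤ} {f g : K} (hf : f ≠ 0) (hg : g ≠ 0) :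
    HDvd (VV W) d f n g ↔ hdiv W d f ≤ hdiv W n g := by
  constructor
  · rintro ⟨h, hh, rfl⟩
    have hh0 := right_ne_zero_of_mul hg
    have : n = d + (n - d) := by ring
    rw [this, hdiv_mul hf hh0]
    exact le_add_of_nonneg_right ((mem_VV hh0).mp hh)
  · intro h
    have hgf : g / f ≠ 0 := div_ne_zero hg hf
    have h1 : g = f * (g / f) := by field_simp
    refine ⟨g / f, ?_, h1⟩
    rw [mem_VV hgf]
    have : n = d + (n - d) := by ring
    rw [this, h1, hdiv_mul hf hgf] at h
    exact (le_add_iff_nonneg_right _).mp h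

theorem Irr.exists_place (hW : degHom (ZMod 2) K W = 1) {d : ℤ} {f : K} (h : Irr (VV W) d f) :
    ∃ p : Place (ZMod 2) K, hdiv W d f = Finsupp.single p 1 ∧ (placeDegree (ZMod 2) p : ℤ) = d := by
  have h0 := (mem_VV h.ne).mp h.mem
  have hd := deg_hdiv hW (n := d) h.ne
  have hne : hdiv W d f ≠ 0 := by
    intro h1
    rw [h1, map_zero] at hd
    exact absurd hd h.pos.ne
  obtain ⟨p, hp⟩ := Finsupp.ne_iff.mp hne
  have hp : hdiv W d f p ≠ 0 := hp
  have hp0 : 0 ≤ hdiv W d f p := h0 p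
  have hs : (0 : Divisor (ZMod 2) K) ≤ hdiv W d f - Finsupp.single p 1 := by
    intro q
    by_cases hq : q = p
    · subst hq
      simp
      omega
    · simpa [Finsupp.single_apply, Ne.symm hq] using h0 q
  have hdeg : degHom (ZMod 2) K (hdiv W d f - Finsupp.single p 1) = d - placeDegree (ZMod 2) p := by
    rw [map_sub, hd, degHom_single, one_mul]
  have hpd := placeDegree_pos p
  by_cases hlt : (placeDegree (ZMod 2) p : ℤ) < d
  · exfalso
    obtain ⟨g, hg, hg0, hgd⟩ := exists_hdiv_eq_of_nonneg hW
      (D := Finsupp.single p 1) (n := placeDegree (ZMod 2) p) (by rw [degHom_single, one_mul]) (by simp)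
    obtain ⟨k, hk, hk0, hkd⟩ := exists_hdiv_eq_of_nonneg hW hdeg hs
    refine h.irr (placeDegree (ZMod 2) p) (by omega) hlt g hg k hk ?_
    refine eq_of_hdiv_eq (W := W) (n := d) h.ne (mul_ne_zero hg0 hk0) ?_
    have : d = placeDegree (ZMod 2) p + (d - placeDegree (ZMod 2) p) := by ring
    conv_rhs => rw [this]
    rw [hdiv_mul hg0 hk0, hgd, hkd]
    abel
  · have h1 := degHom_nonneg hs
    have h2 : d = placeDegree (ZMod 2) p := by omega
    have h3 := eq_zero_of_deg hs (by omega)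
    exact ⟨p, sub_eq_zero.mp h3, h2.symm⟩

theorem exists_ev_VV (hW : degHom (ZMod 2) K W = 1) {d : ℤ} {f : K} (h : Irr (VV W) d f) :
    ∃ (κ : Type) (_ : Field κ) (ev : ℤ → K → κ), Nat.card κ = 2 ^ d.toNat ∧ Ev (VV W) d f κ ev := by
  obtain ⟨p, hp, hpd⟩ := h.exists_place hW
  obtain ⟨θ, hθ, hθo⟩ := p.exists_ord_eq (W p)
  have hmem : ∀ n, ∀ g ∈ VV W n, g * θ ^ n ∈ p.1 := by
    intro n g hg
    by_cases hg0 : g = 0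
    · rw [hg0, zero_mul]; exact p.1.zero_mem
    apply p.mem_of_ord
    rw [p.ord_mul hg0 (zpow_ne_zero _ hθ), p.ord_zpow, hθo]
    have : 0 ≤ n * W p + p.ord g := hg hg0 p
    linarith
  refine ⟨IsLocalRing.ResidueField p.1, inferInstance, fun n g => p.res (g * θ ^ n), ?_, ?_, ?_, ?_, ?_⟩
  · rw [Module.natCard_eq_pow_finrank (K := ZMod 2), ← placeDegree_eq, ← hpd]
    simp
  · intro n g hg k hk
    rw [add_mul, p.res_add (hmem n g hg) (hmem n k hk)]
  · intro m n g hg k hk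
    rw [← p.res_mul (hmem m g hg) (hmem n k hk), zpow_add₀ hθ]
    congr 1
    ring
  · simpa using p.res_const 1
  · intro n g hg
    by_cases hg0 : g = 0
    · simp only [hg0, zero_mul]
      refine iff_of_true (by simpa using p.res_const 0) ⟨0, Submodule.zero_mem _, by simp⟩
    rw [p.res_eq_zero_iff_ord (hmem n g hg) (mul_ne_zero hg0 (zpow_ne_zero _ hθ)),
      p.ord_mul hg0 (zpow_ne_zero _ hθ), p.ord_zpow, hθo, hDvd_iff h.ne hg0, hp]
    have hg' : ∀ q, 0 ≤ hdiv W n g q := (mem_VV hg0).mp hg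
    have heq : hdiv W n g p = n * W p + p.ord g := rfl
    constructor
    · intro h1 q
      by_cases hq : q = p
      · subst hq
        rw [heq, Finsupp.single_eq_same]
        omega
      · simpa [Finsupp.single_apply, Ne.symm hq] using hg' q
    · intro h1
      have := h1 p
      rw [heq, Finsupp.single_eq_same] at this
      omega

theorem hdiv_poles {n : ℤ} {f g : K} (hf0 : f ≠ 0) (hg0 : g ≠ 0) :
    hdiv W n g - poles (ZMod 2) (f / g) = hdiv W n f ⊓ hdiv W n g := by
  ext p
  rw [Finsupp.sub_apply, Finsupp.inf_apply, poles_apply, p.ord_div hf0 hg0]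
  have h1 : hdiv W n f p = n * W p + p.ord f := rfl
  have h2 : hdiv W n g p = n * W p + p.ord g := rfl
  rw [h1, h2]
  rcases le_total (p.ord f) (p.ord g) with h | h
  · rw [inf_eq_left.mpr (by omega), max_eq_right (by omega)]; ring
  · rw [inf_eq_right.mpr (by omega), max_eq_left (by omega)]; ring

theorem hCoprime_iff (hW : degHom (ZMod 2) K W = 1) {n : ℤ} {f g : K} (hf : f ∈ VV W n)
    (hg : g ∈ VV W n) (hf0 : f ≠ 0) (hg0 : g ≠ 0) :
    HCoprime (VV W) n f g ↔ hdiv W n f ⊓ hdiv W n g = 0 := by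
  have hnn : 0 ≤ hdiv W n f ⊓ hdiv W n g := le_inf ((mem_VV hf0).mp hf) ((mem_VV hg0).mp hg)
  constructor
  · intro h
    by_contra hne
    obtain ⟨u, hu, hu0, hud⟩ := exists_hdiv_eq_of_nonneg hW rfl hnn
    refine h _ ?_ u hu ?_ ?_
    · by_contra hcon
      exact hne (eq_zero_of_deg hnn (le_antisymm (not_lt.mp hcon) (degHom_nonneg hnn)))
    · rw [hDvd_iff hu0 hf0, hud]; exact inf_le_left
    · rw [hDvd_iff hu0 hg0, hud]; exact inf_le_right
  · intro h i hi u hu h1 h2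
    have hu0 : u ≠ 0 := by
      rintro rfl
      obtain ⟨k, -, hk⟩ := h1
      exact hf0 (by rw [hk, zero_mul])
    rw [hDvd_iff hu0 hf0] at h1
    rw [hDvd_iff hu0 hg0] at h2
    have h3 := le_inf h1 h2
    rw [h] at h3
    have h4 := degHom_nonneg (sub_nonneg.mpr h3)
    rw [zero_sub, map_neg, deg_hdiv hW hu0] at h4
    omega

theorem transcendental_of_ne {x : K} (h0 : x ≠ 0) (h1 : x ≠ 1) : Transcendental (ZMod 2) x := by
  apply transcendental_of_not_mem
  rintro ⟨c, rfl⟩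
  have : c = 1 := zmod2_eq_one (by rintro rfl; simp at h0)
  rw [this, map_one] at h1
  exact h1 rfl

theorem ell_eq_VV {n : ℤ} : Module.finrank (ZMod 2) (VV W n) = ell (ZMod 2) (n • W) :=
  (ell_eq _).symm

theorem cox_VV (hW : degHom (ZMod 2) K W = 1) : Cox (VV W) where
  mul := VV_mul
  one_mem := by
    unfold VV
    rw [zero_smul]
    exact one_mem_LL le_rfl
  eq_one := by
    intro f hf h0
    unfold VV at hf
    rw [zero_smul] at hf
    exact eq_one_of_mem_LL_zero hf h0
  neg := by
    intro n hn
    refine LL_eq_bot ?_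
    rw [map_zsmul, hW]
    simpa using hn
  finite := fun n => LL_finite _
  rank := by
    intro n
    obtain ⟨C, hC, hR⟩ := exists_canonical (F := ZMod 2) (K := K)
    have h1 := hR (n • W)
    have h2 : ell (ZMod 2) (C - n • W) = ell (ZMod 2) ((6 - n) • W) :=
      ell_eq_of_deg_eq (by rw [map_sub, map_zsmul, map_zsmul, hC, hW]; simp)
    rw [h2, map_zsmul, hW, smul_eq_mul, mul_one] at h1
    rw [ell_eq_VV, ell_eq_VV]
    linarith
  exists_ev := fun d f h => exists_ev_VV hW h
  split := by
    intro n f₁ h₁ f₂ h₂ f₃ h₃ f₄ h₄ h10 h20 he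
    have h30 : f₃ ≠ 0 := left_ne_zero_of_mul (he ▸ mul_ne_zero h10 h20)
    have h40 : f₄ ≠ 0 := right_ne_zero_of_mul (he ▸ mul_ne_zero h10 h20)
    have hs : hdiv W n f₁ + hdiv W n f₂ = hdiv W n f₃ + hdiv W n f₄ := by
      rw [← hdiv_mul h10 h20, ← hdiv_mul h30 h40, he]
    have hnn : 0 ≤ hdiv W n f₁ ⊓ hdiv W n f₃ := le_inf ((mem_VV h10).mp h₁) ((mem_VV h30).mp h₃)
    obtain ⟨α, hα, hα0, hαd⟩ := exists_hdiv_eq_of_nonneg hW rfl hnn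
    generalize degHom (ZMod 2) K (hdiv W n f₁ ⊓ hdiv W n f₃) = i at hα hαd
    obtain ⟨β, hβ, e1⟩ : HDvd (VV W) i α n f₁ := (hDvd_iff hα0 h10).mpr (hαd ▸ inf_le_left)
    obtain ⟨γ, hγ, e3⟩ : HDvd (VV W) i α n f₃ := (hDvd_iff hα0 h30).mpr (hαd ▸ inf_le_right)
    have hβ0 : β ≠ 0 := by rintro rfl; exact h10 (by rw [e1, mul_zero])
    have hγ0 : γ ≠ 0 := by rintro rfl; exact h30 (by rw [e3, mul_zero])
    have hni : n = i + (n - i) := by ring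
    have d1 : hdiv W n f₁ = hdiv W i α + hdiv W (n - i) β := by
      conv_lhs => rw [hni, e1]
      rw [hdiv_mul hα0 hβ0]
    have d3 : hdiv W n f₃ = hdiv W i α + hdiv W (n - i) γ := by
      conv_lhs => rw [hni, e3]
      rw [hdiv_mul hα0 hγ0]
    have hle : hdiv W (n - i) γ ≤ hdiv W n f₂ := by
      intro p
      have a1 : hdiv W n f₁ p = hdiv W i α p + hdiv W (n - i) β p := by rw [d1]; rfl
      have a3 : hdiv W n f₃ p = hdiv W i α p + hdiv W (n - i) γ p := by rw [d3]; rfl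
      have a0 : hdiv W i α p = min (hdiv W n f₁ p) (hdiv W n f₃ p) := by rw [hαd]; rfl
      have a2 : hdiv W n f₁ p + hdiv W n f₂ p = hdiv W n f₃ p + hdiv W n f₄ p := by
        rw [← Finsupp.add_apply, hs]; rfl
      have b4 : 0 ≤ hdiv W n f₄ p := (mem_VV h40).mp h₄ p
      have b2 : 0 ≤ hdiv W n f₂ p := (mem_VV h20).mp h₂ p
      omega
    obtain ⟨δ, hδ, e2⟩ := (hDvd_iff hγ0 h20).mpr hle
    rw [sub_sub_cancel] at hδ
    refine ⟨i, α, hα, β, hβ, γ, hγ, δ, hδ, e1, e2, e3, ?_⟩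
    have : α * γ * (β * δ) = α * γ * f₄ := by
      rw [← e3, ← he, e1, e2, e3]; ring
    exact (mul_left_cancel₀ (mul_ne_zero hα0 hγ0) this).symm
  degree := by
    intro n f hf g hg hf0 hg0 hne hc
    have h1 := (hCoprime_iff hW hf hg hf0 hg0).mp hc
    rw [← hdiv_poles hf0 hg0, sub_eq_zero] at h1
    rw [← xdeg_eq (transcendental_of_ne (div_ne_zero hf0 hg0) (by rwa [ne_eq, div_eq_one_iff_eq hg0])),
      ← h1, deg_hdiv hW hg0]
  fraction := by
    intro x hx0 hx1
    have hxd := xdeg_eq (transcendental_of_ne hx0 hx1)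
    obtain ⟨g, hg, hg0, hgd⟩ := exists_hdiv_eq_of_nonneg hW hxd (poles_nonneg x)
    have hf : x * g ∈ VV W (xdeg (ZMod 2) x) := by
      rw [mem_VV (mul_ne_zero hx0 hg0)]
      unfold hdiv at hgd ⊢
      rw [divf_mul hx0 hg0, add_left_comm, hgd]
      intro p
      have := le_max_right 0 (- p.ord x)
      change (0 : ℤ) ≤ p.ord x + max 0 (- p.ord x)
      omega
    have he : x = x * g / g := by field_simp
    refine ⟨x * g, hf, g, hg, mul_ne_zero hx0 hg0, hg0, he, ?_⟩
    rw [hCoprime_iff hW hf hg (mul_ne_zero hx0 hg0) hg0,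
      ← hdiv_poles (mul_ne_zero hx0 hg0) hg0, ← he, hgd, sub_self]

theorem exists_cox {x : K} (hx : xdeg (ZMod 2) x = 5) (hx0 : x ≠ 0) (hx1 : x ≠ 1) :
    ∃ V : ℤ → Submodule (ZMod 2) K, Cox V := by
  obtain ⟨C, hC, -⟩ := exists_canonical (F := ZMod 2) (K := K)
  refine ⟨VV (C - poles (ZMod 2) x), cox_VV ?_⟩
  rw [map_sub, hC, xdeg_eq (transcendental_of_ne hx0 hx1), hx]
  rfl

end Construction

end Graded

section Codes

/-- The combination of the entries of a list selected by the binary digits of a number. -/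
def lin {M : Type*} [AddCommMonoid M] : ℕ → List M → M
  | _, [] => 0
  | c, v :: vs => (c % 2) • v + lin (c / 2) vs

section Lin

variable {M : Type*} [AddCommMonoid M]

@[simp] theorem lin_nil (c : ℕ) : lin c ([] : List M) = 0 := rfl

theorem lin_cons (c : ℕ) (v : M) (vs : List M) :
    lin c (v :: vs) = (c % 2) • v + lin (c / 2) vs := rfl

@[simp] theorem lin_zero (vs : List M) : lin 0 vs = 0 := by
  induction vs with
  | nil => rfl
  | cons v vs ih => simp [lin_cons, ih]

theorem lin_mem {S : Type*} [SetLike S M] [AddSubmonoidClass S M] (s : S) (c : ℕ) (vs : List M)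
    (h : ∀ v ∈ vs, v ∈ s) : lin c vs ∈ s := by
  induction vs generalizing c with
  | nil => exact zero_mem s
  | cons v vs ih =>
    exact add_mem (nsmul_mem (h v (by simp)) _) (ih _ fun w hw => h w (by simp [hw]))

theorem two_nsmul_eq (h2 : ∀ m : M, m + m = 0) (n : ℕ) (m : M) : (n % 2) • m = n • m := by
  conv_rhs => rw [← Nat.div_add_mod n 2, add_nsmul, mul_comm, mul_nsmul, two_nsmul, h2, zero_add]

theorem lin_bit (h2 : ∀ m : M, m + m = 0) (e c : ℕ) (v : M) (vs : List M) :
    lin (e % 2 + 2 * c) (v :: vs) = e • v + lin c vs := by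
  rw [lin_cons, ← two_nsmul_eq h2 e]
  congr 2 <;> omega

theorem xor_mod_two (a b : ℕ) : (a ^^^ b) % 2 = (a % 2 + b % 2) % 2 := by
  have := Nat.xor_mod_two_pow (a := a) (b := b) (n := 1)
  rw [pow_one] at this
  rw [this]
  rcases Nat.mod_two_eq_zero_or_one a with h | h <;>
    rcases Nat.mod_two_eq_zero_or_one b with h' | h' <;> simp [h, h']

theorem xor_div_two (a b : ℕ) : (a ^^^ b) / 2 = a / 2 ^^^ b / 2 := by
  have := Nat.xor_div_two_pow (a := a) (b := b) (n := 1)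
  simpa using this

theorem lin_xor (h2 : ∀ m : M, m + m = 0) (a b : ℕ) (vs : List M) :
    lin (a ^^^ b) vs = lin a vs + lin b vs := by
  induction vs generalizing a b with
  | nil => simp
  | cons v vs ih =>
    rw [lin_cons, lin_cons, lin_cons, xor_mod_two, xor_div_two, ih, two_nsmul_eq h2, add_nsmul]
    exact add_add_add_comm _ _ _ _

theorem exists_lin_eq_zero (h2 : ∀ m : M, m + m = 0) (S : Set M) (hS : S.Finite) (vs : List M)
    (h : ∀ c, lin c vs ∈ S) (hc : S.ncard < 2 ^ vs.length) :
    ∃ c, 0 < c ∧ c < 2 ^ vs.length ∧ lin c vs = 0 := by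
  have hcard : hS.toFinset.card < (Finset.range (2 ^ vs.length)).card := by
    rwa [Finset.card_range, ← Set.ncard_eq_toFinset_card S hS]
  obtain ⟨a, ha, b, hb, hab, he⟩ := Finset.exists_ne_map_eq_of_card_lt_of_maps_to hcard
    (f := fun c => lin c vs) (fun c _ => by simpa using h c)
  refine ⟨a ^^^ b, Nat.pos_of_ne_zero (by simpa [Nat.xor_eq_zero_iff] using hab),
    Nat.xor_lt_two_pow (by simpa using ha) (by simpa using hb), ?_⟩
  rw [lin_xor h2]
  have he' : lin a vs = lin b vs := he
  rw [he', h2]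

theorem exists_lin_eq (h2 : ∀ m : M, m + m = 0) (S : Set M) (hS : S.Finite) (vs : List M)
    (h : ∀ c, lin c vs ∈ S) (hc : S.ncard ≤ 2 ^ vs.length)
    (hi : ∀ c, c < 2 ^ vs.length → lin c vs = 0 → c = 0) (v : M) (hv : v ∈ S) :
    ∃ c, c < 2 ^ vs.length ∧ lin c vs = v := by
  have hcard : hS.toFinset.card ≤ (Finset.range (2 ^ vs.length)).card := by
    rwa [Finset.card_range, ← Set.ncard_eq_toFinset_card S hS]
  obtain ⟨c, hc, he⟩ := Finset.surj_on_of_inj_on_of_card_le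
    (s := Finset.range (2 ^ vs.length)) (t := hS.toFinset)
    (fun c _ => lin c vs) (fun c _ => by simpa using h c) (fun a b ha hb hab => by
      have := hi (a ^^^ b) (Nat.xor_lt_two_pow (by simpa using ha) (by simpa using hb))
        (by rw [lin_xor h2, hab, h2])
      simpa [Nat.xor_eq_zero_iff] using this) hcard v (by simpa using hv)
  exact ⟨c, by simpa using hc, he.symm⟩

end Lin

/-- The value at `τ` of the polynomial over the field with two elements whose coefficients are the
binary digits of `p`. -/
def pe {κ : Type*} [CommRing κ] (τ : κ) (p : ℕ) : κ :=
  if p = 0 then 0 else (p % 2 : ℕ) + τ * pe τ (p / 2)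
termination_by p
decreasing_by omega

section Pe

variable {κ : Type*} [CommRing κ] (τ : κ)

@[simp] theorem pe_zero : pe τ 0 = 0 := by rw [pe]; simp

theorem pe_eq (p : ℕ) : pe τ p = (p % 2 : ℕ) + τ * pe τ (p / 2) := by
  by_cases h : p = 0
  · simp [h]
  · conv_lhs => rw [pe]
    simp [h]

@[simp] theorem pe_one : pe τ 1 = 1 := by rw [pe_eq]; simp

theorem cast_mod_two (h2 : (2 : κ) = 0) (n : ℕ) : ((n % 2 : ℕ) : κ) = n := by
  conv_rhs => rw [← Nat.div_add_mod n 2]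
  push_cast
  rw [h2]; ring

theorem pe_xor (h2 : (2 : κ) = 0) (a b : ℕ) : pe τ (a ^^^ b) = pe τ a + pe τ b := by
  induction a using Nat.strong_induction_on generalizing b with
  | _ a ih =>
    by_cases h : a = 0
    · simp [h]
    · rw [pe_eq, pe_eq τ a, pe_eq τ b, xor_mod_two, xor_div_two, ih _ (by omega), cast_mod_two h2]
      push_cast
      ring

theorem pe_double (a : ℕ) : pe τ (2 * a) = τ * pe τ a := by
  rw [pe_eq]
  simp

/-- Carryless multiplication of binary numbers, for first factors with at most `k` digits. -/
def clmul : ℕ → ℕ → ℕ → ℕ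
  | 0, _, _ => 0
  | k + 1, a, b => (a % 2 * b) ^^^ (2 * clmul k (a / 2) b)

theorem pe_clmul (h2 : (2 : κ) = 0) (k a b : ℕ) (ha : a < 2 ^ k) :
    pe τ (clmul k a b) = pe τ a * pe τ b := by
  induction k generalizing a with
  | zero =>
    obtain rfl : a = 0 := by simpa using ha
    simp [clmul]
  | succ k ih =>
    rw [clmul, pe_xor τ h2, pe_double, ih _ (by rw [pow_succ] at ha; omega), pe_eq τ a]
    rcases Nat.mod_two_eq_zero_or_one a with h | h <;> simp [h] <;> ring

/-- The code of a combination of polynomial codes. -/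
def comb : ℕ → List ℕ → ℕ
  | _, [] => 0
  | c, v :: vs => (c % 2 * v) ^^^ comb (c / 2) vs

theorem pe_comb (h2 : (2 : κ) = 0) (c : ℕ) (vs : List ℕ) :
    pe τ (comb c vs) = lin c (vs.map (pe τ)) := by
  induction vs generalizing c with
  | nil => simp [comb]
  | cons v vs ih =>
    rw [comb, pe_xor τ h2, ih, List.map_cons, lin_cons]
    rcases Nat.mod_two_eq_zero_or_one c with h | h <;> simp [h]

theorem lin_smul (μ : κ) (c : ℕ) (vs : List κ) :
    lin c (vs.map (μ * ·)) = μ * lin c vs := by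
  induction vs generalizing c with
  | nil => simp
  | cons v vs ih =>
    rw [List.map_cons, lin_cons, lin_cons, ih, mul_add, nsmul_eq_mul, nsmul_eq_mul]
    ring

theorem lin_range_pow (p k : ℕ) (hp : p < 2 ^ k) :
    lin p ((List.range k).map (τ ^ ·)) = pe τ p := by
  induction k generalizing p with
  | zero =>
    obtain rfl : p = 0 := by simpa using hp
    simp
  | succ k ih =>
    rw [List.range_succ_eq_map, List.map_cons, List.map_map, lin_cons, pe_eq,
      ← ih (p / 2) (by rw [pow_succ] at hp; omega), ← lin_smul, List.map_map]
    congr 1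
    · simp
    · congr 2
      funext i
      simp [pow_succ, mul_comm]

end Pe

theorem natDegree_pe_X_lt (k p : ℕ) (hp : p < 2 ^ k) (hp0 : p ≠ 0) :
    (pe (X : (ZMod 2)[X]) p).natDegree < k := by
  induction k generalizing p with
  | zero => simp at hp; omega
  | succ k ih =>
    rw [pe_eq]
    refine lt_of_le_of_lt (Polynomial.natDegree_add_le _ _) (max_lt ?_ ?_)
    · rw [Polynomial.natDegree_natCast]; omega
    · by_cases h : p / 2 = 0
      · simp [h]
      · refine lt_of_le_of_lt Polynomial.natDegree_mul_le ?_
        rw [Polynomial.natDegree_X]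
        have := ih (p / 2) (by rw [pow_succ] at hp; omega) h
        omega

theorem pe_X_ne_zero (p : ℕ) (hp : p ≠ 0) : pe (X : (ZMod 2)[X]) p ≠ 0 := by
  induction p using Nat.strong_induction_on with
  | _ p ih =>
    intro h
    rw [pe_eq] at h
    have h0 : ((p % 2 : ℕ) : ZMod 2) = 0 := by
      have := congrArg (Polynomial.eval 0) h
      simpa using this
    have h1 : p % 2 = 0 := by
      rw [ZMod.natCast_eq_zero_iff] at h0
      omega
    rw [h1, Nat.cast_zero, zero_add, mul_eq_zero] at h
    exact ih (p / 2) (by omega) (by omega) (h.resolve_left Polynomial.X_ne_zero)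

theorem aeval_pe {κ : Type*} [CommRing κ] [Algebra (ZMod 2) κ] (τ : κ) (p : ℕ) :
    Polynomial.aeval τ (pe (X : (ZMod 2)[X]) p) = pe τ p := by
  induction p using Nat.strong_induction_on with
  | _ p ih =>
    by_cases hp : p = 0
    · simp [hp]
    · rw [pe_eq, pe_eq τ, map_add, map_mul, Polynomial.aeval_X, ih _ (by omega), map_natCast]

theorem pe_ne_zero {κ : Type} [Field κ] {d : ℕ} (h2 : (2 : κ) = 0) (hd : Nat.card κ = 2 ^ d)
    (τ : κ) (k : ℕ) (hk : ∀ p, 0 < p → p < 2 ^ k → pe τ p ≠ 0)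
    (hdk : ∀ e, e ∣ d → k ≤ e → e = d) (p : ℕ) (hp : 0 < p) (hpd : p < 2 ^ d) : pe τ p ≠ 0 := by
  have hchar : CharP κ 2 := CharTwo.of_one_ne_zero_of_two_eq_zero one_ne_zero h2
  let _ : Algebra (ZMod 2) κ := ZMod.algebra κ 2
  have hfin : Finite κ := Nat.finite_of_card_ne_zero (by rw [hd]; positivity)
  have hfd : FiniteDimensional (ZMod 2) κ := Module.Finite.of_finite
  have hrank : Module.finrank (ZMod 2) κ = d := by
    have := Module.natCard_eq_pow_finrank (K := ZMod 2) (V := κ)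
    rw [hd, Nat.card_zmod] at this
    exact (Nat.pow_right_injective le_rfl this).symm
  have hinteg : IsIntegral (ZMod 2) τ := IsIntegral.of_finite _ _
  have hmin := IntermediateField.adjoin.finrank hinteg
  have hmul := Module.finrank_mul_finrank (ZMod 2) (IntermediateField.adjoin (ZMod 2) {τ}) κ
  have hcard : Nat.card (IntermediateField.adjoin (ZMod 2) {τ}) =
      2 ^ (minpoly (ZMod 2) τ).natDegree := by
    rw [Module.natCard_eq_pow_finrank (K := ZMod 2), hmin, Nat.card_zmod]
  have hke : k ≤ (minpoly (ZMod 2) τ).natDegree := by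
    by_contra! hlt
    obtain ⟨c, hc0, hc, hl⟩ := exists_lin_eq_zero (M := κ)
      (fun m => by rw [← two_mul, h2, zero_mul])
      (IntermediateField.adjoin (ZMod 2) {τ} : Set κ) (Set.toFinite _)
      ((List.range k).map (τ ^ ·))
      (fun c => lin_mem (IntermediateField.adjoin (ZMod 2) {τ}) c _ (by
        intro v hv
        obtain ⟨i, -, rfl⟩ := List.mem_map.mp hv
        exact pow_mem (IntermediateField.mem_adjoin_simple_self _ _) i))
      (by
        rw [← Nat.card_coe_set_eq]
        change Nat.card (IntermediateField.adjoin (ZMod 2) {τ}) < _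
        rw [hcard]
        simpa using Nat.pow_lt_pow_right one_lt_two hlt)
    have hck : c < 2 ^ k := by simpa using hc
    rw [lin_range_pow τ c k hck] at hl
    exact hk c hc0 hck hl
  have he : (minpoly (ZMod 2) τ).natDegree = d :=
    hdk _ ⟨_, by rw [← hrank, ← hmul, hmin]⟩ hke
  intro h0
  have hdeg := Polynomial.natDegree_le_natDegree
    (minpoly.degree_le_of_ne_zero (ZMod 2) τ (pe_X_ne_zero p hp.ne') (by rw [aeval_pe, h0]))
  have := natDegree_pe_X_lt d p hpd hp.ne'
  omega

end Codes

section CoxBasics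

/-- Linear independence of a list over the field with two elements. -/
def Indep {M : Type*} [AddCommMonoid M] (vs : List M) : Prop :=
  ∀ c, c < 2 ^ vs.length → lin c vs = 0 → c = 0

theorem indep_nil {M : Type*} [AddCommMonoid M] : Indep ([] : List M) := by
  intro c hc _
  simpa using hc

theorem Indep.cons {M : Type*} [AddCommMonoid M] (h2 : ∀ m : M, m + m = 0) {vs : List M}
    (h : Indep vs) {v : M} (hv : ∀ c, c < 2 ^ vs.length → lin c vs ≠ v) : Indep (v :: vs) := by
  intro c hc h0
  rw [List.length_cons, pow_succ] at hc
  rw [lin_cons] at h0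
  have hc2 : c / 2 < 2 ^ vs.length := by omega
  rcases Nat.mod_two_eq_zero_or_one c with h' | h'
  · rw [h', zero_nsmul, zero_add] at h0
    have := h _ hc2 h0
    omega
  · rw [h', one_nsmul] at h0
    refine absurd ?_ (hv _ hc2)
    calc lin (c / 2) vs = (v + v) + lin (c / 2) vs := by rw [h2, zero_add]
      _ = v := by rw [add_assoc, h0, add_zero]

variable {K : Type} [Field K] [Algebra (ZMod 2) K]

variable (K) in
theorem two_eq_zero : (2 : K) = 0 := by
  have := congrArg (algebraMap (ZMod 2) K) (show (2 : ZMod 2) = 0 from rfl)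
  rwa [map_ofNat, map_zero] at this

theorem add_self (m : K) : m + m = 0 := by rw [← two_mul, two_eq_zero, zero_mul]

/-- The dimension of a graded piece. -/
def len (V : ℤ → Submodule (ZMod 2) K) (n : ℤ) : ℕ := Module.finrank (ZMod 2) (V n)

variable {V : ℤ → Submodule (ZMod 2) K}

section Eval

variable {d : ℤ} {f : K} {κ : Type} [Field κ] {ev : ℤ → K → κ}

theorem Ev.zero (E : Ev V d f κ ev) (n : ℤ) : ev n 0 = 0 :=
  (E.zero_iff n 0 (zero_mem _)).mpr ⟨0, zero_mem _, by simp⟩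

theorem Ev.mul' (E : Ev V d f κ ev) {m n k : ℤ} {g h : K} (hg : g ∈ V m) (hh : h ∈ V n)
    (hk : m + n = k) : ev k (g * h) = ev m g * ev n h := by
  subst hk
  exact E.mul m n g hg h hh

theorem Ev.lin (E : Ev V d f κ ev) (n : ℤ) (c : ℕ) (vs : List K) (h : ∀ v ∈ vs, v ∈ V n) :
    ev n (lin c vs) = CFF.lin c (vs.map (ev n)) := by
  induction vs generalizing c with
  | nil => exact E.zero n
  | cons v vs ih =>
    have hv := h v (by simp)
    have hvs : ∀ w ∈ vs, w ∈ V n := fun w hw => h w (by simp [hw])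
    rw [lin_cons, List.map_cons, lin_cons, E.add n _ (nsmul_mem hv _) _ (lin_mem (V n) _ _ hvs),
      ih _ hvs]
    rcases Nat.mod_two_eq_zero_or_one c with h' | h' <;> simp [h', E.zero]

theorem Ev.eq_zero_of_add (E : Ev V d f κ ev) {n : ℤ} {g h : K} (hg : g ∈ V n) (hh : h ∈ V n)
    (he : ev n g = ev n h) (h2 : (2 : κ) = 0) : HDvd V d f n (g + h) := by
  rw [← E.zero_iff n _ (add_mem hg hh), E.add n g hg h hh, he, ← two_mul, h2, zero_mul]

end Eval

namespace Cox

variable (C : Cox V)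
include C

theorem mul' {m n k : ℤ} {f g : K} (hf : f ∈ V m) (hg : g ∈ V n) (hk : m + n = k) :
    f * g ∈ V k := hk ▸ C.mul hf hg

theorem pow_mem' {m k : ℤ} {f : K} (hf : f ∈ V m) (i : ℕ) (hk : i * m = k) : f ^ i ∈ V k := by
  subst hk
  induction i with
  | zero => simpa using C.one_mem
  | succ i ih => exact pow_succ f i ▸ C.mul' ih hf (by push_cast; ring)

theorem exists_point {d : ℤ} {f : K} (h : Irr V d f) : ∃ (κ : Type) (_ : Field κ)
    (ev : ℤ → K → κ), Nat.card κ = 2 ^ d.toNat ∧ Ev V d f κ ev ∧ (2 : κ) = 0 := by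
  obtain ⟨κ, _, ev, hc, E⟩ := C.exists_ev d f h
  refine ⟨κ, _, ev, hc, E, ?_⟩
  have := E.add 0 1 C.one_mem 1 C.one_mem
  rw [add_self, E.zero, E.one, one_add_one_eq_two] at this
  exact this.symm

theorem dvd_or_dvd {d : ℤ} {f : K} (hf : Irr V d f) {m n k : ℤ} {g h : K} (hg : g ∈ V m)
    (hh : h ∈ V n) (hk : m + n = k) (hd : HDvd V d f k (g * h)) :
    HDvd V d f m g ∨ HDvd V d f n h := by
  obtain ⟨κ, _, ev, -, E, -⟩ := C.exists_point hf
  rw [← E.zero_iff k _ (C.mul' hg hh hk), E.mul' hg hh hk, mul_eq_zero, E.zero_iff m g hg,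
    E.zero_iff n h hh] at hd
  exact hd

theorem finite_set (n : ℤ) : (V n : Set K).Finite := by
  have := C.finite n
  have : Finite (V n) := Module.finite_of_finite (ZMod 2)
  exact Set.toFinite _

theorem ncard_eq (n : ℤ) : (V n : Set K).ncard = 2 ^ len V n := by
  have := C.finite n
  rw [← Nat.card_coe_set_eq]
  change Nat.card (V n) = _
  rw [Module.natCard_eq_pow_finrank (K := ZMod 2), Nat.card_zmod, len]

theorem exists_dep {n : ℤ} (vs : List K) (h : ∀ v ∈ vs, v ∈ V n) (hl : len V n < vs.length) :
    ∃ c, 0 < c ∧ c < 2 ^ vs.length ∧ lin c vs = 0 :=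
  exists_lin_eq_zero add_self (V n : Set K) (C.finite_set n) vs (fun c => lin_mem (V n) c vs h)
    (by rw [C.ncard_eq]; exact Nat.pow_lt_pow_right one_lt_two hl)

theorem exists_eq_lin {n : ℤ} {vs : List K} (hi : Indep vs) (h : ∀ v ∈ vs, v ∈ V n)
    (hl : len V n ≤ vs.length) {v : K} (hv : v ∈ V n) : ∃ c, c < 2 ^ vs.length ∧ lin c vs = v :=
  exists_lin_eq add_self (V n : Set K) (C.finite_set n) vs (fun c => lin_mem (V n) c vs h)
    (by rw [C.ncard_eq]; exact Nat.pow_le_pow_right two_pos hl) hi v hv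

theorem exists_new {n : ℤ} (vs : List K) (hl : vs.length < len V n) :
    ∃ v ∈ V n, ∀ c, c < 2 ^ vs.length → lin c vs ≠ v := by
  by_contra! hcon
  have hsub : (V n : Set K) ⊆ ((Finset.range (2 ^ vs.length)).image fun c => lin c vs : Finset K) := by
    intro v hv
    obtain ⟨c, hc, he⟩ := hcon v hv
    simp only [Finset.coe_image, Set.mem_image, Finset.coe_range, Set.mem_Iio]
    exact ⟨c, hc, he⟩
  have h1 := Set.ncard_le_ncard hsub (Finset.finite_toSet _)
  rw [Set.ncard_coe_finset, C.ncard_eq] at h1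
  have h2 := h1.trans Finset.card_image_le
  rw [Finset.card_range] at h2
  have := Nat.pow_lt_pow_right one_lt_two hl
  omega

theorem eq_zero {n : ℤ} (h : len V n = 0) {f : K} (hf : f ∈ V n) : f = 0 := by
  obtain ⟨c, -, hc⟩ := C.exists_eq_lin (vs := []) indep_nil (by simp) (by simp [h]) hf
  simpa using hc.symm

theorem exists_ne_zero {n : ℤ} (h : 0 < len V n) : ∃ f ∈ V n, f ≠ 0 := by
  obtain ⟨f, hf, hn⟩ := C.exists_new (n := n) [] (by simpa using h)
  exact ⟨f, hf, fun h0 => hn 0 (by simp) (by simp [h0])⟩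

omit C in
theorem indep_singleton {f : K} (hf : f ≠ 0) : Indep [f] :=
  indep_nil.cons add_self fun c _ => by simpa using hf.symm

theorem eq_of_len_one {n : ℤ} (h : len V n = 1) {f g : K} (hf : f ∈ V n) (hg : g ∈ V n)
    (hf0 : f ≠ 0) (hg0 : g ≠ 0) : f = g := by
  obtain ⟨c, hc, he⟩ := C.exists_eq_lin (indep_singleton hg0) (by simpa using hg) (by simp [h]) hf
  simp only [List.length_singleton, pow_one] at hc
  interval_cases c
  · simp at he; exact absurd he.symm hf0
  · simpa [lin_cons] using he.symm

theorem len_neg {n : ℤ} (h : n < 0) : len V n = 0 := by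
  rw [len, C.neg n h]; simp

theorem len_zero : len V 0 = 1 := by
  have h : (V 0 : Set K) = {0, 1} := by
    ext f
    simp only [SetLike.mem_coe, Set.mem_insert_iff, Set.mem_singleton_iff]
    constructor
    · intro hf
      by_cases h0 : f = 0
      · exact Or.inl h0
      · exact Or.inr (C.eq_one f hf h0)
    · rintro (rfl | rfl)
      exacts [zero_mem _, C.one_mem]
  have h1 := C.ncard_eq 0
  rw [h, Set.ncard_pair zero_ne_one] at h1
  exact (Nat.pow_right_injective le_rfl (h1.symm.trans (pow_one 2).symm))

theorem len_rank (n : ℤ) : (len V n : ℤ) = len V (6 - n) + n - 3 := C.rank n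

theorem len_four : len V 4 = len V 2 + 1 := by
  have := C.len_rank 4
  norm_num at this; omega

theorem len_five : len V 5 = len V 1 + 2 := by
  have := C.len_rank 5
  norm_num at this; omega

theorem len_six : len V 6 = 4 := by
  have := C.len_rank 6
  norm_num at this
  rw [C.len_zero] at this; omega

theorem len_large {n : ℤ} (h : 6 < n) : (len V n : ℤ) = n - 3 := by
  rw [C.len_rank, C.len_neg (by omega)]; simp

omit C in
theorem len_map (n : ℤ) {a : K} (ha : a ≠ 0) :
    Module.finrank (ZMod 2) ((V n).map (LinearMap.mulLeft (ZMod 2) a)) = len V n :=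
  finrank_map_of_injective (fun x y h => mul_left_cancel₀ ha (by simpa using h)) _

theorem len_add_le {d m : ℤ} {f a : K} (hf : f ∈ V d) (ha : a ∈ V m) (hf0 : f ≠ 0) (ha0 : a ≠ 0)
    (n : ℤ) (h : ∀ g ∈ V n, HDvd V d f (n + m) (a * g) → HDvd V d f n g) :
    len V n + len V (n + m - d) ≤ len V (n + m) + len V (n - d) := by
  set A := (V n).map (LinearMap.mulLeft (ZMod 2) a)
  set B := (V (n + m - d)).map (LinearMap.mulLeft (ZMod 2) f)
  have := C.finite (n + m)
  have := C.finite (n - d)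
  have := C.finite n
  have := C.finite (n + m - d)
  have h1 := Submodule.finrank_sup_add_finrank_inf_eq A B
  have hA : Module.finrank (ZMod 2) A = len V n := len_map n ha0
  have hB : Module.finrank (ZMod 2) B = len V (n + m - d) := len_map _ hf0
  have hsup : A ⊔ B ≤ V (n + m) := by
    refine sup_le ?_ ?_
    · rintro _ ⟨g, hg, rfl⟩
      exact C.mul' ha hg (by ring)
    · rintro _ ⟨g, hg, rfl⟩
      exact C.mul' hf hg (by ring)
  have hinf : A ⊓ B ≤ (V (n - d)).map (LinearMap.mulLeft (ZMod 2) (a * f)) := by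
    rintro _ ⟨⟨g, hg, rfl⟩, k, hk, hkg⟩
    obtain ⟨l, hl, rfl⟩ := h g hg ⟨k, hk, hkg.symm⟩
    exact ⟨l, hl, by simp⟩
  have h2 : Module.finrank (ZMod 2) ↥(A ⊔ B) ≤ len V (n + m) := Submodule.finrank_mono hsup
  have h3 : Module.finrank (ZMod 2) ↥(A ⊓ B) ≤ len V (n - d) :=
    (Submodule.finrank_mono hinf).trans (len_map _ (mul_ne_zero ha0 hf0)).le
  omega

end Cox

end CoxBasics

section Dimensions

theorem xdeg_ratFunc_X {K : Type} [Field K] [Algebra (ZMod 2) K]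
    [Algebra (RatFunc (ZMod 2)) K] [IsScalarTower (ZMod 2) (RatFunc (ZMod 2)) K] :
    xdeg (ZMod 2) (algebraMap (RatFunc (ZMod 2)) K RatFunc.X) =
      Module.finrank (RatFunc (ZMod 2)) K := by
  set x := algebraMap (RatFunc (ZMod 2)) K RatFunc.X with hx
  let φ : RatFunc (ZMod 2) →ₐ[ZMod 2] K := IsScalarTower.toAlgHom (ZMod 2) (RatFunc (ZMod 2)) K
  have hr : φ.fieldRange = IntermediateField.adjoin (ZMod 2) {x} := by
    rw [AlgHom.fieldRange_eq_map, ← RatFunc.adjoin_X, IntermediateField.adjoin_map,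
      Set.image_singleton]
    rfl
  let e : RatFunc (ZMod 2) ≃ₐ[ZMod 2] IntermediateField.adjoin (ZMod 2) {x} :=
    (AlgEquiv.ofInjectiveField φ).trans (IntermediateField.equivOfEq hr)
  exact (Algebra.finrank_eq_of_equiv_equiv e.toRingEquiv (RingEquiv.refl K) (by ext; rfl)).symm

variable {K : Type} [Field K] [Algebra (ZMod 2) K] {V : ℤ → Submodule (ZMod 2) K}

namespace Cox

variable (C : Cox V)
include C

theorem eq_of_hdvd {d : ℤ} {f g : K} (hg0 : g ≠ 0) (h : HDvd V d f d g) :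
    g = f := by
  obtain ⟨u, hu, rfl⟩ := h
  rw [sub_self] at hu
  rw [C.eq_one u hu (right_ne_zero_of_mul hg0), mul_one]

omit C in
theorem irr_one {f : K} (hf : f ∈ V 1) (h0 : f ≠ 0) : Irr V 1 f :=
  ⟨hf, h0, one_pos, fun i h1 h2 => by omega⟩

theorem hdvd_of_pow {d m n : ℤ} {f g : K} (hf : Irr V d f) (hg : g ∈ V m) (i : ℕ)
    (hn : i * m = n) (hi : 0 < i) (h : HDvd V d f n (g ^ i)) : HDvd V d f m g := by
  subst hn
  induction i with
  | zero => omega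
  | succ i ih =>
    rw [pow_succ] at h
    rcases C.dvd_or_dvd hf (C.pow_mem' hg i rfl) hg (by push_cast; ring) h with h | h
    · rcases Nat.eq_zero_or_pos i with rfl | hi
      · obtain ⟨u, hu, h1⟩ := h
        have hd := hf.pos
        rw [C.neg _ (by push_cast; omega), Submodule.mem_bot] at hu
        simp [hu] at h1
      · exact ih hi h
    · exact h

theorem exists_ne_ne {n : ℤ} (h : 2 ≤ len V n) (f : K) : ∃ g ∈ V n, g ≠ 0 ∧ g ≠ f := by
  obtain ⟨g, hg, hn⟩ := C.exists_new (n := n) [f] (by simp; omega)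
  have h0 := hn 0 (by simp)
  have h1 := hn 1 (by simp)
  simp only [lin_zero] at h0
  simp only [lin_cons, lin_nil, Nat.one_mod, one_nsmul, add_zero] at h1
  exact ⟨g, hg, h0.symm, h1.symm⟩

theorem len_one_le : len V 1 ≤ 1 := by
  by_contra! h
  obtain ⟨f, hf, hf0⟩ := C.exists_ne_zero (n := 1) (by omega)
  obtain ⟨a, ha, ha0, haf⟩ := C.exists_ne_ne h f
  have hi := irr_one hf hf0
  have := C.len_add_le hf (C.pow_mem' ha 6 rfl) hf0 (pow_ne_zero 6 ha0) 1 (fun g hg hd => by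
    rcases C.dvd_or_dvd hi (C.pow_mem' ha 6 rfl) hg (by norm_num) hd with h | h
    · exact absurd (C.eq_of_hdvd ha0 (C.hdvd_of_pow hi ha 6 rfl (by norm_num) h)) haf
    · exact h)
  norm_num [C.len_six, C.len_zero] at this
  have h7 := C.len_large (n := 7) (by norm_num)
  omega

theorem len_add_self_le {d : ℤ} {f : K} (hf : Irr V d f) (h : 2 ≤ len V d) :
    len V d + len V d ≤ len V (d + d) + 1 := by
  obtain ⟨a, ha, ha0, haf⟩ := C.exists_ne_ne h f
  have := C.len_add_le hf.mem ha hf.ne ha0 d (fun g hg hd => by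
    rcases C.dvd_or_dvd hf ha hg rfl hd with h | h
    · exact absurd (C.eq_of_hdvd ha0 h) haf
    · exact h)
  rwa [add_sub_cancel_right, sub_self, C.len_zero] at this

theorem len_two_le : len V 2 ≤ 2 := by
  by_contra! h
  by_cases hex : ∃ f, Irr V 2 f
  · obtain ⟨f, hf⟩ := hex
    have := C.len_add_self_le hf (by omega)
    norm_num [C.len_four] at this
    omega
  · push Not at hex
    have key : ∀ f ∈ V 2, f ≠ 0 → ∃ e ∈ V 1, e ≠ 0 ∧ f = e ^ 2 := by
      intro f hf hf0
      by_contra hcon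
      refine hex f ⟨hf, hf0, by norm_num, fun i h1 h2 g hg k hk he => hcon ?_⟩
      obtain rfl : i = 1 := by omega
      norm_num at hk
      have hg0 : g ≠ 0 := by rintro rfl; simp at he; exact hf0 he
      have hk0 : k ≠ 0 := by rintro rfl; simp at he; exact hf0 he
      have hl := C.len_one_le
      have hl' : len V 1 = 1 := by
        by_contra hl'
        exact hg0 (C.eq_zero (by omega) hg)
      exact ⟨g, hg, hg0, by rw [he, C.eq_of_len_one hl' hk hg hk0 hg0, sq]⟩
    obtain ⟨f, hf, hf0⟩ := C.exists_ne_zero (n := 2) (by omega)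
    obtain ⟨a, ha, ha0, haf⟩ := C.exists_ne_ne (n := 2) (by omega) f
    obtain ⟨e, he, he0, rfl⟩ := key f hf hf0
    obtain ⟨e', he', he0', rfl⟩ := key a ha ha0
    have hl := C.len_one_le
    have hl' : len V 1 = 1 := by
      by_contra hl'
      exact he0 (C.eq_zero (by omega) he)
    exact haf (by rw [C.eq_of_len_one hl' he' he he0' he0])

theorem len_three_le : len V 3 ≤ 2 := by
  by_contra! h
  by_cases hex : ∃ f, Irr V 3 f
  · obtain ⟨f, hf⟩ := hex
    have := C.len_add_self_le hf (by omega)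
    norm_num [C.len_six] at this
    omega
  · push Not at hex
    have key : ∀ f ∈ V 3, f ≠ 0 → ∃ e ∈ V 1, ∃ g ∈ V 2, f = e * g := by
      intro f hf hf0
      by_contra hcon
      refine hex f ⟨hf, hf0, by norm_num, fun i h1 h2 g hg k hk he => hcon ?_⟩
      obtain rfl | rfl : i = 1 ∨ i = 2 := by omega
      · norm_num at hk
        exact ⟨g, hg, k, hk, he⟩
      · norm_num at hk
        exact ⟨k, hk, g, hg, he.trans (mul_comm _ _)⟩
    have hl := C.len_one_le
    obtain ⟨f, hf, hf0⟩ := C.exists_ne_zero (n := 3) (by omega)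
    obtain ⟨e, he, g, hg, hef⟩ := key f hf hf0
    have he0 : e ≠ 0 := by rintro rfl; exact hf0 (by simpa using hef)
    have hl' : len V 1 = 1 := by
      by_contra hl'
      exact he0 (C.eq_zero (by omega) he)
    have := C.finite 2
    have hle : V 3 ≤ (V 2).map (LinearMap.mulLeft (ZMod 2) e) := by
      intro a ha
      by_cases ha0 : a = 0
      · subst ha0; exact zero_mem _
      obtain ⟨e', he', g, hg, hef⟩ := key a ha ha0
      have he0' : e' ≠ 0 := by rintro rfl; exact ha0 (by simpa using hef)
      refine ⟨g, hg, ?_⟩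
      rw [hef, C.eq_of_len_one hl' he' he he0' he0]
      simp
    have h3 := (Submodule.finrank_mono hle).trans (len_map 2 he0).le
    have h2 := C.len_two_le
    change len V 3 ≤ _ at h3
    omega

theorem len_le_of_mul {m n : ℤ} {e : K} (he : e ∈ V m) (he0 : e ≠ 0) : len V n ≤ len V (m + n) := by
  have := C.finite (m + n)
  rw [← len_map n he0]
  refine Submodule.finrank_mono ?_
  rintro _ ⟨g, hg, rfl⟩
  exact C.mul he hg

theorem hdvd_of_len {i n : ℤ} {g f : K} (hg : g ∈ V i) (hg0 : g ≠ 0)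
    (h : len V n ≤ len V (n - i)) (hf : f ∈ V n) : HDvd V i g n f := by
  have := C.finite n
  have hle : (V (n - i)).map (LinearMap.mulLeft (ZMod 2) g) ≤ V n := by
    rintro _ ⟨k, hk, rfl⟩
    exact C.mul' hg hk (by ring)
  have := Submodule.eq_of_le_of_finrank_le hle (by rw [len_map _ hg0]; exact h)
  rw [← this] at hf
  obtain ⟨k, hk, rfl⟩ := hf
  exact ⟨k, hk, rfl⟩

theorem no_common {i : ℤ} {g s t : K} (hg : g ∈ V i) (hg0 : g ≠ 0) (hi : 0 < i)
    (h : len V 5 ≤ len V (5 - i)) (hs : s ∈ V 5) (ht : t ∈ V 5) (hst : HCoprime V 5 s t) : False :=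
  hst i hi g hg (C.hdvd_of_len hg hg0 h hs) (C.hdvd_of_len hg hg0 h ht)

/-- The possible dimensions of the first graded pieces. -/
theorem len_cases {s t : K} (hs : s ∈ V 5) (ht : t ∈ V 5) (hst : HCoprime V 5 s t) :
    (len V 1 = 1 ∧ len V 2 = 1 ∧ len V 3 = 1) ∨ (len V 1 = 1 ∧ len V 2 = 1 ∧ len V 3 = 2) ∨
    (len V 1 = 0 ∧ len V 2 = 2 ∧ len V 3 = 0) ∨ (len V 1 = 0 ∧ len V 2 = 0 ∧ len V 3 = 2) ∨
    (len V 1 = 0 ∧ len V 2 = 1 ∧ len V 3 ≤ 1) ∨ (len V 1 = 0 ∧ len V 2 = 0 ∧ len V 3 ≤ 1) := by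
  have h1 := C.len_one_le
  have h2 := C.len_two_le
  have h3 := C.len_three_le
  have h4 := C.len_four
  have h5 := C.len_five
  rcases Nat.eq_zero_or_pos (len V 1) with e1 | e1
  · have a3 : 0 < len V 3 → len V 2 ≠ 2 := fun h e => by
      obtain ⟨g, hg, hg0⟩ := C.exists_ne_zero h
      exact C.no_common hg hg0 (by norm_num) (by norm_num; omega) hs ht hst
    have a2 : 0 < len V 2 → len V 3 ≠ 2 := fun h e => by
      obtain ⟨g, hg, hg0⟩ := C.exists_ne_zero h
      exact C.no_common hg hg0 (by norm_num) (by norm_num; omega) hs ht hst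
    omega
  · obtain ⟨e, he, he0⟩ := C.exists_ne_zero e1
    have b2 := C.len_le_of_mul (n := 1) he he0
    have b3 := C.len_le_of_mul (n := 2) he he0
    norm_num at b2 b3
    have a1 : len V 2 ≠ 2 := fun e =>
      C.no_common he he0 (by norm_num) (by norm_num; omega) hs ht hst
    omega

end Cox

end Dimensions

section Quadrics

theorem lin_comb {M : Type*} [AddCommMonoid M] (h2 : ∀ m : M, m + m = 0) (c : ℕ) (Ls : List ℕ)
    (vs : List M) : lin (comb c Ls) vs = lin c (Ls.map fun l => lin l vs) := by
  induction Ls generalizing c with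
  | nil => simp [comb]
  | cons l Ls ih =>
    rw [comb, lin_xor h2, ih, List.map_cons, lin_cons]
    rcases Nat.mod_two_eq_zero_or_one c with h | h <;> simp [h]

theorem lin_mul {R : Type*} [CommRing R] (y : R) (c : ℕ) (vs : List R) :
    lin c vs * y = lin c (vs.map (· * y)) := by
  induction vs generalizing c with
  | nil => simp
  | cons v vs ih => simp [lin_cons, ← ih, add_mul, mul_assoc]

/-- The entries of a quadruple. -/
def vec {R : Type*} (x : Fin 4 → R) : List R := [x 0, x 1, x 2, x 3]

/-- The quadratic monomials in a quadruple. -/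
def quads {R : Type*} [Mul R] (x : Fin 4 → R) : List R :=
  [x 0 * x 0, x 1 * x 1, x 2 * x 2, x 3 * x 3, x 0 * x 1, x 0 * x 2, x 0 * x 3, x 1 * x 2,
    x 1 * x 3, x 2 * x 3]

/-- The code of the product of two linear forms. -/
def qmul (a b : ℕ) : ℕ :=
  comb a [comb b [1, 16, 32, 64], comb b [16, 2, 128, 256], comb b [32, 128, 4, 512],
    comb b [64, 256, 512, 8]]

theorem lin_qmul {R : Type*} [CommRing R] (h2 : ∀ m : R, m + m = 0) (x : Fin 4 → R) (a b : ℕ) :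
    lin (qmul a b) (quads x) = lin a (vec x) * lin b (vec x) := by
  have e1 : lin b (vec x) * x 0 = lin (comb b [1, 16, 32, 64]) (quads x) := by
    rw [lin_mul, lin_comb h2]
    simp [vec, quads, lin_cons, mul_comm]
  have e2 : lin b (vec x) * x 1 = lin (comb b [16, 2, 128, 256]) (quads x) := by
    rw [lin_mul, lin_comb h2]
    simp [vec, quads, lin_cons, mul_comm]
  have e3 : lin b (vec x) * x 2 = lin (comb b [32, 128, 4, 512]) (quads x) := by
    rw [lin_mul, lin_comb h2]
    simp [vec, quads, lin_cons, mul_comm]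
  have e4 : lin b (vec x) * x 3 = lin (comb b [64, 256, 512, 8]) (quads x) := by
    rw [lin_mul, lin_comb h2]
    simp [vec, quads, lin_cons]
  rw [qmul, lin_comb h2, lin_mul]
  simp only [List.map_cons, List.map_nil, ← e1, ← e2, ← e3, ← e4]
  simp [vec, mul_comm]

/-- The action of a linear substitution on quadratic monomials. -/
def qact (g : Fin 4 → ℕ) : List ℕ :=
  [qmul (g 0) (g 0), qmul (g 1) (g 1), qmul (g 2) (g 2), qmul (g 3) (g 3), qmul (g 0) (g 1),
    qmul (g 0) (g 2), qmul (g 0) (g 3), qmul (g 1) (g 2), qmul (g 1) (g 3), qmul (g 2) (g 3)]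

/-- A linear substitution of a quadruple. -/
def sub {R : Type*} [AddCommMonoid R] (g : Fin 4 → ℕ) (x : Fin 4 → R) : Fin 4 → R :=
  fun i => lin (g i) (vec x)

theorem lin_sub {R : Type*} [CommRing R] (h2 : ∀ m : R, m + m = 0) (g : Fin 4 → ℕ)
    (x : Fin 4 → R) (c : ℕ) : lin c (vec (sub g x)) = lin (comb c (vec g)) (vec x) := by
  rw [lin_comb h2]
  rfl

theorem lin_quads_sub {R : Type*} [CommRing R] (h2 : ∀ m : R, m + m = 0) (g : Fin 4 → ℕ)
    (x : Fin 4 → R) (c : ℕ) : lin c (quads (sub g x)) = lin (comb c (qact g)) (quads x) := by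
  rw [lin_comb h2]
  simp only [qact, quads, List.map_cons, List.map_nil, sub]
  rw [← quads]
  simp only [lin_qmul h2]

/-- A substitution that transforms one quadratic form to another. -/
def isOrth (r r' : ℕ) (g : Fin 4 → ℕ) : Bool :=
  ((List.range 16).all fun c => decide (comb c (vec g) < 16 ∧ (comb c (vec g) = 0 → c = 0))) &&
  ((List.range 1024).all fun c => decide (comb c (qact g) < 1024 ∧
    (comb c (qact g) = 0 ∨ comb c (qact g) = r → c = 0 ∨ c = r'))) &&
  decide (comb r' (qact g) = r)

variable {K : Type} [Field K] [Algebra (ZMod 2) K] {V : ℤ → Submodule (ZMod 2) K}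

/-- A basis of the sixth graded piece satisfying a quadratic relation. -/
structure PreBasis (V : ℤ → Submodule (ZMod 2) K) (r : ℕ) (x : Fin 4 → K) : Prop where
  mem : ∀ i, x i ∈ V 6
  indep : Indep (vec x)
  rel : lin r (quads x) = 0

/-- A basis of the sixth graded piece satisfying a single quadratic relation. -/
structure QBasis (V : ℤ → Submodule (ZMod 2) K) (r : ℕ) (x : Fin 4 → K) : Prop
    extends PreBasis V r x where
  uniq : ∀ c < 1024, lin c (quads x) = 0 → c = 0 ∨ c = r

omit [Field K] [Algebra (ZMod 2) K] in
theorem mem_vec {S : Type*} [SetLike S K] {s : S} {x : Fin 4 → K} (h : ∀ i, x i ∈ s) :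
    ∀ v ∈ vec x, v ∈ s := by
  simp [vec, h]

theorem PreBasis.sub {r r' : ℕ} {x : Fin 4 → K} (h : PreBasis V r x) {g : Fin 4 → ℕ}
    (hg : isOrth r r' g = true) : PreBasis V r' (sub g x) := by
  simp only [isOrth, Bool.and_eq_true, List.all_eq_true, List.mem_range, decide_eq_true_eq] at hg
  obtain ⟨⟨h1, h2⟩, h3⟩ := hg
  refine ⟨fun i => lin_mem (V 6) _ _ (mem_vec h.mem), fun c hc h0 => ?_, ?_⟩
  · rw [lin_sub add_self] at h0
    obtain ⟨h4, h5⟩ := h1 c hc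
    exact h5 (h.indep _ h4 h0)
  · rw [lin_quads_sub add_self, h3, h.rel]

theorem QBasis.sub {r r' : ℕ} {x : Fin 4 → K} (h : QBasis V r x) {g : Fin 4 → ℕ}
    (hg : isOrth r r' g = true) : QBasis V r' (sub g x) := by
  refine ⟨h.toPreBasis.sub hg, fun c hc h0 => ?_⟩
  simp only [isOrth, Bool.and_eq_true, List.all_eq_true, List.mem_range, decide_eq_true_eq] at hg
  rw [lin_quads_sub add_self] at h0
  exact (hg.1.2 c hc).2 (h.uniq _ (hg.1.2 c hc).1 h0)

theorem lin_540 {R : Type*} [CommRing R] (x : Fin 4 → R) :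
    lin 540 (quads x) = x 0 * x 1 + (x 2 * x 2 + x 2 * x 3 + x 3 * x 3) := by
  simp [quads, lin_cons]
  ring

theorem lin_vec {R : Type*} [CommRing R] (c : ℕ) (x : Fin 4 → R) :
    lin c (vec x) = (c % 2 : ℕ) * x 0 + (c / 2 % 2 : ℕ) * x 1 + (c / 2 / 2 % 2 : ℕ) * x 2 +
      (c / 2 / 2 / 2 % 2 : ℕ) * x 3 := by
  simp only [vec, lin_cons, lin_nil, nsmul_eq_mul]
  ring

theorem Ev.quads {d : ℤ} {f : K} {κ : Type} [Field κ] {ev : ℤ → K → κ} (E : Ev V d f κ ev)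
    {x : Fin 4 → K} (hx : ∀ i, x i ∈ V 6) :
    (quads x).map (ev 12) = CFF.quads fun i => ev 6 (x i) := by
  simp only [CFF.quads, List.map_cons, List.map_nil]
  simp only [E.mul' (hx _) (hx _) (show (6 : ℤ) + 6 = 12 by norm_num)]

namespace Cox

variable (C : Cox V)
include C

theorem quads_mem {x : Fin 4 → K} (hx : ∀ i, x i ∈ V 6) : ∀ v ∈ quads x, v ∈ V 12 := by
  simp only [quads, List.mem_cons, List.not_mem_nil, or_false]
  rintro v (rfl | rfl | rfl | rfl | rfl | rfl | rfl | rfl | rfl | rfl) <;>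
    exact C.mul' (hx _) (hx _) rfl

theorem eq_of_dvd_six {h y : K} (hd : HDvd V 6 h 6 y) : y = 0 ∨ y = h := by
  by_cases h0 : y = 0
  · exact Or.inl h0
  · exact Or.inr (C.eq_of_hdvd h0 hd)

/-- Parametrization of a smooth plane section that is prime. -/
theorem plane_low {x : Fin 4 → K} (hx : PreBasis V 540 x) (h : Irr V 6 (x 2)) :
    ∃ (κ : Type) (_ : Field κ) (ev : ℤ → K → κ) (τ μ : κ), Nat.card κ = 2 ^ 6 ∧
      Ev V 6 (x 2) κ ev ∧ (2 : κ) = 0 ∧ μ ≠ 0 ∧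
      (∀ i, ev 6 (x i) = μ * pe τ (![1, 4, 0, 2] i)) ∧ ∀ p, 0 < p → p < 8 → pe τ p ≠ 0 := by
  obtain ⟨κ, _, ev, hcard, E, h2⟩ := C.exists_point h
  have hadd : ∀ m : κ, m + m = 0 := fun m => by rw [← two_mul, h2, zero_mul]
  have e2 : ev 6 (x 2) = 0 :=
    (E.zero_iff 6 _ h.mem).mpr ⟨1, by simpa using C.one_mem, by simp⟩
  have hlin : ∀ c, c < 16 → ev 6 (lin c (vec x)) = 0 → c = 0 ∨ c = 4 := by
    intro c hc h0
    rcases C.eq_of_dvd_six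
      ((E.zero_iff 6 _ (lin_mem (V 6) _ _ (mem_vec hx.mem))).mp h0) with h1 | h1
    · exact Or.inl (hx.indep c hc h1)
    · right
      have h3 : lin (c ^^^ 4) (vec x) = 0 := by
        rw [lin_xor add_self, h1]
        simp [vec, lin_cons, add_self]
      have h4 := hx.indep _ (Nat.xor_lt_two_pow (n := 4) hc (by norm_num)) h3
      have := Nat.xor_eq_zero_iff.mp h4
      exact this
  have hquad : ev 6 (x 0) * ev 6 (x 1) = ev 6 (x 3) * ev 6 (x 3) := by
    have h0 := hx.rel
    have h1 := congrArg (ev 12) h0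
    rw [E.zero, E.lin 12 _ _ (C.quads_mem hx.mem), E.quads hx.mem, lin_540, e2] at h1
    linear_combination h1 - ev 6 (x 3) * ev 6 (x 3) * h2
  have h0 : ev 6 (x 0) ≠ 0 := by
    intro h0
    have := hlin 1 (by norm_num) (by simpa [vec, lin_cons] using h0)
    omega
  set μ := ev 6 (x 0) with hμ
  set τ := ev 6 (x 3) / μ with hτ
  have e3 : ev 6 (x 3) = μ * τ := by rw [hτ]; field_simp
  have e1 : ev 6 (x 1) = μ * τ ^ 2 := by
    rw [e3] at hquad
    exact mul_left_cancel₀ h0 (by rw [hquad]; ring)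
  have hev : ∀ i, ev 6 (x i) = μ * pe τ (![1, 4, 0, 2] i) := by
    intro i
    fin_cases i
    · simp [hμ]
    · simp [e1, pe_eq τ 4, pe_eq τ 2, sq]
    · simp [e2]
    · simp [e3, pe_eq τ 2]
  refine ⟨κ, _, ev, τ, μ, hcard, E, h2, h0, hev, ?_⟩
  · intro p hp hp8 h3
    have h5 : ev 6 (lin (comb p [1, 8, 2]) (vec x)) = 0 := by
      rw [E.lin 6 _ _ (mem_vec hx.mem), lin_comb hadd]
      have : ((vec x).map (ev 6)) = vec (fun i => ev 6 (x i)) := rfl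
      rw [this]
      simp only [List.map_cons, List.map_nil]
      have a1 : lin 1 (vec fun i => ev 6 (x i)) = μ * τ ^ 0 := by simp [vec, lin_cons, hμ]
      have a2 : lin 8 (vec fun i => ev 6 (x i)) = μ * τ ^ 1 := by simp [vec, lin_cons, e3]
      have a3 : lin 2 (vec fun i => ev 6 (x i)) = μ * τ ^ 2 := by simp [vec, lin_cons, e1]
      rw [a1, a2, a3]
      have := lin_smul μ p ((List.range 3).map (τ ^ ·))
      rw [lin_range_pow τ p 3 (by omega), h3, mul_zero] at this
      simpa [List.range_succ] using this
    have := hlin _ ((show ∀ p < 8, comb p [1, 8, 2] < 16 by decide) p hp8) h5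
    exact (show ∀ p < 8, 0 < p → ¬ (comb p [1, 8, 2] = 0 ∨ comb p [1, 8, 2] = 4) by decide)
      p hp8 hp this

/-- Parametrization of a smooth prime plane section of an irreducible space curve. -/
theorem plane_section {x : Fin 4 → K} (hx : QBasis V 540 x) (h : Irr V 6 (x 2)) :
    ∃ (κ : Type) (_ : Field κ) (ev : ℤ → K → κ) (τ μ : κ), Ev V 6 (x 2) κ ev ∧ (2 : κ) = 0 ∧
      μ ≠ 0 ∧ (∀ i, ev 6 (x i) = μ * pe τ (![1, 4, 0, 2] i)) ∧
      ∀ p, 0 < p → p < 64 → pe τ p ≠ 0 := by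
  obtain ⟨κ, _, ev, τ, μ, hcard, E, h2, h0, hev, -⟩ := C.plane_low hx.toPreBasis h
  refine ⟨κ, _, ev, τ, μ, E, h2, h0, hev, ?_⟩
  have hadd : ∀ m : κ, m + m = 0 := fun m => by rw [← two_mul, h2, zero_mul]
  have hμ : ev 6 (x 0) = μ := by simpa using hev 0
  have e1 : ev 6 (x 1) = μ * τ ^ 2 := by simpa [pe_eq τ 4, pe_eq τ 2, sq] using hev 1
  have e3 : ev 6 (x 3) = μ * τ := by simpa [pe_eq τ 2] using hev 3
  have hquads : ∀ c, c < 1024 → ev 12 (lin c (quads x)) = 0 →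
      ∃ l < 16, c ^^^ qmul 4 l = 0 ∨ c ^^^ qmul 4 l = 540 := by
    intro c hc h3
    have hm := C.quads_mem hx.mem
    obtain ⟨l, hl, he⟩ := (E.zero_iff 12 _ (lin_mem (V 12) _ _ hm)).mp h3
    norm_num at hl
    obtain ⟨l, hl16, rfl⟩ := C.exists_eq_lin hx.indep (mem_vec hx.mem) (by rw [C.len_six]; rfl) hl
    refine ⟨l, hl16, hx.uniq _ (Nat.xor_lt_two_pow (n := 10) hc ?_) ?_⟩
    · exact (show ∀ l < 16, qmul 4 l < 2 ^ 10 by decide) l hl16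
    · rw [lin_xor add_self, lin_qmul add_self, he]
      simp [vec, lin_cons, add_self]
  have hquad2 : ∀ p, 0 < p → p < 32 → pe τ p ≠ 0 := by
    intro p hp hp8 h3
    have hm := C.quads_mem hx.mem
    have h5 : ev 12 (lin (comb p [1, 64, 8, 256, 2]) (quads x)) = 0 := by
      rw [E.lin 12 _ _ hm, lin_comb hadd]
      rw [E.quads hx.mem]
      simp only [List.map_cons, List.map_nil]
      have a0 : lin 1 (quads fun i => ev 6 (x i)) = μ ^ 2 * τ ^ 0 := by
        simp [quads, lin_cons, hμ]; ring
      have a1 : lin 64 (quads fun i => ev 6 (x i)) = μ ^ 2 * τ ^ 1 := by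
        simp [quads, lin_cons, hμ, e3]; ring
      have a2 : lin 8 (quads fun i => ev 6 (x i)) = μ ^ 2 * τ ^ 2 := by
        simp [quads, lin_cons, hμ, e3]; ring
      have a3 : lin 256 (quads fun i => ev 6 (x i)) = μ ^ 2 * τ ^ 3 := by
        simp [quads, lin_cons, hμ, e3, e1]; ring
      have a4 : lin 2 (quads fun i => ev 6 (x i)) = μ ^ 2 * τ ^ 4 := by
        simp [quads, lin_cons, hμ, e1]; ring
      rw [a0, a1, a2, a3, a4]
      have := lin_smul (μ ^ 2) p ((List.range 5).map (τ ^ ·))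
      rw [lin_range_pow τ p 5 (by omega), h3, mul_zero] at this
      simpa [List.range_succ] using this
    have := hquads _ ((show ∀ p < 32, comb p [1, 64, 8, 256, 2] < 1024 by decide) p hp8) h5
    exact (show ∀ p < 32, 0 < p → ¬ (∃ l < 16, comb p [1, 64, 8, 256, 2] ^^^ qmul 4 l = 0 ∨
      comb p [1, 64, 8, 256, 2] ^^^ qmul 4 l = 540) by decide +kernel) p hp8 hp this
  exact pe_ne_zero h2 hcard τ 4 (fun p h0 h1 => hquad2 p h0 (by omega)) (by
    intro e he h4
    have := Nat.le_of_dvd (by norm_num) he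
    interval_cases e <;> omega)

end Cox

end Quadrics

section Cubics

theorem comb_lt {k : ℕ} (c : ℕ) (Ls : List ℕ) (h : ∀ l ∈ Ls, l < 2 ^ k) : comb c Ls < 2 ^ k := by
  induction Ls generalizing c with
  | nil => simp [comb]
  | cons l Ls ih =>
    rw [comb]
    refine Nat.xor_lt_two_pow ?_ (ih _ fun m hm => h m (by simp [hm]))
    have := h l (by simp)
    rcases Nat.mod_two_eq_zero_or_one c with h | h <;> simp [h, this]

/-- A block of binary digits. -/
def digits (k m n : ℕ) : ℕ := n / 2 ^ k % 2 ^ m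

theorem digits_comb (k m c : ℕ) (Ls : List ℕ) :
    digits k m (comb c Ls) = comb c (Ls.map (digits k m)) := by
  unfold digits
  induction Ls generalizing c with
  | nil => simp [comb]
  | cons l Ls ih =>
    rw [comb, Nat.xor_div_two_pow, Nat.xor_mod_two_pow, ih, List.map_cons, comb]
    rcases Nat.mod_two_eq_zero_or_one c with h | h <;> simp [h]

theorem comb_double (c : ℕ) (Ls : List ℕ) : comb c (Ls.map (2 * ·)) = 2 * comb c Ls := by
  induction Ls generalizing c with
  | nil => simp [comb]
  | cons l Ls ih =>
    have h2 : ∀ a b : ℕ, 2 * a ^^^ 2 * b = 2 * (a ^^^ b) := by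
      intro a b
      have h1 := xor_mod_two (2 * a) (2 * b)
      have h3 := xor_div_two (2 * a) (2 * b)
      simp only [Nat.mul_mod_right,
        Nat.mul_div_cancel_left _ (show 0 < 2 by norm_num)] at h1 h3
      omega
    rw [List.map_cons, comb, comb, ih, ← h2]
    congr 1
    ring

theorem comb_two_pow (k c : ℕ) (hc : c < 2 ^ k) : comb c ((List.range k).map (2 ^ ·)) = c := by
  induction k generalizing c with
  | zero =>
    obtain rfl : c = 0 := by simpa using hc
    rfl
  | succ k ih =>
    have h1 : (List.range k).map ((2 ^ ·) ∘ Nat.succ) = ((List.range k).map (2 ^ ·)).map (2 * ·) := by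
      rw [List.map_map]
      congr 1
      funext i
      simp [pow_succ, mul_comm]
    rw [List.range_succ_eq_map, List.map_cons, List.map_map, comb, h1, comb_double,
      ih _ (by rw [pow_succ] at hc; omega)]
    have h1 := xor_mod_two (c % 2 * 2 ^ 0) (2 * (c / 2))
    have h3 := xor_div_two (c % 2 * 2 ^ 0) (2 * (c / 2))
    have h4 : c % 2 * 2 ^ 0 / 2 = 0 := by omega
    rw [h4, Nat.zero_xor] at h3
    omega

/-- A property of all combinations of the entries of a list. -/
def allComb (P : ℕ → Bool) : List ℕ → ℕ → Bool
  | [], a => P a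
  | v :: vs, a => allComb P vs a && allComb P vs (a ^^^ v)

theorem allComb_spec {P : ℕ → Bool} {vs : List ℕ} {a : ℕ} (h : allComb P vs a = true) (c : ℕ) :
    P (a ^^^ comb c vs) = true := by
  induction vs generalizing a c with
  | nil => simpa [comb, allComb] using h
  | cons v vs ih =>
    rw [allComb, Bool.and_eq_true] at h
    rw [comb]
    rcases Nat.mod_two_eq_zero_or_one c with h' | h'
    · rw [h', zero_mul, Nat.zero_xor]
      exact ih h.1 _
    · rw [h', one_mul, ← Nat.xor_assoc]
      exact ih h.2 _

/-- The cubic monomials in a quadruple with given indices. -/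
def cubics {R : Type*} [Mul R] (x : Fin 4 → R) (ms : List (Fin 4 × Fin 4 × Fin 4)) : List R :=
  ms.map fun m => x m.1 * x m.2.1 * x m.2.2

/-- The code of a cubic monomial in four quadratic polynomials. -/
def sextic (P : Fin 4 → ℕ) (m : Fin 4 × Fin 4 × Fin 4) : ℕ :=
  clmul 3 (P m.1) (clmul 3 (P m.2.1) (P m.2.2))

/-- The codes of polynomials of degree at most six without factorization into factors of smaller
degree. -/
def isGood (s : ℕ) : Bool :=
  decide (208351213740468988747024739050979329 / 2 ^ s % 2 = 1)

theorem isGood_of_forall {s : ℕ} (hs : s < 128)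
    (h : ∀ a b, 0 < a → a < 64 → 0 < b → b < 64 → s ≠ clmul 6 a b) : isGood s = true := by
  have : ∀ s < 128, isGood s = true ∨ ∃ a ∈ [1, 2, 3, 7, 11, 13], ∃ b < 64, 0 < b ∧
      s = clmul 6 a b := by decide +kernel
  rcases this s hs with h' | ⟨a, ha, b, hb, hb0, rfl⟩
  · exact h'
  · obtain ⟨h1, h2⟩ := (show ∀ a ∈ [1, 2, 3, 7, 11, 13], 0 < a ∧ a < 64 by decide) a ha
    exact absurd rfl (h a b h1 h2 hb0 hb)

/-- The parametrization of the conic in a smooth plane section. -/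
def par (g : Fin 4 → ℕ) : Fin 4 → ℕ := fun i => comb (g i) [1, 4, 0, 2]

/-- Orthogonal substitutions with their inverses, for each of the smooth plane sections. -/
def planes : List ((Fin 4 → ℕ) × (Fin 4 → ℕ)) :=
  [(![1, 2, 4, 8], ![1, 2, 4, 8]),
   (![11, 15, 5, 3], ![7, 15, 3, 9]),
   (![11, 15, 6, 3], ![15, 7, 3, 9]),
   (![1, 2, 8, 4], ![1, 2, 8, 4]),
   (![7, 15, 9, 3], ![7, 15, 9, 3]),
   (![7, 15, 10, 3], ![15, 7, 9, 3]),
   (![1, 2, 12, 4], ![1, 2, 8, 12]),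
   (![7, 11, 13, 3], ![7, 15, 9, 10]),
   (![7, 11, 14, 3], ![15, 7, 9, 10]),
   (![11, 15, 3, 5], ![11, 15, 3, 5])]

theorem planes_spec : ∀ p ∈ planes, isOrth 540 540 p.1 = true ∧
    (∀ i : Fin 4, comb (p.2 i) (vec p.1) = 2 ^ (i : ℕ)) ∧ (∀ i : Fin 4, par p.2 i < 8) := by
  decide +kernel

variable {K : Type} [Field K] [Algebra (ZMod 2) K] {V : ℤ → Submodule (ZMod 2) K}

namespace Cox

variable (C : Cox V)
include C

theorem cubics_mem {x : Fin 4 → K} (hx : ∀ i, x i ∈ V 6) (ms : List (Fin 4 × Fin 4 × Fin 4)) :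
    ∀ v ∈ cubics x ms, v ∈ V 18 := by
  simp only [cubics, List.mem_map]
  rintro v ⟨m, -, rfl⟩
  exact C.mul' (C.mul' (hx _) (hx _) rfl) (hx _) rfl

theorem isGood_of_irr {x : Fin 4 → K} (hx : QBasis V 540 x)
    {p : (Fin 4 → ℕ) × (Fin 4 → ℕ)} (hp : p ∈ planes) (h : Irr V 6 (lin (p.1 2) (vec x)))
    (ms : List (Fin 4 × Fin 4 × Fin 4)) (c : ℕ) (hc : lin c (cubics x ms) = 0) :
    isGood (comb c (ms.map (sextic (par p.2)))) = true := by
  obtain ⟨h1, h2, h3⟩ := planes_spec p hp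
  obtain ⟨κ, _, ev, τ, μ, E, t2, hμ, hev, hτ⟩ := C.plane_section (hx.sub h1) h
  have hadd : ∀ m : κ, m + m = 0 := fun m => by rw [← two_mul, t2, zero_mul]
  have hev' : ∀ i, ev 6 (x i) = μ * pe τ (par p.2 i) := by
    intro i
    have : x i = lin (p.2 i) (vec (sub p.1 x)) := by
      rw [lin_sub add_self, h2 i]
      fin_cases i <;> simp [vec, lin_cons]
    rw [this, E.lin 6 _ _ (mem_vec (hx.sub h1).mem)]
    have h5 : (vec (sub p.1 x)).map (ev 6) = ([1, 4, 0, 2].map (pe τ)).map (μ * ·) := by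
      simp only [vec, List.map_cons, List.map_nil, hev]
      simp
    rw [h5, lin_smul, par, pe_comb τ t2]
  have hS : pe τ (comb c (ms.map (sextic (par p.2)))) = 0 := by
    have h6 := congrArg (ev 18) hc
    rw [E.zero, E.lin 18 _ _ (C.cubics_mem hx.mem ms)] at h6
    have h7 : (cubics x ms).map (ev 18) =
        ((ms.map (sextic (par p.2))).map (pe τ)).map (μ ^ 3 * ·) := by
      simp only [cubics, List.map_map]
      refine List.map_congr_left fun m _ => ?_
      simp only [Function.comp]
      rw [E.mul' (C.mul' (hx.mem _) (hx.mem _) (show (6 : ℤ) + 6 = 12 by norm_num)) (hx.mem _)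
        (by norm_num), E.mul' (hx.mem _) (hx.mem _) (by norm_num), hev', hev', hev', sextic,
        pe_clmul τ t2 3 _ _ (h3 _), pe_clmul τ t2 3 _ _ (h3 _)]
      ring
    rw [h7, lin_smul, ← pe_comb τ t2] at h6
    exact (mul_eq_zero.mp h6).resolve_left (pow_ne_zero 3 hμ)
  refine isGood_of_forall (comb_lt (k := 7) _ _ ?_) ?_
  · simp only [List.mem_map]
    rintro _ ⟨m, -, rfl⟩
    exact (show ∀ a < 8, ∀ b < 8, ∀ c < 8, clmul 3 a (clmul 3 b c) < 2 ^ 7 by decide +kernel)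
      _ (h3 _) _ (h3 _) _ (h3 _)
  · intro a b ha ha' hb hb' he
    rw [he, pe_clmul τ t2 6 _ _ ha', mul_eq_zero] at hS
    exact hS.elim (hτ a ha ha') (hτ b hb hb')

end Cox

end Cubics

section FieldOfOrderSixteen

/-- Multiplication of codes of elements of the field with sixteen elements. -/
def mulSixteen (a b : ℕ) : ℕ := clmul 4 a b % 16 ^^^ comb (clmul 4 a b / 16) [3, 6, 12]

theorem pe_mulSixteen {κ : Type} [Field κ] (h2 : (2 : κ) = 0) {ζ : κ} (hζ : pe ζ 19 = 0) {a b : ℕ}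
    (ha : a < 16) (hb : b < 16) :
    mulSixteen a b < 16 ∧ pe ζ (mulSixteen a b) = pe ζ a * pe ζ b := by
  obtain ⟨h1, c, hc, h3⟩ := (show ∀ a < 16, ∀ b < 16, mulSixteen a b < 16 ∧
    ∃ c < 8, clmul 4 a b = mulSixteen a b ^^^ clmul 3 c 19 by decide +kernel) a ha b hb
  refine ⟨h1, ?_⟩
  rw [← pe_clmul ζ h2 4 a b (by omega), h3, pe_xor ζ h2, pe_clmul ζ h2 3 c 19 hc, hζ, mul_zero,
    add_zero]

theorem exists_primitive {κ : Type} [Field κ] (h2 : (2 : κ) = 0) (hcard : Nat.card κ = 2 ^ 4) :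
    ∃ ζ : κ, pe ζ 19 = 0 ∧ ∀ p, 0 < p → p < 16 → pe ζ p ≠ 0 := by
  have hfin : Finite κ := Nat.finite_of_card_ne_zero (by rw [hcard]; norm_num)
  obtain ⟨g, hg⟩ := IsCyclic.exists_generator (α := κˣ)
  have hord : orderOf g = 15 := by
    rw [orderOf_eq_card_of_forall_mem_zpowers hg, Nat.card_units, hcard]
    norm_num
  have hpow : ∀ (t : κˣ), orderOf t = 15 → ∀ p, 0 < p → p < 16 → pe (t : κ) p ≠ 0 := by
    intro t ht
    have h1 : ∀ i, 0 < i → i < 15 → (t : κ) ^ i ≠ 1 := by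
      intro i h0 hi he
      have : t ^ i = 1 := Units.ext (by simpa using he)
      have := orderOf_dvd_of_pow_eq_one this
      rw [ht] at this
      exact absurd (Nat.le_of_dvd h0 this) (by omega)
    have e2 : pe (t : κ) 2 ≠ 0 := by simp [pe_eq (t : κ) 2]
    have e3 : pe (t : κ) 3 ≠ 0 := by
      intro h
      have h4 := pe_clmul (t : κ) h2 2 3 7 (by norm_num)
      rw [h, zero_mul, show clmul 2 3 7 = 9 from rfl] at h4
      refine h1 3 (by norm_num) (by norm_num) ?_
      simp only [pe_eq (t : κ) 9, pe_eq (t : κ) 4, pe_eq (t : κ) 2] at h4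
      norm_num at h4
      linear_combination h4 - h2
    have e7 : pe (t : κ) 7 ≠ 0 := by
      intro h
      have h4 := pe_clmul (t : κ) h2 2 3 7 (by norm_num)
      rw [h, mul_zero, show clmul 2 3 7 = 9 from rfl] at h4
      refine h1 3 (by norm_num) (by norm_num) ?_
      simp only [pe_eq (t : κ) 9, pe_eq (t : κ) 4, pe_eq (t : κ) 2] at h4
      norm_num at h4
      linear_combination h4 - h2
    have hlow : ∀ p, 0 < p → p < 2 ^ 3 → pe (t : κ) p ≠ 0 := by
      intro p hp hp8
      have := pe_clmul (t : κ) h2 2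
      interval_cases p
      · simp
      · exact e2
      · exact e3
      · rw [show 4 = clmul 2 2 2 from rfl, this 2 2 (by norm_num)]; exact mul_ne_zero e2 e2
      · rw [show 5 = clmul 2 3 3 from rfl, this 3 3 (by norm_num)]; exact mul_ne_zero e3 e3
      · rw [show 6 = clmul 2 2 3 from rfl, this 2 3 (by norm_num)]; exact mul_ne_zero e2 e3
      · exact e7
    exact pe_ne_zero h2 hcard t 3 hlow (by
      intro e he h4
      have := Nat.le_of_dvd (by norm_num) he
      interval_cases e <;> omega)
  have hadd : ∀ m : κ, m + m = 0 := fun m => by rw [← two_mul, h2, zero_mul]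
  obtain ⟨p, hp, hp32, h0⟩ : ∃ p, 0 < p ∧ p < 32 ∧ pe (g : κ) p = 0 := by
    obtain ⟨c, hc, hc32, h0⟩ := exists_lin_eq_zero hadd (Set.univ : Set κ) Set.finite_univ
      ((List.range 5).map ((g : κ) ^ ·)) (fun _ => Set.mem_univ _)
      (by rw [Set.ncard_univ, hcard]; simp)
    simp only [List.length_map, List.length_range] at hc32
    exact ⟨c, hc, hc32, by rwa [lin_range_pow (g : κ) c 5 hc32] at h0⟩
  have hcases : p = 19 ∨ p = 25 ∨ p = 31 := by
    rcases (show ∀ p < 32, 0 < p → (p < 16 ∨ p = 19 ∨ p = 25 ∨ p = 31) ∨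
      ∃ a ∈ [2, 3, 7], ∃ b < 16, 0 < b ∧ p = clmul 4 a b by decide +kernel) p hp32 hp with h | h
    · exact h.resolve_left fun h16 => hpow g hord p hp h16 h0
    · obtain ⟨a, ha, b, hb, hb0, rfl⟩ := h
      obtain ⟨h1, h3⟩ := (show ∀ a ∈ [2, 3, 7], 0 < a ∧ a < 16 by decide) a ha
      rw [pe_clmul _ h2 4 _ _ h3, mul_eq_zero] at h0
      exact absurd h0 (not_or.mpr ⟨hpow g hord a h1 h3, hpow g hord b hb0 hb⟩)
  rcases hcases with rfl | rfl | rfl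
  · exact ⟨g, h0, hpow g hord⟩
  · refine ⟨(g⁻¹ : κˣ), ?_, hpow _ (by rw [orderOf_inv, hord])⟩
    have hg0 : (g : κ) ≠ 0 := g.ne_zero
    simp only [pe_eq (g : κ) 25, pe_eq (g : κ) 12, pe_eq (g : κ) 6, pe_eq (g : κ) 3] at h0
    simp only [pe_eq _ 19, pe_eq _ 9, pe_eq _ 4, pe_eq _ 2]
    norm_num at h0 ⊢
    field_simp
    linear_combination h0
  · exfalso
    have h4 := pe_clmul (g : κ) h2 2 3 31 (by norm_num)
    rw [h0, mul_zero, show clmul 2 3 31 = 33 from rfl] at h4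
    simp only [pe_eq (g : κ) 33, pe_eq (g : κ) 16, pe_eq (g : κ) 8, pe_eq (g : κ) 4,
      pe_eq (g : κ) 2] at h4
    norm_num at h4
    have h5 : (g : κ) ^ 5 = 1 := by linear_combination h4 - h2
    have := orderOf_dvd_of_pow_eq_one (Units.ext (by simpa using h5) : g ^ 5 = 1)
    rw [hord] at this
    omega

end FieldOfOrderSixteen

section Indecomposable

variable {K : Type} [Field K] [Algebra (ZMod 2) K] {V : ℤ → Submodule (ZMod 2) K}

namespace Cox

variable (C : Cox V)
include C

theorem irr_or_sq (h1 : len V 1 = 0) (h2 : len V 2 = 0) (h3 : len V 3 ≤ 1) {f : K} (hf : f ∈ V 6)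
    (h0 : f ≠ 0) : Irr V 6 f ∨ ∃ g ∈ V 3, f = g * g := by
  by_cases h : ∀ i : ℤ, 0 < i → i < 6 → ∀ g ∈ V i, ∀ h ∈ V (6 - i), f ≠ g * h
  · exact Or.inl ⟨hf, h0, by norm_num, h⟩
  · push Not at h
    obtain ⟨i, hi, hi6, g, hg, k, hk, rfl⟩ := h
    have hg0 := left_ne_zero_of_mul h0
    have hk0 := right_ne_zero_of_mul h0
    obtain rfl | rfl | rfl | rfl | rfl : i = 1 ∨ i = 2 ∨ i = 3 ∨ i = 4 ∨ i = 5 := by omega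
    · exact absurd (C.eq_zero h1 hg) hg0
    · exact absurd (C.eq_zero h2 hg) hg0
    · right
      norm_num at hk
      have h4 : len V 3 = 1 := by
        by_contra h5
        exact hg0 (C.eq_zero (by omega) hg)
      rw [C.eq_of_len_one h4 hk hg hk0 hg0]
      exact ⟨g, hg, rfl⟩
    · norm_num at hk
      exact absurd (C.eq_zero h2 hk) hk0
    · norm_num at hk
      exact absurd (C.eq_zero h1 hk) hk0

theorem eq_of_not_irr (h1 : len V 1 = 0) (h2 : len V 2 = 0) (h3 : len V 3 ≤ 1) {f g : K}
    (hf : f ∈ V 6) (hg : g ∈ V 6) (hf0 : f ≠ 0) (hg0 : g ≠ 0) (hfi : ¬ Irr V 6 f)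
    (hgi : ¬ Irr V 6 g) : f = g := by
  obtain ⟨a, ha, rfl⟩ := (C.irr_or_sq h1 h2 h3 hf hf0).resolve_left hfi
  obtain ⟨b, hb, rfl⟩ := (C.irr_or_sq h1 h2 h3 hg hg0).resolve_left hgi
  have ha0 := left_ne_zero_of_mul hf0
  have h4 : len V 3 = 1 := by
    by_contra h5
    exact ha0 (C.eq_zero (by omega) ha)
  rw [C.eq_of_len_one h4 ha hb ha0 (left_ne_zero_of_mul hg0)]

theorem irr_four (h1 : len V 1 = 0) (h2 : len V 2 = 0) {u : K} (hu : u ∈ V 4) (h0 : u ≠ 0) :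
    Irr V 4 u := by
  refine ⟨hu, h0, by norm_num, fun i hi hi4 g hg k hk he => h0 ?_⟩
  obtain rfl | rfl | rfl : i = 1 ∨ i = 2 ∨ i = 3 := by omega
  · rw [he, C.eq_zero h1 hg, zero_mul]
  · rw [he, C.eq_zero h2 hg, zero_mul]
  · norm_num at hk
    rw [he, C.eq_zero h1 hk, mul_zero]

theorem eq_or_eq_of_mul_eq (h1 : len V 1 = 0) (h2 : len V 2 = 0) (h3 : len V 3 ≤ 1)
    {f₁ f₂ f₃ f₄ : K} (m1 : f₁ ∈ V 6) (m2 : f₂ ∈ V 6) (m3 : f₃ ∈ V 6) (m4 : f₄ ∈ V 6)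
    (n1 : f₁ ≠ 0) (n2 : f₂ ≠ 0) (h : f₁ * f₂ = f₃ * f₄) :
    f₁ = f₃ ∧ f₂ = f₄ ∨ f₁ = f₄ ∧ f₂ = f₃ := by
  obtain ⟨i, α, hα, β, hβ, γ, hγ, δ, hδ, rfl, rfl, rfl, rfl⟩ :=
    C.split 6 f₁ m1 f₂ m2 f₃ m3 f₄ m4 n1 n2 h
  have a0 := left_ne_zero_of_mul n1
  have b0 := right_ne_zero_of_mul n1
  have c0 := left_ne_zero_of_mul n2
  have d0 := right_ne_zero_of_mul n2
  have key : ∀ n : ℤ, (n < 0 ∨ n = 1 ∨ n = 2) → ∀ f ∈ V n, f = 0 := by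
    rintro n (hn | rfl | rfl) f hf
    · exact C.eq_zero (C.len_neg hn) hf
    · exact C.eq_zero h1 hf
    · exact C.eq_zero h2 hf
  obtain hi | rfl | rfl | rfl | hi : (i < 0 ∨ i = 1 ∨ i = 2) ∨ i = 0 ∨ i = 3 ∨ i = 6 ∨
      (6 - i < 0 ∨ 6 - i = 1 ∨ 6 - i = 2) := by omega
  · exact absurd (key i hi α hα) a0
  · rw [C.eq_one α hα a0, C.eq_one δ hδ d0]
    simp
  · norm_num at hβ hγ
    have h4 : len V 3 = 1 := by
      by_contra h5
      exact a0 (C.eq_zero (by omega) hα)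
    rw [C.eq_of_len_one h4 hβ hα b0 a0, C.eq_of_len_one h4 hγ hα c0 a0,
      C.eq_of_len_one h4 hδ hα d0 a0]
    simp
  · norm_num at hβ hγ
    rw [C.eq_one β hβ b0, C.eq_one γ hγ c0]
    simp
  · exact absurd (key _ hi β hβ) b0

theorem lin_ne_zero_of_split (h1 : len V 1 = 0) (h2 : len V 2 = 0) (h3 : len V 3 ≤ 1)
    {x : Fin 4 → K} (hx : ∀ i, x i ∈ V 6) (hi : Indep (vec x)) {a b c d : ℕ} (ha : a < 16)
    (hb : b < 16) (hc : c < 16) (hd : d < 16) (ha0 : 0 < a) (hb0 : 0 < b)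
    (h : ¬ (a = c ∧ b = d)) (h' : ¬ (a = d ∧ b = c)) :
    lin (qmul a b ^^^ qmul c d) (quads x) ≠ 0 := by
  intro h0
  rw [lin_xor add_self, lin_qmul add_self, lin_qmul add_self] at h0
  have hm : ∀ c, lin c (vec x) ∈ V 6 := fun c => lin_mem (V 6) c _ (mem_vec hx)
  have hne : ∀ c < 16, 0 < c → lin c (vec x) ≠ 0 := fun c hc h0 he => h0.ne' (hi c hc he)
  have heq : ∀ c < 16, ∀ d < 16, lin c (vec x) = lin d (vec x) → c = d := by
    intro c hc d hd he
    refine Nat.xor_eq_zero_iff.mp (hi _ (Nat.xor_lt_two_pow (n := 4) hc hd) ?_)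
    rw [lin_xor add_self, he, add_self]
  have he : lin a (vec x) * lin b (vec x) = lin c (vec x) * lin d (vec x) := by
    linear_combination h0 - (lin c (vec x) * lin d (vec x)) * two_eq_zero K
  rcases C.eq_or_eq_of_mul_eq h1 h2 h3 (hm a) (hm b) (hm c) (hm d) (hne a ha ha0) (hne b hb hb0) he
    with ⟨h5, h6⟩ | ⟨h5, h6⟩
  · exact h ⟨heq _ ha _ hc h5, heq _ hb _ hd h6⟩
  · exact h' ⟨heq _ ha _ hd h5, heq _ hb _ hc h6⟩

end Cox

end Indecomposable

section QuadricPoint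

/-- The values of the quadratic monomials at a point over the field with sixteen elements. -/
def quadsSixteen (b : Fin 4 → ℕ) : List ℕ :=
  [mulSixteen (b 0) (b 0), mulSixteen (b 1) (b 1), mulSixteen (b 2) (b 2), mulSixteen (b 3) (b 3),
    mulSixteen (b 0) (b 1), mulSixteen (b 0) (b 2), mulSixteen (b 0) (b 3), mulSixteen (b 1) (b 2),
    mulSixteen (b 1) (b 3), mulSixteen (b 2) (b 3)]

/-- A point over the field with sixteen elements. -/
def pointSixteen : Fin 4 → ℕ := ![1, 15, 2, 4]

/-- Differences of products of linear forms that vanish at the point. -/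
def splitQuads : List (ℕ × ℕ × ℕ × ℕ) :=
  [(1, 2, 7, 7), (1, 4, 9, 9), (1, 6, 14, 14), (1, 8, 4, 4), (1, 9, 2, 3), (1, 1, 12, 13), (1,
   4, 10, 11), (2, 4, 14, 14), (2, 5, 9, 9), (3, 3, 4, 7), (1, 1, 3, 5), (2, 5, 10, 11), (3, 5,
   12, 13), (1, 8, 3, 7), (1, 8, 5, 6), (2, 2, 8, 10), (2, 4, 13, 15), (1, 5, 2, 10), (2, 9, 4,
   5), (3, 6, 13, 14), (1, 1, 9, 10), (3, 9, 6, 7), (1, 5, 3, 9), (2, 8, 4, 6), (1, 1, 2, 15),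
   (1, 5, 12, 14), (3, 6, 8, 10), (1, 4, 3, 12), (3, 5, 9, 10), (2, 2, 13, 14), (3, 3, 8, 12),
   (2, 2, 4, 9), (1, 3, 4, 13), (5, 7, 10, 15), (1, 2, 8, 13), (2, 2, 5, 12), (1, 2, 5, 9), (1,
   1, 4, 14), (2, 3, 4, 10), (4, 7, 8, 12), (1, 2, 11, 15), (1, 3, 5, 10), (3, 3, 5, 15), (2,
   3, 11, 14), (5, 5, 11, 14), (1, 1, 6, 8), (1, 2, 6, 14), (1, 3, 9, 15), (6, 6, 9, 15), (2,
   2, 7, 15), (2, 3, 7, 8), (4, 5, 8, 15), (3, 3, 9, 14), (6, 7, 11, 13), (1, 2, 10, 12), (2,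
   3, 6, 13), (3, 3, 6, 11), (4, 4, 10, 13), (1, 1, 7, 11), (1, 3, 7, 12)]

theorem splitQuads_spec : ∀ w ∈ splitQuads, w.1 < 16 ∧ w.2.1 < 16 ∧ w.2.2.1 < 16 ∧ w.2.2.2 < 16 ∧
    0 < w.1 ∧ 0 < w.2.1 ∧ ¬ (w.1 = w.2.2.1 ∧ w.2.1 = w.2.2.2) ∧
    ¬ (w.1 = w.2.2.2 ∧ w.2.1 = w.2.2.1) := by
  decide +kernel

theorem eq_of_comb_quadsSixteen : ∀ c < 1024, comb c (quadsSixteen pointSixteen) = 0 →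
    (c = 0 ∨ c = 540 ∨ c = 471 ∨ c = 971) ∨
    c ∈ splitQuads.map fun w => qmul w.1 w.2.1 ^^^ qmul w.2.2.1 w.2.2.2 := by
  decide +kernel

variable {K : Type} [Field K] [Algebra (ZMod 2) K] {V : ℤ → Submodule (ZMod 2) K}

/-- Coordinates that map to a multiple of a given point of degree four. -/
structure PointQuad (V : ℤ → Submodule (ZMod 2) K) (x : Fin 4 → K) (b : Fin 4 → ℕ) (u : K)
    (κ : Type) [Field κ] (ev : ℤ → K → κ) (ζ l : κ) : Prop where
  isEv : Ev V 4 u κ ev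
  two : (2 : κ) = 0
  root : pe ζ 19 = 0
  ne : ∀ p, 0 < p → p < 16 → pe ζ p ≠ 0
  lt : ∀ i, b i < 16
  l_ne : l ≠ 0
  eq : ∀ i, ev 6 (x i) = l * pe ζ (b i)

section PointQuad

variable {x : Fin 4 → K} {b : Fin 4 → ℕ} {u : K} {κ : Type} [Field κ] {ev : ℤ → K → κ} {ζ l : κ}

theorem PointQuad.lin (P : PointQuad V x b u κ ev ζ l) (hx : ∀ i, x i ∈ V 6) (c : ℕ) :
    ev 6 (lin c (vec x)) = l * pe ζ (comb c (vec b)) := by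
  rw [P.isEv.lin 6 _ _ (mem_vec hx)]
  have h5 : (vec x).map (ev 6) = ((vec b).map (pe ζ)).map (l * ·) := by
    simp only [vec, List.map_cons, List.map_nil, P.eq]
  rw [h5, lin_smul, pe_comb ζ P.two]

end PointQuad

namespace Cox

variable (C : Cox V)
include C

theorem comb_quads_eq_zero {x : Fin 4 → K} {b : Fin 4 → ℕ} {u : K} {κ : Type} [Field κ]
    {ev : ℤ → K → κ} {ζ l : κ} (P : PointQuad V x b u κ ev ζ l) (hx : ∀ i, x i ∈ V 6) {c : ℕ}
    (h0 : lin c (quads x) = 0) : comb c (quadsSixteen b) = 0 := by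
  have h1 := congrArg (ev 12) h0
  rw [P.isEv.zero, P.isEv.lin 12 _ _ (C.quads_mem hx), P.isEv.quads hx] at h1
  have hp := fun i j => pe_mulSixteen P.two P.root (P.lt i) (P.lt j)
  have h5 : (quads fun i => ev 6 (x i)) = ((quadsSixteen b).map (pe ζ)).map (l ^ 2 * ·) := by
    simp only [quads, quadsSixteen, List.map_cons, List.map_nil, P.eq, (hp _ _).2]
    ring_nf
  rw [h5, lin_smul, ← pe_comb ζ P.two] at h1
  have h2 := (mul_eq_zero.mp h1).resolve_left (pow_ne_zero 2 P.l_ne)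
  by_contra hne
  refine P.ne _ (Nat.pos_of_ne_zero hne) (comb_lt (k := 4) _ _ ?_) h2
  simp only [quadsSixteen, List.mem_cons, List.not_mem_nil, or_false]
  rintro _ (rfl | rfl | rfl | rfl | rfl | rfl | rfl | rfl | rfl | rfl) <;> exact (hp _ _).1

theorem exists_pointQuad (h1 : len V 1 = 0) (h2 : len V 2 = 0) :
    ∃ (x : Fin 4 → K) (u : K) (κ : Type) (_ : Field κ) (ev : ℤ → K → κ) (ζ : κ),
      (∀ i, x i ∈ V 6) ∧ PointQuad V x pointSixteen u κ ev ζ 1 := by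
  obtain ⟨u, hu, hu0⟩ := C.exists_ne_zero (n := 4) (by rw [C.len_four]; omega)
  obtain ⟨κ, _, ev, hcard, E, t2⟩ := C.exists_point (C.irr_four h1 h2 hu hu0)
  obtain ⟨ζ, hζ, hne⟩ := exists_primitive t2 (by simpa using hcard)
  have hfin : Finite κ := Nat.finite_of_card_ne_zero (by rw [hcard]; simp)
  have hinj : Function.Injective fun v : (V 6 : Set K) => ev 6 v := by
    rintro ⟨v, hv⟩ ⟨w, hw⟩ he
    obtain ⟨k, hk, h0⟩ := E.eq_zero_of_add hv hw he t2
    norm_num at hk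
    rw [C.eq_zero h2 hk, mul_zero] at h0
    have : v = w := by linear_combination h0 - w * two_eq_zero K
    simpa using this
  have hsurj := (hinj.bijective_of_nat_card_le (by
    rw [Nat.card_coe_set_eq, C.ncard_eq, C.len_six, hcard]; rfl)).2
  choose y hy using fun i => hsurj (pe ζ (pointSixteen i))
  exact ⟨fun i => y i, u, κ, _, ev, ζ, fun i => (y i).2,
    ⟨E, t2, hζ, hne, by decide, one_ne_zero, fun i => by rw [one_mul]; exact hy i⟩⟩

omit C in
theorem indep_of_pointQuad {x : Fin 4 → K} (hx : ∀ i, x i ∈ V 6) {u : K} {κ : Type} [Field κ]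
    {ev : ℤ → K → κ} {ζ l : κ} (P : PointQuad V x pointSixteen u κ ev ζ l) : Indep (vec x) := by
  intro c hc h0
  have h1 := P.lin hx c
  rw [h0, P.isEv.zero] at h1
  obtain ⟨h5, h6⟩ := (show ∀ c < 16, comb c (vec pointSixteen) < 16 ∧
    (comb c (vec pointSixteen) = 0 → c = 0) by decide +kernel) c hc
  refine h6 ?_
  by_contra hne
  exact mul_ne_zero P.l_ne (P.ne _ (Nat.pos_of_ne_zero hne) h5) h1.symm

theorem code_of_pointQuad (h1 : len V 1 = 0) (h2 : len V 2 = 0) (h3 : len V 3 ≤ 1)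
    {x : Fin 4 → K} (hx : ∀ i, x i ∈ V 6) {u : K} {κ : Type} [Field κ]
    {ev : ℤ → K → κ} {ζ l : κ} (P : PointQuad V x pointSixteen u κ ev ζ l) {c : ℕ}
    (hc : c < 1024) (h0 : lin c (quads x) = 0) : c = 0 ∨ c = 540 ∨ c = 471 ∨ c = 971 := by
  refine (eq_of_comb_quadsSixteen c hc (C.comb_quads_eq_zero P hx h0)).resolve_right fun h => ?_
  simp only [List.mem_map] at h
  obtain ⟨w, hw, rfl⟩ := h
  obtain ⟨a1, a2, a3, a4, a5, a6, a7, a8⟩ := splitQuads_spec w hw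
  exact C.lin_ne_zero_of_split h1 h2 h3 hx (indep_of_pointQuad hx P) a1 a2 a3 a4 a5 a6 a7 a8 h0

omit C in
theorem pointQuad_sub {x : Fin 4 → K} (hx : ∀ i, x i ∈ V 6) {u : K} {κ : Type} [Field κ]
    {ev : ℤ → K → κ} {ζ l : κ} {b : Fin 4 → ℕ} (P : PointQuad V x b u κ ev ζ l)
    {g : Fin 4 → ℕ} {m : ℕ} (hm : m < 16) (hm0 : 0 < m) {b' : Fin 4 → ℕ} (hb' : ∀ i, b' i < 16)
    (hg : ∀ i, comb (g i) (vec b) = mulSixteen m (b' i)) :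
    PointQuad V (sub g x) b' u κ ev ζ (l * pe ζ m) :=
  ⟨P.isEv, P.two, P.root, P.ne, hb', mul_ne_zero P.l_ne (P.ne m hm0 hm), fun i => by
    change ev 6 (lin (g i) (vec x)) = _
    rw [P.lin hx, hg, (pe_mulSixteen P.two P.root hm (hb' i)).2, mul_assoc]⟩

/-- The canonical model lies on an elliptic quadric. -/
theorem exists_preBasis (h1 : len V 1 = 0) (h2 : len V 2 = 0) (h3 : len V 3 ≤ 1) :
    ∃ (x : Fin 4 → K) (u : K) (κ : Type) (_ : Field κ) (ev : ℤ → K → κ) (ζ l : κ),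
      PreBasis V 540 x ∧ PointQuad V x pointSixteen u κ ev ζ l := by
  obtain ⟨x, u, κ, _, ev, ζ, hx, P⟩ := C.exists_pointQuad h1 h2
  obtain ⟨c, hc0, hc, hc1⟩ := C.exists_dep (quads x) (C.quads_mem hx) (by
    have := C.len_large (n := 12) (by norm_num)
    simp [quads]; omega)
  have hi := indep_of_pointQuad hx P
  rcases C.code_of_pointQuad h1 h2 h3 hx P (by simpa [quads] using hc) hc1 with rfl | rfl | rfl | rfl
  · omega
  · exact ⟨x, u, κ, _, ev, ζ, 1, ⟨hx, hi, hc1⟩, P⟩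
  · have hB : PreBasis V 471 x := ⟨hx, hi, hc1⟩
    have ho : isOrth 471 540 ![3, 9, 2, 6] = true := by decide +kernel
    exact ⟨_, u, κ, _, ev, ζ, _, hB.sub ho,
      pointQuad_sub hx P (m := 14) (by norm_num) (by norm_num) P.lt (by decide +kernel)⟩
  · have hB : PreBasis V 971 x := ⟨hx, hi, hc1⟩
    have ho : isOrth 971 540 ![6, 13, 14, 1] = true := by decide +kernel
    exact ⟨_, u, κ, _, ev, ζ, _, hB.sub ho,
      pointQuad_sub hx P (m := 13) (by norm_num) (by norm_num) P.lt (by decide +kernel)⟩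

/-- A quadric through a prime plane section meets it in a form that is not of degree four. -/
theorem plane_quartic {x : Fin 4 → K} (hx : PreBasis V 540 x) (h : Irr V 6 (x 2)) {c : ℕ}
    (h0 : lin c (quads x) = 0) (p : ℕ)
    (hp : comb c [1, 16, 0, 4, 4, 0, 2, 0, 8, 0] = p) (hp' : p = 25 ∨ p = 31) : False := by
  obtain ⟨κ, _, ev, τ, μ, hcard, E, t2, hμ, hev, hne⟩ := C.plane_low hx h
  have h1 := congrArg (ev 12) h0
  rw [E.zero, E.lin 12 _ _ (C.quads_mem hx.mem), E.quads hx.mem] at h1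
  have h5 : (quads fun i => ev 6 (x i)) =
      (([1, 16, 0, 4, 4, 0, 2, 0, 8, 0] : List ℕ).map (pe τ)).map (μ ^ 2 * ·) := by
    simp only [quads, hev, List.map_cons, List.map_nil]
    have e4 : pe τ 4 = τ ^ 2 := by simp [pe_eq τ 4, pe_eq τ 2, sq]
    have e2 : pe τ 2 = τ := by simp [pe_eq τ 2]
    have e8 : pe τ 8 = τ ^ 3 := by rw [pe_eq τ 8]; norm_num [e4]; ring
    have e16 : pe τ 16 = τ ^ 4 := by rw [pe_eq τ 16]; norm_num [e8]; ring
    simp [e4, e2, e8, e16]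
    ring_nf
    simp
  rw [h5, lin_smul, ← pe_comb τ t2, hp] at h1
  have h2 := (mul_eq_zero.mp h1).resolve_left (pow_ne_zero 2 hμ)
  have h15 : pe τ 32769 = 0 := by
    rcases hp' with rfl | rfl
    · rw [show 32769 = clmul 12 3929 25 by decide +kernel, pe_clmul τ t2 12 _ _ (by norm_num), h2,
        mul_zero]
    · rw [show 32769 = clmul 12 3171 31 by decide +kernel, pe_clmul τ t2 12 _ _ (by norm_num), h2,
        mul_zero]
  have ht : τ ^ 15 = 1 := by
    simp only [pe_eq τ 32769, pe_eq τ 16384, pe_eq τ 8192, pe_eq τ 4096, pe_eq τ 2048,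
      pe_eq τ 1024, pe_eq τ 512, pe_eq τ 256, pe_eq τ 128, pe_eq τ 64, pe_eq τ 32, pe_eq τ 16,
      pe_eq τ 8, pe_eq τ 4, pe_eq τ 2] at h15
    norm_num at h15
    linear_combination h15 - t2
  have hfin : Finite κ := Nat.finite_of_card_ne_zero (by rw [hcard]; norm_num)
  have hτ0 : τ ≠ 0 := by simpa [pe_eq τ 2] using hne 2 (by norm_num) (by norm_num)
  have ht63 : τ ^ 63 = 1 := by
    have := pow_card_eq_one' (x := Units.mk0 τ hτ0)
    rw [Nat.card_units, hcard] at this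
    simpa using congrArg Units.val this
  have ht3 : τ ^ 3 = 1 := by
    calc τ ^ 3 = (τ ^ 15) ^ 4 * τ ^ 3 := by rw [ht]; ring
      _ = 1 := by rw [← ht63]; ring
  have h9 := pe_clmul τ t2 2 3 7 (by norm_num)
  rw [show clmul 2 3 7 = 9 from rfl] at h9
  refine mul_ne_zero (hne 3 (by norm_num) (by norm_num)) (hne 7 (by norm_num) (by norm_num))
    (h9.symm.trans ?_)
  simp only [pe_eq τ 9, pe_eq τ 4, pe_eq τ 2]
  norm_num
  linear_combination ht3 + t2

/-- The canonical model lies on a unique quadric. -/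
theorem exists_qBasis (h1 : len V 1 = 0) (h2 : len V 2 = 0) (h3 : len V 3 ≤ 1) :
    ∃ (x : Fin 4 → K) (u : K) (κ : Type) (_ : Field κ) (ev : ℤ → K → κ) (ζ l : κ),
      QBasis V 540 x ∧ PointQuad V x pointSixteen u κ ev ζ l := by
  obtain ⟨x, u, κ, _, ev, ζ, l, hx, P⟩ := C.exists_preBasis h1 h2 h3
  refine ⟨x, u, κ, _, ev, ζ, l, ⟨hx, fun c hc h0 => ?_⟩, P⟩
  rcases C.code_of_pointQuad h1 h2 h3 hx.mem P hc h0 with h | h | h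
  · exact Or.inl h
  · exact Or.inr h
  · exfalso
    have hne : ∀ c < 16, 0 < c → lin c (vec x) ≠ 0 := fun c hc h0 he => h0.ne' (hx.indep c hc he)
    by_cases hi : Irr V 6 (x 2)
    · refine C.plane_quartic hx hi h0 31 ?_ (Or.inr rfl)
      rcases h with rfl | rfl <;> decide +kernel
    · have hi3 : Irr V 6 (x 3) := by
        by_contra hi3
        have h23 := C.eq_of_not_irr h1 h2 h3 (hx.mem 2) (hx.mem 3)
          (by simpa [vec, lin_cons] using hne 4 (by norm_num) (by norm_num))
          (by simpa [vec, lin_cons] using hne 8 (by norm_num) (by norm_num)) hi hi3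
        refine hne 12 (by norm_num) (by norm_num) ?_
        simp [vec, lin_cons, h23, add_self]
      have hx' := hx.sub (r' := 540) (g := ![1, 2, 8, 4]) (by decide +kernel)
      have hxx : sub ![1, 2, 8, 4] (sub ![1, 2, 8, 4] x) = x := by
        funext i
        rw [sub, lin_sub add_self]
        fin_cases i <;> simp [comb, vec, lin_cons]
      rw [← hxx, lin_quads_sub add_self] at h0
      refine C.plane_quartic hx' ?_ h0 25 ?_ (Or.inl rfl)
      · simpa [sub, vec, lin_cons] using hi3
      · rcases h with rfl | rfl <;> decide +kernel

end Cox

end QuadricPoint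

section CubicSearch

/-- Two different entries of a list of numbers have a property. -/
def twoOf (f : ℕ → Bool) : List ℕ → Bool
  | [] => false
  | a :: l => f a && l.any f || twoOf f l

theorem exists_of_twoOf {f : ℕ → Bool} {l : List ℕ} (hl : l.Nodup) (h : twoOf f l = true) :
    ∃ a ∈ l, ∃ b ∈ l, a ≠ b ∧ f a = true ∧ f b = true := by
  induction l with
  | nil => simp [twoOf] at h
  | cons a l ih =>
    rw [List.nodup_cons] at hl
    simp only [twoOf, Bool.or_eq_true, Bool.and_eq_true, List.any_eq_true] at h
    rcases h with ⟨ha, b, hb, hfb⟩ | h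
    · exact ⟨a, by simp, b, by simp [hb], fun he => hl.1 (he ▸ hb), ha, hfb⟩
    · obtain ⟨b, hb, c, hc, h⟩ := ih hl.2 h
      exact ⟨b, by simp [hb], c, by simp [hc], h⟩

/-- The plane sections with a factorization. -/
def badPlanes (s : ℕ) (l : List ℕ) : Bool := twoOf (fun i => !isGood (digits (20 + 7 * i) 7 s)) l

/-- Representatives of cubic monomials modulo the quadric. -/
def cubicBasis : List (Fin 4 × Fin 4 × Fin 4) :=
  [(0, 0, 0), (0, 0, 3), (0, 3, 3), (3, 3, 3), (1, 3, 3), (1, 1, 3), (1, 1, 1), (2, 0, 0),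
    (2, 1, 1), (2, 0, 2), (2, 0, 3), (2, 1, 2), (2, 1, 3), (2, 2, 2), (2, 2, 3), (2, 3, 3)]

/-- Values of the cubic monomials at the point of degree four and on the plane sections. -/
def cubicValues : List ℕ :=
  [1042975376643372617290547201, 212680050286549799364984834, 75900258054019130826358788,
    18809225681131323658076168, 72901609462220007363706896, 210880967722103253689565216,
    1041326379899146633223077952, 633431688208215066219249792, 632532215314907398731661568,
    1152947497046820278780559872, 265228191817907414508241920, 1152197876350449532036253696,
    263728896014312557808521216, 823211817169153225474449408, 166698393764441412996382720,
    52925961102073862270910464]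

/-- The codes of the possible cubic relations. -/
def cubicCodes : List ℕ := [10081, 12355, 19181, 33755]

theorem cubicValues_spec : cubicValues.map (digits 0 16) = (List.range 16).map (2 ^ ·) ∧
    cubicValues.map (digits 16 4) = cubicBasis.map (fun m => mulSixteen (pointSixteen m.1)
      (mulSixteen (pointSixteen m.2.1) (pointSixteen m.2.2))) ∧
    ∀ i, (h : i < planes.length) → cubicValues.map (digits (20 + 7 * i) 7) =
      cubicBasis.map (sextic (par planes[i].2)) := by
  decide +kernel

theorem cubic_search : allComb (fun s => !decide (digits 16 4 s = 0) ||
    (0 :: cubicCodes).any (fun c => decide (digits 0 16 s = c)) ||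
    badPlanes s (List.range 10)) cubicValues 0 = true := by
  decide +kernel

variable {K : Type} [Field K] [Algebra (ZMod 2) K] {V : ℤ → Submodule (ZMod 2) K}

namespace Cox

variable (C : Cox V)
include C

theorem comb_cubics_eq_zero {x : Fin 4 → K} {b : Fin 4 → ℕ} {u : K} {κ : Type} [Field κ]
    {ev : ℤ → K → κ} {ζ l : κ} (P : PointQuad V x b u κ ev ζ l) (hx : ∀ i, x i ∈ V 6) {c : ℕ}
    (ms : List (Fin 4 × Fin 4 × Fin 4)) (h0 : lin c (cubics x ms) = 0) :
    comb c (ms.map fun m => mulSixteen (b m.1) (mulSixteen (b m.2.1) (b m.2.2))) = 0 := by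
  have h1 := congrArg (ev 18) h0
  rw [P.isEv.zero, P.isEv.lin 18 _ _ (C.cubics_mem hx ms)] at h1
  have hp := fun i j => pe_mulSixteen P.two P.root (P.lt i) (P.lt j)
  have hp' := fun i j k => pe_mulSixteen P.two P.root (P.lt i) (hp j k).1
  have h5 : (cubics x ms).map (ev 18) = ((ms.map fun m =>
      mulSixteen (b m.1) (mulSixteen (b m.2.1) (b m.2.2))).map (pe ζ)).map (l ^ 3 * ·) := by
    simp only [cubics, List.map_map]
    refine List.map_congr_left fun m _ => ?_
    simp only [Function.comp]
    rw [P.isEv.mul' (C.mul' (hx _) (hx _) (show (6 : ℤ) + 6 = 12 by norm_num)) (hx _)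
      (by norm_num), P.isEv.mul' (hx _) (hx _) (by norm_num), P.eq, P.eq, P.eq, (hp' _ _ _).2,
      (hp _ _).2]
    ring
  rw [h5, lin_smul, ← pe_comb ζ P.two] at h1
  have h2 := (mul_eq_zero.mp h1).resolve_left (pow_ne_zero 3 P.l_ne)
  by_contra hne
  refine P.ne _ (Nat.pos_of_ne_zero hne) (comb_lt (k := 4) _ _ ?_) h2
  simp only [List.mem_map]
  rintro _ ⟨m, -, rfl⟩
  exact (hp' _ _ _).1

omit C in
theorem lin_inj {vs : List K} (hi : Indep vs) {c d : ℕ} (hc : c < 2 ^ vs.length)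
    (hd : d < 2 ^ vs.length) (h : lin c vs = lin d vs) : c = d := by
  refine Nat.xor_eq_zero_iff.mp (hi _ (Nat.xor_lt_two_pow hc hd) ?_)
  rw [lin_xor add_self, h, add_self]

theorem code_eq_of_not_irr (h1 : len V 1 = 0) (h2 : len V 2 = 0) (h3 : len V 3 ≤ 1)
    {x : Fin 4 → K} (hx : PreBasis V 540 x) {c d : ℕ} (hc : c < 16) (hd : d < 16) (hc0 : 0 < c)
    (hd0 : 0 < d) (hci : ¬ Irr V 6 (lin c (vec x))) (hdi : ¬ Irr V 6 (lin d (vec x))) :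
    c = d :=
  lin_inj hx.indep hc hd (C.eq_of_not_irr h1 h2 h3 (lin_mem (V 6) _ _ (mem_vec hx.mem))
    (lin_mem (V 6) _ _ (mem_vec hx.mem)) (fun h => hc0.ne' (hx.indep c hc h))
    (fun h => hd0.ne' (hx.indep d hd h)) hci hdi)

/-- The canonical model lies on one of four cubics. -/
theorem exists_cubic (h1 : len V 1 = 0) (h2 : len V 2 = 0) (h3 : len V 3 ≤ 1) :
    ∃ x : Fin 4 → K, QBasis V 540 x ∧ ∃ c ∈ cubicCodes, lin c (cubics x cubicBasis) = 0 := by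
  obtain ⟨x, u, κ, _, ev, ζ, l, hx, P⟩ := C.exists_qBasis h1 h2 h3
  refine ⟨x, hx, ?_⟩
  obtain ⟨c, hc0, hc, h0⟩ := C.exists_dep (cubics x cubicBasis) (C.cubics_mem hx.mem _) (by
    have := C.len_large (n := 18) (by norm_num)
    simp [cubics, cubicBasis]; omega)
  have hc16 : c < 2 ^ 16 := by simpa [cubics, cubicBasis] using hc
  obtain ⟨s1, s2, s3⟩ := cubicValues_spec
  have hs := allComb_spec cubic_search c
  rw [Nat.zero_xor, digits_comb, s2, C.comb_cubics_eq_zero P hx.mem _ h0, digits_comb, s1,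
    comb_two_pow 16 c hc16] at hs
  simp only [decide_true, Bool.not_true, Bool.false_or, Bool.or_eq_true, List.any_eq_true,
    decide_eq_true_eq] at hs
  rcases hs with ⟨d, hd, rfl⟩ | hs
  · rw [List.mem_cons] at hd
    exact ⟨c, hd.resolve_left hc0.ne', h0⟩
  · exfalso
    obtain ⟨i, hi, j, hj, hij, hbi, hbj⟩ := exists_of_twoOf List.nodup_range hs
    have hlen : planes.length = 10 := rfl
    rw [List.mem_range, ← hlen] at hi hj
    have key : ∀ i, (h : i < planes.length) →
        (!isGood (digits (20 + 7 * i) 7 (comb c cubicValues))) = true →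
        ¬ Irr V 6 (lin (planes[i].1 2) (vec x)) := by
      intro i hi hb hirr
      have := C.isGood_of_irr hx (List.getElem_mem hi) hirr cubicBasis c h0
      rw [digits_comb, s3 i hi, this] at hb
      simp at hb
    obtain ⟨t1, t2⟩ := (show ∀ i, (h : i < planes.length) → planes[i].1 2 < 16 ∧
      0 < planes[i].1 2 by decide +kernel) i hi
    obtain ⟨t3, t4⟩ := (show ∀ i, (h : i < planes.length) → planes[i].1 2 < 16 ∧
      0 < planes[i].1 2 by decide +kernel) j hj
    exact hij ((show ∀ i, (h : i < planes.length) → ∀ j, (h' : j < planes.length) →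
      planes[i].1 2 = planes[j].1 2 → i = j by decide +kernel) i hi j hj
      (C.code_eq_of_not_irr h1 h2 h3 hx.toPreBasis t1 t3 t2 t4 (key i hi hbi) (key j hj hbj)))

end Cox

end CubicSearch

section PlaneModel

theorem map_lin {M N F : Type*} [AddCommMonoid M] [AddCommMonoid N] [FunLike F M N]
    [AddMonoidHomClass F M N] (f : F) (c : ℕ) (vs : List M) : f (lin c vs) = lin c (vs.map f) := by
  induction vs generalizing c with
  | nil => simp
  | cons v vs ih => simp [lin_cons, ih]

/-- The points of the elliptic quadric in affine coordinates. -/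
def quadricPoint {R : Type*} [CommRing R] (a b : R) : Fin 4 → R :=
  ![1, a * a + a * b + b * b, a, b]

/-- The equation of the curve in affine coordinates. -/
def curve {R : Type*} [CommRing R] (a b : R) (c : ℕ) : R :=
  lin c (cubics (quadricPoint a b) cubicBasis)

theorem map_curve {R S : Type*} [CommRing R] [CommRing S] (f : R →+* S) (a b : R) (c : ℕ) :
    f (curve a b c) = curve (f a) (f b) c := by
  rw [curve, map_lin, curve]
  congr 1
  simp only [cubics, List.map_map]
  refine List.map_congr_left fun m _ => ?_
  have h : ∀ i, f (quadricPoint a b i) = quadricPoint (f a) (f b) i := by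
    intro i
    fin_cases i <;> simp [quadricPoint]
  simp [h]

theorem curve_monic {c : ℕ} (hc : c ∈ cubicCodes) :
    (curve (C X) X c : (ZMod 2)[X][X]).Monic ∧
      (curve (C X) X c : (ZMod 2)[X][X]).natDegree = 6 := by
  set a : (ZMod 2)[X][X] := C X with ha
  set q := a * a + a * X + X * X with hq
  have hqd : q = X ^ 2 + (C X * X + C (X * X)) := by rw [hq, ha, map_mul]; ring
  have hlow : (C X * X + C (X * X) : (ZMod 2)[X][X]).degree < 2 := by
    refine lt_of_le_of_lt (degree_linear_le) ?_
    decide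
  have hqm : q.Monic := by
    rw [hqd]; exact monic_X_pow_add (n := 2) (by exact_mod_cast hlow)
  have hqn : q.natDegree = 2 := by
    rw [hqd, natDegree_add_eq_left_of_degree_lt (by rw [degree_X_pow]; exact_mod_cast hlow),
      natDegree_X_pow]
  have hm3 : (q ^ 3).Monic := hqm.pow 3
  have hn3 : (q ^ 3).natDegree = 6 := by rw [hqm.natDegree_pow, hqn]
  have hrest : curve a X c = q ^ 3 + lin (c ^^^ 64) (cubics (quadricPoint a X) cubicBasis) := by
    have h2 : (2 : (ZMod 2)[X][X]) = 0 := by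
      exact_mod_cast CharP.cast_eq_zero ((ZMod 2)[X][X]) 2
    have hadd : ∀ m : (ZMod 2)[X][X], m + m = 0 := fun m => by rw [← two_mul, h2, zero_mul]
    rw [lin_xor hadd]
    have : lin 64 (cubics (quadricPoint a X) cubicBasis) = q ^ 3 := by
      simp [cubics, cubicBasis, quadricPoint, lin_cons]
      rw [← hq]; ring
    rw [this, curve]
    linear_combination -(q ^ 3) * h2
  have hd : (lin (c ^^^ 64) (cubics (quadricPoint a X) cubicBasis)).degree < (q ^ 3).degree := by
    rw [degree_eq_natDegree hm3.ne_zero, hn3, ← mem_degreeLT]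
    have hb : lin (c ^^^ 64) (cubics (quadricPoint a X) cubicBasis) =
        lin (c ^^^ 64) ((cubics (quadricPoint a X) cubicBasis).set 6 0) := by
      simp only [cubicCodes, List.mem_cons, List.not_mem_nil, or_false] at hc
      rcases hc with rfl | rfl | rfl | rfl <;> simp [cubics, cubicBasis, lin_cons]
    rw [hb]
    refine lin_mem _ _ _ ?_
    have hN : q.natDegree ≤ 2 := hqn.le
    have ha0 : a.natDegree = 0 := by simp [ha]
    have hX : (X : (ZMod 2)[X][X]).natDegree ≤ 1 := natDegree_X_le
    have hmul : ∀ (p r : (ZMod 2)[X][X]) (i j : ℕ), p.natDegree ≤ i → r.natDegree ≤ j →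
        (p * r).natDegree ≤ i + j := fun p r i j h h' => natDegree_mul_le_of_le h h'
    have key : ∀ p r s : (ZMod 2)[X][X], ∀ i j k : ℕ, p.natDegree ≤ i → r.natDegree ≤ j →
        s.natDegree ≤ k → i + j + k < 6 → p * r * s ∈ degreeLT ((ZMod 2)[X]) 6 := by
      intro p r s i j k h1 h2 h3 h4
      rw [mem_degreeLT]
      refine lt_of_le_of_lt degree_le_natDegree ?_
      have := hmul _ _ _ _ (hmul _ _ _ _ h1 h2) h3
      exact_mod_cast lt_of_le_of_lt this h4
    have d : ∀ i : Fin 4, (quadricPoint a X i).natDegree ≤ ![0, 2, 0, 1] i := by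
      intro i
      fin_cases i
      · simp [quadricPoint]
      · simpa [quadricPoint] using hN
      · simp [quadricPoint, ha0]
      · simp [quadricPoint]
    intro v hv
    simp only [cubics, cubicBasis, List.map_cons, List.map_nil, List.set_cons_succ,
      List.set_cons_zero, List.mem_cons, List.not_mem_nil, or_false] at hv
    rcases hv with h | h | h | h | h | h | h | h | h | h | h | h | h | h | h | h <;> rw [h]
    all_goals first
      | exact zero_mem _
      | exact key _ _ _ _ _ _ (d _) (d _) (d _) (by decide)
  rw [hrest]
  exact ⟨hm3.add_of_left hd, by rw [natDegree_add_eq_left_of_degree_lt hd, hn3]⟩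

variable {K : Type} [Field K] [Algebra (ZMod 2) K] {V : ℤ → Submodule (ZMod 2) K}

/-- Evaluation of bivariate polynomials. -/
def evalTwo {L : Type*} [CommRing L] [Algebra (ZMod 2) L] (a b : L) : (ZMod 2)[X][X] →+* L :=
  eval₂RingHom (aeval a : (ZMod 2)[X] →ₐ[ZMod 2] L).toRingHom b

theorem evalTwo_X {L : Type*} [CommRing L] [Algebra (ZMod 2) L] (a b : L) :
    evalTwo a b X = b := by simp [evalTwo]

theorem evalTwo_C {L : Type*} [CommRing L] [Algebra (ZMod 2) L] (a b : L) (p : (ZMod 2)[X]) :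
    evalTwo a b (C p) = aeval a p := by simp [evalTwo]

/-- Coordinates in which the curve is given by a cubic with known code. -/
structure Model (V : ℤ → Submodule (ZMod 2) K) (c : ℕ) (x : Fin 4 → K) : Prop
    extends QBasis V 540 x where
  cubic : lin c (cubics x cubicBasis) = 0

theorem Model.coord_ne {c : ℕ} {x : Fin 4 → K} (h : Model V c x) {d : ℕ} (hd : d < 16)
    (hd0 : 0 < d) : lin d (vec x) ≠ 0 := fun h0 => hd0.ne' (h.indep d hd h0)

theorem Model.x_ne {c : ℕ} {x : Fin 4 → K} (h : Model V c x) : x 0 ≠ 0 := by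
  simpa [vec, lin_cons] using h.coord_ne (d := 1) (by norm_num) (by norm_num)

theorem Model.quadricPoint_eq {c : ℕ} {x : Fin 4 → K} (h : Model V c x) (i : Fin 4) :
    quadricPoint (x 2 / x 0) (x 3 / x 0) i = x i / x 0 := by
  have h0 := h.x_ne
  fin_cases i
  · simp [quadricPoint, h0]
  · have h1 := h.rel
    rw [lin_540] at h1
    simp only [quadricPoint, Fin.mk_one, Matrix.cons_val_one, Matrix.cons_val_zero]
    field_simp
    linear_combination h1 - x 0 * x 1 * two_eq_zero K
  · simp [quadricPoint]
  · simp [quadricPoint]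

theorem Model.curve_eq_zero {c : ℕ} {x : Fin 4 → K} (h : Model V c x) :
    curve (x 2 / x 0) (x 3 / x 0) c = 0 := by
  have h1 : cubics (quadricPoint (x 2 / x 0) (x 3 / x 0)) cubicBasis =
      (cubics x cubicBasis).map (· * (x 0 ^ 3)⁻¹) := by
    simp only [cubics, List.map_map]
    refine List.map_congr_left fun m _ => ?_
    simp only [Function.comp, h.quadricPoint_eq]
    field_simp
  rw [curve, h1, ← lin_mul, h.cubic, zero_mul]

theorem pe_eq_zero_of_natDegree {κ : Type} [Field κ] [Algebra (ZMod 2) κ] {τ : κ}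
    (hτ : ∀ p, 0 < p → p < 64 → pe τ p ≠ 0) {q : (ZMod 2)[X]} (hq : q.natDegree < 6)
    (h0 : aeval τ q = 0) : q = 0 := by
  have hz : ∀ a : ZMod 2, ((a.val : ℕ) : κ) = algebraMap (ZMod 2) κ a := by
    intro a
    by_cases ha : a = 0
    · simp [ha]
    · rw [zmod2_eq_one ha, map_one, ZMod.val_one, Nat.cast_one]
  set n := ∑ i ∈ Finset.range 6, (q.coeff i).val * 2 ^ i with hn
  have hv : ∀ i, (q.coeff i).val < 2 := fun i => ZMod.val_lt _
  have hn' : n = (q.coeff 0).val + 2 * ((q.coeff 1).val + 2 * ((q.coeff 2).val +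
      2 * ((q.coeff 3).val + 2 * ((q.coeff 4).val + 2 * (q.coeff 5).val)))) := by
    rw [hn]; simp only [Finset.sum_range_succ, Finset.sum_range_zero]; ring
  have h1 := hv 0
  have h2 := hv 1
  have h3 := hv 2
  have h4 := hv 3
  have h5 := hv 4
  have h6 := hv 5
  have step : ∀ a m, a < 2 → pe τ (a + 2 * m) = (a : ℕ) + τ * pe τ m := by
    intro a m ha
    rw [pe_eq τ (a + 2 * m)]
    congr 2
    · omega
    · congr 1; omega
  have h7 : pe τ n = aeval τ q := by
    have h8 : pe τ (q.coeff 5).val = ((q.coeff 5).val : κ) := by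
      have : (q.coeff 5).val = 0 ∨ (q.coeff 5).val = 1 := by omega
      rcases this with h | h <;> simp [h]
    rw [hn', step _ _ h1, step _ _ h2, step _ _ h3, step _ _ h4, step _ _ h5, h8,
      aeval_eq_sum_range' hq]
    simp only [hz, Finset.sum_range_succ, Finset.sum_range_zero, Algebra.smul_def]
    ring
  have hn0 : n = 0 := by
    by_contra hne
    exact hτ n (Nat.pos_of_ne_zero hne) (by omega) (h7.trans h0)
  ext i
  rw [coeff_zero]
  by_cases hi : i < 6
  · have : (q.coeff i).val = 0 := by interval_cases i <;> omega
    exact (ZMod.val_eq_zero _).mp this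
  · exact coeff_eq_zero_of_natDegree_lt (by omega)

namespace Cox

variable (Z : Cox V)
include Z

/-- Specialization of rational functions at a prime. -/
theorem exists_specialization {d m : ℤ} {f a : K} {κ : Type} [Field κ] [Algebra (ZMod 2) κ]
    {ev : ℤ → K → κ}
    (E : Ev V d f κ ev) (ha : a ∈ V m) (ha0 : a ≠ 0) (hea : ev m a ≠ 0) {y z : K} (hy : y ∈ V m)
    (hz : z ∈ V m) (p : (ZMod 2)[X][X]) (h0 : evalTwo (y / a) (z / a) p = 0) :
    evalTwo (ev m y / ev m a) (ev m z / ev m a) p = 0 := by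
  set μ := ev m a with hμ
  let Rel : K → κ → Prop := fun w v => ∃ N : ℕ, w * a ^ N ∈ V (N * m) ∧
    ev (N * m) (w * a ^ N) = v * μ ^ N
  have hpow : ∀ N : ℕ, ev (N * m) (a ^ N) = μ ^ N := by
    intro N
    induction N with
    | zero => simpa using E.one
    | succ N ih =>
      rw [pow_succ, E.mul' (Z.pow_mem' ha N rfl) ha (k := ((N + 1 : ℕ) : ℤ) * m)
        (by push_cast; ring), ih, pow_succ]
  have hup : ∀ (w : K) (v : κ) (N M : ℕ), w * a ^ N ∈ V (N * m) →
      ev (N * m) (w * a ^ N) = v * μ ^ N → w * a ^ (N + M) ∈ V ((N + M : ℕ) * m) ∧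
      ev ((N + M : ℕ) * m) (w * a ^ (N + M)) = v * μ ^ (N + M) := by
    intro w v N M h1 h2
    rw [pow_add, ← mul_assoc]
    have hk : (N : ℤ) * m + M * m = (N + M : ℕ) * m := by push_cast; ring
    exact ⟨Z.mul' h1 (Z.pow_mem' ha M rfl) hk, by
      rw [E.mul' h1 (Z.pow_mem' ha M rfl) hk, h2, hpow, pow_add, mul_assoc]⟩
  have hadd : ∀ w v w' v', Rel w v → Rel w' v' → Rel (w + w') (v + v') := by
    rintro w v w' v' ⟨N, h1, h2⟩ ⟨M, h3, h4⟩
    obtain ⟨h5, h6⟩ := hup w v N M h1 h2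
    obtain ⟨h7, h8⟩ := hup w' v' M N h3 h4
    rw [Nat.add_comm M N] at h7 h8
    exact ⟨N + M, by rw [add_mul]; exact add_mem h5 h7, by
      rw [add_mul, E.add _ _ h5 _ h7, h6, h8, add_mul]⟩
  have hmul : ∀ w v w' v', Rel w v → Rel w' v' → Rel (w * w') (v * v') := by
    rintro w v w' v' ⟨N, h1, h2⟩ ⟨M, h3, h4⟩
    have hk : (N : ℤ) * m + M * m = (N + M : ℕ) * m := by push_cast; ring
    have he : w * w' * a ^ (N + M) = (w * a ^ N) * (w' * a ^ M) := by rw [pow_add]; ring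
    exact ⟨N + M, he ▸ Z.mul' h1 h3 hk, by rw [he, E.mul' h1 h3 hk, h2, h4, pow_add]; ring⟩
  have hzero : Rel 0 0 := ⟨0, by simp, by simpa using E.zero _⟩
  have hone : Rel 1 1 := ⟨0, by simpa using Z.one_mem, by simpa using E.one⟩
  have hvar : ∀ w ∈ V m, Rel (w / a) (ev m w / μ) := by
    intro w hw
    have : w / a * a ^ 1 = w := by field_simp
    exact ⟨1, by rw [this]; simpa using hw, by rw [this]; simp; field_simp⟩
  have hconst : ∀ b : ZMod 2, Rel (algebraMap (ZMod 2) K b) (algebraMap (ZMod 2) κ b) := by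
    intro b
    by_cases hb : b = 0
    · simpa [hb] using hzero
    · simpa [zmod2_eq_one hb] using hone
  have hin : ∀ q : (ZMod 2)[X], Rel (aeval (y / a) q) (aeval (ev m y / μ) q) := by
    intro q
    induction q using Polynomial.induction_on with
    | C b => simpa using hconst b
    | add q r hq hr => simpa using hadd _ _ _ _ hq hr
    | monomial n b h =>
      have := hmul _ _ _ _ h (hvar y hy)
      simp only [map_mul, map_pow, aeval_X, aeval_C] at this ⊢
      simpa [pow_succ, mul_assoc] using this
  have hall : ∀ p, Rel (evalTwo (y / a) (z / a) p) (evalTwo (ev m y / μ) (ev m z / μ) p) := by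
    intro p
    induction p using Polynomial.induction_on with
    | C b => simpa [evalTwo_C] using hin b
    | add q r hq hr => rw [map_add, map_add]; exact hadd _ _ _ _ hq hr
    | monomial n b h =>
      rw [pow_succ, ← mul_assoc, map_mul, map_mul (evalTwo (ev m y / μ) (ev m z / μ)), evalTwo_X,
        evalTwo_X]
      exact hmul _ _ _ _ h (hvar z hz)
  obtain ⟨N, -, h2⟩ := hall p
  rw [h0, zero_mul, E.zero] at h2
  exact (mul_eq_zero.mp h2.symm).resolve_right (pow_ne_zero N hea)

end Cox

end PlaneModel

section Automorphism

variable {K : Type} [Field K] [Algebra (ZMod 2) K] {V : ℤ → Submodule (ZMod 2) K}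

namespace Cox

variable (Z : Cox V)
include Z

theorem hcoprime_of_irr {d : ℤ} {f g : K} (hf : Irr V d f) (hg0 : g ≠ 0) (hne : g ≠ f) :
    HCoprime V d f g := by
  rintro i hi u hu ⟨h, hh, he⟩ h2
  rcases lt_trichotomy i d with h3 | rfl | h3
  · exact hf.irr i hi h3 u hu h hh he
  · rw [sub_self] at hh
    have h1 : h = 1 := Z.eq_one h hh (by rintro rfl; exact hf.ne (by simpa using he))
    rw [h1, mul_one] at he
    exact hne ((Z.eq_of_hdvd hg0 h2).trans he.symm)
  · rw [Z.neg _ (by omega), Submodule.mem_bot] at hh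
    exact hf.ne (by rw [he, hh, mul_zero])

variable {c : ℕ} {x : Fin 4 → K}

theorem eq_zero_of_evalTwo (hx : Model V c x) (hp : Irr V 6 (x 2)) (p : (ZMod 2)[X][X])
    (hd : p.natDegree < 6) (h0 : evalTwo (x 2 / x 0) (x 3 / x 0) p = 0) : p = 0 := by
  by_contra hne
  have hu : ¬ IsUnit (C X : (ZMod 2)[X][X]) := by
    rw [isUnit_C]; exact not_isUnit_X
  obtain ⟨p', he, hnd⟩ :=
    (FiniteMultiplicity.of_not_isUnit hu hne).exists_eq_pow_mul_and_not_dvd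
  have hy : x 2 / x 0 ≠ 0 := div_ne_zero hp.ne hx.x_ne
  have h1 : evalTwo (x 2 / x 0) (x 3 / x 0) p' = 0 := by
    rw [he, map_mul, map_pow, evalTwo_C, aeval_X] at h0
    exact (mul_eq_zero.mp h0).resolve_left (pow_ne_zero _ hy)
  have hp' : p' ≠ 0 := by rintro rfl; exact hnd (dvd_zero _)
  have hd' : p'.natDegree < 6 := by
    have h2 : p.natDegree = (C X ^ multiplicity (C X) p : (ZMod 2)[X][X]).natDegree +
        p'.natDegree := by
      conv_lhs => rw [he]
      exact natDegree_mul (pow_ne_zero _ (by simp)) hp'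
    omega
  obtain ⟨κ, _, ev, τ, μ, E, h2, hμ, hev, hτ⟩ := Z.plane_section hx.toQBasis hp
  have : CharP κ 2 := CharTwo.of_one_ne_zero_of_two_eq_zero one_ne_zero h2
  let _ : Algebra (ZMod 2) κ := ZMod.algebra κ 2
  have e0 : ev 6 (x 0) = μ := by simpa using hev 0
  have e2 : ev 6 (x 2) = 0 := by simpa using hev 2
  have e3 : ev 6 (x 3) = μ * τ := by simpa [pe_eq τ 2] using hev 3
  have h3 := Z.exists_specialization E (hx.mem 0) hx.x_ne (by rwa [e0]) (hx.mem 2) (hx.mem 3) p' h1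
  rw [e0, e2, e3, zero_div, mul_div_cancel_left₀ _ hμ] at h3
  apply hnd
  rw [C_dvd_iff_dvd_coeff]
  have h4 : evalTwo 0 τ p' = aeval τ (p'.map (constantCoeff (R := ZMod 2))) := by
    rw [evalTwo, aeval_def, eval₂_map]
    change eval₂ _ _ _ = _
    congr 1
    ext b
    · simp
    · simp
  have h5 : p'.map (constantCoeff (R := ZMod 2)) = 0 :=
    pe_eq_zero_of_natDegree hτ (lt_of_le_of_lt natDegree_map_le hd') (h4 ▸ h3)
  intro i
  rw [X_dvd_iff]
  have := congrArg (fun q => coeff q i) h5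
  simpa using this

theorem ker_evalTwo (hc : c ∈ cubicCodes) (hx : Model V c x) (hp : Irr V 6 (x 2)) :
    RingHom.ker (evalTwo (x 2 / x 0) (x 3 / x 0)) = Ideal.span {(curve (C X) X c : (ZMod 2)[X][X])} := by
  obtain ⟨hm, hd⟩ := curve_monic hc
  have h0 : evalTwo (x 2 / x 0) (x 3 / x 0) (curve (C X) X c) = 0 := by
    rw [map_curve, evalTwo_C, aeval_X, evalTwo_X, hx.curve_eq_zero]
  ext p
  rw [RingHom.mem_ker, Ideal.mem_span_singleton]
  refine ⟨fun h => ?_, fun ⟨q, hq⟩ => by rw [hq, map_mul, h0, zero_mul]⟩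
  rw [← modByMonic_eq_zero_iff_dvd hm]
  refine Z.eq_zero_of_evalTwo hx hp _ ?_ ?_
  · have := natDegree_modByMonic_lt p hm (fun h => by rw [h] at hd; simp at hd)
    omega
  · have h2 := modByMonic_add_div p (curve (C X) X c)
    rw [← h2, map_add, map_mul, h0, zero_mul, add_zero] at h
    exact h

theorem exists_eq_div [Genus4 (ZMod 2) K] (hx : Model V c x) (hp : Irr V 6 (x 2)) (w : K) :
    ∃ p q, w = evalTwo (x 2 / x 0) (x 3 / x 0) p / evalTwo (x 2 / x 0) (x 3 / x 0) q := by
  set y := x 2 / x 0 with hy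
  set z := x 3 / x 0 with hz
  have hF : IsFunctionField (ZMod 2) K := FunField.isFunctionField
  have hne : x 0 ≠ x 2 := by
    intro h
    have h1 := hx.coord_ne (d := 5) (by norm_num) (by norm_num)
    simp [vec, lin_cons, h, add_self] at h1
  have hdeg : xdeg (ZMod 2) y = 6 := by
    exact_mod_cast Z.degree 6 _ (hx.mem 2) _ (hx.mem 0) hp.ne hx.x_ne hne.symm
      (Z.hcoprime_of_irr hp hx.x_ne hne)
  have ht : Transcendental (ZMod 2) y := transcendental_of_ne (div_ne_zero hp.ne hx.x_ne)
    (by rw [hy, ne_eq, div_eq_one_iff_eq hx.x_ne]; exact hne.symm)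
  have := finiteDimensional_of_transcendental hF ht
  have hi : XInd (ZMod 2) y (fun i : Fin 6 => z ^ (i : ℕ)) := by
    intro p h0
    have h1 : (∑ i : Fin 6, C (p i) * X ^ (i : ℕ)) = 0 := by
      refine Z.eq_zero_of_evalTwo hx hp _ ?_ ?_
      · rw [Nat.lt_iff_le_pred (by norm_num)]
        refine natDegree_sum_le_of_forall_le _ _ fun i _ => ?_
        exact (natDegree_C_mul_X_pow_le _ _).trans (by have := i.2; omega)
      · rw [map_sum, ← h0]
        exact Finset.sum_congr rfl fun i _ => by
          rw [map_mul, map_pow, evalTwo_C, evalTwo_X]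
    funext i
    have h2 := congrArg (fun q => coeff q i) h1
    simpa [finsetSum_coeff, coeff_C_mul, coeff_X_pow, Fin.val_inj] using h2
  let B := basisOfLinearIndependentOfCardEqFinrank hi.linearIndependent
    (by rw [Fintype.card_fin]; exact hdeg.symm)
  have hB : ∀ i, B i = z ^ (i : ℕ) := fun i => by
    simp [B, coe_basisOfLinearIndependentOfCardEqFinrank]
  have htop : w ∈ IntermediateField.adjoin (ZMod 2) {y, z} := by
    rw [← B.sum_repr w]
    refine sum_mem fun i _ => ?_
    rw [hB, IntermediateField.smul_def, smul_eq_mul]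
    refine mul_mem ?_ (pow_mem (IntermediateField.subset_adjoin _ _ (by simp)) _)
    exact IntermediateField.adjoin.mono _ _ _ (by simp) (B.repr w i).2
  obtain ⟨r, hr, s, hs, rfl⟩ := IntermediateField.mem_adjoin_iff_div.mp htop
  have key : ∀ r ∈ Algebra.adjoin (ZMod 2) {y, z}, ∃ p, evalTwo y z p = r := by
    intro r hr
    induction hr using Algebra.adjoin_induction with
    | mem r hr =>
      rcases hr with rfl | rfl
      · exact ⟨C X, by rw [evalTwo_C, aeval_X]⟩
      · exact ⟨X, evalTwo_X _ _⟩
    | algebraMap b => exact ⟨C (C b), by rw [evalTwo_C, aeval_C]⟩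
    | add a b _ _ ha hb =>
      obtain ⟨p, rfl⟩ := ha
      obtain ⟨q, rfl⟩ := hb
      exact ⟨p + q, map_add _ _ _⟩
    | mul a b _ _ ha hb =>
      obtain ⟨p, rfl⟩ := ha
      obtain ⟨q, rfl⟩ := hb
      exact ⟨p * q, map_mul _ _ _⟩
  obtain ⟨p, rfl⟩ := key r hr
  obtain ⟨q, rfl⟩ := key s hs
  exact ⟨p, q, rfl⟩

/-- Two models of the same curve are related by an automorphism of the field. -/
theorem exists_ringEquiv [Genus4 (ZMod 2) K] {x' : Fin 4 → K} (hc : c ∈ cubicCodes)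
    (hx : Model V c x) (hp : Irr V 6 (x 2)) (hx' : Model V c x') (hp' : Irr V 6 (x' 2)) :
    ∃ σ : K ≃+* K, ∀ a b, σ (lin a (vec x) / lin b (vec x)) =
      lin a (vec x') / lin b (vec x') := by
  set φ : (ZMod 2)[X][X] →+* K := evalTwo (x 2 / x 0) (x 3 / x 0) with hφ
  set φ' : (ZMod 2)[X][X] →+* K := evalTwo (x' 2 / x' 0) (x' 3 / x' 0) with hφ'
  have hk : RingHom.ker φ = RingHom.ker φ' :=
    (Z.ker_evalTwo hc hx hp).trans (Z.ker_evalTwo hc hx' hp').symm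
  have hfr : IsFractionRing φ.range K := IsFractionRing.of_field _ _ fun w => by
    obtain ⟨p, q, h⟩ := Z.exists_eq_div hx hp w
    exact ⟨⟨_, p, rfl⟩, ⟨_, q, rfl⟩, h⟩
  have hfr' : IsFractionRing φ'.range K := IsFractionRing.of_field _ _ fun w => by
    obtain ⟨p, q, h⟩ := Z.exists_eq_div hx' hp' w
    exact ⟨⟨_, p, rfl⟩, ⟨_, q, rfl⟩, h⟩
  let e : φ.range ≃+* φ'.range := (RingHom.quotientKerEquivRange φ).symm.trans
    ((Ideal.quotEquivOfEq hk).trans (RingHom.quotientKerEquivRange φ'))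
  have he : ∀ p, e ⟨φ p, p, rfl⟩ = ⟨φ' p, p, rfl⟩ := by
    intro p
    have h1 : (RingHom.quotientKerEquivRange φ).symm ⟨φ p, p, rfl⟩ = Ideal.Quotient.mk _ p := by
      rw [RingEquiv.symm_apply_eq]; rfl
    simp only [e, RingEquiv.trans_apply, h1]
    rfl
  let σ : K ≃+* K := IsFractionRing.ringEquivOfRingEquiv e
  have hσ : ∀ p, σ (φ p) = φ' p := by
    intro p
    have := IsFractionRing.ringEquivOfRingEquiv_algebraMap (K := K) (L := K) e ⟨φ p, p, rfl⟩
    rw [he] at this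
    exact this
  have hy : σ (x 2 / x 0) = x' 2 / x' 0 := by
    have := hσ (C X)
    rwa [hφ, hφ', evalTwo_C, evalTwo_C, aeval_X, aeval_X] at this
  have hz : σ (x 3 / x 0) = x' 3 / x' 0 := by
    have := hσ X
    rwa [hφ, hφ', evalTwo_X, evalTwo_X] at this
  have hq : ∀ i, σ (x i / x 0) = x' i / x' 0 := by
    intro i
    rw [← hx.quadricPoint_eq, ← hx'.quadricPoint_eq, ← hy, ← hz]
    fin_cases i <;> simp [quadricPoint]
  have hl : ∀ a, σ (lin a (vec x) / x 0) = lin a (vec x') / x' 0 := by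
    intro a
    rw [div_eq_mul_inv, lin_mul, map_lin, div_eq_mul_inv, lin_mul]
    congr 1
    simp only [vec, List.map_cons, List.map_nil, ← div_eq_mul_inv, hq]
  refine ⟨σ, fun a b => ?_⟩
  have h0 := hx.x_ne
  have h0' := hx'.x_ne
  rw [← div_div_div_cancel_right₀ h0 (lin a (vec x)), map_div₀, hl, hl,
    div_div_div_cancel_right₀ h0']

end Cox

end Automorphism

section OrderFive

variable {K : Type} [Field K] [Algebra (ZMod 2) K] {V : ℤ → Submodule (ZMod 2) K}

/-- A substitution of order five preserving the quadric and each of the cubics. -/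
def rotation : Fin 4 → ℕ := ![2, 11, 6, 14]

theorem isOrth_rotation : isOrth 540 540 rotation = true := by decide +kernel

theorem Model.rotate {c : ℕ} {x : Fin 4 → K} (hc : c ∈ cubicCodes) (h : Model V c x) :
    Model V c (sub rotation x) := by
  refine ⟨h.toQBasis.sub isOrth_rotation, ?_⟩
  have h1 := h.rel
  rw [lin_540] at h1
  have h2 := h.cubic
  have e : (2 : K) = 0 := two_eq_zero K
  have e4 : (4 : K) = 0 := by linear_combination 2 * e
  have e6 : (6 : K) = 0 := by linear_combination 3 * e
  have e8 : (8 : K) = 0 := by linear_combination 4 * e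
  have e10 : (10 : K) = 0 := by linear_combination 5 * e
  have e12 : (12 : K) = 0 := by linear_combination 6 * e
  have e14 : (14 : K) = 0 := by linear_combination 7 * e
  have e16 : (16 : K) = 0 := by linear_combination 8 * e
  simp only [cubicCodes, List.mem_cons, List.not_mem_nil, or_false] at hc
  rcases hc with rfl | rfl | rfl | rfl <;>
    simp [cubics, cubicBasis, lin_cons, sub, vec, rotation] at h2 ⊢
  · linear_combination (norm := skip) h2 + (x 0 + x 1) * h1
    ring_nf; simp [e, e4, e6, e8, e12]
  · linear_combination (norm := skip) h2 + (x 0 + x 3) * h1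
    ring_nf; simp [e, e4, e6]
  · linear_combination (norm := skip) h2
    ring_nf; simp [e, e4, e6, e8, e10, e12, e14]
  · linear_combination (norm := skip) h2
    ring_nf; simp [e, e4, e6, e8, e10, e12, e14, e16]

theorem iterate_rotate {x : Fin 4 → K} (σ : K ≃+* K)
    (hσ : ∀ a b, σ (lin a (vec x) / lin b (vec x)) =
      lin a (vec (sub rotation x)) / lin b (vec (sub rotation x))) :
    σ^[6] (x 2 / x 0) = lin 6 (vec x) / lin 2 (vec x) := by
  have h : ∀ a b, σ (lin a (vec x) / lin b (vec x)) =
      lin (comb a (vec rotation)) (vec x) / lin (comb b (vec rotation)) (vec x) := by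
    intro a b
    rw [hσ, lin_sub add_self, lin_sub add_self]
  have h0 : x 2 / x 0 = lin 4 (vec x) / lin 1 (vec x) := by simp [vec, lin_cons]
  rw [h0]
  simp only [Function.iterate_succ, Function.iterate_zero, Function.comp, h, id]
  congr 2

theorem Model.ne_of_iterate {c : ℕ} {x : Fin 4 → K} (hx : Model V c x) :
    lin 6 (vec x) / lin 2 (vec x) ≠ x 2 / x 0 := by
  intro h
  have h1 := hx.coord_ne (d := 2) (by norm_num) (by norm_num)
  rw [div_eq_div_iff h1 hx.x_ne] at h
  have h2 : lin (qmul 6 1 ^^^ qmul 4 2) (quads x) = 0 := by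
    rw [lin_xor add_self, lin_qmul add_self, lin_qmul add_self]
    have : lin 4 (vec x) * lin 2 (vec x) = lin 6 (vec x) * lin 1 (vec x) := by
      have e1 : lin 1 (vec x) = x 0 := by simp [vec, lin_cons]
      have e4 : lin 4 (vec x) = x 2 := by simp [vec, lin_cons]
      rw [e1, e4, h]
    rw [this, add_self]
  have := hx.uniq _ (by decide) h2
  revert this
  decide

namespace Cox

variable (Z : Cox V)
include Z

/-- A curve of this type has an automorphism whose sixth power is not trivial. -/
theorem exists_automorphism [Genus4 (ZMod 2) K] (h1 : len V 1 = 0) (h2 : len V 2 = 0)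
    (h3 : len V 3 ≤ 1) : ∃ (σ : K ≃+* K) (w : K), σ^[6] w ≠ w := by
  obtain ⟨x, hx, c, hc, h0⟩ := Z.exists_cubic h1 h2 h3
  have key : ∀ x, Model V c x → Irr V 6 (lin 4 (vec x)) →
      Irr V 6 (lin (comb 4 (vec rotation)) (vec x)) →
      ∃ (σ : K ≃+* K) (w : K), σ^[6] w ≠ w := by
    intro x hx hp hp'
    obtain ⟨σ, hσ⟩ := Z.exists_ringEquiv hc hx (by simpa [vec, lin_cons] using hp) (hx.rotate hc)
      (by rw [← lin_sub add_self] at hp'; simpa [vec, lin_cons] using hp')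
    exact ⟨σ, x 2 / x 0, by rw [iterate_rotate σ hσ]; exact hx.ne_of_iterate⟩
  have hx' : Model V c x := ⟨hx, h0⟩
  have hirr : ∀ a b, a < 16 → b < 16 → 0 < a → 0 < b → a ≠ b →
      ¬ Irr V 6 (lin a (vec x)) → Irr V 6 (lin b (vec x)) := by
    intro a b ha hb ha0 hb0 hne hn
    by_contra hn'
    exact hne (Z.code_eq_of_not_irr h1 h2 h3 hx.toPreBasis ha hb ha0 hb0 hn hn')
  by_cases hp : Irr V 6 (lin 4 (vec x)) ∧ Irr V 6 (lin (comb 4 (vec rotation)) (vec x))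
  · exact key x hx' hp.1 hp.2
  · refine key (sub rotation (sub rotation x)) ((hx'.rotate hc).rotate hc) ?_ ?_ <;>
      rw [lin_sub add_self, lin_sub add_self] <;>
      (rw [not_and_or] at hp; rcases hp with hp | hp) <;>
      exact hirr _ _ (by decide) (by decide) (by decide) (by decide) (by decide) hp

end Cox

omit [Algebra (ZMod 2) K] in
theorem xdeg_ringEquiv {F : Type*} [Field F] [Algebra F K] (σ : K ≃ₐ[F] K) (w : K) :
    xdeg F (σ w) = xdeg F w := by
  have h : (IntermediateField.adjoin F {w}).map (σ : K →ₐ[F] K) =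
      IntermediateField.adjoin F {σ w} := by
    rw [IntermediateField.adjoin_map, Set.image_singleton]; rfl
  rw [xdeg, xdeg, ← h]
  exact (Algebra.finrank_eq_of_equiv_equiv
    (IntermediateField.intermediateFieldMap σ (IntermediateField.adjoin F {w})).toRingEquiv
    σ.toRingEquiv rfl).symm

theorem mobius_iterate {F : Type*} [Field F] (σ : F ≃+* F) {f g a b : F} (hf : f ≠ 0) (hg : g ≠ 0)
    (hne : f ≠ g) (ha : a = f ∨ a = g ∨ a = f + g) (hb : b = f ∨ b = g ∨ b = f + g)
    (h2 : (2 : F) = 0) (hab : a ≠ b) (h : σ (f / g) = a / b) : σ^[6] (f / g) = f / g := by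
  have hfg : f + g ≠ 0 := fun h0 => hne (by linear_combination h0 - g * h2)
  have hadd : ∀ m : F, m + m = 0 := fun m => by rw [← two_mul, h2, zero_mul]
  obtain ⟨t, rfl⟩ : ∃ t, f = t * g := ⟨f / g, by field_simp⟩
  rw [mul_div_cancel_right₀ _ hg] at h ⊢
  have ht : t ≠ 0 := left_ne_zero_of_mul hf
  have ht' : t + 1 ≠ 0 := fun h0 => hfg (by rw [← add_one_mul, h0, zero_mul])
  have i1 : t / (t + 1) + 1 = (t + 1)⁻¹ := by field_simp; linear_combination t * h2
  have i2 : (t + 1)⁻¹ + 1 = t / (t + 1) := by field_simp; linear_combination h2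
  have i3 : (t + 1) / t + 1 = t⁻¹ := by field_simp; linear_combination t * h2
  have key : σ (σ t) = t ∨ σ (σ (σ t)) = t := by
    rcases ha with rfl | rfl | rfl <;> rcases hb with rfl | rfl | rfl
    · exact absurd rfl hab
    · rw [mul_div_cancel_right₀ _ hg] at h
      rw [h, h]; exact .inl rfl
    · have h3 : σ t = t / (t + 1) := by rw [h]; field_simp
      left
      rw [h3, map_div₀, map_add, map_one, h3, i1]
      field_simp
    · have h3 : σ t = t⁻¹ := by rw [h]; field_simp
      left
      rw [h3, map_inv₀, h3, inv_inv]
    · exact absurd rfl hab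
    · have h3 : σ t = (t + 1)⁻¹ := by rw [h]; field_simp
      right
      have h4 : σ (σ t) = (t + 1) / t := by
        rw [h3, map_inv₀, map_add, map_one, h3, i2, inv_div]
      rw [h4, map_div₀, map_add, map_one, h3, i2]
      field_simp
    · have h3 : σ t = (t + 1) / t := by rw [h]; field_simp
      right
      have h4 : σ (σ t) = (t + 1)⁻¹ := by
        rw [h3, map_div₀, map_add, map_one, h3, i3]
        field_simp
      rw [h4, map_inv₀, map_add, map_one, h3, i3, inv_inv]
    · have h3 : σ t = t + 1 := by rw [h]; field_simp
      left
      rw [h3, map_add, map_one, h3]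
      linear_combination h2
    · exact absurd rfl hab
  simp only [Function.iterate_succ, Function.iterate_zero, Function.comp, id]
  rcases key with h | h <;> simp only [h]

omit [Algebra (ZMod 2) K] in
theorem algebraMap_ratFunc_X_ne_zero [Algebra (RatFunc (ZMod 2)) K] :
    algebraMap (RatFunc (ZMod 2)) K RatFunc.X ≠ 0 := by
  simpa using RatFunc.X_ne_zero

omit [Algebra (ZMod 2) K] in
theorem algebraMap_ratFunc_X_ne_one [Algebra (RatFunc (ZMod 2)) K] :
    algebraMap (RatFunc (ZMod 2)) K RatFunc.X ≠ 1 := by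
  rw [ne_eq, FaithfulSMul.algebraMap_eq_one_iff, ← RatFunc.algebraMap_X,
    FaithfulSMul.algebraMap_eq_one_iff]
  intro h
  simpa [coeff_one] using congrArg (coeff · 1) h

theorem Cox.isCyclic_of_automorphism (Z : Cox V) [Genus4 (ZMod 2) K] [Algebra (RatFunc (ZMod 2)) K]
    [IsScalarTower (ZMod 2) (RatFunc (ZMod 2)) K]
    (hdeg : Module.finrank (RatFunc (ZMod 2)) K = 5) (h5 : len V 5 = 2) {σ : K ≃+* K} {w : K}
    (hσ : σ^[6] w ≠ w) :
    Normal (RatFunc (ZMod 2)) K ∧ IsGalois (RatFunc (ZMod 2)) K ∧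
      IsCyclic (K ≃ₐ[RatFunc (ZMod 2)] K) ∧ Nat.card (K ≃ₐ[RatFunc (ZMod 2)] K) = 5 := by
  set T : K := algebraMap (RatFunc (ZMod 2)) K RatFunc.X with hT
  have hxT : xdeg (ZMod 2) T = 5 := xdeg_ratFunc_X.trans hdeg
  have hT0 : T ≠ 0 := algebraMap_ratFunc_X_ne_zero
  have hT1 : T ≠ 1 := algebraMap_ratFunc_X_ne_one
  have hσc : ∀ b, σ (algebraMap (ZMod 2) K b) = algebraMap (ZMod 2) K b := by
    intro b
    by_cases hb : b = 0
    · simp [hb]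
    · simp [zmod2_eq_one hb]
  have hxσ : xdeg (ZMod 2) (σ T) = 5 :=
    (xdeg_ringEquiv (AlgEquiv.ofRingEquiv hσc) T).trans hxT
  obtain ⟨f, hf, g, hg, hf0, hg0, hfg, -⟩ := Z.fraction T hT0 hT1
  obtain ⟨a, ha, b, hb, ha0, hb0, hab, -⟩ := Z.fraction (σ T) (by simpa using hT0)
    (by simpa using hT1)
  rw [hxT] at hf hg
  rw [hxσ] at ha hb
  have hne : f ≠ g := fun h => hT1 (by rw [hfg, h, div_self hg0])
  have hi : Indep [f, g] := (indep_singleton hg0).cons add_self (by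
    intro c hc
    simp only [List.length_singleton, pow_one] at hc
    interval_cases c
    · simpa [lin_cons] using hf0.symm
    · simpa [lin_cons] using hne.symm)
  have hsp : ∀ v ∈ V 5, v ≠ 0 → v = f ∨ v = g ∨ v = f + g := by
    intro v hv hv0
    obtain ⟨c, hc, rfl⟩ := Z.exists_eq_lin (n := 5) hi (by
      intro u hu
      simp only [List.mem_cons, List.not_mem_nil, or_false] at hu
      rcases hu with rfl | rfl <;> assumption) (by rw [h5]; rfl) hv
    simp only [List.length_cons, List.length_nil] at hc
    interval_cases c <;> simp [lin_cons] at hv0 ⊢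
  have h6 : σ^[6] T = T := by
    rw [hfg] at hab ⊢
    exact mobius_iterate σ hf0 hg0 hne (hsp a ha ha0) (hsp b hb hb0) (two_eq_zero K)
      (fun h => hT1 (by
        rw [← hfg, h, div_self hb0] at hab
        simpa using hab)) hab
  have hfix : ∀ r : RatFunc (ZMod 2), (σ ^ 6) (algebraMap _ K r) = algebraMap _ K r := by
    have h7 : ((σ ^ 6 : K ≃+* K) : K →+* K).comp (algebraMap (RatFunc (ZMod 2)) K) =
        algebraMap (RatFunc (ZMod 2)) K := by
      refine IsLocalization.ringHom_ext (nonZeroDivisors (ZMod 2)[X]) ?_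
      refine Polynomial.ringHom_ext (fun b => ?_) ?_
      · by_cases hb : b = 0
        · simp [hb]
        · simp [zmod2_eq_one hb]
      · have h8 : (σ ^ 6) T = T := by simpa using h6
        simpa [hT] using h8
    exact fun r => RingHom.congr_fun h7 r
  have : FiniteDimensional (RatFunc (ZMod 2)) K := .of_finrank_pos (by rw [hdeg]; norm_num)
  have hcard : Nat.card (K ≃ₐ[RatFunc (ZMod 2)] K) = 5 := by
    have h7 := IntermediateField.finrank_fixedField_eq_card (F := RatFunc (ZMod 2)) (E := K) ⊤
    have h8 := Module.finrank_mul_finrank (RatFunc (ZMod 2))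
      (IntermediateField.fixedField (⊤ : Subgroup (K ≃ₐ[RatFunc (ZMod 2)] K))) K
    rw [hdeg, h7, Subgroup.card_top] at h8
    have h9 : Nat.card (K ≃ₐ[RatFunc (ZMod 2)] K) ∣ 5 := ⟨_, by rw [mul_comm]; exact h8.symm⟩
    rcases (Nat.dvd_prime Nat.prime_five).mp h9 with h | h
    · exfalso
      have := (Nat.card_eq_one_iff_unique.mp h).1
      apply hσ
      have h10 : (AlgEquiv.ofRingEquiv hfix : K ≃ₐ[RatFunc (ZMod 2)] K) = AlgEquiv.refl :=
        Subsingleton.elim _ _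
      have := AlgEquiv.congr_fun h10 w
      simpa using this
    · exact h
  have hgal : IsGalois (RatFunc (ZMod 2)) K :=
    IsGalois.of_card_aut_eq_finrank _ _ (hcard.trans hdeg.symm)
  have : Fact (Nat.Prime 5) := ⟨Nat.prime_five⟩
  exact ⟨inferInstance, hgal, isCyclic_of_prime_card hcard, hcard⟩

end OrderFive

section LineOfQuadric

/-- The cubic monomials for a line with a triple point. -/
def lineCubics : List (Fin 4 × Fin 4 × Fin 4) :=
  [(1, 1, 1), (0, 0, 0), (0, 1, 1), (0, 2, 2), (0, 3, 3), (0, 0, 2), (0, 0, 3), (0, 1, 2), (0,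
    1, 3), (0, 2, 3)]

/-- Values of the cubic monomials on the plane sections. -/
def lineValues : List ℕ :=
  [6485878309024059673804800, 8134875053250043741995008, 9029833103793371452801024,
    2050116773693304460017664, 8200412155599897042616320, 4790262008607895371907072,
    9580512591292098014085120, 3426705706602326095036416, 6853375572675866663059456,
    4100214781147512771182592]

/-- The cubic monomials for a line with a simple point. -/
def lineCubics' : List (Fin 4 × Fin 4 × Fin 4) :=
  [(0, 0, 0), (0, 0, 0), (0, 1, 1), (0, 2, 2), (0, 3, 3), (0, 0, 2), (0, 0, 3), (0, 1, 2), (0,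
    1, 3), (0, 2, 3), (1, 0, 0), (1, 1, 1), (1, 2, 2), (1, 3, 3), (1, 0, 2), (1, 0, 3), (1, 1,
    2), (1, 1, 3), (1, 2, 3)]

/-- Values of the cubic monomials on the plane sections. -/
def lineValues' : List ℕ :=
  [8134875053250043741995008, 8134875053250043741995008, 9029833103793371452801024,
    2050116773693304460017664, 8200412155599897042616320, 4790262008607895371907072,
    9580512591292098014085120, 3426705706602326095036416, 6853375572675866663059456,
    4100214781147512771182592, 4981527165738447926198272, 6485878309024059673804800,
    1300496077322557715382272, 5201763563800773580029952, 3426705706602326095036416,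
    6853375572675866663059456, 3890789115300227883991040, 7781430026845552338010112,
    2600918977552656071917568]

theorem lineValues_spec : ∀ i, (h : i < 9) → lineValues.map (digits (20 + 7 * i) 7) =
    lineCubics.map (sextic (par (planes[i]'(h.trans (by decide))).2)) := by
  decide +kernel

theorem lineValues_spec' : ∀ i, (h : i < 9) → lineValues'.map (digits (20 + 7 * i) 7) =
    lineCubics'.map (sextic (par (planes[i]'(h.trans (by decide))).2)) := by
  decide +kernel

theorem lineValues_search : ∀ Q < 512,
    badPlanes (comb (1 + 2 * Q) lineValues) (List.range 9) = true := by
  decide +kernel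

theorem lineValues_search' : ∀ Q < 512,
    badPlanes (comb (1 + 2 * (Q + 512 * Q)) lineValues') (List.range 9) = true := by
  decide +kernel

theorem lin_append {M : Type*} [AddCommMonoid M] (vs ws : List M) (c d : ℕ)
    (hc : c < 2 ^ vs.length) : lin (c + 2 ^ vs.length * d) (vs ++ ws) = lin c vs + lin d ws := by
  induction vs generalizing c with
  | nil =>
    obtain rfl : c = 0 := by simpa using hc
    simp
  | cons v vs ih =>
    rw [List.length_cons, pow_succ] at hc ⊢
    have h1 : (c + 2 ^ vs.length * 2 * d) / 2 = c / 2 + 2 ^ vs.length * d := by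
      rw [show c + 2 ^ vs.length * 2 * d = c + 2 * (2 ^ vs.length * d) by ring]; omega
    have h2 : (c + 2 ^ vs.length * 2 * d) % 2 = c % 2 := by
      rw [show c + 2 ^ vs.length * 2 * d = c + 2 * (2 ^ vs.length * d) by ring]; omega
    rw [List.cons_append, lin_cons, lin_cons, h1, h2, ih _ (by omega), add_assoc]

variable {K : Type} [Field K] [Algebra (ZMod 2) K] {V : ℤ → Submodule (ZMod 2) K}

/-- A basis of the sixth graded piece whose first two entries vanish on a divisor of degree two. -/
structure LineBasis (V : ℤ → Submodule (ZMod 2) K) (e : K) (m : Fin 2 → K) (x : Fin 4 → K) :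
    Prop where
  mem : ∀ i, x i ∈ V 6
  indep : Indep (vec x)
  left : ∀ i, m i ∈ V 4
  zero : x 0 = e * m 0
  one : x 1 = e * m 1

/-- The nine quadratic monomials apart from the product of the first two entries. -/
def nine {R : Type*} [Mul R] (x : Fin 4 → R) : List R :=
  [x 0 * x 0, x 1 * x 1, x 2 * x 2, x 3 * x 3, x 0 * x 2, x 0 * x 3, x 1 * x 2,
    x 1 * x 3, x 2 * x 3]

theorem LineBasis.sub {e : K} {m : Fin 2 → K} {x : Fin 4 → K} (hx : LineBasis V e m x)
    {g : Fin 4 → ℕ} (hg : ∀ c < 16, comb c (vec g) < 16 ∧ (comb c (vec g) = 0 → c = 0))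
    (h0 : g 0 < 4) (h1 : g 1 < 4) :
    LineBasis V e ![lin (g 0) [m 0, m 1], lin (g 1) [m 0, m 1]] (CFF.sub g x) := by
  have key : ∀ c < 4, lin c (vec x) = e * lin c [m 0, m 1] := by
    intro c hc
    have a1 : c / 2 / 2 = 0 := by omega
    rw [lin_vec, a1, hx.zero, hx.one]
    simp only [lin_cons, lin_nil, nsmul_eq_mul]
    simp
    ring
  refine ⟨fun i => lin_mem (V 6) _ _ (mem_vec hx.mem), fun c hc h => ?_, fun i => ?_,
    key _ h0, key _ h1⟩
  · rw [lin_sub add_self] at h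
    exact (hg c hc).2 (hx.indep _ (hg c hc).1 h)
  · fin_cases i <;> exact lin_mem (V 4) _ _ (by simp [hx.left])

namespace Cox

variable (C : Cox V)
include C

theorem irr_two (h1 : len V 1 = 0) {e : K} (he : e ∈ V 2) (h0 : e ≠ 0) : Irr V 2 e := by
  refine ⟨he, h0, by norm_num, fun i hi hi2 g hg k hk hgk => h0 ?_⟩
  obtain rfl : i = 1 := by omega
  rw [hgk, C.eq_zero h1 hg, zero_mul]

theorem irr_or (h1 : len V 1 = 0) (h2 : len V 2 = 1) (h3 : len V 3 ≤ 1) {e : K} (he : e ∈ V 2)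
    (he0 : e ≠ 0) {f : K} (hf : f ∈ V 6) (h0 : f ≠ 0) :
    Irr V 6 f ∨ (∃ h ∈ V 4, f = e * h) ∨ ∃ s ∈ V 3, f = s * s := by
  by_cases h : ∀ i : ℤ, 0 < i → i < 6 → ∀ g ∈ V i, ∀ h ∈ V (6 - i), f ≠ g * h
  · exact Or.inl ⟨hf, h0, by norm_num, h⟩
  push Not at h
  obtain ⟨i, hi, hi6, g, hg, k, hk, rfl⟩ := h
  have hg0 := left_ne_zero_of_mul h0
  have hk0 := right_ne_zero_of_mul h0
  obtain rfl | rfl | rfl | rfl | rfl : i = 1 ∨ i = 2 ∨ i = 3 ∨ i = 4 ∨ i = 5 := by omega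
  · exact absurd (C.eq_zero h1 hg) hg0
  · exact Or.inr (Or.inl ⟨k, hk, by rw [C.eq_of_len_one h2 hg he hg0 he0]⟩)
  · norm_num at hk
    have h4 : len V 3 = 1 := by
      by_contra h5
      exact hg0 (C.eq_zero (by omega) hg)
    exact Or.inr (Or.inr ⟨g, hg, by rw [C.eq_of_len_one h4 hk hg hk0 hg0]⟩)
  · norm_num at hk
    exact Or.inr (Or.inl ⟨g, hg, by rw [C.eq_of_len_one h2 hk he hk0 he0, mul_comm]⟩)
  · norm_num at hk
    exact absurd (C.eq_zero h1 hk) hk0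

theorem eq_or_eq_of_mul (h1 : len V 1 = 0) (h2 : len V 2 ≤ 1) (h3 : len V 3 ≤ 1)
    {f₁ f₂ f₃ f₄ : K} (m1 : f₁ ∈ V 6) (m2 : f₂ ∈ V 6) (m3 : f₃ ∈ V 6) (m4 : f₄ ∈ V 6)
    (n1 : f₁ ≠ 0) (n2 : f₂ ≠ 0) (h : f₁ * f₂ = f₃ * f₄) : f₁ = f₃ ∨ f₁ = f₄ := by
  obtain ⟨i, α, hα, β, hβ, γ, hγ, δ, hδ, rfl, rfl, rfl, rfl⟩ :=
    C.split 6 f₁ m1 f₂ m2 f₃ m3 f₄ m4 n1 n2 h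
  have a0 := left_ne_zero_of_mul n1
  have b0 := right_ne_zero_of_mul n1
  have c0 := left_ne_zero_of_mul n2
  have d0 := right_ne_zero_of_mul n2
  have key : ∀ n : ℤ, n ≤ 3 → ∀ f ∈ V n, ∀ g ∈ V n, f ≠ 0 → g ≠ 0 → f = g := by
    intro n hn f hf g hg hf0 hg0
    have : len V n ≤ 1 := by
      obtain hn | rfl | rfl | rfl | rfl : n < 0 ∨ n = 0 ∨ n = 1 ∨ n = 2 ∨ n = 3 := by omega
      · rw [C.len_neg hn]; omega
      · rw [C.len_zero]
      · omega
      · exact h2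
      · exact h3
    refine C.eq_of_len_one (le_antisymm this ?_) hf hg hf0 hg0
    by_contra h0
    exact hf0 (C.eq_zero (by omega) hf)
  rcases le_total i 3 with hi | hi
  · right
    rw [key i hi α hα δ hδ a0 d0, mul_comm]
  · left
    rw [key (6 - i) (by omega) β hβ γ hγ b0 c0]

theorem exists_lineBasis (h1 : len V 1 = 0) (h2 : len V 2 = 1) :
    ∃ (e : K) (m : Fin 2 → K) (x : Fin 4 → K), Irr V 2 e ∧ LineBasis V e m x ∧ m 0 = e * e := by
  obtain ⟨e, he, he0⟩ := C.exists_ne_zero (n := 2) (by omega)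
  have he2 : e * e ∈ V 4 := C.mul' he he rfl
  obtain ⟨u, hu, hu1⟩ := C.exists_new (n := 4) [e * e] (by rw [C.len_four]; simp; omega)
  have i2 : Indep [u, e * e] :=
    (indep_singleton (mul_ne_zero he0 he0)).cons add_self hu1
  have i2' : Indep [e * u, e * (e * e)] := by
    intro c hc h0
    refine i2 c hc (mul_left_cancel₀ he0 ?_)
    rw [mul_comm, lin_mul, mul_zero, ← h0]
    simp [mul_comm]
  have l6 := C.len_six
  obtain ⟨y, hy, hy1⟩ := C.exists_new (n := 6) [e * u, e * (e * e)] (by simp; omega)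
  obtain ⟨z, hz, hz1⟩ := C.exists_new (n := 6) [y, e * u, e * (e * e)] (by simp; omega)
  have i4 := (i2'.cons add_self hy1).cons add_self hz1
  refine ⟨e, ![e * e, u], ![e * (e * e), e * u, y, z], C.irr_two h1 he he0,
    ⟨?_, ?_, ?_, rfl, rfl⟩, rfl⟩
  · intro i
    fin_cases i
    exacts [C.mul' he he2 rfl, C.mul' he hu rfl, hy, hz]
  · intro c hc h0
    have hc : c < 16 := hc
    have key := i4 (c / 2 / 2 / 2 % 2 + 2 * (c / 2 / 2 % 2) + 4 * (c / 2 % 2) + 8 * (c % 2))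
      (by simp; omega) (by
        rw [← h0, lin_vec]
        simp only [lin_cons, lin_nil, nsmul_eq_mul]
        have a1 : (c / 2 / 2 / 2 % 2 + 2 * (c / 2 / 2 % 2) + 4 * (c / 2 % 2) + 8 * (c % 2)) % 2 =
          c / 2 / 2 / 2 % 2 := by omega
        have a2 : (c / 2 / 2 / 2 % 2 + 2 * (c / 2 / 2 % 2) + 4 * (c / 2 % 2) + 8 * (c % 2)) / 2 % 2
          = c / 2 / 2 % 2 := by omega
        have a3 : (c / 2 / 2 / 2 % 2 + 2 * (c / 2 / 2 % 2) + 4 * (c / 2 % 2) + 8 * (c % 2)) / 2 / 2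
          % 2 = c / 2 % 2 := by omega
        have a4 : (c / 2 / 2 / 2 % 2 + 2 * (c / 2 / 2 % 2) + 4 * (c / 2 % 2) + 8 * (c % 2)) / 2 / 2
          / 2 % 2 = c % 2 := by omega
        rw [a1, a2, a3, a4]
        simp
        ring)
    omega
  · intro i
    fin_cases i
    exacts [he2, hu]

theorem line_kernel {e : K} {m : Fin 2 → K} {x : Fin 4 → K} (h2 : len V 2 = 1)
    (hx : LineBasis V e m x) {c : ℕ} (hc : c < 16) (hd : HDvd V 2 e 6 (lin c (vec x))) :
    c < 4 := by
  obtain ⟨h, hh, he⟩ := hd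
  norm_num at hh
  have i2 : Indep [m 0, m 1] := by
    intro d hd h0
    simp only [List.length_cons, List.length_nil, zero_add] at hd
    refine hx.indep d (by simp [vec]; omega) ?_
    have a1 : d / 2 / 2 = 0 := by omega
    have := congrArg (e * ·) h0
    simp only [lin_cons, lin_nil, nsmul_eq_mul, mul_zero] at this
    rw [lin_vec, a1, hx.zero, hx.one]
    simp
    linear_combination this
  obtain ⟨d, hd, rfl⟩ := C.exists_eq_lin i2 (n := 4) (by simp [hx.left])
    (by rw [C.len_four]; simp; omega) hh
  simp only [List.length_cons, List.length_nil, zero_add] at hd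
  have h3 : lin c (vec x) = lin d (vec x) := by
    have a1 : d / 2 / 2 = 0 := by omega
    rw [he, lin_vec d, a1, hx.zero, hx.one]
    simp only [lin_cons, lin_nil, nsmul_eq_mul]
    simp
    ring
  have := lin_inj hx.indep (by simpa [vec] using hc) (by simp [vec]; omega) h3
  omega

theorem line_digits {e : K} {m : Fin 2 → K} {x : Fin 4 → K} (h2 : len V 2 = 1) (he : Irr V 2 e)
    (hx : LineBasis V e m x) {c : ℕ} (h0 : lin c (quads x) = 0) :
    c / 4 % 2 = c / 8 % 2 ∧ c / 8 % 2 = c / 512 % 2 := by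
  obtain ⟨κ, _, ev, hcard, E, t2⟩ := C.exists_point he
  have hadd : ∀ m : κ, m + m = 0 := fun m => by rw [← two_mul, t2, zero_mul]
  have hlin : ∀ d < 16, 4 ≤ d → ev 6 (lin d (vec x)) ≠ 0 := fun d hd hd4 hz => by
    have := C.line_kernel h2 hx hd
      ((E.zero_iff 6 _ (lin_mem (V 6) _ _ (mem_vec hx.mem))).mp hz)
    omega
  have e0 : ev 6 (x 0) = 0 := (E.zero_iff 6 _ (hx.mem 0)).mpr ⟨m 0, hx.left 0, hx.zero⟩
  have e1 : ev 6 (x 1) = 0 := (E.zero_iff 6 _ (hx.mem 1)).mpr ⟨m 1, hx.left 1, hx.one⟩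
  have e2 : ev 6 (x 2) ≠ 0 := by simpa [vec, lin_cons] using hlin 4 (by norm_num) le_rfl
  have e3 : ev 6 (x 3) ≠ 0 := by simpa [vec, lin_cons] using hlin 8 (by norm_num) (by norm_num)
  have e4 : ev 6 (x 2) + ev 6 (x 3) ≠ 0 := by
    rw [← E.add 6 _ (hx.mem 2) _ (hx.mem 3)]
    simpa [vec, lin_cons] using hlin 12 (by norm_num) (by norm_num)
  have hz := congrArg (ev 12) h0
  rw [E.zero, E.lin 12 _ _ (C.quads_mem hx.mem), E.quads hx.mem] at hz
  simp only [quads, lin_cons, lin_nil, e0, e1, mul_zero, zero_mul, smul_zero, zero_add, add_zero,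
    Nat.div_div_eq_div_mul] at hz
  norm_num at hz
  rcases Nat.mod_two_eq_zero_or_one (c / 4) with b1 | b1 <;>
  rcases Nat.mod_two_eq_zero_or_one (c / 8) with b2 | b2 <;>
  rcases Nat.mod_two_eq_zero_or_one (c / 512) with b3 | b3 <;>
  simp only [b1, b2, b3] at hz ⊢ <;> norm_num at hz ⊢
  · exact hz.elim e2 e3
  · exact e3 hz
  · exact mul_ne_zero e3 e4 (by linear_combination hz)
  · exact e2 hz
  · exact mul_ne_zero e2 e4 (by linear_combination hz)
  · exact mul_ne_zero e4 e4 (by linear_combination hz + ev 6 (x 2) * ev 6 (x 3) * t2)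

theorem line_eq_zero {e : K} {m : Fin 2 → K} {x : Fin 4 → K} (h1 : len V 1 = 0)
    (h2 : len V 2 = 1) (h3 : len V 3 ≤ 1) (hx : LineBasis V e m x) {c : ℕ} (hc : c < 1024)
    (hb : c / 4 % 2 = 0 ∧ c / 8 % 2 = 0 ∧ c / 512 % 2 = 0) (h0 : lin c (quads x) = 0) :
    c = 0 := by
  obtain ⟨p, hp, q, hq, hq2, rfl⟩ := (show ∀ c < 1024, c / 4 % 2 = 0 ∧ c / 8 % 2 = 0 ∧
    c / 512 % 2 = 0 → ∃ p < 16, ∃ q < 16, q % 2 = 0 ∧ c = qmul 1 p ^^^ qmul 2 q by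
      decide +kernel) c hc hb
  have hm : ∀ p, lin p (vec x) ∈ V 6 := fun p => lin_mem (V 6) _ _ (mem_vec hx.mem)
  have hinj : ∀ p < 16, ∀ q < 16, lin p (vec x) = lin q (vec x) → p = q :=
    fun p hp q hq h => lin_inj hx.indep hp hq h
  rw [lin_xor add_self, lin_qmul add_self, lin_qmul add_self] at h0
  by_cases hp0 : p = 0
  · subst hp0
    rw [lin_zero, mul_zero, zero_add, mul_eq_zero] at h0
    rcases h0 with h0 | h0
    · exact absurd (hinj 2 (by norm_num) 0 (by norm_num) (by simpa using h0)) (by norm_num)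
    · obtain rfl := hinj q hq 0 (by norm_num) (by simpa using h0)
      rfl
  · exfalso
    rcases C.eq_or_eq_of_mul h1 h2.le h3 (hm 1) (hm p) (hm 2) (hm q)
      (fun h => by simpa using hinj 1 (by norm_num) 0 (by norm_num) (by simpa using h))
      (fun h => hp0 (hinj p hp 0 (by norm_num) (by simpa using h)))
      (by linear_combination h0 - lin 2 (vec x) * lin q (vec x) * (two_eq_zero (K := K)))
      with h | h
    · simpa using hinj 1 (by norm_num) 2 (by norm_num) h
    · obtain rfl := hinj 1 (by norm_num) q hq h
      omega

theorem line_uniq {e : K} {m : Fin 2 → K} {x : Fin 4 → K} (h1 : len V 1 = 0)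
    (h2 : len V 2 = 1) (h3 : len V 3 ≤ 1) (he : Irr V 2 e) (hx : LineBasis V e m x)
    (hr : lin 540 (quads x) = 0) : QBasis V 540 x := by
  refine ⟨⟨hx.mem, hx.indep, hr⟩, fun c hc h0 => ?_⟩
  have hd := C.line_digits h2 he hx h0
  by_cases hb : c / 4 % 2 = 0
  · exact Or.inl (C.line_eq_zero h1 h2 h3 hx hc (by omega) h0)
  · right
    refine Nat.xor_eq_zero_iff.mp (C.line_eq_zero h1 h2 h3 hx
      (Nat.xor_lt_two_pow (n := 10) hc (by norm_num)) ?_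
      (by rw [lin_xor add_self, h0, hr, add_zero]))
    rw [show (4 : ℕ) = 2 ^ 2 by rfl, show (8 : ℕ) = 2 ^ 3 by rfl, show (512 : ℕ) = 2 ^ 9 by rfl,
      Nat.xor_div_two_pow, Nat.xor_div_two_pow, Nat.xor_div_two_pow, xor_mod_two, xor_mod_two,
      xor_mod_two]
    norm_num
    omega

/-- The canonical model contains a line with coordinates of a standard form. -/
theorem exists_line (h1 : len V 1 = 0) (h2 : len V 2 = 1) (h3 : len V 3 ≤ 1) :
    ∃ (e : K) (m : Fin 2 → K) (x : Fin 4 → K), Irr V 2 e ∧ LineBasis V e m x ∧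
      QBasis V 540 x ∧ (m 0 = e * e ∨ m 0 + m 1 = e * e) := by
  obtain ⟨e, m, x, he, hx, hm⟩ := C.exists_lineBasis h1 h2
  obtain ⟨r, hr0, hr, h0⟩ := C.exists_dep (quads x) (C.quads_mem hx.mem) (by
    have := C.len_large (n := 12) (by norm_num)
    simp [quads]; omega)
  have hr : r < 1024 := by simpa [quads] using hr
  have hd := C.line_digits h2 he hx h0
  have hr1 : r / 4 % 2 = 1 := by
    by_contra hb
    exact hr0.ne' (C.line_eq_zero h1 h2 h3 hx hr (by omega) h0)
  obtain ⟨r', hr', hq⟩ := (show ∀ r < 1024, r / 4 % 2 = 1 → r / 8 % 2 = 1 → r / 512 % 2 = 1 →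
    ∃ r' ∈ [524, 525, 526, 527, 540, 541, 542, 543], comb r' (qact ![1, 2,
      4 ^^^ (r / 64 % 2 + 2 * (r / 256 % 2)), 8 ^^^ (r / 32 % 2 + 2 * (r / 128 % 2))]) = r by
      decide +kernel) r hr hr1 (by omega) (by omega)
  have hA : r / 64 % 2 + 2 * (r / 256 % 2) < 4 := by omega
  have hB : r / 32 % 2 + 2 * (r / 128 % 2) < 4 := by omega
  generalize r / 64 % 2 + 2 * (r / 256 % 2) = A at *
  generalize r / 32 % 2 + 2 * (r / 128 % 2) = B at *
  have hy := hx.sub (g := ![1, 2, 4 ^^^ A, 8 ^^^ B]) ((show ∀ A < 4, ∀ B < 4, ∀ c < 16,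
    comb c (vec ![1, 2, 4 ^^^ A, 8 ^^^ B]) < 16 ∧
      (comb c (vec ![1, 2, 4 ^^^ A, 8 ^^^ B]) = 0 → c = 0) by decide +kernel) A hA B hB)
    (by simp) (by simp)
  have hy0 : lin r' (quads (CFF.sub ![1, 2, 4 ^^^ A, 8 ^^^ B] x)) = 0 := by
    rw [lin_quads_sub add_self, hq, h0]
  generalize CFF.sub ![1, 2, 4 ^^^ A, 8 ^^^ B] x = y at hy hy0
  obtain ⟨m', hm', hy⟩ : ∃ m' : Fin 2 → K, m' 0 = e * e ∧ LineBasis V e m' y :=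
    ⟨_, by simpa [lin_cons] using hm, hy⟩
  have kill : ∀ p₁ < 16, ∀ p₂ < 16, ∀ p₃ < 16, ∀ p₄ < 16, 0 < p₁ → 0 < p₂ → p₁ ≠ p₃ →
      p₁ ≠ p₄ → lin (qmul p₁ p₂ ^^^ qmul p₃ p₄) (quads y) ≠ 0 := by
    intro p₁ q₁ p₂ q₂ p₃ q₃ p₄ q₄ n₁ n₂ n₃ n₄ hz
    have hmem : ∀ p, lin p (vec y) ∈ V 6 := fun p => lin_mem (V 6) _ _ (mem_vec hy.mem)
    rw [lin_xor add_self, lin_qmul add_self, lin_qmul add_self] at hz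
    rcases C.eq_or_eq_of_mul h1 h2.le h3 (hmem p₁) (hmem p₂) (hmem p₃) (hmem p₄)
      (fun h => n₁.ne' (hy.indep p₁ q₁ h)) (fun h => n₂.ne' (hy.indep p₂ q₂ h))
      (by linear_combination hz - lin p₃ (vec y) * lin p₄ (vec y) * (two_eq_zero (K := K)))
      with h | h
    · exact n₃ (lin_inj hy.indep q₁ q₃ h)
    · exact n₄ (lin_inj hy.indep q₁ q₄ h)
  simp only [List.mem_cons, List.not_mem_nil, or_false] at hr'
  rcases hr' with rfl | rfl | rfl | rfl | rfl | rfl | rfl | rfl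
  · exact absurd hy0 (kill 4 (by norm_num) 12 (by norm_num) 8 (by norm_num) 8 (by norm_num)
      (by norm_num) (by norm_num) (by norm_num) (by norm_num))
  · exact absurd hy0 (kill 4 (by norm_num) 8 (by norm_num) 13 (by norm_num) 13 (by norm_num)
      (by norm_num) (by norm_num) (by norm_num) (by norm_num))
  · exact absurd hy0 (kill 4 (by norm_num) 8 (by norm_num) 14 (by norm_num) 14 (by norm_num)
      (by norm_num) (by norm_num) (by norm_num) (by norm_num))
  · exact absurd hy0 (kill 4 (by norm_num) 8 (by norm_num) 15 (by norm_num) 15 (by norm_num)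
      (by norm_num) (by norm_num) (by norm_num) (by norm_num))
  · exact ⟨e, m', y, he, hy, C.line_uniq h1 h2 h3 he hy hy0, Or.inl hm'⟩
  · have hz := hy.sub (g := ![1, 3, 4, 8]) (by decide +kernel) (by simp) (by simp)
    refine ⟨e, _, _, he, hz, C.line_uniq h1 h2 h3 he hz ?_, Or.inl ?_⟩
    · rw [lin_quads_sub add_self, ← hy0]
      congr 1
    · simpa [lin_cons] using hm'
  · have hz := hy.sub (g := ![2, 3, 4, 8]) (by decide +kernel) (by simp) (by simp)
    refine ⟨e, _, _, he, hz, C.line_uniq h1 h2 h3 he hz ?_, Or.inr ?_⟩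
    · rw [lin_quads_sub add_self, ← hy0]
      congr 1
    · simp [lin_cons]
      linear_combination hm' + m' 1 * (two_eq_zero (K := K))
  · exact absurd hy0 (kill 5 (by norm_num) 13 (by norm_num) 10 (by norm_num) 11 (by norm_num)
      (by norm_num) (by norm_num) (by norm_num) (by norm_num))

theorem not_badPlanes (h1 : len V 1 = 0) (h2 : len V 2 = 1) (h3 : len V 3 ≤ 1)
    {e : K} {m : Fin 2 → K} {x : Fin 4 → K} (he : Irr V 2 e) (hl : LineBasis V e m x)
    (hx : QBasis V 540 x) {ms : List (Fin 4 × Fin 4 × Fin 4)} {vs : List ℕ}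
    (hv : ∀ i, (h : i < 9) → vs.map (digits (20 + 7 * i) 7) =
      ms.map (sextic (par (planes[i]'(h.trans (by decide))).2))) {c : ℕ}
    (h0 : lin c (cubics x ms) = 0) : badPlanes (comb c vs) (List.range 9) ≠ true := by
  intro hs
  obtain ⟨i, hi, j, hj, hij, hbi, hbj⟩ := exists_of_twoOf List.nodup_range hs
  rw [List.mem_range] at hi hj
  have hlen : planes.length = 10 := rfl
  have key : ∀ i, (h : i < 9) → (!isGood (digits (20 + 7 * i) 7 (comb c vs))) = true →
      ∃ s ∈ V 3, lin ((planes[i]'(h.trans (by decide))).1 2) (vec x) = s * s := by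
    intro i hi hb
    obtain ⟨t1, t2⟩ := (show ∀ i, (h : i < 9) → (planes[i]'(h.trans (by decide))).1 2 < 16 ∧
      4 ≤ (planes[i]'(h.trans (by decide))).1 2 by decide +kernel) i hi
    rcases C.irr_or h1 h2 h3 he.mem he.ne (lin_mem (V 6) _ _ (mem_vec hx.mem))
      (fun h => by have := hx.indep _ t1 h; omega) with h | h | h
    · have := C.isGood_of_irr hx (List.getElem_mem (by omega)) h ms c h0
      rw [digits_comb, hv i hi, this] at hb
      simp at hb
    · have := C.line_kernel h2 hl t1 h
      omega
    · exact h
  obtain ⟨s, hs, es⟩ := key i hi hbi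
  obtain ⟨t, ht, et⟩ := key j hj hbj
  obtain ⟨t1, t2⟩ := (show ∀ i, (h : i < 9) → (planes[i]'(h.trans (by decide))).1 2 < 16 ∧
    0 < (planes[i]'(h.trans (by decide))).1 2 by decide +kernel) i hi
  obtain ⟨t3, t4⟩ := (show ∀ i, (h : i < 9) → (planes[i]'(h.trans (by decide))).1 2 < 16 ∧
    0 < (planes[i]'(h.trans (by decide))).1 2 by decide +kernel) j hj
  refine hij ((show ∀ i, (h : i < 9) → ∀ j, (h' : j < 9) →
    (planes[i]'(h.trans (by decide))).1 2 = (planes[j]'(h'.trans (by decide))).1 2 → i = j by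
      decide +kernel) i hi j hj (lin_inj hx.indep t1 t3 ?_))
  have hs0 : s ≠ 0 := by
    rintro rfl
    exact t2.ne' (hx.indep _ t1 (by rw [es, mul_zero]))
  have ht0 : t ≠ 0 := by
    rintro rfl
    exact t4.ne' (hx.indep _ t3 (by rw [et, mul_zero]))
  have h4 : len V 3 = 1 := by
    by_contra h5
    exact hs0 (C.eq_zero (by omega) hs)
  rw [es, et, C.eq_of_len_one h4 hs ht hs0 ht0]

omit C in
theorem lin_nine {x : Fin 4 → K} (hq : QBasis V 540 x) {Q : ℕ} (hQ : Q < 512) (h0 : lin Q (nine x) = 0) : Q = 0 := by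
  have hz : lin (Q % 16 + 32 * (Q / 16)) (quads x) = 0 := by
    rw [← h0]
    have a1 : (Q % 16 + 32 * (Q / 16)) % 2 = Q % 2 := by omega
    have a2 : (Q % 16 + 32 * (Q / 16)) / 2 % 2 = Q / 2 % 2 := by omega
    have a3 : (Q % 16 + 32 * (Q / 16)) / 2 / 2 % 2 = Q / 2 / 2 % 2 := by omega
    have a4 : (Q % 16 + 32 * (Q / 16)) / 2 / 2 / 2 % 2 = Q / 2 / 2 / 2 % 2 := by omega
    have a5 : (Q % 16 + 32 * (Q / 16)) / 2 / 2 / 2 / 2 % 2 = 0 := by omega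
    have a6 : (Q % 16 + 32 * (Q / 16)) / 2 / 2 / 2 / 2 / 2 = Q / 2 / 2 / 2 / 2 := by omega
    simp only [quads, nine, lin_cons, lin_nil, a1, a2, a3, a4, a5, a6]
    simp
  rcases hq.uniq _ (by omega) hz with h | h <;> omega

/-- The first graded piece and the second one cannot have dimensions zero and one. -/
theorem false_of_line (h1 : len V 1 = 0) (h2 : len V 2 = 1) (h3 : len V 3 ≤ 1) : False := by
  obtain ⟨e, m, x, he, hl, hx, hm⟩ := C.exists_line h1 h2 h3
  have dep : ∀ u ∈ V 4, ∃ Q < 512, u * u * u + lin Q (nine x) = 0 := by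
    intro u hu
    have h9 : ∀ v ∈ nine x, v ∈ V 12 := fun v hv => C.quads_mem hx.mem v (by
      simp only [nine, quads, List.mem_cons, List.not_mem_nil, or_false] at hv ⊢
      tauto)
    obtain ⟨c, hc0, hc, h0⟩ := C.exists_dep (n := 12) (u * u * u :: nine x) (by
      rintro v hv
      rcases List.mem_cons.mp hv with rfl | hv
      · exact C.mul' (C.mul' hu hu rfl) hu rfl
      · exact h9 v hv) (by
      have := C.len_large (n := 12) (by norm_num)
      simp [nine]; omega)
    have hc : c < 1024 := by simpa [nine] using hc
    rw [lin_cons] at h0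
    rcases Nat.mod_two_eq_zero_or_one c with hp | hp
    · rw [hp, zero_smul, zero_add] at h0
      have := lin_nine hx (by omega) h0
      omega
    · rw [hp, one_smul] at h0
      exact ⟨c / 2, by omega, h0⟩
  rcases hm with hm | hm
  · obtain ⟨Q, hQ, h0⟩ := dep _ (hl.left 1)
    refine C.not_badPlanes h1 h2 h3 he hl hx lineValues_spec (c := 1 + 2 * Q) ?_
      (lineValues_search Q hQ)
    have : cubics x lineCubics = (x 1 * x 1 * x 1) :: (nine x).map (· * x 0) := by
      simp [cubics, lineCubics, nine, mul_comm, mul_left_comm]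
    rw [this, lin_cons, ← lin_mul, show (1 + 2 * Q) % 2 = 1 by omega,
      show (1 + 2 * Q) / 2 = Q by omega, one_smul]
    rw [hl.one]
    have e0 : x 0 = e * (e * e) := by rw [hl.zero, hm]
    linear_combination (e * (e * e)) * h0 + lin Q (nine x) * e0
  · obtain ⟨Q, hQ, h0⟩ := dep _ (hl.left 0)
    refine C.not_badPlanes h1 h2 h3 he hl hx lineValues_spec' (c := 1 + 2 * (Q + 512 * Q)) ?_
      (lineValues_search' Q hQ)
    have : cubics x lineCubics' = (x 0 * x 0 * x 0) ::
        ((nine x).map (· * x 0) ++ (nine x).map (· * x 1)) := by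
      simp [cubics, lineCubics', nine, mul_comm, mul_left_comm]
    have h5 := lin_append ((nine x).map (· * x 0)) ((nine x).map (· * x 1)) Q Q
      (by simpa [nine] using hQ)
    rw [show 2 ^ ((nine x).map (· * x 0)).length = 512 by simp [nine]] at h5
    rw [this, lin_cons, show (1 + 2 * (Q + 512 * Q)) % 2 = 1 by omega,
      show (1 + 2 * (Q + 512 * Q)) / 2 = Q + 512 * Q by omega, h5, ← lin_mul, ← lin_mul, one_smul]
    have e0 : x 0 + x 1 = e * (e * e) := by rw [hl.zero, hl.one, ← hm]; ring
    have e1 := hl.zero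
    have : x 0 * x 0 * x 0 = e * e * e * (m 0 * m 0 * m 0) := by rw [e1]; ring
    linear_combination this + (e * (e * e)) * h0 + lin Q (nine x) * e0

end Cox

end LineOfQuadric

section Forms

open Polynomial

variable {K : Type} [Field K] {a b : K}

/-- The binary form of degree `k` in `a` and `b` with coefficients the digits of `p`. -/
def form (a b : K) (k p : ℕ) : K := b ^ k * pe (a / b) p

@[simp] theorem form_zero (k : ℕ) : form a b k 0 = 0 := by simp [form]

theorem form_one (k : ℕ) : form a b k 1 = b ^ k := by simp [form]

theorem form_succ (k p : ℕ) : form a b (k + 1) p = b * form a b k p := by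
  rw [form, form, pow_succ]; ring

theorem form_succ_double (hb : b ≠ 0) (k p : ℕ) :
    form a b (k + 1) (2 * p) = a * form a b k p := by
  rw [form, form, pow_succ, pe_double]
  field_simp

/-- The monomials of degree `k` in two variables. -/
def monomials (a b : K) (k : ℕ) : List K := (List.range (k + 1)).map fun i => b ^ k * (a / b) ^ i

theorem lin_monomials {k p : ℕ} (hp : p < 2 ^ (k + 1)) :
    lin p (monomials a b k) = form a b k p := by
  rw [form, ← lin_range_pow _ _ _ hp, ← lin_smul, List.map_map]
  rfl

theorem length_monomials (k : ℕ) : (monomials a b k).length = k + 1 := by simp [monomials]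

variable [Algebra (ZMod 2) K] {V : ℤ → Submodule (ZMod 2) K}

theorem form_xor (k p q : ℕ) : form a b k (p ^^^ q) = form a b k p + form a b k q := by
  rw [form, form, form, pe_xor _ (two_eq_zero K), mul_add]

theorem pe_transcendental {τ : K} (hτ : Transcendental (ZMod 2) τ) {p : ℕ} (h : pe τ p = 0) :
    p = 0 := by
  by_contra hp
  exact hτ ⟨pe X p, pe_X_ne_zero p hp, by rw [aeval_pe, h]⟩

theorem form_clmul {k l m p q : ℕ} (n : ℕ) (hp : p < 2 ^ n) (hm : k + l = m) :
    form a b m (clmul n p q) = form a b k p * form a b l q := by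
  rw [form, form, form, pe_clmul _ (two_eq_zero K) n p q hp, ← hm, pow_add]
  ring

theorem form_eq_zero (hb : b ≠ 0) (hτ : Transcendental (ZMod 2) (a / b)) {k p : ℕ}
    (h : form a b k p = 0) : p = 0 :=
  pe_transcendental hτ ((mul_eq_zero.1 h).resolve_left (pow_ne_zero _ hb))

theorem form_inj (hb : b ≠ 0) (hτ : Transcendental (ZMod 2) (a / b)) {k p q : ℕ}
    (h : form a b k p = form a b k q) : p = q := by
  refine Nat.xor_eq_zero_iff.1 (form_eq_zero (k := k) hb hτ ?_)
  rw [form_xor, h, add_self]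

theorem indep_monomials (hb : b ≠ 0) (hτ : Transcendental (ZMod 2) (a / b)) (k : ℕ) :
    Indep (monomials a b k) := by
  intro c hc h
  rw [length_monomials] at hc
  rw [lin_monomials hc] at h
  exact form_eq_zero hb hτ h

namespace Cox

variable (C : Cox V)
include C

theorem form_mem {e : ℤ} (ha : a ∈ V e) (hb : b ∈ V e) (hb0 : b ≠ 0) (k : ℕ) {n : ℤ}
    (hn : k * e = n) {p : ℕ} (hp : p < 2 ^ (k + 1)) : form a b k p ∈ V n := by
  subst hn
  induction k generalizing p with
  | zero =>
    obtain rfl | rfl : p = 0 ∨ p = 1 := by omega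
    · simp
    · simpa [form] using C.one_mem
  | succ k ih =>
    rw [← Nat.div_add_mod p 2]
    have h1 : p / 2 < 2 ^ (k + 1) := by rw [pow_succ] at hp; omega
    have h2 : 2 * (p / 2) + p % 2 = (2 * (p / 2)) ^^^ (p % 2) := by
      rcases Nat.mod_two_eq_zero_or_one p with h | h
      · simp [h]
      · rw [h]
        exact (Nat.xor_one_of_even (even_two_mul _)).symm
    rw [h2, form_xor, form_succ_double hb0]
    refine Submodule.add_mem _ (C.mul' ha (ih h1) (by push_cast; ring)) ?_
    rcases Nat.mod_two_eq_zero_or_one p with h | h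
    · simp [h]
    · rw [h, form_one]
      exact C.pow_mem' hb _ rfl

theorem monomials_mem {e : ℤ} (ha : a ∈ V e) (hb : b ∈ V e) (hb0 : b ≠ 0) (k : ℕ) {n : ℤ}
    (hn : k * e = n) : ∀ v ∈ monomials a b k, v ∈ V n := by
  intro v hv
  obtain ⟨i, hi, rfl⟩ := List.mem_map.1 hv
  have hi' : i < k + 1 := List.mem_range.1 hi
  have h1 : b ^ k * (a / b) ^ i = b ^ (k - i) * a ^ i := by
    have : b ^ k = b ^ (k - i) * b ^ i := by rw [← pow_add]; congr 1; omega
    rw [this, mul_assoc, ← mul_pow, mul_div_cancel₀ _ hb0]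
  rw [h1]
  refine C.mul' (C.pow_mem' hb _ rfl) (C.pow_mem' ha i rfl) ?_
  rw [← hn, ← add_mul]
  congr 1
  push_cast [Nat.cast_sub (show i ≤ k by omega)]
  ring

theorem exists_form {e : ℤ} (ha : a ∈ V e) (hb : b ∈ V e) (hb0 : b ≠ 0)
    (hτ : Transcendental (ZMod 2) (a / b)) (k : ℕ) {n : ℤ} (hn : k * e = n)
    (hl : len V n ≤ k + 1) {f : K} (hf : f ∈ V n) : ∃ p < 2 ^ (k + 1), f = form a b k p := by
  obtain ⟨c, hc, rfl⟩ := C.exists_eq_lin (indep_monomials hb0 hτ k)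
    (C.monomials_mem ha hb hb0 k hn)
    (by rw [length_monomials]; exact hl) hf
  rw [length_monomials] at hc
  exact ⟨c, hc, lin_monomials hc⟩

end Cox

end Forms

section Hyperelliptic

/-- The code `m` of a binary form of degree `d` is not a product. -/
abbrev IrrCode (d m : ℕ) : Prop :=
  ∀ k < d, 0 < k → ∀ p < 2 ^ (k + 1), ∀ q < 2 ^ (d - k + 1), clmul (k + 1) p q ≠ m

/-- Codes of irreducible binary forms. -/
def irrCodes : List (ℕ × ℕ) :=
  [(1, 1), (1, 2), (1, 3), (2, 7), (3, 11), (3, 13), (4, 19), (4, 25), (4, 31)]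

theorem irrCodes_spec : ∀ x ∈ irrCodes, 0 < x.1 ∧ x.1 ≤ 4 ∧ 0 < x.2 ∧ x.2 < 2 ^ (x.1 + 1) ∧
    IrrCode x.1 x.2 := by
  decide +kernel

/-- Codes of binary quintics without factors of degree at most two. -/
def quintics : List ℕ := [37, 41, 47, 55, 59, 61]

theorem quintics_spec : ∀ H < 64, H ∈ quintics ∨ (∃ q < 32, clmul 2 1 q = H) ∨
    (∃ q < 32, clmul 2 2 q = H) ∨ (∃ q < 32, clmul 2 3 q = H) ∨ ∃ q < 16, clmul 3 7 q = H := by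
  decide +kernel

theorem xor_notMem_quintics : ∀ F ∈ quintics, ∀ G ∈ quintics, F ^^^ G ∉ quintics := by
  decide +kernel

/-- For quintics `F` and `G`, a form of degree `d` dividing a norm. -/
def quinticTable : List (ℕ × ℕ × ℕ × ℕ × ℕ × ℕ) :=
  [(37, 37, 2, 7, 2, 37), (37, 41, 3, 13, 4, 97), (37, 47, 3, 11, 6, 91), (37, 55, 2, 7, 2, 35),
    (37, 59, 4, 25, 4, 55), (37, 61, 3, 11, 2, 25), (41, 37, 3, 11, 6, 69), (41, 41, 2, 7, 2, 41),
    (41, 47, 3, 11, 2, 31), (41, 55, 4, 19, 12, 137), (41, 59, 2, 7, 2, 47),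
    (41, 61, 3, 13, 4, 117), (47, 37, 3, 13, 2, 19), (47, 41, 4, 25, 14, 247),
    (47, 47, 2, 7, 2, 47), (47, 55, 3, 11, 4, 81), (47, 59, 3, 11, 2, 31), (47, 61, 2, 7, 2, 41),
    (55, 37, 2, 7, 2, 49), (55, 41, 3, 11, 6, 117), (55, 47, 4, 31, 4, 37), (55, 55, 2, 7, 2, 55),
    (55, 59, 3, 13, 6, 73), (55, 61, 3, 11, 4, 103), (59, 37, 3, 11, 4, 127),
    (59, 41, 2, 7, 2, 61), (59, 47, 3, 13, 2, 25), (59, 55, 3, 11, 2, 19), (59, 59, 2, 7, 2, 59),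
    (59, 61, 4, 31, 8, 143), (61, 37, 4, 19, 10, 241), (61, 41, 3, 11, 4, 115),
    (61, 47, 2, 7, 2, 59), (61, 55, 3, 13, 6, 81), (61, 59, 3, 11, 6, 103), (61, 61, 2, 7, 2, 61)]

theorem quinticTable_spec : ∀ F ∈ quintics, ∀ G ∈ quintics, ∃ e ∈ quinticTable, e.1 = F ∧
    e.2.1 = G ∧ (e.2.2.1, e.2.2.2.1) ∈ irrCodes ∧ e.2.2.2.2.1 < 2 ^ e.2.2.1 ∧
    e.2.2.2.2.2 < 2 ^ (e.2.2.1 + 4) ∧ G ^^^ clmul 8 (clmul 4 e.2.2.2.2.1 (e.2.2.2.2.1 ^^^ 1)) F =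
    clmul 5 e.2.2.2.1 e.2.2.2.2.2 := by
  decide +kernel

theorem clmul_lt : ∀ u < 16, clmul 4 u (u ^^^ 1) < 2 ^ 8 := by
  decide +kernel

variable {K : Type} [Field K] [Algebra (ZMod 2) K] {V : ℤ → Submodule (ZMod 2) K}

namespace Cox

variable (C : Cox V)
include C

theorem eq_zero_or_eq_zero {d n k : ℤ} {M x y R : K} (hM : Irr V d M) (hz : len V (n - d) = 0)
    (hx : x ∈ V n) (hy : y ∈ V n) (hR : R ∈ V k) (hk : d + k = 2 * n) (h : x * y = M * R) :
    x = 0 ∨ y = 0 := by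
  have hd : HDvd V d M (2 * n) (x * y) := ⟨R, by rwa [show 2 * n - d = k by omega], h⟩
  rcases C.dvd_or_dvd hM hx hy (two_mul n).symm hd with ⟨g, hg, rfl⟩ | ⟨g, hg, rfl⟩
  · exact Or.inl (by rw [C.eq_zero hz hg, mul_zero])
  · exact Or.inr (by rw [C.eq_zero hz hg, mul_zero])

theorem irr_form (h1 : len V 1 = 0) (h2 : len V 2 = 2) (h3 : len V 3 = 0) {a b : K} (ha : a ∈ V 2)
    (hb : b ∈ V 2) (hb0 : b ≠ 0) (hτ : Transcendental (ZMod 2) (a / b)) {d m : ℕ}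
    (h : (d, m) ∈ irrCodes) : Irr V (2 * d) (form a b d m) := by
  obtain ⟨s1, s2, s3, s4, s5⟩ := irrCodes_spec _ h
  dsimp only at s1 s2 s3 s4 s5
  have f0 : form a b d m ≠ 0 := fun h => s3.ne' (form_eq_zero hb0 hτ h)
  refine ⟨C.form_mem ha hb hb0 d (by ring) s4, f0, by omega, fun i hi hid g hg k hk hgk => ?_⟩
  have g0 : g ≠ 0 := fun e => f0 (by rw [hgk, e, zero_mul])
  have k0 : k ≠ 0 := fun e => f0 (by rw [hgk, e, mul_zero])
  rcases Int.even_or_odd' i with ⟨j, rfl | rfl⟩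
  · have h4 := C.len_four
    have h6 := C.len_six
    have key : ∀ n : ℕ, 0 < n → n < d → len V (n * 2) ≤ n + 1 := by
      intro n hn hnd
      obtain rfl | rfl | rfl : n = 1 ∨ n = 2 ∨ n = 3 := by omega
      · exact h2.le
      · norm_num; omega
      · norm_num; omega
    lift j to ℕ using by omega
    obtain ⟨p, hp, rfl⟩ := C.exists_form ha hb hb0 hτ j (mul_comm _ _)
      (by rw [mul_comm]; exact key j (by omega) (by omega)) hg
    obtain ⟨q, hq, rfl⟩ := C.exists_form ha hb hb0 hτ (d - j)
      (by push_cast [Nat.cast_sub (show j ≤ d by omega)]; ring)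
      (by
        have := key (d - j) (by omega) (by omega)
        rwa [show ((d - j : ℕ) : ℤ) * 2 = 2 * d - 2 * j by
          push_cast [Nat.cast_sub (show j ≤ d by omega)]; ring] at this) hk
    rw [← form_clmul (j + 1) hp (show j + (d - j) = d by omega)] at hgk
    exact s5 j (by omega) (by omega) p hp q hq (form_inj hb0 hτ hgk).symm
  · have hodd : ∀ n : ℤ, n = 1 ∨ n = 3 → ∀ x ∈ V n, x = 0 := by
      rintro n (rfl | rfl) x hx
      · exact C.eq_zero h1 hx
      · exact C.eq_zero h3 hx
    obtain hj | hj : (2 * j + 1 = 1 ∨ 2 * j + 1 = 3) ∨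
        (2 * d - (2 * j + 1) = 1 ∨ 2 * d - (2 * j + 1) = 3) := by omega
    · exact g0 (hodd _ hj g hg)
    · exact k0 (hodd _ hj k hk)

theorem mem_quintics (h1 : len V 1 = 0) (h2 : len V 2 = 2) (h3 : len V 3 = 0) {a b : K}
    (ha : a ∈ V 2) (hb : b ∈ V 2) (hb0 : b ≠ 0) (hτ : Transcendental (ZMod 2) (a / b)) {x y : K}
    (hx : x ∈ V 5) (hy : y ∈ V 5) (hx0 : x ≠ 0) (hy0 : y ≠ 0) {H : ℕ} (hH : H < 64)
    (h : x * y = form a b 5 H) : H ∈ quintics := by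
  rcases quintics_spec H hH with h' | h'
  · exact h'
  have key : ∀ d m q : ℕ, (d, m) ∈ irrCodes → (hd : d = 1 ∨ d = 2) → q < 2 ^ (5 - d + 1) →
      clmul (d + 1) m q = H → False := by
    intro d m q hdm hd hq hm
    have hI := C.irr_form h1 h2 h3 ha hb hb0 hτ hdm
    rw [← hm, form_clmul _ (irrCodes_spec _ hdm).2.2.2.1 (show d + (5 - d) = 5 by omega)] at h
    have hz : len V (5 - 2 * d) = 0 := by
      rcases hd with rfl | rfl
      · exact h3
      · exact h1
    rcases C.eq_zero_or_eq_zero hI hz hx hy (C.form_mem ha hb hb0 (5 - d) rfl hq)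
      (by rcases hd with rfl | rfl <;> norm_num) h with h | h
    · exact hx0 h
    · exact hy0 h
  obtain ⟨q, hq, hm⟩ | ⟨q, hq, hm⟩ | ⟨q, hq, hm⟩ | ⟨q, hq, hm⟩ := h'
  · exact (key 1 1 q (by decide) (by simp) hq hm).elim
  · exact (key 1 2 q (by decide) (by simp) hq hm).elim
  · exact (key 1 3 q (by decide) (by simp) hq hm).elim
  · exact (key 2 7 q (by decide) (by simp) hq hm).elim

theorem irr_five (h1 : len V 1 = 0) (h3 : len V 3 = 0) {s : K} (hs : s ∈ V 5) (h0 : s ≠ 0) :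
    Irr V 5 s := by
  refine ⟨hs, h0, by norm_num, fun i hi hi5 g hg k hk hgk => h0 ?_⟩
  obtain rfl | rfl | rfl | rfl : i = 1 ∨ i = 2 ∨ i = 3 ∨ i = 4 := by omega
  · rw [hgk, C.eq_zero h1 hg, zero_mul]
  · rw [hgk, C.eq_zero h3 hk, mul_zero]
  · rw [hgk, C.eq_zero h3 hg, zero_mul]
  · rw [hgk, C.eq_zero h1 hk, mul_zero]

/-- There is no hyperelliptic curve of the given kind. -/
theorem false_of_pencil_two [Genus4 (ZMod 2) K] (h1 : len V 1 = 0) (h2 : len V 2 = 2)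
    (h3 : len V 3 = 0) : False := by
  have h5 := C.len_five
  have h10 : len V 10 = 7 := by
    have := C.len_large (n := 10) (by norm_num)
    omega
  obtain ⟨b, hb, hb0⟩ := C.exists_ne_zero (n := 2) (by omega)
  obtain ⟨a, ha, ha0, hab⟩ := C.exists_ne_ne (n := 2) (by omega) b
  have hτ : Transcendental (ZMod 2) (a / b) := transcendental_of_ne (div_ne_zero ha0 hb0)
    fun h => hab (by field_simp at h; exact h)
  have dep : ∀ x ∈ V 10, ∀ y ∈ V 10, ∃ c G : ℕ, c < 4 ∧ G < 64 ∧ (c = 0 → 0 < G) ∧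
      lin c [x, y] = form a b 5 G := by
    intro x hx y hy
    obtain ⟨c, hc0, hc, h⟩ := C.exists_dep (n := 10) (monomials a b 5 ++ [x, y]) (by
      intro v hv
      rcases List.mem_append.1 hv with hv | hv
      · exact C.monomials_mem ha hb hb0 5 (by norm_num) v hv
      · simp only [List.mem_cons, List.not_mem_nil, or_false] at hv
        rcases hv with rfl | rfl
        · exact hx
        · exact hy) (by rw [List.length_append, length_monomials, h10]; simp)
    have hc' : c < 256 := by simpa [length_monomials] using hc
    have e : c = c % 64 + 2 ^ (monomials a b 5).length * (c / 64) := by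
      rw [length_monomials]; omega
    rw [e, lin_append _ _ _ _ (by rw [length_monomials]; omega), lin_monomials (by omega)] at h
    exact ⟨c / 64, c % 64, by omega, by omega, by omega, by
      linear_combination h - form a b 5 (c % 64) * two_eq_zero K⟩
  obtain ⟨y, hy, hy0⟩ := C.exists_ne_zero (n := 5) (by omega)
  obtain ⟨x, hx, hx0, hxy⟩ := C.exists_ne_ne (n := 5) (by omega) y
  have sq : ∀ u v : K, (u + v) * (u + v) = u * u + v * v := fun u v => by
    linear_combination u * v * two_eq_zero K
  obtain ⟨s, hs, hs0, F, hF, hsF⟩ : ∃ s ∈ V 5, s ≠ 0 ∧ ∃ F < 64, s * s = form a b 5 F := by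
    obtain ⟨c, F, hc, hF, hcF, h⟩ := dep (x * x) (C.mul hx hx) (y * y) (C.mul hy hy)
    have hxy' : x + y ≠ 0 := fun h => hxy (by linear_combination h - y * two_eq_zero K)
    interval_cases c
    · have := form_eq_zero hb0 hτ (show form a b 5 F = 0 by rw [← h]; simp [lin])
      have := hcF rfl
      omega
    · exact ⟨x, hx, hx0, F, hF, by rw [← h]; simp [lin]⟩
    · exact ⟨y, hy, hy0, F, hF, by rw [← h]; simp [lin]⟩
    · exact ⟨x + y, add_mem hx hy, hxy', F, hF, by rw [sq, ← h]; simp [lin]⟩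
  obtain ⟨t, ht, ht0, hts⟩ := C.exists_ne_ne (n := 5) (by omega) s
  have hst : s + t ≠ 0 := fun h => hts (by linear_combination h - s * two_eq_zero K)
  have quin := fun {x y : K} (hx : x ∈ V 5) (hy : y ∈ V 5) =>
    C.mem_quintics h1 h2 h3 ha hb hb0 hτ hx hy
  have hF' := quin hs hs hs0 hs0 hF hsF
  obtain ⟨c, G, hc, hG, hcG, h⟩ := dep (s * t) (C.mul hs ht) (t * t) (C.mul ht ht)
  have hGF : F ^^^ G < 64 := Nat.xor_lt_two_pow (n := 6) hF hG
  interval_cases c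
  · have := form_eq_zero hb0 hτ (show form a b 5 G = 0 by rw [← h]; simp [lin])
    have := hcG rfl
    omega
  · have e : s * t = form a b 5 G := by rw [← h]; simp [lin]
    exact xor_notMem_quintics F hF' G (quin hs ht hs0 ht0 hG e)
      (quin hs (add_mem hs ht) hs0 hst hGF (by rw [form_xor, ← hsF, ← e, mul_add]))
  · have e : t * t = form a b 5 G := by rw [← h]; simp [lin]
    exact xor_notMem_quintics F hF' G (quin ht ht ht0 ht0 hG e)
      (quin (add_mem hs ht) (add_mem hs ht) hst hst hGF (by rw [form_xor, ← hsF, ← e, sq]))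
  have e : t * (s + t) = form a b 5 G := by rw [← h]; simp [lin]; ring
  have hG' := quin ht (add_mem hs ht) ht0 hst hG e
  obtain ⟨⟨F, G, d, m, u, q⟩, -, rfl, rfl, hdm, hu, hq, hid⟩ := quinticTable_spec F hF' G hG'
  dsimp only at hF hG hs hsF hF' h hG' e hGF hdm hu hq hid
  obtain ⟨d1, d2, m1, m2, -⟩ := irrCodes_spec _ hdm
  dsimp only at d1 d2 m1 m2
  obtain ⟨r, rfl⟩ : ∃ r, d = r + 1 := ⟨d - 1, by omega⟩
  have hU := C.form_mem ha hb hb0 r (n := 2 * r) (by ring) hu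
  have hB := C.pow_mem' hb r (k := 2 * r) (by ring)
  have hu16 : u < 16 := hu.trans_le (Nat.pow_le_pow_right two_pos d2 : 2 ^ (r + 1) ≤ 2 ^ 4)
  have key : (b ^ r * t + form a b r u * s) * (b ^ r * t + form a b r u * s + b ^ r * s) =
      form a b (r + 1) m * form a b (r + 4) q := by
    have := congrArg (form a b (r + r + 5)) hid
    rw [form_xor, form_clmul 8 (clmul_lt u hu16) (show r + r + 5 = r + r + 5 from rfl),
      form_clmul 4 (k := r) (l := r) hu16 rfl, form_xor, form_one,
      form_clmul (k := r + 1) (l := r + 4) 5 (m2.trans_le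
        (Nat.pow_le_pow_right two_pos (by omega) : 2 ^ (r + 1 + 1) ≤ 2 ^ 5))
        (by ring)] at this
    rw [← this, ← hsF, show form a b (r + r + 5) G = b ^ r * b ^ r * form a b 5 G by
      rw [form, form]; ring, ← e]
    linear_combination form a b r u * s * t * b ^ r * two_eq_zero K
  have hI := C.irr_form h1 h2 h3 ha hb hb0 hτ hdm
  have h5' := C.irr_five h1 h3 hs hs0
  have hX : b ^ r * t + form a b r u * s ∈ V (2 * r + 5) :=
    add_mem (C.mul hB ht) (C.mul hU hs)
  have hBt : HDvd V 5 s (2 * r + 5) (b ^ r * t) := by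
    rw [HDvd, add_sub_cancel_right]
    have hz : len V (2 * r + 5 - 2 * (r + 1 : ℕ)) = 0 := by
      rwa [show (2 * r + 5 - 2 * (r + 1 : ℕ) : ℤ) = 3 by push_cast; ring]
    rcases C.eq_zero_or_eq_zero hI hz hX (add_mem hX (C.mul hB hs))
      (C.form_mem ha hb hb0 (r + 4) rfl hq) (by push_cast; ring) key with h | h
    · exact ⟨form a b r u, hU, by linear_combination h - form a b r u * s * two_eq_zero K⟩
    · exact ⟨form a b r u + b ^ r, add_mem hU hB, by
        linear_combination h - (form a b r u + b ^ r) * s * two_eq_zero K⟩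
  rcases C.dvd_or_dvd h5' hB ht rfl hBt with h | h
  · have hb' : HDvd V 5 s 2 b := by
      rcases Nat.eq_zero_or_pos r with rfl | hr
      · obtain ⟨g, hg, h⟩ := h
        rw [C.neg _ (by norm_num), Submodule.mem_bot] at hg
        simp [hg] at h
      · exact C.hdvd_of_pow h5' hb r (by ring) hr h
    obtain ⟨g, hg, rfl⟩ := hb'
    rw [C.neg _ (by norm_num), Submodule.mem_bot] at hg
    exact hb0 (by rw [hg, mul_zero])
  · exact hts (C.eq_of_hdvd ht0 h)

end Cox

end Hyperelliptic

section Cone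

variable {K : Type} [Field K] {a b : K}

theorem form_two_pow (hb : b ≠ 0) (k : ℕ) : form a b k (2 ^ k) = a ^ k := by
  induction k with
  | zero => simp [form]
  | succ k ih => rw [pow_succ, mul_comm, form_succ_double hb, ih, pow_succ, mul_comm]

variable [Algebra (ZMod 2) K] {V : ℤ → Submodule (ZMod 2) K}

/-- The sum of the first `k` binary digits. -/
def bitSum : ℕ → ℕ → ℕ
  | 0, _ => 0
  | k + 1, p => p % 2 + bitSum k (p / 2)

theorem pe_one_left {κ : Type*} [CommRing κ] (k p : ℕ) (hp : p < 2 ^ k) :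
    pe (1 : κ) p = (bitSum k p : ℕ) := by
  induction k generalizing p with
  | zero =>
    obtain rfl : p = 0 := by simpa using hp
    simp [bitSum]
  | succ k ih =>
    rw [pe_eq, ih _ (by rw [pow_succ] at hp; omega), bitSum]
    push_cast
    ring

theorem Ev.pow (C : Cox V) {d : ℤ} {f : K} {κ : Type} [Field κ] {ev : ℤ → K → κ}
    (E : Ev V d f κ ev) {e : ℤ} (hb : b ∈ V e) (k : ℕ) {n : ℤ} (hn : k * e = n) :
    ev n (b ^ k) = ev e b ^ k := by
  subst hn
  induction k with
  | zero => simpa using E.one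
  | succ k ih =>
    rw [pow_succ, E.mul' (C.pow_mem' hb k rfl) hb (by push_cast; ring), ih, pow_succ]

theorem Ev.form (C : Cox V) {d : ℤ} {f : K} {κ : Type} [Field κ] {ev : ℤ → K → κ}
    (E : Ev V d f κ ev) {e : ℤ} (ha : a ∈ V e) (hb : b ∈ V e) (hb0 : b ≠ 0) (hβ : ev e b ≠ 0)
    (k : ℕ) {n : ℤ} (hn : k * e = n) {p : ℕ} (hp : p < 2 ^ (k + 1)) :
    ev n (form a b k p) = ev e b ^ k * pe (ev e a / ev e b) p := by
  subst hn
  induction k generalizing p with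
  | zero =>
    obtain rfl | rfl : p = 0 ∨ p = 1 := by omega
    · simp [E.zero]
    · simpa [CFF.form] using E.one
  | succ k ih =>
    have h1 : p / 2 < 2 ^ (k + 1) := by rw [pow_succ] at hp; omega
    have m1 := C.form_mem ha hb hb0 k rfl h1
    have h3 : CFF.form a b (k + 1) p = a * CFF.form a b k (p / 2) + (p % 2 : ℕ) * b ^ (k + 1) := by
      conv_lhs => rw [CFF.form, pe_eq]
      rw [CFF.form, pow_succ]
      field_simp
      ring
    have m2 : ∀ j : ℕ, (j : K) * b ^ (k + 1) ∈ V (((k + 1 : ℕ) : ℤ) * e) := fun j => by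
      have h := nsmul_mem (C.pow_mem' hb (k + 1) rfl) j
      rwa [nsmul_eq_mul] at h
    rw [h3, E.add _ _ (C.mul' ha m1 (by push_cast; ring)) _ (m2 _),
      E.mul' ha m1 (by push_cast; ring), ih h1, pe_eq _ p]
    have h4 : ev (((k + 1 : ℕ) : ℤ) * e) ((p % 2 : ℕ) * b ^ (k + 1)) =
        (p % 2 : ℕ) * ev e b ^ (k + 1) := by
      rcases Nat.mod_two_eq_zero_or_one p with h | h
      · simp [h, E.zero]
      · simp only [h, Nat.cast_one, one_mul]
        exact E.pow C hb (k + 1) rfl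
    rw [h4, pow_succ]
    field_simp
    ring

/-- Evaluation of binary forms of degree one at a point vanishing exactly at `D`. -/
structure PointEval (V : ℤ → Submodule (ZMod 2) K) (a b : K) (D : ℕ → ℕ → Prop) (L c : K)
    (κ : Type) [Field κ] (f : ℤ → K → κ) : Prop where
  card : Nat.card κ = 2 ^ 3
  two : (2 : κ) = 0
  left : L ∈ V 3
  right : c ∈ V 3
  hom : Ev V 3 L κ f
  ne : f 3 c ≠ 0
  forms : ∀ k p : ℕ, ∀ n : ℤ, k * 3 = n → p < 2 ^ (k + 1) →
    (D k p ∧ f n (form a b k p) = 0) ∨ (¬ D k p ∧ f n (form a b k p) = f 3 c ^ k)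

/-- Vanishing of the form with code `p` at the three rational points. -/
def vanishing : List (ℕ → ℕ → Prop) :=
  [fun _ p => p % 2 = 0, fun k p => p < 2 ^ k, fun k p => bitSum (k + 1) p % 2 = 0]

/-- A pencil of degree three. -/
structure Pencil (V : ℤ → Submodule (ZMod 2) K) (a b : K) : Prop where
  one : len V 1 = 0
  two : len V 2 = 0
  three : len V 3 = 2
  left : a ∈ V 3
  right : b ∈ V 3
  left_ne : a ≠ 0
  right_ne : b ≠ 0
  transc : Transcendental (ZMod 2) (a / b)

namespace Pencil

variable (P : Pencil V a b) (C : Cox V)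

include P in
theorem ne : a ≠ b := fun h => P.transc (by
  rw [h, div_self P.right_ne]; exact isAlgebraic_one)

include C in
theorem ev_ne {x y : K} (hy : y ∈ V 3) (hy0 : y ≠ 0) (hxy : x ≠ y) {κ : Type}
    [Field κ] {ev : ℤ → K → κ} (E : Ev V 3 x κ ev) : ev 3 y ≠ 0 := fun h =>
  hxy (C.eq_of_hdvd hy0 ((E.zero_iff 3 y hy).1 h)).symm

include P C

theorem irr {x : K} (hx : x ∈ V 3) (hx0 : x ≠ 0) : Irr V 3 x := by
  refine ⟨hx, hx0, by norm_num, fun i hi hi3 g hg k hk hgk => hx0 ?_⟩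
  obtain rfl | rfl : i = 1 ∨ i = 2 := by omega
  · rw [hgk, C.eq_zero P.one hg, zero_mul]
  · rw [hgk, C.eq_zero P.one hk, mul_zero]

theorem exists_pointEval (D : ℕ → ℕ → Prop) (hD : D ∈ vanishing) : ∃ (L c : K) (κ : Type)
    (_ : Field κ) (ev : ℤ → K → κ), PointEval V a b D L c κ ev := by
  have hab := P.ne
  simp only [vanishing, List.mem_cons, List.not_mem_nil, or_false] at hD
  rcases hD with rfl | rfl | rfl
  · obtain ⟨κ, _, ev, hc, E, h2⟩ := C.exists_point (P.irr C P.left P.left_ne)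
    have hβ := ev_ne C P.right P.right_ne hab E
    have h0 : ev 3 a = 0 := (E.zero_iff 3 a P.left).2
      ⟨1, by simpa using C.one_mem, by rw [mul_one]⟩
    refine ⟨a, b, κ, _, ev, hc, h2, P.left, P.right, E, hβ, fun k p n hn hp => ?_⟩
    rw [E.form C P.left P.right P.right_ne hβ k hn hp, h0, zero_div, pe_eq]
    rcases Nat.mod_two_eq_zero_or_one p with h | h <;> simp [h]
  · obtain ⟨κ, _, ev, hc, E, h2⟩ := C.exists_point (P.irr C P.right P.right_ne)
    have hβ := ev_ne C P.left P.left_ne hab.symm E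
    have h0 : ev 3 b = 0 := (E.zero_iff 3 b P.right).2
      ⟨1, by simpa using C.one_mem, by rw [mul_one]⟩
    have key : ∀ k p : ℕ, ∀ n : ℤ, k * 3 = n → p < 2 ^ k → ev n (form a b k p) = 0 := by
      intro k p n hn hp
      obtain _ | k := k
      · obtain rfl : p = 0 := by simpa using hp
        simp [E.zero]
      · rw [form_succ, E.mul' P.right (C.form_mem P.left P.right P.right_ne k rfl hp)
          (by rw [← hn]; push_cast; ring), h0, zero_mul]
    refine ⟨b, a, κ, _, ev, hc, h2, P.right, P.left, E, hβ, fun k p n hn hp => ?_⟩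
    by_cases h : p < 2 ^ k
    · exact Or.inl ⟨h, key k p n hn h⟩
    · refine Or.inr ⟨h, ?_⟩
      have hp' : p ^^^ 2 ^ k < 2 ^ k := by
        have h1 : p / 2 ^ k = 1 := by
          rw [pow_succ] at hp
          exact Nat.div_eq_of_lt_le (by omega) (by omega)
        have h2 := Nat.xor_div_two_pow (a := p) (b := 2 ^ k) (n := k)
        rw [h1, Nat.div_self (by positivity), Nat.xor_self] at h2
        exact (Nat.div_eq_zero_iff_lt (by positivity)).1 h2
      have e : p = (p ^^^ 2 ^ k) ^^^ 2 ^ k := by rw [Nat.xor_assoc, Nat.xor_self, Nat.xor_zero]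
      rw [e, form_xor, form_two_pow P.right_ne,
        E.add _ _ (C.form_mem P.left P.right P.right_ne k hn (hp'.trans_le (by
            rw [pow_succ]; omega))) _
          (C.pow_mem' P.left k hn), key k _ n hn hp', zero_add, E.pow C P.left k hn]
  · have hab0 : a + b ≠ 0 := fun h => hab (by linear_combination h - b * two_eq_zero K)
    have m := add_mem P.left P.right
    obtain ⟨κ, _, ev, hc, E, h2⟩ := C.exists_point (P.irr C m hab0)
    have hβ := ev_ne C P.right P.right_ne (by simpa using P.left_ne) E
    have h0 : ev 3 a + ev 3 b = 0 := by
      rw [← E.add 3 a P.left b P.right, E.zero_iff 3 _ m]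
      exact ⟨1, by simpa using C.one_mem, by rw [mul_one]⟩
    have h1 : ev 3 a / ev 3 b = 1 := by
      rw [div_eq_one_iff_eq hβ]
      linear_combination h0 - ev 3 b * h2
    refine ⟨a + b, b, κ, _, ev, hc, h2, m, P.right, E, hβ, fun k p n hn hp => ?_⟩
    rw [E.form C P.left P.right P.right_ne hβ k hn hp, h1, pe_one_left _ _ hp, ← cast_mod_two h2]
    rcases Nat.mod_two_eq_zero_or_one (bitSum (k + 1) p) with h | h <;> simp [h]

end Pencil

end Cone

section TrigonalCone

theorem clmul_lt_eight : ∀ p < 4, ∀ q < 4, clmul 2 p q < 8 := by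
  decide +kernel

theorem clmul_sq_lt : ∀ p < 8, clmul 3 p p < 32 ∧ ∀ q < 32, clmul 3 p q < 128 := by
  decide +kernel

theorem irr_codes : (∀ p < 4, ∀ q < 4, clmul 2 p q ≠ 7) ∧
    ∀ p < 4, ∀ q < 8, clmul 2 p q ≠ 11 ∧ clmul 2 p q ≠ 13 := by
  decide +kernel

/-- Codes of quartic forms without rational zeros. -/
def pointlessQuartics : List ℕ := [19, 21, 25, 31]

/-- Codes of sextic forms without rational zeros. -/
def pointlessSextics : List ℕ :=
  [67, 69, 73, 79, 81, 87, 91, 93, 97, 103, 107, 109, 115, 117, 121, 127]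

theorem mem_pointlessQuartics : ∀ F < 32,
    F % 2 = 0 ∨ F < 16 ∨ bitSum 5 F % 2 = 0 ∨ F ∈ pointlessQuartics := by
  decide +kernel

theorem mem_pointlessSextics : ∀ F < 128,
    F % 2 = 0 ∨ F < 64 ∨ bitSum 7 F % 2 = 0 ∨ F ∈ pointlessSextics := by
  decide +kernel

/-- A binary form of small degree dividing a norm. -/
theorem exists_factor : ∀ F ∈ pointlessQuartics, ∀ G ∈ pointlessSextics, ∃ S < 8,
    (∃ q < 32, clmul 3 S (clmul 3 S S ^^^ F) ^^^ G = clmul 3 7 q) ∨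
    (∃ q < 16, clmul 3 S (clmul 3 S S ^^^ F) ^^^ G = clmul 4 11 q) ∨
    ∃ q < 16, clmul 3 S (clmul 3 S S ^^^ F) ^^^ G = clmul 4 13 q := by
  decide +kernel

variable {K : Type} [Field K] [Algebra (ZMod 2) K] {V : ℤ → Submodule (ZMod 2) K} {a b : K}

/-- An element of degree six which is not a binary form. -/
structure Pencil.Third (V : ℤ → Submodule (ZMod 2) K) (a b w : K) : Prop where
  mem : w ∈ V 6
  ne : ∀ p < 8, w ≠ form a b 2 p

namespace Pencil

variable (P : Pencil V a b) (C : Cox V)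
include P C

theorem exists_form_one {x : K} (hx : x ∈ V 3) : ∃ p < 4, x = form a b 1 p :=
  C.exists_form P.left P.right P.right_ne P.transc 1 (by norm_num) (by rw [P.three]) hx

theorem exists_form_two {x y : K} (hx : x ∈ V 3) (hy : y ∈ V 3) :
    ∃ p < 8, x * y = form a b 2 p := by
  obtain ⟨p, hp, rfl⟩ := P.exists_form_one C hx
  obtain ⟨q, hq, rfl⟩ := P.exists_form_one C hy
  exact ⟨_, clmul_lt_eight p hp q hq, (form_clmul 2 hp rfl).symm⟩

theorem form_mem (k : ℕ) {n : ℤ} (hn : k * 3 = n) {p : ℕ} (hp : p < 2 ^ (k + 1)) :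
    form a b k p ∈ V n :=
  C.form_mem P.left P.right P.right_ne k hn hp

variable {w : K} (T : Third V a b w)
include T

theorem Third.add {q : ℕ} (hq : q < 8) : Third V a b (w + form a b 2 q) := by
  refine ⟨add_mem T.mem (P.form_mem C 2 (by norm_num) hq), fun p hp h => ?_⟩
  refine T.ne (p ^^^ q) (Nat.xor_lt_two_pow (n := 3) hp hq) ?_
  rw [form_xor, ← h]
  linear_combination -form a b 2 q * two_eq_zero K

theorem pe_ne {D : ℕ → ℕ → Prop} {L c : K} {κ : Type} [Field κ] {ev : ℤ → K → κ}
    (E : PointEval V a b D L c κ ev) (p : ℕ) (h0 : 0 < p) (h8 : p < 8) :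
    pe (ev 6 w / ev 3 c ^ 2) p ≠ 0 := by
  have hc := E.ne
  have key : ∀ x ∈ V 3, ∀ y ∈ V 3, ev 6 (w + x * y) ≠ 0 := by
    intro x hx y hy h
    obtain ⟨q, hq, hxy⟩ := P.exists_form_two C hx hy
    have T' := T.add P C hq
    rw [← hxy] at T'
    obtain ⟨k, hk, h⟩ := (E.hom.zero_iff 6 _ T'.mem).1 h
    obtain ⟨p, hp, h'⟩ := P.exists_form_two C E.left hk
    exact T'.ne p hp (h.trans h')
  have h1 : ev 6 w ≠ 0 := by simpa using key 0 (zero_mem _) 0 (zero_mem _)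
  have h2 : ev 6 w + ev 3 c ^ 2 ≠ 0 := by
    rw [sq, ← E.hom.mul' E.right E.right (show (3 : ℤ) + 3 = 6 by norm_num),
      ← E.hom.add 6 _ T.mem _ (C.mul E.right E.right)]
    exact key c E.right c E.right
  refine pe_ne_zero (d := 3) E.two E.card _ 2 (fun p hp hp4 => ?_) (fun e he h => ?_) p h0 h8
  · have hdiv : ev 6 w / ev 3 c ^ 2 ≠ 0 := div_ne_zero h1 (pow_ne_zero _ hc)
    have p2 : pe (ev 6 w / ev 3 c ^ 2) 2 = ev 6 w / ev 3 c ^ 2 := by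
      rw [show (2 : ℕ) = 2 * 1 from rfl, pe_double, pe_one, mul_one]
    interval_cases p
    · simp
    · rwa [p2]
    · rw [show (3 : ℕ) = 2 ^^^ 1 from rfl, pe_xor _ E.two, p2, pe_one]
      intro h
      apply h2
      field_simp at h
      simpa using h
  · have := Nat.le_of_dvd (by norm_num) he
    interval_cases e
    · norm_num at he
    · rfl

theorem quadratic_free (p q r : ℕ) (h : pe (a / b) p * w ^ 2 + pe (a / b) q * (b ^ 2 * w) +
    pe (a / b) r * b ^ 4 = 0) : p = 0 ∧ q = 0 ∧ r = 0 := by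
  induction hn : p + q + r using Nat.strong_induction_on generalizing p q r with
  | _ n ih =>
  subst hn
  obtain ⟨L, c, κ, _, ev, E⟩ := P.exists_pointEval C (fun _ p => p % 2 = 0) (by simp [vanishing])
  have hc := E.ne
  obtain ⟨N, hN⟩ : ∃ N, p + q + r < N := exists_gt _
  have hlt : ∀ m, m ≤ p + q + r → m < 2 ^ (N + 1) := fun m hm =>
    Nat.lt_two_pow_self.trans_le (Nat.pow_le_pow_right two_pos (by omega))
  have hform : ∀ m, m ≤ p + q + r → ev (N * 3) (form a b N m) = (m % 2 : ℕ) * ev 3 c ^ N := by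
    intro m hm
    rcases E.forms N m _ rfl (hlt m hm) with ⟨h1, h2⟩ | ⟨h1, h2⟩
    · rw [h2, h1]; simp
    · rw [h2, Nat.mod_two_ne_zero.1 h1]; simp
  have hb : ∀ k : ℕ, ∀ n : ℤ, k * 3 = n → ev n (b ^ k) = ev 3 c ^ k := by
    intro k n hn
    rcases E.forms k 1 n hn (Nat.one_lt_two_pow (by omega)) with ⟨h1, -⟩ | ⟨-, h2⟩
    · simp at h1
    · rwa [form_one] at h2
  have m1 := C.mul' T.mem T.mem (show (6 : ℤ) + 6 = 12 by norm_num)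
  have m2 := C.mul' (C.pow_mem' P.right 2 (show _ = (6 : ℤ) by norm_num)) T.mem
    (show (6 : ℤ) + 6 = 12 by norm_num)
  have m3 := C.pow_mem' P.right 4 (show _ = (12 : ℤ) by norm_num)
  have f1 := P.form_mem C N rfl (hlt p (by omega))
  have f2 := P.form_mem C N rfl (hlt q (by omega))
  have f3 := P.form_mem C N rfl (hlt r (by omega))
  have e0 : form a b N p * (w * w) + form a b N q * (b ^ 2 * w) + form a b N r * b ^ 4 = 0 := by
    simp only [form]
    linear_combination b ^ N * h
  have e1 := congrArg (ev (N * 3 + 12)) e0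
  rw [E.hom.zero, E.hom.add _ _ (add_mem (C.mul f1 m1) (C.mul f2 m2)) _ (C.mul f3 m3),
    E.hom.add _ _ (C.mul f1 m1) _ (C.mul f2 m2), E.hom.mul _ _ _ f1 _ m1, E.hom.mul _ _ _ f2 _ m2,
    E.hom.mul _ _ _ f3 _ m3, hform p (by omega), hform q (by omega), hform r (by omega),
    E.hom.mul' T.mem T.mem (by norm_num),
    E.hom.mul' (C.pow_mem' P.right 2 (show _ = (6 : ℤ) by norm_num)) T.mem (by norm_num),
    hb 2 6 (by norm_num), hb 4 12 (by norm_num)] at e1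
  have e2 : pe (ev 6 w / ev 3 c ^ 2) (r % 2 + 2 * (q % 2 + 2 * (p % 2))) = 0 := by
    have a1 : (r % 2 + 2 * (q % 2 + 2 * (p % 2))) % 2 = r % 2 := by omega
    have a2 : (r % 2 + 2 * (q % 2 + 2 * (p % 2))) / 2 = q % 2 + 2 * (p % 2) := by omega
    have a3 : (q % 2 + 2 * (p % 2)) % 2 = q % 2 := by omega
    have a4 : (q % 2 + 2 * (p % 2)) / 2 = p % 2 := by omega
    rw [pe_eq, a1, a2, pe_eq, a3, a4, pe_eq, Nat.mod_mod,
      Nat.div_eq_of_lt (Nat.mod_lt p two_pos), pe_zero]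
    refine (mul_eq_zero.1 (?_ : ev 3 c ^ (N + 4) * _ = 0)).resolve_left (pow_ne_zero _ hc)
    have hω : ev 6 w = ev 6 w / ev 3 c ^ 2 * ev 3 c ^ 2 := by field_simp
    rw [hω] at e1
    linear_combination e1
  have e3 : r % 2 + 2 * (q % 2 + 2 * (p % 2)) = 0 := by
    by_contra h0
    exact P.pe_ne C T E _ (by omega) (by omega) e2
  have hp : p = 2 * (p / 2) := by omega
  have hq : q = 2 * (q / 2) := by omega
  have hr : r = 2 * (r / 2) := by omega
  by_cases h0 : p + q + r = 0
  · omega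
  · have h4 := ih (p / 2 + q / 2 + r / 2) (by omega) (p / 2) (q / 2) (r / 2) (by
      refine (mul_eq_zero.1 (?_ : a / b * _ = 0)).resolve_left (div_ne_zero P.left_ne P.right_ne)
      rw [← h, hp, hq, hr, pe_double, pe_double, pe_double]
      simp only [Nat.mul_div_cancel_left _ two_pos]
      ring) rfl
    omega

end Pencil

end TrigonalCone

section TrigonalConeEnd

variable {K : Type} [Field K] [Algebra (ZMod 2) K] {V : ℤ → Submodule (ZMod 2) K} {a b : K}

namespace Pencil

variable (P : Pencil V a b) (C : Cox V)
include P C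

theorem irr_quadratic : Irr V 6 (form a b 2 7) := by
  have f0 : form a b 2 7 ≠ 0 := fun h => by
    have := form_eq_zero P.right_ne P.transc h
    omega
  refine ⟨P.form_mem C 2 (by norm_num) (by norm_num), f0, by norm_num, fun i hi hi6 g hg k hk h => ?_⟩
  obtain rfl | rfl | rfl | rfl | rfl : i = 1 ∨ i = 2 ∨ i = 3 ∨ i = 4 ∨ i = 5 := by omega
  · exact f0 (by rw [h, C.eq_zero P.one hg, zero_mul])
  · exact f0 (by rw [h, C.eq_zero P.two hg, zero_mul])
  · obtain ⟨p, hp, rfl⟩ := P.exists_form_one C hg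
    obtain ⟨q, hq, rfl⟩ := P.exists_form_one C hk
    rw [← form_clmul 2 hp rfl] at h
    exact irr_codes.1 p hp q hq (form_inj P.right_ne P.transc h).symm
  · exact f0 (by rw [h, C.eq_zero P.two hk, mul_zero])
  · exact f0 (by rw [h, C.eq_zero P.one hk, mul_zero])

omit P C in
theorem pe_cubic_ne_zero {κ : Type} [Field κ] (h2 : (2 : κ) = 0) (hc : Nat.card κ = 2 ^ 4)
    (τ : κ) {m : ℕ} (hm : m = 11 ∨ m = 13) : pe τ m ≠ 0 := by
  intro h
  have : Finite κ := Nat.finite_of_card_ne_zero (by rw [hc]; norm_num)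
  have := Fintype.ofFinite κ
  have h16 : τ ^ 16 = τ := by
    have := FiniteField.pow_card τ
    rwa [← Nat.card_eq_fintype_card, hc] at this
  have h7 : τ ^ 7 = 1 := by
    rcases hm with rfl | rfl
    · have h : τ ^ 3 + τ + 1 = 0 := by
        rw [pe_eq, pe_eq, pe_eq, pe_eq] at h
        norm_num at h
        linear_combination h
      linear_combination (τ ^ 4 - τ ^ 2 - τ + 1) * h + (τ ^ 2 - 1) * h2
    · have h : τ ^ 3 + τ ^ 2 + 1 = 0 := by
        rw [pe_eq, pe_eq, pe_eq, pe_eq] at h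
        norm_num at h
        linear_combination h
      linear_combination (τ ^ 4 - τ ^ 3 + τ ^ 2 - 2 * τ + 3) * h + (τ - 2 - 2 * τ ^ 2) * h2
  have h1 : τ ^ 2 = τ := by linear_combination h16 - τ ^ 2 * (τ ^ 7 + 1) * h7
  have h1' : τ = 1 := by linear_combination h7 - (τ ^ 5 + τ ^ 4 + τ ^ 3 + τ ^ 2 + τ + 1) * h1
  rw [h1', pe_one_left 4 m (by omega)] at h
  rcases hm with rfl | rfl <;> norm_num [bitSum] at h <;>
    exact one_ne_zero (show (1 : κ) = 0 by linear_combination h - h2)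

variable {w : K} (T : Third V a b w)
include T

theorem exists_eq_add {x : K} (hx : x ∈ V 6) : ∃ p < 8, x = form a b 2 p ∨ x = w + form a b 2 p := by
  have hi : Indep (w :: monomials a b 2) :=
    Indep.cons add_self (indep_monomials P.right_ne P.transc 2) fun c hc => by
      rw [length_monomials] at hc
      rw [lin_monomials hc]
      exact (T.ne c hc).symm
  obtain ⟨c, hc, rfl⟩ := C.exists_eq_lin hi (n := 6) (by
      intro v hv
      rcases List.mem_cons.1 hv with rfl | hv
      · exact T.mem
      · exact C.monomials_mem P.left P.right P.right_ne 2 (by norm_num) v hv)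
    (by rw [List.length_cons, length_monomials, C.len_six]) hx
  rw [List.length_cons, length_monomials] at hc
  refine ⟨c / 2, by omega, ?_⟩
  rw [lin_cons, lin_monomials (by omega)]
  rcases Nat.mod_two_eq_zero_or_one c with h | h <;> simp [h]

theorem quadratic_ne {r t : ℕ} : w ^ 2 + form a b 2 r * w + form a b 4 t ≠ 0 := fun h => by
  have := P.quadratic_free C T 1 r t (by
    rw [pe_one]
    rw [form, form] at h
    linear_combination h)
  omega

theorem irr_cubic {m : ℕ} (hm : m = 11 ∨ m = 13) : Irr V 9 (form a b 3 m) := by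
  have f0 : form a b 3 m ≠ 0 := fun h => by
    have := form_eq_zero P.right_ne P.transc h
    omega
  have mem := P.form_mem C 3 (n := 9) (by norm_num) (p := m) (by omega)
  have three_six : ∀ g ∈ V 3, ∀ k ∈ V 6, form a b 3 m ≠ g * k := by
    intro g hg k hk h
    obtain ⟨p, hp, rfl⟩ := P.exists_form_one C hg
    obtain ⟨q, hq, rfl | rfl⟩ := P.exists_eq_add C T hk
    · rw [← form_clmul 2 hp rfl] at h
      have := irr_codes.2 p hp q hq
      have := form_inj P.right_ne P.transc h
      omega
    · have h' := P.quadratic_free C T 0 p (m ^^^ clmul 2 p q) (by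
        rw [pe_xor _ (two_eq_zero K), pe_clmul _ (two_eq_zero K) 2 p q hp, pe_zero]
        simp only [form] at h
        have hb := P.right_ne
        have h' : b ^ 3 * (pe (a / b) m * b ^ 4 + pe (a / b) p * pe (a / b) q * b ^ 4 +
            b ^ 2 * w * pe (a / b) p) = 0 := by
          linear_combination b ^ 4 * h + (b ^ 5 * pe (a / b) p * w +
            b ^ 7 * pe (a / b) p * pe (a / b) q) * two_eq_zero K
        have h'' := (mul_eq_zero.1 h').resolve_left (pow_ne_zero _ hb)
        linear_combination h'')
      obtain rfl : p = 0 := by omega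
      exact f0 (by rw [h, form_zero, zero_mul])
  have four_five : ∀ g ∈ V 4, ∀ k ∈ V 5, form a b 3 m ≠ g * k := by
    intro g hg k hk h
    have g0 : g ≠ 0 := fun e => f0 (by rw [h, e, zero_mul])
    have hI : Irr V 4 g := by
      refine ⟨hg, g0, by norm_num, fun i hi hi4 x hx y hy hxy => g0 ?_⟩
      obtain rfl | rfl | rfl : i = 1 ∨ i = 2 ∨ i = 3 := by omega
      · rw [hxy, C.eq_zero P.one hx, zero_mul]
      · rw [hxy, C.eq_zero P.two hx, zero_mul]
      · rw [hxy, C.eq_zero P.one hy, mul_zero]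
    obtain ⟨κ, _, ev, hc, E, h2⟩ := C.exists_point hI
    have hβ : ev 3 b ≠ 0 := fun hb => by
      obtain ⟨y, hy, hby⟩ := (E.zero_iff 3 b P.right).1 hb
      rw [C.neg _ (by norm_num), Submodule.mem_bot] at hy
      exact P.right_ne (by rw [hby, hy, mul_zero])
    have h0 := (E.zero_iff 9 _ mem).2 ⟨k, by norm_num; exact hk, h⟩
    rw [E.form C P.left P.right P.right_ne hβ 3 (by norm_num) (by omega)] at h0
    exact pe_cubic_ne_zero h2 hc _ hm ((mul_eq_zero.1 h0).resolve_left (pow_ne_zero _ hβ))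
  refine ⟨mem, f0, by norm_num, fun i hi hi9 g hg k hk h => ?_⟩
  obtain rfl | rfl | rfl | rfl | rfl | rfl | rfl | rfl : i = 1 ∨ i = 2 ∨ i = 3 ∨ i = 4 ∨ i = 5 ∨
    i = 6 ∨ i = 7 ∨ i = 8 := by omega
  · exact f0 (by rw [h, C.eq_zero P.one hg, zero_mul])
  · exact f0 (by rw [h, C.eq_zero P.two hg, zero_mul])
  · exact three_six g hg k (by norm_num at hk; exact hk) h
  · exact four_five g hg k (by norm_num at hk; exact hk) h
  · exact four_five k (by norm_num at hk; exact hk) g hg (by rw [h, mul_comm])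
  · exact three_six k (by norm_num at hk; exact hk) g hg (by rw [h, mul_comm])
  · exact f0 (by rw [h, C.eq_zero P.two hk, mul_zero])
  · exact f0 (by rw [h, C.eq_zero P.one hk, mul_zero])

theorem exists_cubic : ∃ q2 < 8, ∃ q4 < 32, ∃ q6 < 128,
    w ^ 3 + form a b 2 q2 * w ^ 2 + form a b 4 q4 * w + form a b 6 q6 = 0 := by
  have hlen : len V 18 = 15 := by
    have := C.len_large (n := 18) (by norm_num)
    omega
  have mon := fun (k : ℕ) {n : ℤ} (hn : k * 3 = n) => C.monomials_mem P.left P.right P.right_ne k hn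
  obtain ⟨c, hc0, hc, h⟩ := C.exists_dep (n := 18) (monomials a b 6 ++
      ((monomials a b 4).map (w * ·) ++ ((monomials a b 2).map (w ^ 2 * ·) ++ [w ^ 3]))) (by
    intro v hv
    simp only [List.mem_append, List.mem_map, List.mem_singleton] at hv
    rcases hv with hv | ⟨y, hy, rfl⟩ | ⟨y, hy, rfl⟩ | rfl
    · exact mon 6 (by norm_num) v hv
    · exact C.mul' T.mem (mon 4 rfl y hy) (by norm_num)
    · exact C.mul' (C.pow_mem' T.mem 2 rfl) (mon 2 rfl y hy) (by norm_num)
    · exact C.pow_mem' T.mem 3 (by norm_num)) (by simp [length_monomials, hlen])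
  have hc' : c < 65536 := by simpa [length_monomials] using hc
  have e : c = c % 128 + 2 ^ (monomials a b 6).length * (c / 128 % 32 +
      2 ^ ((monomials a b 4).map (w * ·)).length * (c / 4096 % 8 +
      2 ^ ((monomials a b 2).map (w ^ 2 * ·)).length * (c / 32768))) := by
    simp only [List.length_map, length_monomials]
    omega
  rw [e, lin_append _ _ _ _ (by rw [length_monomials]; omega),
    lin_append _ _ _ _ (by rw [List.length_map, length_monomials]; omega),
    lin_append _ _ _ _ (by rw [List.length_map, length_monomials]; omega), lin_smul, lin_smul,
    lin_monomials (by omega), lin_monomials (by omega), lin_monomials (by omega)] at h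
  obtain h0 | h1 : c / 32768 = 0 ∨ c / 32768 = 1 := by omega
  · rw [h0, lin_zero, add_zero] at h
    have hb := pow_ne_zero 2 P.right_ne
    have := P.quadratic_free C T (c / 4096 % 8) (c / 128 % 32) (c % 128) (by
      refine (mul_eq_zero.1 (?_ : b ^ 2 * _ = 0)).resolve_left hb
      simp only [form] at h
      linear_combination h)
    omega
  · refine ⟨c / 4096 % 8, by omega, c / 128 % 32, by omega, c % 128, by omega, ?_⟩
    rw [h1] at h
    simp [lin] at h
    linear_combination h

theorem codes_of_cubic {F G : ℕ} (hF : F < 32) (hG : G < 128)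
    (h : w ^ 3 + form a b 4 F * w + form a b 6 G = 0) :
    F ∈ pointlessQuartics ∧ G ∈ pointlessSextics := by
  have key : ∀ D ∈ vanishing, ¬ D 4 F ∧ ¬ D 6 G := by
    intro D hD
    obtain ⟨L, c, κ, _, ev, E⟩ := P.exists_pointEval C D hD
    have hc := E.ne
    have h2 := E.two
    have mF := P.form_mem C 4 (n := 12) (by norm_num) (p := F) hF
    have mG := P.form_mem C 6 (n := 18) (by norm_num) (p := G) hG
    have m3 := C.pow_mem' T.mem 3 (k := 18) (by norm_num)
    have m1 := C.mul' mF T.mem (show _ = (18 : ℤ) by norm_num)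
    have e := congrArg (ev 18) h
    rw [E.hom.zero, E.hom.add _ _ (add_mem m3 m1) _ mG, E.hom.add _ _ m3 _ m1,
      E.hom.pow C T.mem 3 (by norm_num), E.hom.mul' mF T.mem (by norm_num)] at e
    set ω := ev 6 w / ev 3 c ^ 2 with hω
    have hw : ev 6 w = ω * ev 3 c ^ 2 := by rw [hω]; field_simp
    have h6 := pow_ne_zero 6 hc
    have n2 := P.pe_ne C T E 2 (by norm_num) (by norm_num)
    have n3 := P.pe_ne C T E 3 (by norm_num) (by norm_num)
    have n5 := P.pe_ne C T E 5 (by norm_num) (by norm_num)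
    have n7 := P.pe_ne C T E 7 (by norm_num) (by norm_num)
    rw [← hω] at n2 n3 n5 n7
    have p2 : pe ω 2 = ω := by rw [pe_eq, pe_eq]; norm_num
    have p3 : pe ω 3 = 1 + ω := by rw [pe_eq, pe_eq]; norm_num
    have p5 : pe ω 5 = 1 + ω ^ 2 := by rw [pe_eq, pe_eq, pe_eq]; norm_num; ring
    have p7 : pe ω 7 = 1 + ω + ω ^ 2 := by rw [pe_eq, pe_eq, pe_eq]; norm_num; ring
    rw [p2] at n2
    rw [p3] at n3
    rw [p5] at n5
    rw [p7] at n7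
    rcases E.forms 4 F 12 (by norm_num) hF with ⟨d4, f4⟩ | ⟨d4, f4⟩ <;>
    rcases E.forms 6 G 18 (by norm_num) hG with ⟨d6, f6⟩ | ⟨d6, f6⟩ <;>
    rw [f4, f6, hw] at e
    · exact absurd (show ev 3 c ^ 6 * ω ^ 3 = 0 by linear_combination e)
        (mul_ne_zero h6 (pow_ne_zero _ n2))
    · exact absurd (show ev 3 c ^ 6 * ((1 + ω) * (1 + ω + ω ^ 2)) = 0 by
        linear_combination e + ev 3 c ^ 6 * (ω + ω ^ 2) * h2) (mul_ne_zero h6 (mul_ne_zero n3 n7))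
    · exact absurd (show ev 3 c ^ 6 * (ω * (1 + ω ^ 2)) = 0 by linear_combination e)
        (mul_ne_zero h6 (mul_ne_zero n2 n5))
    · exact ⟨d4, d6⟩
  simp only [vanishing, List.forall_mem_cons, List.not_mem_nil, false_implies, implies_true,
    and_true] at key
  obtain ⟨⟨k1, k2⟩, ⟨k3, k4⟩, k5, k6⟩ := key
  exact ⟨((mem_pointlessQuartics F hF).resolve_left k1 |>.resolve_left k3).resolve_left k5,
    ((mem_pointlessSextics G hG).resolve_left k2 |>.resolve_left k4).resolve_left k6⟩

theorem false_of_cubic {F G : ℕ} (hF : F < 32) (hG : G < 128)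
    (h : w ^ 3 + form a b 4 F * w + form a b 6 G = 0) : False := by
  obtain ⟨hF', hG'⟩ := P.codes_of_cubic C T hF hG h
  obtain ⟨S, hS, hfac⟩ := exists_factor F hF' G hG'
  have T' := T.add P C hS
  have hSS := (clmul_sq_lt S hS).1
  have hSF : clmul 3 S S ^^^ F < 32 := Nat.xor_lt_two_pow (n := 5) hSS hF
  have hq : w ^ 2 + form a b 2 S * w + form a b 4 (clmul 3 S S ^^^ F) ∈ V 12 :=
    add_mem (add_mem (C.pow_mem' T.mem 2 (by norm_num))
      (C.mul' (P.form_mem C 2 rfl hS) T.mem (by norm_num))) (P.form_mem C 4 (by norm_num) hSF)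
  have key : (w + form a b 2 S) *
      (w ^ 2 + form a b 2 S * w + form a b 4 (clmul 3 S S ^^^ F)) =
      form a b 6 (clmul 3 S (clmul 3 S S ^^^ F) ^^^ G) := by
    rw [form_xor 6, form_clmul 3 (k := 2) (l := 4) hS rfl, form_xor 4,
      form_clmul 3 (k := 2) (l := 2) hS rfl]
    linear_combination h + (form a b 2 S * w ^ 2 + form a b 2 S ^ 2 * w - form a b 6 G) *
      two_eq_zero K
  have h1 : ∀ t < 8, w + form a b 2 S ≠ form a b 2 t := T'.ne
  have h2 : ∀ r t, w ^ 2 + form a b 2 S * w + form a b 4 (clmul 3 S S ^^^ F) ≠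
      form a b 2 r * w + form a b 4 t := fun r t h' => by
    refine P.quadratic_ne C T (r := S ^^^ r) (t := clmul 3 S S ^^^ F ^^^ t) ?_
    rw [form_xor 2, form_xor 4]
    linear_combination h' + (form a b 2 r * w + form a b 4 t) * two_eq_zero K
  have hdvd : ∀ {d : ℤ} {M R : K}, Irr V d M → R ∈ V (18 - d) →
      form a b 6 (clmul 3 S (clmul 3 S S ^^^ F) ^^^ G) = M * R →
      HDvd V d M 6 (w + form a b 2 S) ∨
      HDvd V d M 12 (w ^ 2 + form a b 2 S * w + form a b 4 (clmul 3 S S ^^^ F)) :=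
    fun hM hR hMR => C.dvd_or_dvd hM T'.mem hq (show (6 : ℤ) + 12 = 18 by norm_num)
      ⟨_, hR, key.trans hMR⟩
  have cubic : ∀ m, m = 11 ∨ m = 13 → ∀ q < 16,
      clmul 3 S (clmul 3 S S ^^^ F) ^^^ G ≠ clmul 4 m q := by
    intro m hm q hq hmq
    rcases hdvd (P.irr_cubic C T hm) (P.form_mem C 3 (by norm_num) hq)
      (by rw [hmq]; exact form_clmul 4 (k := 3) (l := 3) (by omega) rfl) with ⟨k, hk, h'⟩ | ⟨k, hk, h'⟩
    · rw [C.neg _ (by norm_num), Submodule.mem_bot] at hk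
      exact h1 0 (by norm_num) (by rw [h', hk, mul_zero, form_zero])
    · obtain ⟨t, ht, rfl⟩ := P.exists_form_one C (by norm_num at hk; exact hk)
      refine h2 0 (clmul 4 m t) ?_
      rw [h', form_clmul 4 (k := 3) (l := 1) (by omega) rfl, form_zero, zero_mul, zero_add]
  obtain ⟨q, hq, hmq⟩ | ⟨q, hq, hmq⟩ | ⟨q, hq, hmq⟩ := hfac
  · rcases hdvd (P.irr_quadratic C) (P.form_mem C 4 (by norm_num) hq)
      (by rw [hmq]; exact form_clmul 3 (k := 2) (l := 4) (by omega) rfl) with ⟨k, hk, h'⟩ | ⟨k, hk, h'⟩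
    · by_cases hk0 : k = 0
      · exact h1 0 (by norm_num) (by rw [h', hk0, mul_zero, form_zero])
      · have hk1 : k = 1 := C.eq_of_len_one C.len_zero (by norm_num at hk; exact hk) C.one_mem hk0
          one_ne_zero
        exact h1 7 (by norm_num) (by rw [h', hk1, mul_one])
    · obtain ⟨t, ht, rfl | rfl⟩ := P.exists_eq_add C T (x := k) (by norm_num at hk; exact hk)
      · refine h2 0 (clmul 3 7 t) ?_
        rw [h', form_clmul 3 (k := 2) (l := 2) (by omega) rfl, form_zero, zero_mul, zero_add]
      · refine h2 7 (clmul 3 7 t) ?_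
        rw [h', form_clmul 3 (k := 2) (l := 2) (by omega) rfl, mul_add]
  · exact cubic 11 (Or.inl rfl) q hq hmq
  · exact cubic 13 (Or.inr rfl) q hq hmq

end Pencil

/-- There is no trigonal curve on a cone of the given kind. -/
theorem Cox.false_of_pencil_three (C : Cox V) [Genus4 (ZMod 2) K] (h1 : len V 1 = 0)
    (h2 : len V 2 = 0) (h3 : len V 3 = 2) : False := by
  obtain ⟨b, hb, hb0⟩ := C.exists_ne_zero (n := 3) (by omega)
  obtain ⟨a, ha, ha0, hab⟩ := C.exists_ne_ne (n := 3) (by omega) b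
  have P : Pencil V a b := ⟨h1, h2, h3, ha, hb, ha0, hb0,
    transcendental_of_ne (div_ne_zero ha0 hb0) fun h => hab (by field_simp at h; exact h)⟩
  obtain ⟨w, hw, hne⟩ := C.exists_new (n := 6) (monomials a b 2)
    (by rw [length_monomials, C.len_six]; norm_num)
  have T : Pencil.Third V a b w := ⟨hw, fun p hp h => hne p (by rwa [length_monomials])
    (by rw [lin_monomials hp, h])⟩
  obtain ⟨q2, h2, q4, h4, q6, h6, h⟩ := P.exists_cubic C T
  refine P.false_of_cubic C (T.add P C h2) (F := clmul 3 q2 q2 ^^^ q4)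
    (G := q6 ^^^ clmul 3 q2 q4) (Nat.xor_lt_two_pow (n := 5) (clmul_sq_lt q2 h2).1 h4)
    (Nat.xor_lt_two_pow (n := 7) h6 ((clmul_sq_lt q2 h2).2 q4 h4)) ?_
  rw [form_xor 4, form_xor 6, form_clmul 3 (k := 2) (l := 2) h2 rfl,
    form_clmul 3 (k := 2) (l := 4) h2 rfl]
  linear_combination h + (form a b 2 q2 * w ^ 2 + 2 * form a b 2 q2 ^ 2 * w +
    form a b 2 q2 ^ 3 + form a b 2 q2 * form a b 4 q4) * two_eq_zero K

end TrigonalConeEnd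

section AffineRing

/-- The functions regular away from a rational point, filtered by the pole order. -/
structure Affine {R : Type} [CommRing R] (W : ℤ → AddSubgroup R) (l : ℤ → ℕ) : Prop where
  two : (2 : R) = 0
  mono : ∀ n, W (n - 1) ≤ W n
  one : 1 ∈ W 0
  neg : ∀ n < 0, ∀ x ∈ W n, x = 0
  mul : ∀ m n, ∀ x ∈ W m, ∀ y ∈ W n, x * y ∈ W (m + n)
  le_of_len : ∀ n, l n ≤ l (n - 1) → W n ≤ W (n - 1)
  exists_new : ∀ n, l (n - 1) < l n → ∃ x ∈ W n, x ∉ W (n - 1)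
  add_lead : ∀ n, ∀ x ∈ W n, x ∉ W (n - 1) → ∀ y ∈ W n, y ∉ W (n - 1) → x + y ∈ W (n - 1)
  mul_lead : ∀ m n, ∀ x ∈ W m, x ∉ W (m - 1) → ∀ y ∈ W n, y ∉ W (n - 1) → x * y ∉ W (m + n - 1)
  eval : ∀ d, 0 < d → ∀ x ∈ W d, x ∉ W (d - 1) →
    (∀ i, 0 < i → i < d → ∀ y ∈ W i, ∀ z ∈ W (d - i), x ≠ y * z) →
    ∃ (κ : Type) (_ : Field κ) (φ : R →+* κ), Nat.card κ = 2 ^ d.toNat ∧ φ x = 0 ∧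
      ∀ n, ∀ y ∈ W n, φ y = 0 → ∃ z ∈ W (n - d), y = x * z

variable {K : Type} [Field K] [Algebra (ZMod 2) K] {V : ℤ → Submodule (ZMod 2) K} {e : K}

namespace Cox

variable (C : Cox V)

include C in
theorem mul_pow_mem (he : e ∈ V 1) {x : K} {n : ℕ} (h : x * e ^ n ∈ V n) (m : ℕ) :
    x * e ^ (n + m) ∈ V (n + m : ℕ) := by
  rw [pow_add, ← mul_assoc]
  exact C.mul' h (C.pow_mem' he m (mul_one _)) (by push_cast; ring)

/-- The ring of functions regular away from the point `e`. -/
def affine (he : e ∈ V 1) : Subring K where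
  carrier := {x | ∃ n : ℕ, x * e ^ n ∈ V n}
  mul_mem' := by
    rintro x y ⟨n, hn⟩ ⟨m, hm⟩
    refine ⟨n + m, ?_⟩
    rw [pow_add, mul_mul_mul_comm]
    exact C.mul' hn hm (by push_cast; ring)
  one_mem' := ⟨0, by simpa using C.one_mem⟩
  add_mem' := by
    rintro x y ⟨n, hn⟩ ⟨m, hm⟩
    refine ⟨n + m, ?_⟩
    rw [add_mul]
    refine add_mem (C.mul_pow_mem he hn m) ?_
    rw [add_comm n m]
    exact C.mul_pow_mem he hm n
  zero_mem' := ⟨0, by simp⟩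
  neg_mem' := by
    rintro x ⟨n, hn⟩
    exact ⟨n, by rw [neg_mul]; exact neg_mem hn⟩

/-- The functions with a pole of order at most `n`. -/
def poles (he : e ∈ V 1) (n : ℤ) : AddSubgroup (C.affine he) where
  carrier := {x | (x : K) * e ^ n ∈ V n}
  add_mem' := fun {x y} hx hy => by
    change ((x + y : C.affine he) : K) * e ^ n ∈ V n
    rw [Subring.coe_add, add_mul]
    exact add_mem hx hy
  zero_mem' := by simp
  neg_mem' := fun {x} hx => by
    change ((-x : C.affine he) : K) * e ^ n ∈ V n
    rw [Subring.coe_neg, neg_mul]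
    exact neg_mem hx

theorem exists_affine_of_mem (he : e ∈ V 1) (he0 : e ≠ 0) {n : ℤ} {f : K} (hf : f ∈ V n) :
    ∃ x ∈ C.poles he n, (x : K) * e ^ n = f := by
  have h : f / e ^ n * e ^ n = f := by field_simp
  by_cases hn : n < 0
  · rw [C.neg n hn, Submodule.mem_bot] at hf
    exact ⟨0, zero_mem _, by simp [hf]⟩
  · lift n to ℕ using by omega
    refine ⟨⟨f / e ^ (n : ℤ), n, ?_⟩, ?_, h⟩
    · rw [← zpow_natCast, h]; exact hf
    · change f / e ^ (n : ℤ) * e ^ (n : ℤ) ∈ V n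
      rwa [h]

theorem exists_affine_hom (he : e ∈ V 1) {d : ℤ} {f : K} {κ : Type} [Field κ] {ev : ℤ → K → κ}
    (E : Ev V d f κ ev) (hne : ev 1 e ≠ 0) : ∃ φ : C.affine he →+* κ,
    ∀ (n : ℕ) (x : C.affine he), (x : K) * e ^ n ∈ V n →
      φ x * ev 1 e ^ n = ev n ((x : K) * e ^ n) := by
  have well : ∀ (n m : ℕ) (x : K), x * e ^ n ∈ V n → x * e ^ m ∈ V m →
      ev n (x * e ^ n) * ev 1 e ^ m = ev m (x * e ^ m) * ev 1 e ^ n := by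
    intro n m x hn hm
    rw [← E.pow C he m (mul_one _), ← E.pow C he n (mul_one _),
      ← E.mul' hn (C.pow_mem' he m (mul_one _)) rfl, ← E.mul' hm (C.pow_mem' he n (mul_one _)) rfl,
      add_comm (n : ℤ)]
    congr 1
    ring
  choose N hN using fun x : C.affine he => x.2
  have spec : ∀ (n : ℕ) (x : C.affine he), (x : K) * e ^ n ∈ V n →
      ev (N x) ((x : K) * e ^ N x) / ev 1 e ^ N x * ev 1 e ^ n = ev n ((x : K) * e ^ n) := by
    intro n x hn
    have := well _ _ _ (hN x) hn
    field_simp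
    rw [this, mul_comm]
  refine ⟨⟨⟨⟨fun x => ev (N x) ((x : K) * e ^ N x) / ev 1 e ^ N x, ?_⟩, ?_⟩, ?_, ?_⟩, spec⟩
  · have := spec 0 1 (by simpa using C.one_mem)
    simpa [E.one] using this
  · intro x y
    have hxy : ((x * y : C.affine he) : K) * e ^ (N x + N y) =
      (x * e ^ N x) * (y * e ^ N y) := by rw [Subring.coe_mul, pow_add, mul_mul_mul_comm]
    have h := spec (N x + N y) (x * y) (by
      rw [hxy]
      exact C.mul' (hN x) (hN y) (by push_cast; ring))
    rw [hxy, E.mul' (k := (N x + N y : ℕ)) (hN x) (hN y) (by push_cast; ring),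
      ← spec _ x (hN x), ← spec _ y (hN y)] at h
    refine mul_right_cancel₀ (pow_ne_zero (N x + N y) hne) ?_
    exact h.trans (by ring)
  · simp [E.zero]
  · intro x y
    have hx := C.mul_pow_mem he (hN x) (N y)
    have hy := C.mul_pow_mem he (hN y) (N x)
    rw [add_comm (N y)] at hy
    have hxy : ((x + y : C.affine he) : K) * e ^ (N x + N y) =
      x * e ^ (N x + N y) + y * e ^ (N x + N y) := by rw [Subring.coe_add, add_mul]
    have h := spec (N x + N y) (x + y) (by rw [hxy]; exact add_mem hx hy)
    rw [hxy, E.add _ _ hx _ hy, ← spec _ x hx, ← spec _ y hy, ← add_mul] at h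
    exact mul_right_cancel₀ (pow_ne_zero _ hne) h

theorem isAffine (h1 : len V 1 = 1) (he : e ∈ V 1) (he0 : e ≠ 0) :
    Affine (C.poles he) (len V) := by
  have hz : ∀ m n : ℤ, e ^ (m + n) = e ^ m * e ^ n := fun m n => zpow_add₀ he0 m n
  have hs : ∀ n : ℤ, e ^ n = e * e ^ (n - 1) := fun n => by
    rw [← zpow_one_add₀ he0]; congr 1; ring
  have hI := irr_one he he0
  have mem_iff : ∀ n (x : C.affine he), x ∈ C.poles he n ↔ (x : K) * e ^ n ∈ V n := fun _ _ => Iff.rfl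
  have dvd_iff : ∀ n (x : C.affine he), HDvd V 1 e n ((x : K) * e ^ n) ↔ x ∈ C.poles he (n - 1) := by
    intro n x
    constructor
    · rintro ⟨h, hh, hx⟩
      rw [mem_iff]
      rw [hs n, mul_left_comm] at hx
      rwa [mul_left_cancel₀ he0 hx]
    · intro hx
      exact ⟨_, hx, by rw [hs n]; ring⟩
  obtain ⟨κ, _, ev, hc, E, h2⟩ := C.exists_point hI
  have hc2 : Nat.card κ = 2 := by simpa using hc
  have bool : ∀ x : κ, x ≠ 0 → x = 1 := by
    intro x hx
    have : Finite κ := Nat.finite_of_card_ne_zero (by omega)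
    have := Fintype.ofFinite κ
    have := FiniteField.pow_card_sub_one_eq_one x hx
    rwa [← Nat.card_eq_fintype_card, hc2, pow_one] at this
  have ev_iff : ∀ n (x : C.affine he), x ∈ C.poles he n →
      (ev n ((x : K) * e ^ n) = 0 ↔ x ∈ C.poles he (n - 1)) := fun n x hx => by
    rw [E.zero_iff n _ hx, dvd_iff]
  refine ⟨?_, ?_, ?_, ?_, ?_, ?_, ?_, ?_, ?_, ?_⟩
  · exact Subtype.ext (two_eq_zero K)
  · intro n x hx
    rw [mem_iff, hs n, mul_left_comm]
    exact C.mul' he hx (by ring)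
  · rw [mem_iff]; simpa using C.one_mem
  · intro n hn x hx
    rw [mem_iff, C.neg n hn, Submodule.mem_bot] at hx
    exact Subtype.ext ((mul_eq_zero.1 hx).resolve_right (zpow_ne_zero _ he0))
  · intro m n x hx y hy
    rw [mem_iff, hz, Subring.coe_mul, mul_mul_mul_comm]
    exact C.mul hx hy
  · intro n hl x hx
    rw [← dvd_iff]
    exact C.hdvd_of_len he he0 hl hx
  · intro n hl
    by_contra! hcon
    refine hl.not_ge ?_
    have := C.finite (n - 1)
    rw [← len_map (n - 1) he0]
    refine Submodule.finrank_mono fun f hf => ?_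
    obtain ⟨x, hx, rfl⟩ := C.exists_affine_of_mem he he0 hf
    obtain ⟨k, hk, h⟩ := (dvd_iff n x).2 (hcon x hx)
    exact ⟨k, hk, h.symm⟩
  · intro n x hx hx' y hy hy'
    rw [← dvd_iff, Subring.coe_add, add_mul]
    rw [← ev_iff n x hx] at hx'
    rw [← ev_iff n y hy] at hy'
    exact E.eq_zero_of_add hx hy ((bool _ hx').trans (bool _ hy').symm) h2
  · intro m n x hx hx' y hy hy' hxy
    rw [← ev_iff m x hx] at hx'
    rw [← ev_iff n y hy] at hy'
    rw [← dvd_iff, Subring.coe_mul, hz, mul_mul_mul_comm, ← E.zero_iff _ _ (C.mul hx hy),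
      E.mul _ _ _ hx _ hy] at hxy
    exact (mul_ne_zero hx' hy') hxy
  · intro d hd x hx hx' hirr
    have hx0 : (x : K) * e ^ d ≠ 0 := fun h => hx' (by
      rw [← dvd_iff, h]; exact ⟨0, zero_mem _, by simp⟩)
    have hI' : Irr V d ((x : K) * e ^ d) := by
      refine ⟨hx, hx0, hd, fun i hi hid g hg k hk hgk => ?_⟩
      obtain ⟨y, hy, rfl⟩ := C.exists_affine_of_mem he he0 hg
      obtain ⟨z, hz', rfl⟩ := C.exists_affine_of_mem he he0 hk
      refine hirr i hi hid y hy z hz' (Subtype.ext ?_)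
      refine mul_right_cancel₀ (zpow_ne_zero d he0) ?_
      rw [hgk, Subring.coe_mul, mul_mul_mul_comm, ← hz, add_sub_cancel]
    obtain ⟨κ', _, ev', hc', E', h2'⟩ := C.exists_point hI'
    have hne : ev' 1 e ≠ 0 := fun h => by
      obtain ⟨g, hg, heg⟩ := (E'.zero_iff 1 e he).1 h
      have hg0 : g ≠ 0 := fun h => he0 (by rw [heg, h, mul_zero])
      obtain rfl | hd1 : d = 1 ∨ 1 < d := by omega
      · have := C.eq_of_len_one h1 hx he hx0 he0
        refine hx' ?_
        have h1' : (x : K) = 1 := mul_right_cancel₀ he0 (by simpa using this)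
        rw [mem_iff, h1']
        simpa using C.one_mem
      · rw [C.neg _ (by omega), Submodule.mem_bot] at hg
        exact hg0 hg
    obtain ⟨φ, hφ⟩ := C.exists_affine_hom he E' hne
    have zero_iff : ∀ (n : ℤ) (y : C.affine he), y ∈ C.poles he n →
        (φ y = 0 ↔ HDvd V d ((x : K) * e ^ d) n ((y : K) * e ^ n)) := by
      intro n y hy
      by_cases hn : n < 0
      · rw [mem_iff, C.neg n hn, Submodule.mem_bot] at hy
        have hy0 : y = 0 := Subtype.ext ((mul_eq_zero.1 hy).resolve_right (zpow_ne_zero _ he0))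
        rw [hy0]
        simp only [map_zero, Subring.coe_zero, zero_mul, true_iff]
        exact ⟨0, zero_mem _, by simp⟩
      · lift n to ℕ using by omega
        rw [mem_iff, zpow_natCast] at hy
        rw [zpow_natCast, ← E'.zero_iff _ _ hy, ← hφ n y hy, mul_eq_zero,
          or_iff_left (pow_ne_zero n hne)]
    refine ⟨κ', _, φ, hc', ?_, fun n y hy h0 => ?_⟩
    · rw [zero_iff d x hx]
      exact ⟨1, by simpa using C.one_mem, by rw [mul_one]⟩
    · obtain ⟨k, hk, h⟩ := (zero_iff n y hy).1 h0
      obtain ⟨z, hz', rfl⟩ := C.exists_affine_of_mem he he0 hk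
      refine ⟨z, hz', Subtype.ext ?_⟩
      refine mul_right_cancel₀ (zpow_ne_zero n he0) ?_
      rw [h, Subring.coe_mul, mul_mul_mul_comm, ← hz, add_sub_cancel]

end Cox

end AffineRing

section Lead

variable {R : Type} [CommRing R] {W : ℤ → AddSubgroup R} {l : ℤ → ℕ} {x y a z : R} {m n d : ℤ}

theorem map_pe {κ : Type} [Field κ] (φ : R →+* κ) (x : R) (p : ℕ) : φ (pe x p) = pe (φ x) p := by
  induction p using Nat.strong_induction_on with
  | _ p ih =>
    by_cases hp : p = 0
    · simp [hp]
    · rw [pe_eq, pe_eq (φ x), map_add, map_mul, ih _ (by omega), map_natCast]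

/-- The function `x` has a pole of order exactly `n`. -/
def Lead (W : ℤ → AddSubgroup R) (n : ℤ) (x : R) : Prop := x ∈ W n ∧ x ∉ W (n - 1)

namespace Affine

variable (A : Affine W l)
include A

theorem le (h : m ≤ n) : W m ≤ W n := by
  induction n, h using Int.leInduction with
  | base => exact le_rfl
  | succ n _ ih => exact ih.trans (by simpa using A.mono (n + 1))

theorem lead_mul (hx : Lead W m x) (hy : Lead W n y) (hd : m + n = d) : Lead W d (x * y) := by
  subst hd
  exact ⟨A.mul m n x hx.1 y hy.1, A.mul_lead m n x hx.1 hx.2 y hy.1 hy.2⟩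

theorem lead_add (hx : Lead W n x) (hy : y ∈ W (n - 1)) : Lead W n (x + y) :=
  ⟨add_mem hx.1 (A.mono n hy), fun h => hx.2 (by simpa using sub_mem h hy)⟩

theorem lead_one (hx : Lead W n x) : Lead W 0 1 :=
  ⟨A.one, fun h => hx.2 (by rw [← mul_one x, A.neg _ (by norm_num) 1 h, mul_zero]; exact zero_mem _)⟩

theorem lead_pow (hx : Lead W n x) (k : ℕ) (hd : k * n = d) : Lead W d (x ^ k) := by
  subst hd
  induction k with
  | zero => simpa using A.lead_one hx
  | succ k ih =>
    rw [pow_succ]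
    exact A.lead_mul ih hx (by push_cast; ring)

theorem lead_len (hx : Lead W n x) : l (n - 1) < l n := by
  by_contra! h
  exact hx.2 (A.le_of_len n h hx.1)

theorem lead_nonneg (hx : Lead W n x) : 0 ≤ n := by
  by_contra! h
  exact hx.2 (by rw [A.neg n h x hx.1]; exact zero_mem _)

theorem eq_one (hx : Lead W 0 x) : x = 1 := by
  have h := A.neg (-1) (by norm_num) _ (A.add_lead 0 x hx.1 hx.2 1 A.one (A.lead_one hx).2)
  linear_combination h - A.two

theorem lead_pe (hx : Lead W n x) (hn : 0 < n) (k p : ℕ) (hp : 2 ^ k ≤ p) (hp' : p < 2 ^ (k + 1)) :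
    Lead W (k * n) (pe x p) := by
  induction k generalizing p with
  | zero =>
    obtain rfl : p = 1 := by simp at hp hp'; omega
    simpa using A.lead_one hx
  | succ k ih =>
    rw [pow_succ] at hp hp'
    have hm : ((p % 2 : ℕ) : R) ∈ W 0 := by
      rcases Nat.mod_two_eq_zero_or_one p with h | h <;> rw [h]
      · simp
      · simpa using A.one
    rw [pe_eq, add_comm ((p % 2 : ℕ) : R)]
    refine A.lead_add (A.lead_mul (d := (k + 1 : ℕ) * n) hx
      (ih (p / 2) (by omega) (by omega)) (by push_cast; ring)) (A.le ?_ hm)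
    push_cast
    nlinarith

/-- A function which is not a product of functions with fewer poles generates a prime ideal. -/
theorem exists_field (hx : Lead W d x) (hd : 0 < d)
    (h : ∀ i, 0 < i → i < d → ∀ y z, Lead W i y → Lead W (d - i) z → x ≠ y * z) :
    ∃ (κ : Type) (_ : Field κ) (φ : R →+* κ), Nat.card κ = 2 ^ d.toNat ∧ (2 : κ) = 0 ∧ φ x = 0 ∧
      ∀ n y, Lead W n y → φ y = 0 → ∃ z, Lead W (n - d) z ∧ y = x * z := by
  obtain ⟨κ, _, φ, hc, h0, hk⟩ := A.eval d hd x hx.1 hx.2 (fun i hi hid y hy z hz hxyz => by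
    refine h i hi hid y z ⟨hy, fun hy' => hx.2 ?_⟩ ⟨hz, fun hz' => hx.2 ?_⟩ hxyz
    · rw [hxyz]
      exact A.le (by omega) (A.mul _ _ y hy' z hz)
    · rw [hxyz]
      exact A.le (by omega) (A.mul _ _ y hy z hz'))
  refine ⟨κ, _, φ, hc, by rw [← map_ofNat φ 2, A.two, map_zero], h0, fun n y hy hy0 => ?_⟩
  obtain ⟨z, hz, hyz⟩ := hk n y hy.1 hy0
  refine ⟨z, ⟨hz, fun hz' => hy.2 ?_⟩, hyz⟩
  rw [hyz]
  exact A.le (by omega) (A.mul _ _ x hx.1 z hz')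

end Affine

end Lead

section Trigonal

variable {R : Type} [CommRing R] {W : ℤ → AddSubgroup R} {l : ℤ → ℕ} {x y a z : R} {m n d : ℤ}

theorem xor_two_pow_lt {i k : ℕ} (hi : i < 2 ^ k) : i ^^^ 2 ^ k < 2 ^ (k + 1) :=
  Nat.xor_lt_two_pow (hi.trans (Nat.pow_lt_pow_right one_lt_two (by omega)))
    (Nat.pow_lt_pow_right one_lt_two (by omega))

/-- The combinations of the first powers of `a` times the powers of `z` below the third. -/
def Rep (a z : R) (p q r : ℕ) (x : R) : Prop :=
  ∃ i < 2 ^ p, ∃ j < 2 ^ q, ∃ k < 2 ^ r, x = pe a i + z * pe a j + z ^ 2 * pe a k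

theorem pe_two_pow (a : R) (k : ℕ) : pe a (2 ^ k) = a ^ k := by
  induction k with
  | zero => simp
  | succ k ih => rw [pow_succ', pe_double, ih, pow_succ']

namespace Affine

variable (A : Affine W l)
include A

theorem rep_gap {p q r : ℕ} (h : ∀ x ∈ W (n - 1), Rep a z p q r x) (hl : l n ≤ l (n - 1)) :
    ∀ x ∈ W n, Rep a z p q r x := fun x hx => h x (A.le_of_len n hl hx)

theorem rep_step {p q r p' q' r' : ℕ} (h : ∀ x ∈ W (n - 1), Rep a z p q r x) (hy : Lead W n y)
    (hr : ∀ x, Rep a z p q r x → Rep a z p' q' r' x ∧ Rep a z p' q' r' (x + y)) :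
    ∀ x ∈ W n, Rep a z p' q' r' x := by
  intro x hx
  by_cases hx' : x ∈ W (n - 1)
  · exact (hr x (h x hx')).1
  · have := (hr _ (h _ (A.add_lead n x hx hx' y hy.1 hy.2))).2
    rwa [add_assoc, ← two_mul, A.two, zero_mul, add_zero] at this

theorem rep_left {p q r : ℕ} (h : ∀ x ∈ W (n - 1), Rep a z p q r x) (hy : Lead W n (a ^ p)) :
    ∀ x ∈ W n, Rep a z (p + 1) q r x := by
  refine A.rep_step h hy fun x ⟨i, hi, j, hj, k, hk, hx⟩ => ⟨⟨i, ?_, j, hj, k, hk, hx⟩,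
    ⟨i ^^^ 2 ^ p, xor_two_pow_lt hi, j, hj, k, hk, ?_⟩⟩
  · rw [pow_succ]; omega
  · rw [hx, pe_xor a A.two, pe_two_pow]; ring

theorem rep_middle {p q r : ℕ} (h : ∀ x ∈ W (n - 1), Rep a z p q r x) (hy : Lead W n (z * a ^ q)) :
    ∀ x ∈ W n, Rep a z p (q + 1) r x := by
  refine A.rep_step h hy fun x ⟨i, hi, j, hj, k, hk, hx⟩ => ⟨⟨i, hi, j, ?_, k, hk, hx⟩,
    ⟨i, hi, j ^^^ 2 ^ q, xor_two_pow_lt hj, k, hk, ?_⟩⟩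
  · rw [pow_succ]; omega
  · rw [hx, pe_xor a A.two, pe_two_pow]; ring

theorem rep_right {p q r : ℕ} (h : ∀ x ∈ W (n - 1), Rep a z p q r x)
    (hy : Lead W n (z ^ 2 * a ^ r)) : ∀ x ∈ W n, Rep a z p q (r + 1) x := by
  refine A.rep_step h hy fun x ⟨i, hi, j, hj, k, hk, hx⟩ => ⟨⟨i, hi, j, hj, k, ?_, hx⟩,
    ⟨i, hi, j, hj, k ^^^ 2 ^ r, xor_two_pow_lt hk, ?_⟩⟩
  · rw [pow_succ]; omega
  · rw [hx, pe_xor a A.two, pe_two_pow]; ring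

end Affine

/-- The pole orders at the point are generated by three and five. -/
def Gaps (l : ℤ → ℕ) : Prop := l 1 ≤ l 0 ∧ l 2 ≤ l 1 ∧ l 4 ≤ l 3 ∧ l 7 ≤ l 6

/-- An equation between functions with poles of orders three and five. -/
structure Trigonal (W : ℤ → AddSubgroup R) (a z : R) (p q : ℕ) : Prop where
  left : Lead W 3 a
  right : Lead W 5 z
  eqn : z ^ 3 + pe a p * z + pe a q = 0
  bound : p < 16
  bound' : q < 64
  le_bound : 32 ≤ q

namespace Affine

variable (A : Affine W l) (G : Gaps l)
include A G

theorem exists_trigonal (ha : Lead W 3 a) (hz : Lead W 5 z) : ∃ z' p q, Trigonal W a z' p q := by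
  obtain ⟨g1, g2, g4, g7⟩ := G
  have r0 : ∀ x ∈ W 0, Rep a z 1 0 0 x :=
    A.rep_left (n := 0) (p := 0) (fun x hx => ⟨0, by simp, 0, by simp, 0, by simp, by
      simp [A.neg (0 - 1) (by norm_num) x hx]⟩) (A.lead_pow ha 0 (by norm_num))
  have r1 := A.rep_gap (n := 1) r0 g1
  have r2 := A.rep_gap (n := 2) r1 g2
  have r3 := A.rep_left (n := 3) r2 (A.lead_pow ha 1 (by norm_num))
  have r4 := A.rep_gap (n := 4) r3 g4
  have r5 := A.rep_middle (n := 5) r4 (A.lead_mul hz (A.lead_pow ha 0 rfl) (by norm_num))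
  have r6 := A.rep_left (n := 6) r5 (A.lead_pow ha 2 (by norm_num))
  have r7 := A.rep_gap (n := 7) r6 g7
  have r8 := A.rep_middle (n := 8) r7 (A.lead_mul hz (A.lead_pow ha 1 rfl) (by norm_num))
  have r9 := A.rep_left (n := 9) r8 (A.lead_pow ha 3 (by norm_num))
  have r10 := A.rep_right (n := 10) r9
    (A.lead_mul (A.lead_pow hz 2 rfl) (A.lead_pow ha 0 rfl) (by norm_num))
  have r11 := A.rep_middle (n := 11) r10 (A.lead_mul hz (A.lead_pow ha 2 rfl) (by norm_num))
  have r12 := A.rep_left (n := 12) r11 (A.lead_pow ha 4 (by norm_num))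
  have r13 := A.rep_right (n := 13) r12
    (A.lead_mul (A.lead_pow hz 2 rfl) (A.lead_pow ha 1 rfl) (by norm_num))
  have r14 := A.rep_middle (n := 14) r13 (A.lead_mul hz (A.lead_pow ha 3 rfl) (by norm_num))
  have lz := A.lead_pow hz 3 (d := 15) (by norm_num)
  have la := A.lead_pow ha 5 (d := 15) (by norm_num)
  obtain ⟨i, hi, j, hj, k, hk, h⟩ := r14 _ (A.add_lead 15 _ lz.1 lz.2 _ la.1 la.2)
  norm_num at hi hj hk
  have hjk : clmul 4 j k < 32 ∧ clmul 2 k k < 16 := by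
    have : ∀ j ∈ List.range 16, ∀ k ∈ List.range 4, clmul 4 j k < 32 ∧ clmul 2 k k < 16 := by
      decide +kernel
    exact this j (by simpa using hj) k (by simpa using hk)
  have hb : i ^^^ clmul 4 j k < 32 := Nat.xor_lt_two_pow (n := 5) hi hjk.1
  have hb' : 32 ^^^ (i ^^^ clmul 4 j k) = 32 + (i ^^^ clmul 4 j k) := by
    have : ∀ m ∈ List.range 32, 32 ^^^ m = 32 + m := by decide +kernel
    exact this _ (by simpa using hb)
  have hl : pe a k ∈ W 4 := by
    obtain hk2 | hk2 | rfl : 2 ≤ k ∨ k = 1 ∨ k = 0 := by omega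
    · exact A.le (by norm_num) (A.lead_pe ha (by norm_num) 1 k hk2 hk).1
    · rw [hk2, pe_one]; exact A.le (by norm_num) A.one
    · simp
  refine ⟨z + pe a k, j ^^^ clmul 2 k k, 32 ^^^ (i ^^^ clmul 4 j k), ha, A.lead_add hz hl, ?_,
    Nat.xor_lt_two_pow (n := 4) hj hjk.2, by omega, by omega⟩
  rw [pe_xor a A.two, pe_xor a A.two, pe_xor a A.two, pe_clmul a A.two 2 k k hk,
    pe_clmul a A.two 4 j k hj, show 32 = 2 ^ 5 from rfl, pe_two_pow]
  linear_combination h + (z ^ 2 * pe a k * 2 + z * pe a k ^ 2 * 2 + pe a k ^ 3 + pe a i + z * pe a j +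
    pe a j * pe a k) * A.two

theorem not_lead (hx : Lead W n x) : n ≠ 1 ∧ n ≠ 2 ∧ n ≠ 4 ∧ n ≠ 7 := by
  obtain ⟨g1, g2, g4, g7⟩ := G
  have := A.lead_len hx
  refine ⟨?_, ?_, ?_, ?_⟩ <;> rintro rfl <;> norm_num at this <;> omega

theorem eq_of_lead_three (ha : Lead W 3 a) (hy : Lead W 3 y) : y = a ∨ y = a + 1 := by
  obtain ⟨g1, g2, -⟩ := G
  have h := A.le_of_len 1 g1 (A.le_of_len 2 g2 (A.add_lead 3 y hy.1 hy.2 a ha.1 ha.2))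
  by_cases h0 : y + a ∈ W (-1)
  · left
    linear_combination A.neg (-1) (by norm_num) _ h0 - a * A.two
  · right
    linear_combination A.eq_one ⟨h, h0⟩ - a * A.two

end Affine

end Trigonal

section Trigonal

variable {R : Type} [CommRing R] {W : ℤ → AddSubgroup R} {l : ℤ → ℕ} {x y a z : R} {n : ℤ} {p q : ℕ}

/-- Codes of irreducible sextics. -/
def sextics : List ℕ := [67, 73, 87, 91, 97, 103, 109, 115, 117]

/-- The code of the value at `s` of the cubic equation. -/
def cubicValue (p q s : ℕ) : ℕ := q ^^^ clmul 4 p s ^^^ clmul 3 s (clmul 3 s s)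

theorem pe_cubicValue {κ : Type} [Field κ] (h2 : (2 : κ) = 0) (τ : κ) {p q s : ℕ} (hp : p < 16)
    (hs : s < 8) :
    pe τ (cubicValue p q s) = pe τ s ^ 3 + pe τ p * pe τ s + pe τ q := by
  rw [cubicValue, pe_xor τ h2, pe_xor τ h2, pe_clmul τ h2 _ _ _ hp, pe_clmul τ h2 _ _ _ hs,
    pe_clmul τ h2 _ _ _ hs]
  ring

theorem exists_pe_eq {κ : Type} [Field κ] (h2 : (2 : κ) = 0) {c : ℕ} (hc : c < 2) (s : ℕ) :
    ∃ m < 2, pe (c : κ) s = (m : ℕ) := by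
  obtain rfl | rfl : c = 0 ∨ c = 1 := by omega
  · exact ⟨s % 2, Nat.mod_lt _ two_pos, by rw [pe_eq]; simp⟩
  · exact ⟨bitSum s s % 2, Nat.mod_lt _ two_pos, by
      rw [Nat.cast_one, pe_one_left s s Nat.lt_two_pow_self, cast_mod_two h2]⟩

namespace Trigonal

variable (A : Affine W l) (G : Gaps l) (T : Trigonal W a z p q)
include T

theorem map_eqn {κ : Type} [Field κ] (φ : R →+* κ) :
    φ z ^ 3 + pe (φ a) p * φ z + pe (φ a) q = 0 := by
  have := congrArg φ T.eqn
  simpa [map_pe] using this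

include A G

theorem exists_point {c : ℕ} (hc : c < 2) : ∃ (κ : Type) (_ : Field κ) (φ : R →+* κ),
    (2 : κ) = 0 ∧ φ a = c ∧ ∀ s, 0 < s → s < 8 → pe (φ z) s ≠ 0 := by
  have hc' : (c : R) ∈ W 0 := by
    obtain rfl | rfl : c = 0 ∨ c = 1 := by omega
    · simp
    · simpa using A.one
  obtain ⟨κ, _, φ, hκ, h2, h0, hk⟩ := A.exists_field
    (A.lead_add T.left (A.le (by norm_num) hc')) (by norm_num) (fun i hi hi3 y z hy hz => by
      have := A.not_lead G hy
      omega)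
  have hz : ∀ s : R, s ∈ W 0 → φ (z + s) ≠ 0 := fun s hs hs0 => by
    obtain ⟨y, hy, -⟩ := hk _ _ (A.lead_add T.right (A.le (by norm_num) hs)) hs0
    have := A.not_lead G hy
    omega
  refine ⟨κ, _, φ, h2, ?_, pe_ne_zero (d := 3) h2 hκ _ 2 (fun s hs hs4 => ?_) ?_⟩
  · rw [map_add, map_natCast] at h0
    linear_combination h0 - c * h2
  · have z0 := hz 0 (zero_mem _)
    have z1 := hz 1 A.one
    rw [map_add, map_one] at z1
    rw [add_zero] at z0
    obtain rfl | rfl | rfl : s = 1 ∨ s = 2 ∨ s = 3 := by omega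
    · simp
    · rwa [show 2 = 2 * 1 from rfl, pe_double, pe_one, mul_one]
    · rw [pe_eq]
      simpa [add_comm] using z1
  · intro e he h2e
    obtain rfl | rfl := (Nat.dvd_prime Nat.prime_three).1 he <;> omega

theorem digits : p % 2 = 1 ∧ q % 2 = 1 ∧ bitSum 4 p % 2 = 1 ∧ bitSum 6 q % 2 = 1 := by
  have key : ∀ {κ : Type} [Field κ] (ζ : κ) (u v : ℕ), (2 : κ) = 0 →
      (∀ s, 0 < s → s < 8 → pe ζ s ≠ 0) → ζ ^ 3 + u * ζ + v = 0 → u % 2 = 1 ∧ v % 2 = 1 := by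
    intro κ _ ζ u v h2 hζ h
    have h1 := hζ 2 (by norm_num) (by norm_num)
    have h3 := hζ 3 (by norm_num) (by norm_num)
    have h7 := hζ 7 (by norm_num) (by norm_num)
    simp [pe_eq ζ 2, pe_eq ζ 3, pe_eq ζ 7] at h1 h3 h7
    rw [← cast_mod_two h2 u, ← cast_mod_two h2 v] at h
    rcases Nat.mod_two_eq_zero_or_one u with hu | hu <;>
    rcases Nat.mod_two_eq_zero_or_one v with hv | hv <;> rw [hu, hv] at h <;>
    simp only [Nat.cast_zero, Nat.cast_one] at h
    · exact absurd (by linear_combination h) (pow_ne_zero 3 h1)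
    · exact absurd (by linear_combination h + (ζ ^ 2 + ζ) * h2) (mul_ne_zero h3 h7)
    · exact absurd (by linear_combination h + ζ ^ 2 * h2) (mul_ne_zero h1 (mul_ne_zero h3 h3))
    · exact ⟨hu, hv⟩
  obtain ⟨κ, _, φ, h2, ha, hz⟩ := T.exists_point A G (c := 0) (by norm_num)
  obtain ⟨κ', _, φ', h2', ha', hz'⟩ := T.exists_point A G (c := 1) (by norm_num)
  have h := T.map_eqn φ
  have h' := T.map_eqn φ'
  rw [ha, Nat.cast_zero, pe_eq 0 p, pe_eq 0 q, zero_mul, zero_mul, add_zero, add_zero] at h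
  rw [ha', Nat.cast_one, pe_one_left 4 p T.bound, pe_one_left 6 q T.bound'] at h'
  have k := key _ _ _ h2 hz h
  have k' := key _ _ _ h2' hz' h'
  exact ⟨by omega, by omega, k'.1, k'.2⟩

theorem quintic {s : ℕ} (hs : s < 4) : cubicValue p q s ∈ quintics := by
  have ls : pe a s ∈ W 4 := by
    obtain h | rfl | rfl : 2 ≤ s ∨ s = 1 ∨ s = 0 := by omega
    · exact A.le (by norm_num) (A.lead_pe T.left (by norm_num) 1 s h hs).1
    · rw [pe_one]; exact A.le (by norm_num) A.one
    · simp
  obtain ⟨κ, _, φ, hκ, h2, h0, hk⟩ := A.exists_field (A.lead_add T.right ls) (by norm_num)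
    (fun i hi hi5 y z hy hz => by
      have := A.not_lead G hy
      have := A.not_lead G hz
      omega)
  have irr := pe_ne_zero (d := 5) h2 hκ (φ a) 2 (fun r hr hr4 => by
      obtain h | rfl : 2 ≤ r ∨ r = 1 := by omega
      · intro hr0
        rw [← map_pe] at hr0
        obtain ⟨y, hy, -⟩ := hk _ _ (A.lead_pe T.left (by norm_num) 1 r h hr4) hr0
        have := A.lead_nonneg hy
        omega
      · simp) (by
      intro e he h2e
      obtain rfl | rfl := (Nat.dvd_prime Nat.prime_five).1 he <;> omega)
  have hz : φ z = pe (φ a) s := by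
    rw [map_add, map_pe] at h0
    linear_combination h0 - pe (φ a) s * h2
  have h := T.map_eqn φ
  rw [hz, ← pe_cubicValue h2 _ T.bound (by omega)] at h
  have key : ∀ c ∈ List.range' 32 32, c ∈ quintics ∨ ∃ m ∈ List.range 32, ∃ n ∈ List.range 32,
      0 < m ∧ 0 < n ∧ clmul 5 m n = c := by decide +kernel
  have bd : ∀ p ∈ List.range 16, ∀ s ∈ List.range 4,
      clmul 4 p s < 32 ∧ clmul 3 s (clmul 3 s s) < 32 := by decide +kernel
  have bq : ∀ q ∈ List.range 32, 32 + q = q ^^^ 32 := by decide +kernel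
  have hpb := T.bound
  have hqb := T.bound'
  have hql := T.le_bound
  obtain ⟨b1, b2⟩ := bd p (by simpa using hpb) s (by simpa using hs)
  obtain ⟨r, hr, hqr⟩ : ∃ r < 32, q = r ^^^ 32 :=
    ⟨q - 32, by omega, by rw [← bq _ (by simp; omega)]; omega⟩
  have hval : cubicValue p q s = 32 + (r ^^^ clmul 4 p s ^^^ clmul 3 s (clmul 3 s s)) := by
    have b3 : r ^^^ clmul 4 p s ^^^ clmul 3 s (clmul 3 s s) < 32 :=
      Nat.xor_lt_two_pow (n := 5) (Nat.xor_lt_two_pow (n := 5) hr b1) b2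
    rw [bq _ (by simpa using b3), cubicValue, hqr]
    ac_rfl
  have b3 : r ^^^ clmul 4 p s ^^^ clmul 3 s (clmul 3 s s) < 32 :=
    Nat.xor_lt_two_pow (n := 5) (Nat.xor_lt_two_pow (n := 5) hr b1) b2
  rcases key (cubicValue p q s) (by simp [hval]; omega) with hc | ⟨m, hm, n, hn, hm0, hn0, hmn⟩
  · exact hc
  · simp only [List.mem_range] at hm hn
    rw [← hmn, pe_clmul _ h2 5 m n hm] at h
    exact absurd h (mul_ne_zero (irr m hm0 hm) (irr n hn0 hn))

theorem sextic {s : ℕ} (hs : 4 ≤ s) (hs8 : s < 8) : cubicValue p q s ∈ sextics := by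
  have ls := A.lead_pe T.left (by norm_num) 2 s hs hs8
  have lx : Lead W 6 (pe a s + z) := A.lead_add (by simpa using ls) T.right.1
  have hfac : ∀ y, Lead W 3 y → ∃ c < 2, y = a + (c : ℕ) := fun y hy => by
    rcases A.eq_of_lead_three G T.left hy with rfl | rfl
    · exact ⟨0, by norm_num, by simp⟩
    · exact ⟨1, by norm_num, by simp⟩
  have root : ∀ {c : ℕ} (hc : c < 2), ∀ y, pe a s + z ≠ (a + (c : ℕ)) * y := by
    intro c hc y h
    obtain ⟨κ, _, φ, h2, ha, hz⟩ := T.exists_point A G hc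
    obtain ⟨m, hm, hpe⟩ := exists_pe_eq h2 hc s
    have := congrArg φ h
    rw [map_mul, map_add, map_add, map_pe, ha, hpe, map_natCast, ← two_mul, h2, zero_mul,
      zero_mul] at this
    refine hz (2 + m) (by omega) (by omega) ?_
    rw [pe_eq]
    obtain rfl | rfl : m = 0 ∨ m = 1 := by omega
    · simpa using this
    · simpa using this
  obtain ⟨κ, _, φ, hκ, h2, h0, hk⟩ := A.exists_field lx (by norm_num)
    (fun i hi hi6 y z hy hz h => by
      have n1 := A.not_lead G hy
      have n2 := A.not_lead G hz
      obtain rfl : i = 3 := by omega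
      obtain ⟨c, hc, rfl⟩ := hfac y hy
      exact root hc z h)
  have small : ∀ r, 0 < r → r < 8 → pe (φ a) r ≠ 0 := by
    intro r hr hr8 hr0
    rw [← map_pe] at hr0
    obtain h | h | rfl : 4 ≤ r ∨ 2 ≤ r ∧ r < 4 ∨ r = 1 := by omega
    · obtain ⟨y, hy, he⟩ := hk _ _ (A.lead_pe T.left (by norm_num) 2 r h hr8) hr0
      rw [A.eq_one (x := y) (by simpa using hy), mul_one] at he
      have hrs : r ^^^ s < 4 := by
        have : ∀ r ∈ List.range' 4 4, ∀ s ∈ List.range' 4 4, r ^^^ s < 4 := by decide +kernel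
        exact this r (by simp; omega) s (by simp; omega)
      have hm : pe a (r ^^^ s) ∈ W 4 := by
        obtain h | h | h : 2 ≤ r ^^^ s ∨ r ^^^ s = 1 ∨ r ^^^ s = 0 := by omega
        · exact A.le (by norm_num) (A.lead_pe T.left (by norm_num) 1 _ h hrs).1
        · rw [h, pe_one]; exact A.le (by norm_num) A.one
        · simp [h]
      refine T.right.2 ?_
      rw [show z = pe a (r ^^^ s) by
        rw [pe_xor a A.two]; linear_combination -he + pe a s * A.two - pe a s * A.two - pe a s * A.two]
      exact hm
    · obtain ⟨y, hy, -⟩ := hk _ _ (A.lead_pe T.left (by norm_num) 1 r h.1 h.2) hr0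
      have := A.lead_nonneg hy
      omega
    · simp at hr0
  have medium : ∀ r, 0 < r → r < 16 → pe (φ a) r ≠ 0 := by
    intro r hr hr16
    by_cases hr8 : r < 8
    · exact small r hr hr8
    have key : ∀ r ∈ List.range' 8 8, (r % 2 = 1 ∧ bitSum 4 r % 2 = 1) ∨
        ∃ m ∈ List.range 8, ∃ n ∈ List.range 8, 0 < m ∧ 0 < n ∧ clmul 3 m n = r := by
      decide +kernel
    rcases key r (by simp; omega) with hr1 | ⟨m, hm, n, hn, hm0, hn0, hmn⟩
    · intro hr0
      rw [← map_pe] at hr0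
      obtain ⟨y, hy, he⟩ := hk _ _ (A.lead_pe T.left (by norm_num) 3 r (by omega) hr16) hr0
      obtain ⟨c, hc, rfl⟩ := hfac y (by simpa using hy)
      obtain ⟨κ', _, φ', h2', ha', hz'⟩ := T.exists_point A G hc
      have := congrArg φ' he
      rw [map_mul, map_add φ' a, map_pe, ha', map_natCast, ← two_mul, h2', zero_mul,
        mul_zero] at this
      obtain rfl | rfl : c = 0 ∨ c = 1 := by omega
      · rw [pe_eq, hr1.1] at this
        simp at this
      · rw [Nat.cast_one, pe_one_left 4 r hr16, ← cast_mod_two h2', hr1.2] at this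
        simp at this
    · simp only [List.mem_range] at hm hn
      rw [← hmn, pe_clmul _ h2 3 m n hm]
      exact mul_ne_zero (small m hm0 hm) (small n hn0 hn)
  have irr := pe_ne_zero (d := 6) h2 hκ (φ a) 4 medium (by
    intro e he h4e
    have := Nat.le_of_dvd (by norm_num) he
    interval_cases e <;> omega)
  have hz : φ z = pe (φ a) s := by
    rw [map_add, map_pe] at h0
    linear_combination h0 - pe (φ a) s * h2
  have h := T.map_eqn φ
  rw [hz, ← pe_cubicValue h2 _ T.bound (by omega)] at h
  have key : ∀ c ∈ List.range' 64 64, c ∈ sextics ∨ ∃ m ∈ List.range 16, ∃ n ∈ List.range 64,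
      0 < m ∧ 0 < n ∧ clmul 4 m n = c := by decide +kernel
  have bd : ∀ p ∈ List.range 16, ∀ s ∈ List.range' 4 4, clmul 4 p s < 64 ∧
      clmul 3 s (clmul 3 s s) ^^^ 64 < 64 := by decide +kernel
  have bq : ∀ q ∈ List.range 64, 64 + q = q ^^^ 64 := by decide +kernel
  have hpb := T.bound
  have hqb := T.bound'
  obtain ⟨b1, b2⟩ := bd p (by simpa using hpb) s (by simp; omega)
  have b3 : q ^^^ clmul 4 p s ^^^ (clmul 3 s (clmul 3 s s) ^^^ 64) < 64 :=
    Nat.xor_lt_two_pow (n := 6) (Nat.xor_lt_two_pow (n := 6) hqb b1) b2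
  have hval : cubicValue p q s =
      64 + (q ^^^ clmul 4 p s ^^^ (clmul 3 s (clmul 3 s s) ^^^ 64)) := by
    rw [bq _ (by simpa using b3), ← Nat.xor_assoc, Nat.xor_xor_cancel_right, cubicValue]
  rcases key (cubicValue p q s) (by simp [hval]; omega) with hc | ⟨m, hm, n, hn, hm0, hn0, hmn⟩
  · exact hc
  · simp only [List.mem_range] at hm hn
    rw [← hmn, pe_clmul _ h2 4 m n hm] at h
    exact absurd h (mul_ne_zero (irr m hm0 (by omega)) (irr n hn0 hn))

theorem cases : (p, q) ∈ [(1, 37), (1, 55), (7, 41), (7, 61)] := by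
  have key : ∀ p ∈ List.range 16, ∀ q ∈ List.range' 32 32, (p, q) ∈
      [(1, 37), (1, 55), (7, 41), (7, 61)] ∨ (p % 2 ≠ 1 ∨ q % 2 ≠ 1 ∨ bitSum 4 p % 2 ≠ 1 ∨
        bitSum 6 q % 2 ≠ 1) ∨ (∃ s ∈ List.range 4, cubicValue p q s ∉ quintics) ∨
        ∃ s ∈ List.range' 4 4, cubicValue p q s ∉ sextics := by decide +kernel
  have hpb := T.bound
  have hqb := T.bound'
  have hql := T.le_bound
  obtain ⟨d1, d2, d3, d4⟩ := T.digits A G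
  rcases key p (by simpa using hpb) q (by simp; omega) with h | h | ⟨s, hs, h⟩ | ⟨s, hs, h⟩
  · exact h
  · omega
  · exact absurd (T.quintic A G (by simpa using hs)) h
  · simp at hs
    exact absurd (T.sextic A G (by omega) (by omega)) h

theorem octic {c g u v : ℕ} (hc : c < 2) (hg : g < 8)
    (hgc : (if c = 0 then g else bitSum 3 g) % 2 = 1)
    (hu : 16 ≤ u) (hu' : u < 32) (hv : 16 ≤ v) (hv' : v < 32)
    (h : clmul 3 g (clmul 3 g g) ^^^ clmul 4 p (clmul 3 g (clmul 2 (2 + c) (2 + c))) ^^^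
      clmul 6 q (clmul 2 (2 + c) (clmul 2 (2 + c) (2 + c))) = clmul 5 u v) : False := by
  have hca : pe a (2 + c) = a + (c : ℕ) := by
    rw [pe_eq]
    obtain rfl | rfl : c = 0 ∨ c = 1 := by omega
    · simp
    · simp [add_comm]
  have hfac : ∀ y, Lead W 3 y → ∃ c < 2, y = a + (c : ℕ) := fun y hy => by
    rcases A.eq_of_lead_three G T.left hy with rfl | rfl
    · exact ⟨0, by norm_num, by simp⟩
    · exact ⟨1, by norm_num, by simp⟩
  have mem6 : pe a g ∈ W 7 := by
    obtain h | h | rfl | rfl : 4 ≤ g ∨ 2 ≤ g ∧ g < 4 ∨ g = 1 ∨ g = 0 := by omega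
    · exact A.le (by norm_num) (A.lead_pe T.left (by norm_num) 2 g h hg).1
    · exact A.le (by norm_num) (A.lead_pe T.left (by norm_num) 1 g h.1 h.2).1
    · rw [pe_one]; exact A.le (by norm_num) A.one
    · simp
  have lf : Lead W 3 (pe a (2 + c)) := by
    simpa using A.lead_pe T.left (by norm_num) 1 (2 + c) (by omega) (by omega)
  have lx : Lead W 8 (z * pe a (2 + c) + pe a g) :=
    A.lead_add (A.lead_mul T.right lf (by norm_num)) mem6
  have root : ∀ y, Lead W 3 y → ∀ w, z * pe a (2 + c) + pe a g ≠ y * w := by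
    intro y hy w h
    obtain ⟨e, he, rfl⟩ := hfac y hy
    obtain ⟨κ, _, φ, h2, ha, hz⟩ := T.exists_point A G he
    have := congrArg φ h
    rw [map_mul φ (a + _), map_add φ a, ha, map_natCast, ← two_mul, h2, zero_mul, zero_mul, hca,
      map_add, map_mul, map_add, map_natCast, ha, map_pe, ha] at this
    by_cases hec : e = c
    · subst hec
      rw [← two_mul, h2, zero_mul, mul_zero, zero_add] at this
      obtain rfl | rfl : e = 0 ∨ e = 1 := by omega
      · simp only [if_true] at hgc
        rw [pe_eq, hgc] at this
        simp at this
      · rw [Nat.cast_one, pe_one_left 3 g hg, ← cast_mod_two h2] at this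
        rw [if_neg one_ne_zero] at hgc
        rw [hgc] at this
        simp at this
    · obtain ⟨m, hm, hpe⟩ := exists_pe_eq h2 he g
      have hec1 : (e : κ) + c = 1 := by
        have : e + c = 1 := by omega
        rw [← Nat.cast_add, this, Nat.cast_one]
      rw [hec1, mul_one, hpe] at this
      refine hz (2 + m) (by omega) (by omega) ?_
      rw [pe_eq]
      obtain rfl | rfl : m = 0 ∨ m = 1 := by omega
      · simpa using this
      · simpa [add_comm] using this
  obtain ⟨κ, _, φ, hκ, h2, h0, hk⟩ := A.exists_field lx (by norm_num)
    (fun i hi hi8 y w hy hw h => by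
      have n1 := A.not_lead G hy
      have n2 := A.not_lead G hw
      obtain rfl | rfl : i = 3 ∨ i = 5 := by omega
      · exact root y hy w h
      · exact root w hw y (by rw [h, mul_comm]))
  have quartic : ∀ r, 16 ≤ r → r < 32 → pe (φ a) r ≠ 0 := by
    intro r hr hr' hr0
    rw [← map_pe] at hr0
    obtain ⟨y, hy, -⟩ := hk _ _ (A.lead_pe T.left (by norm_num) 4 r hr hr') hr0
    exact (A.not_lead G hy).2.2.1 (by norm_num)
  have he := T.map_eqn φ
  have key := congrArg (pe (φ a)) h
  have hc4 : 2 + c < 2 ^ 2 := by omega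
  rw [pe_xor _ h2, pe_xor _ h2, pe_clmul _ h2 3 g _ hg, pe_clmul _ h2 3 g _ hg,
    pe_clmul _ h2 4 p _ T.bound, pe_clmul _ h2 3 g _ hg, pe_clmul _ h2 2 _ _ hc4,
    pe_clmul _ h2 6 q _ T.bound', pe_clmul _ h2 2 _ _ hc4, pe_clmul _ h2 2 _ _ hc4,
    pe_clmul _ h2 5 u v hu'] at key
  rw [map_add, map_mul, map_pe, map_pe] at h0
  refine mul_ne_zero (quartic u hu hu') (quartic v hv hv') ?_
  have hg0 : pe (φ a) g = φ z * pe (φ a) (2 + c) := by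
    linear_combination h0 - φ z * pe (φ a) (2 + c) * h2
  rw [← key, hg0]
  linear_combination pe (φ a) (2 + c) ^ 3 * he

theorem false : False := by
  have h := T.cases A G
  simp only [List.mem_cons, Prod.mk.injEq, List.not_mem_nil, or_false] at h
  rcases h with ⟨rfl, rfl⟩ | ⟨rfl, rfl⟩ | ⟨rfl, rfl⟩ | ⟨rfl, rfl⟩
  · exact T.octic A G (c := 1) (g := 2) (u := 19) (v := 31) (by norm_num) (by norm_num)
      (by decide +kernel) (by norm_num) (by norm_num) (by norm_num) (by norm_num) (by decide +kernel)
  · exact T.octic A G (c := 0) (g := 3) (u := 19) (v := 25) (by norm_num) (by norm_num)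
      (by decide +kernel) (by norm_num) (by norm_num) (by norm_num) (by norm_num) (by decide +kernel)
  · exact T.octic A G (c := 0) (g := 1) (u := 31) (v := 31) (by norm_num) (by norm_num)
      (by decide +kernel) (by norm_num) (by norm_num) (by norm_num) (by norm_num) (by decide +kernel)
  · exact T.octic A G (c := 0) (g := 5) (u := 19) (v := 31) (by norm_num) (by norm_num)
      (by decide +kernel) (by norm_num) (by norm_num) (by norm_num) (by norm_num) (by decide +kernel)

end Trigonal

/-- There is no curve with a point at which the pole orders are generated by three and five. -/
theorem Affine.false_of_gaps (A : Affine W l) (G : Gaps l) (h3 : l 2 < l 3) (h5 : l 4 < l 5) :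
    False := by
  obtain ⟨a, ha, ha'⟩ := A.exists_new 3 (by simpa using h3)
  obtain ⟨z, hz, hz'⟩ := A.exists_new 5 (by simpa using h5)
  obtain ⟨z', p, q, T⟩ := A.exists_trigonal G ⟨ha, ha'⟩ ⟨hz, hz'⟩
  exact T.false A G

theorem Cox.false_of_trigonal {K : Type} [Field K] [Algebra (ZMod 2) K]
    {V : ℤ → Submodule (ZMod 2) K} (C : Cox V) (h1 : len V 1 = 1) (h2 : len V 2 = 1)
    (h3 : len V 3 = 2) : False := by
  obtain ⟨e, he, he0⟩ := C.exists_ne_zero (n := 1) (by omega)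
  have l0 := C.len_zero
  have l4 := C.len_four
  have l5 := C.len_five
  have l6 := C.len_six
  have l7 := C.len_large (n := 7) (by norm_num)
  exact (C.isAffine h1 he he0).false_of_gaps ⟨by omega, by omega, by omega, by omega⟩ (by omega)
    (by omega)

end Trigonal

section Codes

/-- Carryless multiplication of binary numbers. -/
def cmul (a b : ℕ) : ℕ := clmul (a.log2 + 1) a b

/-- The product of `x.1 + x.2 * σ` and `y.1 + y.2 * σ` when `σ ^ 2 = t.1 + t.2 * σ`. -/
def pmul (t x y : ℕ × ℕ) : ℕ × ℕ :=
  (cmul x.1 y.1 ^^^ cmul (cmul x.2 y.2) t.1,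
    cmul x.1 y.2 ^^^ cmul x.2 y.1 ^^^ cmul (cmul x.2 y.2) t.2)

/-- The norm of `x.1 + x.2 * σ` when `σ ^ 2 = t.1 + t.2 * σ`. -/
def pnorm (t x : ℕ × ℕ) : ℕ :=
  cmul x.1 x.1 ^^^ cmul (cmul x.1 x.2) t.2 ^^^ cmul (cmul x.2 x.2) t.1

/-- The sum of the selected pairs. -/
def psum : ℕ → List (ℕ × ℕ) → ℕ × ℕ
  | _, [] => (0, 0)
  | c, v :: vs => ((c % 2 * v.1) ^^^ (psum (c / 2) vs).1, (c % 2 * v.2) ^^^ (psum (c / 2) vs).2)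

variable {κ : Type} [Field κ] (h2 : (2 : κ) = 0) {τ σ : κ}
include h2

theorem pe_cmul (τ : κ) (a b : ℕ) : pe τ (cmul a b) = pe τ a * pe τ b :=
  pe_clmul τ h2 _ a b Nat.lt_log2_self

/-- The value of the pair `x`. -/
def pv (τ σ : κ) (x : ℕ × ℕ) : κ := pe τ x.1 + σ * pe τ x.2

theorem pv_pmul {t : ℕ × ℕ} (ht : σ ^ 2 = pv τ σ t) (x y : ℕ × ℕ) :
    pv τ σ (pmul t x y) = pv τ σ x * pv τ σ y := by
  simp only [pv, pmul, pe_xor τ h2, pe_cmul h2] at ht ⊢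
  linear_combination -(pe τ x.2 * pe τ y.2) * ht

theorem pe_pnorm {t x : ℕ × ℕ} (ht : σ ^ 2 = pv τ σ t) (hx : pv τ σ x = 0) :
    pe τ (pnorm t x) = 0 := by
  simp only [pv, pnorm, pe_xor τ h2, pe_cmul h2] at ht hx ⊢
  linear_combination (pe τ x.1 + pe τ x.2 * pe τ t.2 + pe τ x.2 * σ) * hx - pe τ x.2 ^ 2 * ht -
    (pe τ x.1 * pe τ x.2 * σ + σ * pe τ x.2 ^ 2 * pe τ t.2) * h2

theorem pv_psum (c : ℕ) (vs : List (ℕ × ℕ)) : pv τ σ (psum c vs) = lin c (vs.map (pv τ σ)) := by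
  induction vs generalizing c with
  | nil => simp [psum, pv]
  | cons v vs ih =>
    rw [List.map_cons, lin_cons, ← ih]
    rcases Nat.mod_two_eq_zero_or_one c with h | h <;>
      simp [psum, pv, pe_xor τ h2, h]
    ring

end Codes

section Tetragonal

variable {R : Type} [CommRing R] {W : ℤ → AddSubgroup R} {l : ℤ → ℕ} {x y u s w : R} {m n d : ℤ}

namespace Affine

variable (A : Affine W l)
include A

theorem span_cons {vs : List R} (h : ∀ x ∈ W (n - 1), ∃ c < 2 ^ vs.length, x = lin c vs)
    (hy : Lead W n y) : ∀ x ∈ W n, ∃ c < 2 ^ (y :: vs).length, x = lin c (y :: vs) := by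
  have h2 : ∀ m : R, m + m = 0 := fun m => by rw [← two_mul, A.two, zero_mul]
  have key : ∀ e < 2, ∀ x ∈ W (n - 1), ∃ c < 2 ^ (y :: vs).length, e • y + x = lin c (y :: vs) := by
    intro e he x hx
    obtain ⟨c, hc, rfl⟩ := h x hx
    refine ⟨e % 2 + 2 * c, ?_, (lin_bit h2 e c y vs).symm⟩
    rw [List.length_cons, pow_succ]
    omega
  intro x hx
  by_cases hx' : x ∈ W (n - 1)
  · simpa using key 0 (by norm_num) x hx'
  · obtain ⟨c, hc, h⟩ := key 1 (by norm_num) _ (A.add_lead n x hx hx' y hy.1 hy.2)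
    exact ⟨c, hc, by rw [← h, one_smul]; linear_combination -(y * A.two)⟩

theorem span_gap {vs : List R} (h : ∀ x ∈ W (n - 1), ∃ c < 2 ^ vs.length, x = lin c vs)
    (hl : l n ≤ l (n - 1)) : ∀ x ∈ W n, ∃ c < 2 ^ vs.length, x = lin c vs :=
  fun x hx => h x (A.le_of_len n hl hx)

end Affine

/-- The pole orders at the point are generated by four, five and six. -/
def TetraGaps (l : ℤ → ℕ) : Prop := l 1 ≤ l 0 ∧ l 2 ≤ l 1 ∧ l 3 ≤ l 2 ∧ l 7 ≤ l 6

/-- The equations between functions with poles of orders four, five and six. -/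
structure Tetragonal (W : ℤ → AddSubgroup R) (u s w : R) (c : ℕ) : Prop where
  lead_u : Lead W 4 u
  lead_s : Lead W 5 s
  lead_w : Lead W 6 w
  quadric : u * w = s ^ 2 + s + 1
  cubic : w ^ 2 + u ^ 3 = lin c [s * w, u * w, u * s, u ^ 2, w, s, u, 1]
  bound : c < 256

namespace Affine

variable (A : Affine W l) (G : TetraGaps l)
include A G

theorem span_nine (hu : Lead W 4 u) (hs : Lead W 5 s) (hw : Lead W 6 w) :
    ∀ x ∈ W 9, ∃ c < 2 ^ [u * s, u ^ 2, w, s, u, 1].length,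
    x = lin c [u * s, u ^ 2, w, s, u, 1] := by
  obtain ⟨g1, g2, g3, g7⟩ := G
  have r0 := A.span_cons (n := 0) (vs := []) (fun x hx => ⟨0, by simp, by
    simpa using A.neg (0 - 1) (by norm_num) x hx⟩) (A.lead_one hu)
  have r1 := A.span_gap (n := 1) r0 g1
  have r2 := A.span_gap (n := 2) r1 g2
  have r3 := A.span_gap (n := 3) r2 g3
  have r6 := A.span_cons (n := 6) (A.span_cons (n := 5) (A.span_cons (n := 4) r3 hu) hs) hw
  have r7 := A.span_gap (n := 7) r6 g7
  exact A.span_cons (n := 9) (A.span_cons (n := 8) r7 (A.lead_pow hu 2 (by norm_num)))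
    (A.lead_mul hu hs (by norm_num))

theorem not_lead_tetra (hx : Lead W n x) : n ≠ 1 ∧ n ≠ 2 ∧ n ≠ 3 ∧ n ≠ 7 := by
  obtain ⟨g1, g2, g3, g7⟩ := G
  have := A.lead_len hx
  refine ⟨?_, ?_, ?_, ?_⟩ <;> rintro rfl <;> norm_num at this <;> omega

theorem exists_tetragonal (hu : Lead W 4 u) (hs : Lead W 5 s) (hw : Lead W 6 w) :
    ∃ u s w c, Tetragonal W u s w c := by
  have l1 := A.lead_pow hs 2 (d := 10) (by norm_num)
  have l2 := A.lead_mul hu hw (d := 10) (by norm_num)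
  obtain ⟨c, -, h⟩ := A.span_nine G hu hs hw _ (A.add_lead 10 _ l1.1 l1.2 _ l2.1 l2.2)
  have digit : ∀ n : ℕ, ∃ e : R, (e = 0 ∨ e = 1) ∧ ((n % 2 : ℕ) : R) = e := by
    intro n
    rcases Nat.mod_two_eq_zero_or_one n with h | h <;> rw [h]
    · exact ⟨0, by simp⟩
    · exact ⟨1, by simp⟩
  have hone := A.le (n := 3) (by norm_num) A.one
  have smul : ∀ {e x : R} {n : ℤ}, (e = 0 ∨ e = 1) → x ∈ W n → e * x ∈ W n := by
    rintro e x n (rfl | rfl) hx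
    · simp
    · simpa using hx
  simp only [lin_cons, lin_nil, nsmul_eq_mul, add_zero] at h
  obtain ⟨e0, d0, h0⟩ := digit c
  obtain ⟨e1, d1, h1⟩ := digit (c / 2)
  obtain ⟨e2, d2, h2⟩ := digit (c / 2 / 2)
  obtain ⟨e3, d3, h3⟩ := digit (c / 2 / 2 / 2)
  obtain ⟨e4, d4, h4⟩ := digit (c / 2 / 2 / 2 / 2)
  obtain ⟨e5, d5, h5⟩ := digit (c / 2 / 2 / 2 / 2 / 2)
  rw [h0, h1, h2, h3, h4, h5] at h
  have q2 : e2 ^ 2 = e2 := by rcases d2 with rfl | rfl <;> ring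
  have hu' : Lead W 4 (u + e2) := A.lead_add hu (by simpa using smul d2 hone)
  have hw' : Lead W 6 (w + (e0 * s + e1 * u + e4 + e1 * e2)) := by
    refine A.lead_add hw (add_mem (add_mem (add_mem (smul d0 hs.1) (smul d1 (A.le (by norm_num) hu.1)))
      ?_) (smul d1 ?_))
    · simpa using smul d4 (A.le (n := 5) (by norm_num) A.one)
    · simpa using smul d2 (A.le (n := 5) (by norm_num) A.one)
  have rel : (u + e2) * (w + (e0 * s + e1 * u + e4 + e1 * e2)) =
      s ^ 2 + (e3 + e0 * e2) * s + (e5 + e2 * e4 + e1 * e2) := by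
    linear_combination h + e1 * q2 +
      (u * e2 * e1 + u * e0 * s + u * e4 + u ^ 2 * e1 + e2 * w - s ^ 2) * A.two
  generalize u + e2 = v at *
  generalize w + (e0 * s + e1 * u + e4 + e1 * e2) = t at *
  obtain ⟨κ, _, φ, -, k2, hv0, hk⟩ := A.exists_field hu' (by norm_num) (fun i hi hi4 y z hy hz => by
    have := A.not_lead_tetra G hy
    omega)
  have s0 : φ s ≠ 0 := fun h0 => by
    obtain ⟨y, hy, -⟩ := hk _ _ hs h0
    exact (A.not_lead_tetra G hy).1 (by norm_num)
  have s1 : φ s + 1 ≠ 0 := fun h0 => by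
    obtain ⟨y, hy, -⟩ := hk _ _ (A.lead_add hs (A.le (by norm_num) A.one)) (by rw [map_add, map_one, h0])
    exact (A.not_lead_tetra G hy).1 (by norm_num)
  have bits : ∀ {e f : R}, (e = 0 ∨ e = 1) → (f = 0 ∨ f = 1) → (e + f = 0 ∨ e + f = 1) := by
    rintro e f (rfl | rfl) (rfl | rfl)
    · simp
    · simp
    · simp
    · left; linear_combination A.two
  have bits' : ∀ {e f : R}, (e = 0 ∨ e = 1) → (f = 0 ∨ f = 1) → (e * f = 0 ∨ e * f = 1) := by
    rintro e f (rfl | rfl) (rfl | rfl) <;> simp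
  have quad : v * t = s ^ 2 + s + 1 := by
    have hb := bits d3 (bits' d0 d2)
    have hd := bits (bits d5 (bits' d2 d4)) (bits' d1 d2)
    generalize e3 + e0 * e2 = b at *
    generalize e5 + e2 * e4 + e1 * e2 = f at *
    have := congrArg φ rel
    rw [map_mul, hv0, zero_mul] at this
    rcases hb with rfl | rfl <;> rcases hd with rfl | rfl <;> simp at this
    · exact absurd this.symm (pow_ne_zero 2 s0)
    · exact absurd (by linear_combination -this + φ s * k2) (mul_ne_zero s1 s1)
    · exact absurd (by linear_combination -this) (mul_ne_zero s0 s1)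
    · rw [rel]; ring
  have l3 := A.lead_pow hw' 2 (d := 12) (by norm_num)
  have l4 := A.lead_pow hu' 3 (d := 12) (by norm_num)
  have r10 := A.span_cons (n := 10) (A.span_nine G hu' hs hw')
    (A.lead_mul hu' hw' (by norm_num))
  have r11 := A.span_cons (n := 11) r10 (A.lead_mul hs hw' (by norm_num))
  obtain ⟨c, hc, h⟩ := r11 _ (A.add_lead 12 _ l3.1 l3.2 _ l4.1 l4.2)
  exact ⟨v, s, t, c, hu', hs, hw', quad, h, by simpa using hc⟩

end Affine

end Tetragonal

section Tetragonal

/-- Codes of polynomials prime to every irreducible sextic and to two of the quartics. -/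
def smooths : List ℕ := [64, 65, 84, 85, 93, 95, 99, 107, 124]

theorem pe_smooth_ne_zero {κ : Type} [Field κ] (hκ : Nat.card κ = 2 ^ 6) (h2 : (2 : κ) = 0) (τ : κ)
    (h8 : ∀ r, 0 < r → r < 8 → pe τ r ≠ 0) {n : ℕ} (hn : n ∈ smooths) : pe τ n ≠ 0 := by
  have quartic : ∀ g ∈ [11, 13], ∀ n ∈ smooths, ∃ r ∈ List.range' 1 7, ∃ j ∈ List.range 16,
      n ^^^ cmul j g = r := by decide +kernel
  have reduce : ∀ g ∈ [11, 13], pe τ g = 0 → pe τ n ≠ 0 := by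
    intro g hg hg0 hn0
    obtain ⟨r, hr, j, -, h⟩ := quartic g hg n hn
    simp only [List.mem_range', one_mul] at hr
    refine h8 r (by omega) (by omega) ?_
    rw [← h, pe_xor _ h2, pe_cmul h2, hg0, hn0, mul_zero, add_zero]
  by_cases a1 : pe τ 11 = 0
  · exact reduce 11 (by simp) a1
  by_cases a2 : pe τ 13 = 0
  · exact reduce 13 (by simp) a2
  have small : ∀ r ∈ List.range' 8 8, r = 11 ∨ r = 13 ∨ ∃ a ∈ List.range' 1 7, ∃ b ∈ List.range' 1 7,
      cmul a b = r := by decide +kernel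
  have h64 : ∀ r, 0 < r → r < 64 → pe τ r ≠ 0 := by
    refine pe_ne_zero (d := 6) h2 hκ τ 4 (fun r hr hr' => ?_) (fun e he h4 => ?_)
    · by_cases h : r < 8
      · exact h8 r hr h
      · rcases small r (by simp only [List.mem_range', one_mul]; exact ⟨r - 8, by omega, by omega⟩)
          with rfl | rfl | ⟨a, ha, b, hb, rfl⟩
        · exact a1
        · exact a2
        · simp only [List.mem_range', one_mul] at ha hb
          rw [pe_cmul h2]
          exact mul_ne_zero (h8 a (by omega) (by omega)) (h8 b (by omega) (by omega))
    · have := Nat.le_of_dvd (by norm_num) he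
      interval_cases e <;> omega
  have split : ∀ n ∈ smooths, ∃ a ∈ [2, 3, 7], ∃ b ∈ List.range' 1 63, cmul a b = n := by
    decide +kernel
  obtain ⟨a, ha, b, hb, rfl⟩ := split n hn
  simp only [List.mem_range', one_mul] at hb
  rw [pe_cmul h2]
  refine mul_ne_zero (h8 a ?_ ?_) (h64 b (by omega) (by omega)) <;>
    · simp only [List.mem_cons, List.not_mem_nil, or_false] at ha
      omega

/-- The function of pole order six at a point of the plane. -/
def line (m : ℕ) : ℕ × ℕ := (m % 4, m / 4)

/-- The square of the function of pole order five at a point of the plane. -/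
def square (m : ℕ) : ℕ × ℕ := (1 ^^^ 2 * (m % 4), 1 ^^^ 2 * (m / 4))

/-- The value of the cubic equation at a point of the plane. -/
def cubicPair (m c : ℕ) : ℕ × ℕ :=
  let p := pmul (square m) (line m) (line m)
  let q := psum c [pmul (square m) (0, 1) (line m), pmul (square m) (2, 0) (line m), (0, 2), (4, 0),
    line m, (0, 1), (2, 0), (1, 0)]
  (p.1 ^^^ 8 ^^^ q.1, p.2 ^^^ q.2)

theorem cubicPair_cases : ∀ c ∈ List.range 256,
    (∃ m ∈ List.range 8, pnorm (square m) (cubicPair m c) ∈ smooths) ∨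
    ∃ m ∈ List.range 8, ∃ a ∈ List.range' 4 4, ∃ b ∈ List.range' 4 4,
      pmul (square m) (a, 1) (b, 1) = pmul (square m) (3, 0) (cubicPair m c) := by
  decide +kernel

variable {R : Type} [CommRing R] {W : ℤ → AddSubgroup R} {l : ℤ → ℕ} {u s w : R} {n : ℤ} {c : ℕ}

namespace Tetragonal

variable (T : Tetragonal W u s w c) (A : Affine W l) (G : TetraGaps l)
include T A G

theorem exists_point {m : ℕ} (hm : m < 8) : ∃ (κ : Type) (_ : Field κ) (φ : R →+* κ),
    Nat.card κ = 2 ^ 6 ∧ (2 : κ) = 0 ∧ φ w = pv (φ u) (φ s) (line m) ∧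
    ∀ n y, Lead W n y → n ∈ [0, 4, 5, 8, 9] → φ y ≠ 0 := by
  have h5 : pe u (m % 4) + s * pe u (m / 4) ∈ W 5 := by
    have o := A.le (n := 5) (by norm_num) A.one
    have v := A.le (n := 5) (by norm_num) T.lead_u.1
    have v' := T.lead_s.1
    refine add_mem ?_ ?_
    · have : m % 4 < 4 := by omega
      interval_cases m % 4
      · simp
      · simpa using o
      · simpa [pe_eq u 2] using v
      · simpa [pe_eq u 3] using add_mem o v
    · have : m / 4 < 2 := by omega
      interval_cases m / 4
      · simp
      · simpa using v'
  obtain ⟨κ, _, φ, hκ, h2, h0, hk⟩ := A.exists_field (A.lead_add T.lead_w h5) (by norm_num)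
    (fun i hi hi6 y z hy hz => by
      have := A.not_lead_tetra G hy
      have := A.not_lead_tetra G hz
      omega)
  refine ⟨κ, _, φ, hκ, h2, ?_, fun n y hy hn hy0 => ?_⟩
  · simp only [map_add, map_mul, map_pe] at h0
    simp only [pv, line]
    linear_combination h0 - (pe (φ u) (m % 4) + φ s * pe (φ u) (m / 4)) * h2
  · obtain ⟨z, hz, -⟩ := hk n y hy hy0
    have := A.not_lead_tetra G hz
    have := A.lead_nonneg hz
    simp only [List.mem_cons, List.not_mem_nil, or_false] at hn
    omega

theorem false : False := by
  have point : ∀ m < 8, ∃ (κ : Type) (_ : Field κ) (τ σ : κ), Nat.card κ = 2 ^ 6 ∧ (2 : κ) = 0 ∧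
      σ ^ 2 = pv τ σ (square m) ∧ pv τ σ (cubicPair m c) = 0 ∧
      (∀ r, 0 < r → r < 8 → pe τ r ≠ 0) ∧ ∀ a ∈ List.range' 4 4, pv τ σ (a, 1) ≠ 0 := by
    intro m hm
    obtain ⟨κ, _, φ, hκ, h2, hw, hk⟩ := T.exists_point A G hm
    have p2 : ∀ τ : κ, pe τ 2 = τ := fun τ => by simp [pe_eq τ 2]
    have p4 : pe (φ u) 4 = φ u ^ 2 := pe_two_pow (φ u) 2
    have hs : φ s ^ 2 = pv (φ u) (φ s) (square m) := by
      have h := congrArg φ T.quadric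
      simp only [map_mul, map_add, map_one, map_pow, hw] at h
      simp only [pv, square, line, pe_xor _ h2, pe_one, pe_double] at h ⊢
      linear_combination -h - (φ s + 1) * h2
    refine ⟨κ, _, φ u, φ s, hκ, h2, hs, ?_, fun r hr hr8 hr0 => ?_, fun a ha ha0 => ?_⟩
    · have h := congrArg φ T.cubic
      have hp := pv_pmul h2 hs (line m) (line m)
      have hq := pv_psum (σ := φ s) (τ := φ u) h2 c [pmul (square m) (0, 1) (line m),
        pmul (square m) (2, 0) (line m), (0, 2), (4, 0), line m, (0, 1), (2, 0), (1, 0)]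
      have e : [pmul (square m) (0, 1) (line m), pmul (square m) (2, 0) (line m), (0, 2), (4, 0),
          line m, (0, 1), (2, 0), (1, 0)].map (pv (φ u) (φ s)) =
          [s * w, u * w, u * s, u ^ 2, w, s, u, 1].map φ := by
        simp only [List.map_cons, List.map_nil, pv_pmul h2 hs, ← hw, map_mul, map_pow, map_one]
        simp [pv, p2, p4, mul_comm]
      rw [e, ← map_lin, ← h, map_add, map_pow, map_pow] at hq
      rw [← hw] at hp
      have e8 : pe (φ u) 8 = φ u ^ 3 := pe_two_pow (φ u) 3
      simp only [pv] at hp hq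
      simp only [pv, cubicPair, pe_xor _ h2, e8]
      linear_combination hp + hq + (φ u ^ 3 + φ w ^ 2) * h2
    · rw [← map_pe] at hr0
      rcases (by omega : r < 2 ∨ 2 ≤ r ∧ r < 4 ∨ 4 ≤ r) with h | ⟨h, h'⟩ | h
      · exact hk _ _ (A.lead_pe T.lead_u (by norm_num) 0 r hr (by omega)) (by simp) hr0
      · exact hk _ _ (A.lead_pe T.lead_u (by norm_num) 1 r h h') (by simp) hr0
      · exact hk _ _ (A.lead_pe T.lead_u (by norm_num) 2 r h hr8) (by simp) hr0
    · simp only [List.mem_range', one_mul] at ha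
      have hl := A.lead_add (A.lead_pe T.lead_u (by norm_num) 2 a (by omega) (by omega))
        (A.le (by norm_num) T.lead_s.1)
      refine hk _ _ hl (by simp) ?_
      rw [map_add, map_pe]
      simpa [pv] using ha0
  rcases cubicPair_cases c (List.mem_range.2 T.bound) with ⟨m, hm, h⟩ | ⟨m, hm, a, ha, b, hb, h⟩
  · obtain ⟨κ, _, τ, σ, hκ, h2, ht, h0, h8, -⟩ := point m (List.mem_range.1 hm)
    exact pe_smooth_ne_zero hκ h2 τ h8 h (pe_pnorm h2 ht h0)
  · obtain ⟨κ, _, τ, σ, hκ, h2, ht, h0, -, h1⟩ := point m (List.mem_range.1 hm)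
    have := congrArg (pv τ σ) h
    rw [pv_pmul h2 ht, pv_pmul h2 ht, h0, mul_zero] at this
    exact mul_ne_zero (h1 a ha) (h1 b hb) this

end Tetragonal

/-- There is no curve with a point at which the pole orders are generated by four, five and six. -/
theorem Affine.false_of_tetraGaps (A : Affine W l) (G : TetraGaps l) (h4 : l 3 < l 4)
    (h5 : l 4 < l 5) (h6 : l 5 < l 6) : False := by
  obtain ⟨u, hu, hu'⟩ := A.exists_new 4 (by simpa using h4)
  obtain ⟨s, hs, hs'⟩ := A.exists_new 5 (by simpa using h5)
  obtain ⟨w, hw, hw'⟩ := A.exists_new 6 (by simpa using h6)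
  obtain ⟨u, s, w, c, T⟩ := A.exists_tetragonal G ⟨hu, hu'⟩ ⟨hs, hs'⟩ ⟨hw, hw'⟩
  exact T.false A G

theorem Cox.false_of_tetragonal {K : Type} [Field K] [Algebra (ZMod 2) K]
    {V : ℤ → Submodule (ZMod 2) K} (C : Cox V) (h1 : len V 1 = 1) (h2 : len V 2 = 1)
    (h3 : len V 3 = 1) : False := by
  obtain ⟨e, he, he0⟩ := C.exists_ne_zero (n := 1) (by omega)
  have l0 := C.len_zero
  have l4 := C.len_four
  have l5 := C.len_five
  have l6 := C.len_six
  have l7 := C.len_large (n := 7) (by norm_num)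
  exact (C.isAffine h1 he he0).false_of_tetraGaps ⟨by omega, by omega, by omega, by omega⟩ (by omega)
    (by omega) (by omega)

end Tetragonal

end CFF

open CFF in
/-- For a congruence function field `K` over `𝔽₂` of genus `4` and class
number `1`, with (its unique) rational subfield `k = 𝔽₂(T)` of degree `5`,
the extension `K/k` is normal, hence Galois with cyclic Galois group of
order `5`. -/
theorem extension_is_normal_and_cyclic_of_order_five
    (K : Type) [Field K] [Algebra (ZMod 2) K]
    [Algebra (RatFunc (ZMod 2)) K] [IsScalarTower (ZMod 2) (RatFunc (ZMod 2)) K]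
    (hFF : IsFunctionField (ZMod 2) K)
    (hconst : HasExactConstants (ZMod 2) K)
    (hg : genus (ZMod 2) K = 4)
    (hh : classNumber (ZMod 2) K = 1)
    (hdeg : Module.finrank (RatFunc (ZMod 2)) K = 5) :
    Normal (RatFunc (ZMod 2)) K ∧ IsGalois (RatFunc (ZMod 2)) K ∧
      IsCyclic (K ≃ₐ[RatFunc (ZMod 2)] K) ∧
      Nat.card (K ≃ₐ[RatFunc (ZMod 2)] K) = 5 := by
  have : FunField (ZMod 2) K := ⟨hFF, hconst⟩
  have : Genus4 (ZMod 2) K := ⟨hg, hh⟩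
  have hT0 := algebraMap_ratFunc_X_ne_zero (K := K)
  have hT1 := algebraMap_ratFunc_X_ne_one (K := K)
  have hT := (xdeg_ratFunc_X (K := K)).trans hdeg
  obtain ⟨V, C⟩ := exists_cox hT hT0 hT1
  obtain ⟨s, hs, t, ht, -, -, -, hst⟩ := C.fraction _ hT0 hT1
  rw [hT] at hs ht hst
  rcases C.len_cases hs ht hst with ⟨h1, h2, h3⟩ | ⟨h1, h2, h3⟩ | ⟨h1, h2, h3⟩ | ⟨h1, h2, h3⟩ |
    ⟨h1, h2, h3⟩ | ⟨h1, h2, h3⟩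
  · exact (C.false_of_tetragonal h1 h2 h3).elim
  · exact (C.false_of_trigonal h1 h2 h3).elim
  · exact (C.false_of_pencil_two h1 h2 h3).elim
  · exact (C.false_of_pencil_three h1 h2 h3).elim
  · exact (C.false_of_line h1 h2 h3).elim
  · obtain ⟨σ, w, hσ⟩ := C.exists_automorphism h1 h2 h3
    have h5 := C.len_five
    exact C.isCyclic_of_automorphism hdeg (by omega) hσ
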